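/- For every κ, W, δ₀, m₀ > 0 there exist ε₀ > 0 and d₀ > 0 such that for every ε ∈ (0, ε₀] the following uniqueness holds: if ψ⁽¹⁾ and ψ⁽²⁾ are centralized stream functions of steady vortex rings with parameters (ε, W, μ⁽¹⁾) and (ε, W, μ⁽²⁾) respectively, where μ⁽¹⁾, μ⁽²⁾ ≥ m₀, both circulations equal κ, and both cross-sections are simply connected, contained in {x ∈ ℝ² : δ₀ ≤ x₁ ≤ 1/δ₀}, and of diameter at most d₀, then ψ⁽¹⁾ = ψ⁽²⁾ and μ⁽¹⁾ = μ⁽²⁾. -/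

import Mathlib

open MeasureTheory Real Filter
open scoped RealInnerProductSpace

noncomputable section

/-- The plane `ℝ²` with the Euclidean norm. -/
abbrev Plane : Type := EuclideanSpace ℝ (Fin 2)

/-- The point `(a, b)` of the plane. -/
def mk2 (a b : ℝ) : Plane := (WithLp.equiv 2 (Fin 2 → ℝ)).symm ![a, b]

/-- The open right half plane `Π = {x : x₁ > 0}`. -/
def halfPlane : Set Plane := {x : Plane | 0 < x 0}

/-- The reflection `x̄ = (−x₁, x₂)` of a point `x = (x₁, x₂)`. -/
def reflPt (x : Plane) : Plane := mk2 (-(x 0)) (x 1)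

/-- The Green function `G_*` on the half plane of the operator `−(1/x₁)div((1/x₁)∇)`. -/
def Gstar (x x' : Plane) : ℝ :=
  x 0 * (x' 0) ^ 2 / (4 * π) *
    ∫ θ in (-π)..π, Real.cos θ /
      Real.sqrt ((x 1 - x' 1) ^ 2 + (x 0) ^ 2 + (x' 0) ^ 2 - 2 * x 0 * x' 0 * Real.cos θ)

/-- The Green function of `−Δ` on the half plane. -/
def Gfun (x x' : Plane) : ℝ :=
  (1 / (4 * π)) * Real.log
    (((x 0 + x' 0) ^ 2 + (x 1 - x' 1) ^ 2) / ((x 0 - x' 0) ^ 2 + (x 1 - x' 1) ^ 2))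

/-- The regular part `H_c(x,x') = G_*(x,x') − c² G(x,x')`. -/
def Hker (c : ℝ) (x x' : Plane) : ℝ := Gstar x x' - c ^ 2 * Gfun x x'

/-- The regular part `H_c`, extended continuously to the diagonal. -/
def HkerExt (c : ℝ) (x x' : Plane) : ℝ := by
  classical
  exact if x = x' then limUnder (nhdsWithin x' {x'}ᶜ) (fun y => Hker c y x')
    else Hker c x x'

/-- The cross-section `A = {x ∈ Π : ψ(x) − (W/2) x₁² ln(1/ε) > μ}`. -/
def crossSection (ψ : Plane → ℝ) (ε W μ : ℝ) : Set Plane :=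
  {x : Plane | x ∈ halfPlane ∧ μ < ψ x - W / 2 * (x 0) ^ 2 * Real.log (1 / ε)}

/-- `ψ` is a stream function of a steady vortex ring with parameters `(ε, W, μ)`. -/
structure IsVortexRingStream (ψ : Plane → ℝ) (ε W μ : ℝ) : Prop where
  continuousOn : ContinuousOn ψ halfPlane
  bounded : Bornology.IsBounded (crossSection ψ ε W μ)
  closure_subset : closure (crossSection ψ ε W μ) ⊆ halfPlane
  repr : ∀ x ∈ halfPlane, ψ x = (∫ x' in crossSection ψ ε W μ, Gstar x x') / ε ^ 2

/-- The circulation `ε⁻² ∫_A x₁ dx` of a vortex ring. -/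
def circulation (ψ : Plane → ℝ) (ε W μ : ℝ) : ℝ :=
  (∫ x in crossSection ψ ε W μ, x 0) / ε ^ 2

/-- `ψ` is centralized: it is even in the second variable. -/
def Centralized (ψ : Plane → ℝ) : Prop :=
  ∀ a b : ℝ, ψ (mk2 a (-b)) = ψ (mk2 a b)

namespace VortexRing

theorem abs_log_le_add_inv {t : ℝ} (ht : 0 ≤ t) : |Real.log t| ≤ t + t⁻¹ := by
  rcases ht.eq_or_lt with rfl | ht
  · simp
  have h1 := Real.log_le_sub_one_of_pos ht
  have h2 := Real.log_le_sub_one_of_pos (inv_pos.2 ht)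
  rw [Real.log_inv] at h2
  have : 0 < t⁻¹ := inv_pos.2 ht
  rw [abs_le]; constructor <;> linarith

theorem volume_real_ball (c : ℂ) {r : ℝ} (hr : 0 ≤ r) :
    volume.real (Metric.ball c r) = π * r ^ 2 := by
  rw [measureReal_def, Complex.volume_ball, ENNReal.toReal_mul, ENNReal.toReal_pow,
    ENNReal.toReal_ofReal hr]
  simp [NNReal.coe_real_pi, mul_comm]

theorem integral_inv_norm_ball {ρ : ℝ} (hρ : 0 < ρ) :
    IntegrableOn (fun w : ℂ => ‖w‖⁻¹) (Metric.ball 0 ρ) ∧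
      ∫ w in Metric.ball (0 : ℂ) ρ, ‖w‖⁻¹ = 2 * π * ρ := by
  constructor
  · rw [integrableOn_fun_norm_addHaar (μ := volume) (f := fun t : ℝ => t⁻¹)]
    rw [integrableOn_congr_fun (g := fun _ => (1 : ℝ)) _ measurableSet_Ioo]
    · simp
    · intro y hy
      simp [Complex.finrank_real_complex, mul_inv_cancel₀ hy.1.ne']
  · rw [← integral_indicator measurableSet_ball]
    have : ∀ w : ℂ, (Metric.ball (0 : ℂ) ρ).indicator (fun w => ‖w‖⁻¹) w =
        (fun t : ℝ => if t < ρ then t⁻¹ else 0) ‖w‖ := by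
      intro w; simp [Set.indicator]
    simp_rw [this]
    rw [integral_fun_norm_addHaar (μ := volume) (fun t : ℝ => if t < ρ then t⁻¹ else 0)]
    rw [volume_real_ball _ zero_le_one, Complex.finrank_real_complex]
    have : ∫ y in Set.Ioi (0 : ℝ), y ^ (2 - 1) • (if y < ρ then y⁻¹ else 0)
        = ∫ y in Set.Ioi (0 : ℝ), (Set.Iio ρ).indicator (fun _ => (1 : ℝ)) y := by
      refine setIntegral_congr_fun measurableSet_Ioi fun y hy => ?_
      have : y ≠ 0 := ne_of_gt hy
      simp only [Set.indicator, Set.mem_Iio]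
      split_ifs <;> simp [this]
    rw [this, setIntegral_indicator measurableSet_Iio]
    simp
    rw [show Set.Ioi 0 ∩ Set.Iio ρ = Set.Ioo 0 ρ from rfl]
    simp [hρ.le]; ring

theorem integral_inv_norm_sub_ball (c : ℂ) {ρ : ℝ} (hρ : 0 < ρ) :
    IntegrableOn (fun w : ℂ => ‖c - w‖⁻¹) (Metric.ball c ρ) ∧
      ∫ w in Metric.ball c ρ, ‖c - w‖⁻¹ = 2 * π * ρ := by
  have hm : MeasurePreserving (fun w : ℂ => c - w) volume volume :=
    Measure.measurePreserving_sub_left volume c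
  have he : MeasurableEmbedding (fun w : ℂ => c - w) :=
    (Homeomorph.subLeft c).measurableEmbedding
  have hp : (fun w : ℂ => c - w) ⁻¹' (Metric.ball 0 ρ) = Metric.ball c ρ := by
    ext w; simp [dist_eq_norm, norm_sub_rev]
  have h := integral_inv_norm_ball hρ
  constructor
  · have := (hm.integrableOn_comp_preimage he (s := Metric.ball 0 ρ)).2 h.1
    rwa [hp] at this
  · rw [← hp, hm.setIntegral_preimage_emb he (fun w : ℂ => ‖w‖⁻¹), h.2]

theorem inv_norm_sub_setIntegral {S : Set ℂ} (hv : volume S ≠ ⊤) (c : ℂ)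
    {ρ : ℝ} (hρ : 0 < ρ) :
    IntegrableOn (fun w : ℂ => ‖c - w‖⁻¹) S ∧
      ∫ w in S, ‖c - w‖⁻¹ ≤ 2 * π * ρ + volume.real S / ρ := by
  have hb := integral_inv_norm_sub_ball c hρ
  set g : ℂ → ℝ := fun w => (Metric.ball c ρ).indicator (fun w => ‖c - w‖⁻¹) w + ρ⁻¹
  have hi : Integrable ((Metric.ball c ρ).indicator fun w : ℂ => ‖c - w‖⁻¹) :=
    (integrable_indicator_iff measurableSet_ball).2 hb.1
  have hg : IntegrableOn g S := by
    refine Integrable.add hi.integrableOn ?_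
    exact integrableOn_const hv
  have hle : ∀ w, ‖c - w‖⁻¹ ≤ g w := by
    intro w
    simp only [g, Set.indicator]
    split_ifs with h
    · have := inv_pos.2 hρ; linarith
    · rw [zero_add]
      refine inv_anti₀ hρ ?_
      simpa [dist_eq_norm, norm_sub_rev] using h
  have hf : IntegrableOn (fun w : ℂ => ‖c - w‖⁻¹) S := by
    refine Integrable.mono' hg (by fun_prop) (ae_of_all _ fun w => ?_)
    rw [Real.norm_of_nonneg (by positivity)]; exact hle w
  refine ⟨hf, (integral_mono hf hg hle).trans ?_⟩
  have h1 : ∫ w in S, (Metric.ball c ρ).indicator (fun w => ‖c - w‖⁻¹) w ≤ 2 * π * ρ := by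
    rw [← hb.2, ← integral_indicator measurableSet_ball]
    exact setIntegral_le_integral hi (ae_of_all _ fun w => Set.indicator_nonneg (by intros; positivity) w)
  simp only [g]
  rw [integral_add hi.integrableOn (integrableOn_const hv)]
  simp only [integral_const, smul_eq_mul, measureReal_restrict_apply_univ]
  rw [div_eq_mul_inv]; linarith

/-- Integrability against a kernel singularity of order at most one. -/
theorem integrableOn_of_le_inv_norm {S : Set ℂ} (hS : MeasurableSet S) (hv : volume S ≠ ⊤) (c : ℂ)
    {f : ℂ → ℝ} (hf : AEStronglyMeasurable f (volume.restrict S)) {C : ℝ}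
    (hb : ∀ w ∈ S, |f w| ≤ C * (1 + ‖c - w‖⁻¹)) : IntegrableOn f S := by
  refine Integrable.mono' (g := fun w => C * (1 + ‖c - w‖⁻¹)) ?_ hf ?_
  · exact ((integrableOn_const hv).add (inv_norm_sub_setIntegral hv c one_pos).1).const_mul C
  · exact (ae_restrict_iff' hS).2 (ae_of_all _ fun w hw => by simpa using hb w hw)

theorem integrableOn_log_norm_sub {S : Set ℂ} (hS : MeasurableSet S)
    (hb : Bornology.IsBounded S) (c : ℂ) : IntegrableOn (fun w => Real.log ‖c - w‖) S := by
  obtain ⟨R, hR, hsub⟩ := hb.subset_closedBall_lt 0 c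
  refine integrableOn_of_le_inv_norm hS hb.measure_lt_top.ne c (C := R + 1)
    (Real.measurable_log.comp (by fun_prop)).aestronglyMeasurable fun w hw => ?_
  have h1 := hsub hw
  rw [Metric.mem_closedBall, dist_eq_norm, norm_sub_rev] at h1
  refine (abs_log_le_add_inv (norm_nonneg _)).trans ?_
  have : 0 ≤ ‖c - w‖⁻¹ := by positivity
  nlinarith

theorem integrable_prod_inv_norm {S T : Set ℂ} (hv : volume S ≠ ⊤) (hw : volume T ≠ ⊤)
    {φ : ℂ → ℂ} (hφ : Measurable φ) :
    Integrable (fun p : ℂ × ℂ => ‖φ p.1 - p.2‖⁻¹)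
      ((volume.restrict S).prod (volume.restrict T)) := by
  have : IsFiniteMeasure (volume.restrict S) := ⟨by simpa using hv.lt_top⟩
  have : IsFiniteMeasure (volume.restrict T) := ⟨by simpa using hw.lt_top⟩
  have hm : Measurable (fun p : ℂ × ℂ => ‖φ p.1 - p.2‖⁻¹) := by fun_prop
  rw [integrable_prod_iff hm.aestronglyMeasurable]
  refine ⟨ae_of_all _ fun x => (inv_norm_sub_setIntegral hw (φ x) one_pos).1, ?_⟩
  refine Integrable.of_bound (C := 2 * π * 1 + volume.real T / 1) ?_ (ae_of_all _ fun x => ?_)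
  · exact (hm.norm.stronglyMeasurable.integral_prod_right' (ν := volume.restrict T)).aestronglyMeasurable
  · simp only [norm_inv, norm_norm]
    rw [Real.norm_of_nonneg (by positivity)]
    exact (inv_norm_sub_setIntegral hw (φ x) one_pos).2

theorem integrable_prod_of_le_inv_norm {S T : Set ℂ} (hS : MeasurableSet S) (hv : volume S ≠ ⊤)
    (hT : MeasurableSet T) (hw : volume T ≠ ⊤) {f : ℂ × ℂ → ℝ} {φ : ℂ → ℂ} (hφ : Measurable φ)
    (hf : AEStronglyMeasurable f ((volume.restrict S).prod (volume.restrict T))) {C : ℝ}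
    (hb : ∀ x ∈ S, ∀ y ∈ T, |f (x, y)| ≤ C * (1 + ‖φ x - y‖⁻¹)) :
    Integrable f ((volume.restrict S).prod (volume.restrict T)) := by
  have : IsFiniteMeasure (volume.restrict S) := ⟨by simpa using hv.lt_top⟩
  have : IsFiniteMeasure (volume.restrict T) := ⟨by simpa using hw.lt_top⟩
  refine Integrable.mono' (g := fun p => C * (1 + ‖φ p.1 - p.2‖⁻¹)) ?_ hf ?_
  · exact ((integrable_const _).add (integrable_prod_inv_norm hv hw hφ)).const_mul C
  · rw [Measure.prod_restrict]
    exact (ae_restrict_iff' (hS.prod hT)).2 (ae_of_all _ fun p hp => by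
      simpa using hb p.1 hp.1 p.2 hp.2)

theorem ae_prod_ne {S T : Set ℂ} {φ : ℂ → ℂ} (hφ : Measurable φ) :
    ∀ᵐ p : ℂ × ℂ ∂((volume.restrict S).prod (volume.restrict T)), φ p.1 ≠ p.2 := by
  have hm : MeasurableSet {p : ℂ × ℂ | φ p.1 ≠ p.2} :=
    (measurableSet_eq_fun (by fun_prop) (by fun_prop)).compl
  refine (Measure.ae_prod_mem_iff_ae_ae_mem hm).2 ?_
  refine ae_of_all _ fun x => ae_restrict_of_ae ?_
  filter_upwards [Measure.ae_ne volume (φ x)] with y hy using hy.symm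

/-- The profile of the ring kernel as a function of the normalized distance. -/
def ringProfile (σ : ℝ) : ℝ :=
  1 / (4 * π) * ∫ θ in (-π)..π, Real.cos θ / √(σ ^ 2 + 2 - 2 * Real.cos θ)

/-- The Lipschitz remainder of `ringProfile` after removal of its logarithmic singularity. -/
def regProfile (σ : ℝ) : ℝ :=
  1 / (2 * π) * Real.log (2 + √(4 + σ ^ 2)) +
    1 / (4 * π) * ∫ θ in (-π)..π,
      (Real.cos θ - Real.cos (θ / 2)) / √(σ ^ 2 + 4 * Real.sin (θ / 2) ^ 2)

theorem two_sub_two_cos (θ : ℝ) : 2 - 2 * Real.cos θ = 4 * Real.sin (θ / 2) ^ 2 := by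
  have := Real.cos_sq (θ / 2)
  have h2 := Real.sin_sq_add_cos_sq (θ / 2)
  rw [show 2 * (θ / 2) = θ by ring] at this
  linarith

theorem abs_cos_sub_cos_half_le {θ : ℝ} (hθ : θ ∈ Set.Icc (-π) π) :
    |Real.cos θ - Real.cos (θ / 2)| ≤ 3 / 4 * (4 * Real.sin (θ / 2) ^ 2) := by
  have hc : 0 ≤ Real.cos (θ / 2) :=
    Real.cos_nonneg_of_neg_pi_div_two_le_of_le (by linarith [hθ.1]) (by linarith [hθ.2])
  have h1 := Real.cos_le_one (θ / 2)
  have h2 := Real.sin_sq_add_cos_sq (θ / 2)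
  have h3 := two_sub_two_cos θ
  rw [abs_le]; constructor <;> nlinarith

theorem abs_sqrt_add_sub_sqrt_add_le {v : ℝ} (hv : 0 ≤ v) (s t : ℝ) :
    |√(s ^ 2 + v) - √(t ^ 2 + v)| ≤ |s - t| := by
  rcases hv.eq_or_lt with rfl | hv
  · simp only [add_zero, Real.sqrt_sq_eq_abs]; exact abs_abs_sub_abs_le_abs_sub s t
  have hs : 0 < √(s ^ 2 + v) := Real.sqrt_pos.2 (by positivity)
  have ht : 0 < √(t ^ 2 + v) := Real.sqrt_pos.2 (by positivity)
  have h : (√(s ^ 2 + v) - √(t ^ 2 + v)) * (√(s ^ 2 + v) + √(t ^ 2 + v)) = (s - t) * (s + t) := by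
    have := Real.mul_self_sqrt (show 0 ≤ s ^ 2 + v by positivity)
    have := Real.mul_self_sqrt (show 0 ≤ t ^ 2 + v by positivity)
    nlinarith
  have h2 := congrArg abs h
  rw [abs_mul, abs_mul, abs_of_pos (add_pos hs ht)] at h2
  have h3 : |s + t| ≤ √(s ^ 2 + v) + √(t ^ 2 + v) := by
    refine (abs_add_le s t).trans (add_le_add ?_ ?_) <;>
    · rw [← Real.sqrt_sq_eq_abs]; exact Real.sqrt_le_sqrt (by linarith)
  by_contra hcon
  push Not at hcon
  have : |s - t| * |s + t| ≤ |s - t| * (√(s ^ 2 + v) + √(t ^ 2 + v)) :=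
    mul_le_mul_of_nonneg_left h3 (abs_nonneg _)
  nlinarith

theorem div_sqrt_lipschitz {n v : ℝ} (hv : 0 ≤ v) (hn : |n| ≤ 3 / 4 * v) (s t : ℝ) :
    |n / √(s ^ 2 + v) - n / √(t ^ 2 + v)| ≤ 3 / 4 * |s - t| := by
  rcases hv.eq_or_lt with rfl | hv
  · have : n = 0 := by simpa using hn
    simp [this]
  have hs : 0 < √(s ^ 2 + v) := Real.sqrt_pos.2 (by positivity)
  have ht : 0 < √(t ^ 2 + v) := Real.sqrt_pos.2 (by positivity)
  have hvs : v ≤ √(s ^ 2 + v) * √(t ^ 2 + v) := by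
    rw [← Real.sqrt_mul (by positivity)]
    refine Real.le_sqrt_of_sq_le ?_
    nlinarith [mul_nonneg (sq_nonneg s) (sq_nonneg t), mul_nonneg (sq_nonneg s) hv.le,
      mul_nonneg (sq_nonneg t) hv.le]
  have : n / √(s ^ 2 + v) - n / √(t ^ 2 + v) =
      n * (√(t ^ 2 + v) - √(s ^ 2 + v)) / (√(s ^ 2 + v) * √(t ^ 2 + v)) := by
    field_simp
  rw [this, abs_div, abs_mul, abs_of_pos (mul_pos hs ht), div_le_iff₀ (mul_pos hs ht)]
  have h1 := abs_sqrt_add_sub_sqrt_add_le hv.le t s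
  rw [abs_sub_comm t s] at h1
  calc |n| * |√(t ^ 2 + v) - √(s ^ 2 + v)| ≤ (3 / 4 * v) * |s - t| := by gcongr
    _ ≤ 3 / 4 * |s - t| * (√(s ^ 2 + v) * √(t ^ 2 + v)) := by
      nlinarith [abs_nonneg (s - t), mul_le_mul_of_nonneg_left hvs (abs_nonneg (s - t))]

theorem abs_div_sqrt_le {n v : ℝ} (hv : 0 ≤ v) (hv4 : v ≤ 4) (hn : |n| ≤ 3 / 4 * v) (s : ℝ) :
    |n / √(s ^ 2 + v)| ≤ 3 / 2 := by
  rcases hv.eq_or_lt with rfl | hv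
  · have : n = 0 := by simpa using hn
    norm_num [this]
  have hs : 0 < √(s ^ 2 + v) := Real.sqrt_pos.2 (by positivity)
  rw [abs_div, abs_of_pos hs, div_le_iff₀ hs]
  have h1 : √v ≤ √(s ^ 2 + v) := Real.sqrt_le_sqrt (by nlinarith)
  have h2 : √v ≤ 2 := by rw [Real.sqrt_le_left (by norm_num)]; linarith
  have h3 := Real.mul_self_sqrt hv.le
  nlinarith [Real.sqrt_nonneg v]

theorem sin_half_bounds (θ : ℝ) :
    0 ≤ 4 * Real.sin (θ / 2) ^ 2 ∧ 4 * Real.sin (θ / 2) ^ 2 ≤ 4 :=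
  ⟨by positivity, by nlinarith [Real.sin_sq_le_one (θ / 2)]⟩

theorem intervalIntegrable_regProfile (σ : ℝ) :
    IntervalIntegrable (fun θ => (Real.cos θ - Real.cos (θ / 2)) /
      √(σ ^ 2 + 4 * Real.sin (θ / 2) ^ 2)) volume (-π) π := by
  have h : IntervalIntegrable (fun _ : ℝ => (3 / 2 : ℝ)) volume (-π) π :=
    intervalIntegrable_const
  refine h.mono_fun (Measurable.aestronglyMeasurable (by fun_prop)) ?_
  refine (ae_restrict_iff' measurableSet_uIoc).2 (ae_of_all _ fun θ hθ => ?_)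
  rw [Set.uIoc_of_le (by linarith [Real.pi_pos])] at hθ
  simp only [Real.norm_eq_abs, abs_of_pos (by norm_num : (0 : ℝ) < 3 / 2)]
  exact abs_div_sqrt_le (sin_half_bounds θ).1 (sin_half_bounds θ).2
    (abs_cos_sub_cos_half_le ⟨hθ.1.le, hθ.2⟩) σ

theorem integral_cos_half_div_sqrt {σ : ℝ} (hσ : 0 < σ) :
    ∫ θ in (-π)..π, Real.cos (θ / 2) / √(σ ^ 2 + 4 * Real.sin (θ / 2) ^ 2) =
      2 * (Real.log (2 + √(4 + σ ^ 2)) - Real.log σ) := by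
  have hpos : ∀ θ : ℝ, 0 < σ ^ 2 + 4 * Real.sin (θ / 2) ^ 2 := fun θ => by positivity
  have hd : ∀ θ ∈ Set.uIcc (-π) π, HasDerivAt (fun θ => Real.arsinh (2 * Real.sin (θ / 2) / σ))
      (Real.cos (θ / 2) / √(σ ^ 2 + 4 * Real.sin (θ / 2) ^ 2)) θ := by
    intro θ _
    have h1 : HasDerivAt (fun θ : ℝ => 2 * Real.sin (θ / 2) / σ) (Real.cos (θ / 2) / σ) θ := by
      have := (((hasDerivAt_id θ).div_const 2).sin.const_mul 2).div_const σ
      exact this.congr_deriv (by simp only [id]; ring)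
    have := h1.arsinh
    convert this using 1
    rw [show σ ^ 2 + 4 * Real.sin (θ / 2) ^ 2 = σ ^ 2 * (1 + (2 * Real.sin (θ / 2) / σ) ^ 2) by
      field_simp; ring]
    rw [Real.sqrt_mul (by positivity), Real.sqrt_sq hσ.le, smul_eq_mul]
    field_simp
  rw [intervalIntegral.integral_eq_sub_of_hasDerivAt hd]
  · have h1 : Real.arsinh (2 / σ) = Real.log (2 + √(4 + σ ^ 2)) - Real.log σ := by
      rw [Real.arsinh, ← Real.log_div (by positivity) hσ.ne']
      congr 1
      rw [show 1 + (2 / σ) ^ 2 = (4 + σ ^ 2) / σ ^ 2 by field_simp; ring,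
        Real.sqrt_div (by positivity), Real.sqrt_sq hσ.le]
      field_simp
    rw [neg_div, Real.sin_neg, Real.sin_pi_div_two, mul_neg, neg_div, Real.arsinh_neg, mul_one, h1]
    ring
  · refine Continuous.intervalIntegrable ?_ _ _
    exact Continuous.div (by fun_prop) (by fun_prop) fun θ => (Real.sqrt_pos.2 (hpos θ)).ne'

theorem ringProfile_eq {σ : ℝ} (hσ : 0 < σ) :
    ringProfile σ = -(1 / (2 * π)) * Real.log σ + regProfile σ := by
  have hpos : ∀ θ : ℝ, 0 < σ ^ 2 + 4 * Real.sin (θ / 2) ^ 2 := fun θ => by positivity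
  have h : ∫ θ in (-π)..π, Real.cos θ / √(σ ^ 2 + 2 - 2 * Real.cos θ) =
      (∫ θ in (-π)..π, (Real.cos θ - Real.cos (θ / 2)) / √(σ ^ 2 + 4 * Real.sin (θ / 2) ^ 2)) +
      ∫ θ in (-π)..π, Real.cos (θ / 2) / √(σ ^ 2 + 4 * Real.sin (θ / 2) ^ 2) := by
    rw [← intervalIntegral.integral_add (intervalIntegrable_regProfile σ)]
    · refine intervalIntegral.integral_congr fun θ _ => ?_
      rw [add_sub_assoc, two_sub_two_cos, ← add_div]; congr 1; ring
    · refine Continuous.intervalIntegrable ?_ _ _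
      exact Continuous.div (by fun_prop) (by fun_prop) fun θ => (Real.sqrt_pos.2 (hpos θ)).ne'
  rw [ringProfile, regProfile, h, integral_cos_half_div_sqrt hσ]
  field_simp
  ring

theorem regProfile_lipschitz (s t : ℝ) : |regProfile s - regProfile t| ≤ |s - t| := by
  have hpi := Real.pi_gt_three
  set J : ℝ → ℝ := fun σ => ∫ θ in (-π)..π,
      (Real.cos θ - Real.cos (θ / 2)) / √(σ ^ 2 + 4 * Real.sin (θ / 2) ^ 2)
  have hJ : |J s - J t| ≤ 3 / 4 * |s - t| * (2 * π) := by
    simp only [J]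
    rw [← intervalIntegral.integral_sub (intervalIntegrable_regProfile s)
      (intervalIntegrable_regProfile t), ← Real.norm_eq_abs]
    refine (intervalIntegral.norm_integral_le_of_norm_le_const (C := 3 / 4 * |s - t|)
      fun θ hθ => ?_).trans (le_of_eq ?_)
    · rw [Set.uIoc_of_le (by linarith)] at hθ
      exact div_sqrt_lipschitz (sin_half_bounds θ).1 (abs_cos_sub_cos_half_le ⟨hθ.1.le, hθ.2⟩) s t
    · rw [abs_of_pos (by linarith : 0 < π - -π)]; ring
  have hL : |Real.log (2 + √(4 + s ^ 2)) - Real.log (2 + √(4 + t ^ 2))| ≤ |s - t| := by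
    have key : ∀ s t : ℝ, Real.log (2 + √(4 + s ^ 2)) - Real.log (2 + √(4 + t ^ 2)) ≤ |s - t| := by
      intro s t
      have hs : 0 ≤ √(4 + s ^ 2) := Real.sqrt_nonneg _
      have ht : 0 ≤ √(4 + t ^ 2) := Real.sqrt_nonneg _
      rw [← Real.log_div (by positivity) (by positivity)]
      refine (Real.log_le_sub_one_of_pos (by positivity)).trans ?_
      rw [div_sub_one (by positivity), div_le_iff₀ (by positivity)]
      have h := abs_sqrt_add_sub_sqrt_add_le (show (0 : ℝ) ≤ 4 by norm_num) s t
      rw [add_comm (s ^ 2), add_comm (t ^ 2)] at h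
      nlinarith [le_abs_self (√(4 + s ^ 2) - √(4 + t ^ 2)), abs_nonneg (s - t)]
    rw [abs_le]
    refine ⟨?_, key s t⟩
    have := key t s
    rw [abs_sub_comm t s] at this; linarith
  have : regProfile s - regProfile t =
      1 / (2 * π) * (Real.log (2 + √(4 + s ^ 2)) - Real.log (2 + √(4 + t ^ 2))) +
        1 / (4 * π) * (J s - J t) := by
    simp only [regProfile, J]; ring
  rw [this]
  refine (abs_add_le _ _).trans ?_
  rw [abs_mul, abs_mul, abs_of_pos (by positivity : 0 < 1 / (2 * π)),
    abs_of_pos (by positivity : 0 < 1 / (4 * π))]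
  have e1 : 1 / (2 * π) * |Real.log (2 + √(4 + s ^ 2)) - Real.log (2 + √(4 + t ^ 2))| ≤
      1 / 6 * |s - t| := by
    gcongr; linarith
  have e2 : 1 / (4 * π) * |J s - J t| ≤ 3 / 8 * |s - t| := by
    calc _ ≤ 1 / (4 * π) * (3 / 4 * |s - t| * (2 * π)) := by gcongr
      _ = _ := by field_simp; ring
  linarith [abs_nonneg (s - t)]

theorem regProfile_differentiableAt {σ : ℝ} (hσ : 0 < σ) : DifferentiableAt ℝ regProfile σ := by
  have hpi := Real.pi_pos
  have hpos : ∀ θ : ℝ, σ ^ 2 + 4 * Real.sin (θ / 2) ^ 2 ≠ 0 := fun θ => by positivity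
  have hJ : DifferentiableAt ℝ (fun σ => ∫ θ in (-π)..π,
      (Real.cos θ - Real.cos (θ / 2)) / √(σ ^ 2 + 4 * Real.sin (θ / 2) ^ 2)) σ := by
    have hd : ∀ θ, HasDerivAt (fun s => (Real.cos θ - Real.cos (θ / 2)) /
        √(s ^ 2 + 4 * Real.sin (θ / 2) ^ 2))
        (-((Real.cos θ - Real.cos (θ / 2)) * (σ / √(σ ^ 2 + 4 * Real.sin (θ / 2) ^ 2))) /
          (√(σ ^ 2 + 4 * Real.sin (θ / 2) ^ 2)) ^ 2) σ := by
      intro θ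
      have hp := hpos θ
      have h1 : HasDerivAt (fun s : ℝ => √(s ^ 2 + 4 * Real.sin (θ / 2) ^ 2))
          (σ / √(σ ^ 2 + 4 * Real.sin (θ / 2) ^ 2)) σ := by
        have := ((hasDerivAt_pow 2 σ).add_const (4 * Real.sin (θ / 2) ^ 2)).sqrt hp
        convert this using 1
        simp; ring
      have := (hasDerivAt_const σ (Real.cos θ - Real.cos (θ / 2))).fun_div h1
        (Real.sqrt_ne_zero'.2 (lt_of_le_of_ne (by positivity) hp.symm))
      exact this.congr_deriv (by ring)
    refine (intervalIntegral.hasDerivAt_integral_of_dominated_loc_of_lip (s := Set.univ)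
      (bound := fun _ => 3 / 4) (F' := fun θ => _) univ_mem
      (Eventually.of_forall fun s => Measurable.aestronglyMeasurable (by fun_prop))
      (intervalIntegrable_regProfile σ) (Measurable.aestronglyMeasurable (by fun_prop))
      (ae_of_all _ fun θ hθ => ?_) intervalIntegrable_const
      (ae_of_all _ fun θ _ => hd θ)).2.differentiableAt
    rw [Set.uIoc_of_le (by linarith)] at hθ
    refine LipschitzOnWith.of_dist_le_mul fun s _ t _ => ?_
    simp only [Real.dist_eq]
    simpa using div_sqrt_lipschitz (sin_half_bounds θ).1
      (abs_cos_sub_cos_half_le ⟨hθ.1.le, hθ.2⟩) s t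
  unfold regProfile
  refine DifferentiableAt.add (DifferentiableAt.const_mul ?_ _) (hJ.const_mul _)
  refine DifferentiableAt.log ?_ (by positivity)
  refine (DifferentiableAt.sqrt ?_ (by positivity)).const_add _
  fun_prop

/-- The scale-invariant ring kernel `G_*(x, x') / x₁²`. -/
def ringKern (x x' : ℂ) : ℝ :=
  x'.re / x.re * √(x'.re / x.re) * ringProfile (‖x - x'‖ / √(x.re * x'.re))

/-- The regular part of the ring kernel in terms of ratio, product and distance. -/
def regPart (q m p : ℝ) : ℝ :=
  q * √q * (1 / (4 * π) * Real.log m + regProfile (p / √m)) -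
    1 / (2 * π) * (q * √q - 1) * Real.log p

/-- The ring kernel minus its logarithmic singularity. -/
def regKern (x x' : ℂ) : ℝ := regPart (x'.re / x.re) (x.re * x'.re) ‖x - x'‖

theorem ringKern_eq {x x' : ℂ} (hx : 0 < x.re) (hx' : 0 < x'.re) (hne : x ≠ x') :
    ringKern x x' = -(1 / (2 * π)) * Real.log ‖x - x'‖ + regKern x x' := by
  have hp : 0 < ‖x - x'‖ := norm_pos_iff.2 (sub_ne_zero.2 hne)
  have hm : 0 < x.re * x'.re := mul_pos hx hx'
  rw [ringKern, regKern, regPart, ringProfile_eq (div_pos hp (Real.sqrt_pos.2 hm)),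
    Real.log_div hp.ne' (Real.sqrt_pos.2 hm).ne', Real.log_sqrt hm.le]
  ring

theorem mul_sqrt_lipschitz {p q : ℝ} (hp : 0 ≤ p) (hq : 0 ≤ q) (hp4 : p ≤ 4) (hq4 : q ≤ 4) :
    |p * √p - q * √q| ≤ 4 * |p - q| := by
  obtain ⟨u, hu, rfl⟩ : ∃ u, 0 ≤ u ∧ p = u ^ 2 := ⟨√p, Real.sqrt_nonneg _, (Real.sq_sqrt hp).symm⟩
  obtain ⟨v, hv, rfl⟩ : ∃ v, 0 ≤ v ∧ q = v ^ 2 := ⟨√q, Real.sqrt_nonneg _, (Real.sq_sqrt hq).symm⟩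
  rw [Real.sqrt_sq hu, Real.sqrt_sq hv]
  have hu2 : u ≤ 2 := by nlinarith
  have hv2 : v ≤ 2 := by nlinarith
  rw [show u ^ 2 * u - v ^ 2 * v = (u - v) * (u ^ 2 + u * v + v ^ 2) by ring,
    show u ^ 2 - v ^ 2 = (u - v) * (u + v) by ring, abs_mul, abs_mul,
    abs_of_nonneg (by positivity : 0 ≤ u ^ 2 + u * v + v ^ 2), abs_of_nonneg (by positivity : 0 ≤ u + v)]
  have : u ^ 2 + u * v + v ^ 2 ≤ 4 * (u + v) := by nlinarith [mul_nonneg hu hv]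
  nlinarith [abs_nonneg (u - v)]

theorem abs_log_sub_log_le {m n c : ℝ} (hc : 0 < c) (hm : c ≤ m) (hn : c ≤ n) :
    |Real.log m - Real.log n| ≤ c⁻¹ * |m - n| := by
  have key : ∀ m n : ℝ, c ≤ m → c ≤ n → Real.log m - Real.log n ≤ c⁻¹ * |m - n| := by
    intro m n hm hn
    have hm0 : 0 < m := hc.trans_le hm
    have hn0 : 0 < n := hc.trans_le hn
    rw [← Real.log_div hm0.ne' hn0.ne']
    refine (Real.log_le_sub_one_of_pos (div_pos hm0 hn0)).trans ?_
    rw [div_sub_one hn0.ne', div_eq_inv_mul]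
    refine (mul_le_mul_of_nonneg_left (le_abs_self _) (by positivity)).trans ?_
    exact mul_le_mul_of_nonneg_right (inv_anti₀ hc hn) (abs_nonneg _)
  rw [abs_le]
  have := key n m hn hm
  rw [abs_sub_comm n m] at this
  exact ⟨by linarith, key m n hm hn⟩

theorem abs_sqrt_sub_sqrt_le {m n : ℝ} (hm : 1 / 4 ≤ m) (hn : 1 / 4 ≤ n) :
    |√m - √n| ≤ |m - n| := by
  have h1 : 1 / 2 ≤ √m := Real.le_sqrt_of_sq_le (by linarith)
  have h2 : 1 / 2 ≤ √n := Real.le_sqrt_of_sq_le (by linarith)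
  have h : m - n = (√m - √n) * (√m + √n) := by
    have := Real.mul_self_sqrt (by linarith : 0 ≤ m)
    have := Real.mul_self_sqrt (by linarith : 0 ≤ n)
    nlinarith
  rw [h, abs_mul, abs_of_pos (by linarith : 0 < √m + √n)]
  nlinarith [abs_nonneg (√m - √n)]

theorem div_sqrt_sub_div_sqrt_le {m n p q : ℝ} (hm : 1 / 4 ≤ m) (hn : 1 / 4 ≤ n)
    (hq : 0 ≤ q) (hq1 : q ≤ 1) : |p / √m - q / √n| ≤ 2 * |p - q| + 4 * |m - n| := by
  have h1 : 1 / 2 ≤ √m := Real.le_sqrt_of_sq_le (by linarith)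
  have h2 : 1 / 2 ≤ √n := Real.le_sqrt_of_sq_le (by linarith)
  have hm' : 0 < √m := by linarith
  have hn' : 0 < √n := by linarith
  have e : p / √m - q / √n = (p - q) / √m + q * (√n - √m) / (√m * √n) := by
    field_simp; ring
  rw [e]
  refine (abs_add_le _ _).trans (add_le_add ?_ ?_)
  · rw [abs_div, abs_of_pos hm', div_le_iff₀ hm']
    nlinarith [abs_nonneg (p - q)]
  · have h := abs_sqrt_sub_sqrt_le hn hm
    rw [abs_sub_comm n m] at h
    rw [abs_div, abs_mul, abs_of_pos (mul_pos hm' hn'), abs_of_nonneg hq,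
      div_le_iff₀ (mul_pos hm' hn')]
    have h3 : 1 / 4 ≤ √m * √n := by nlinarith
    calc q * |√n - √m| ≤ 1 * |m - n| := by gcongr
      _ ≤ 4 * |m - n| * (√m * √n) := by nlinarith [abs_nonneg (m - n)]

theorem regPart_sub_le : ∃ C : ℝ, 1 ≤ C ∧ ∀ q m p q' m' p' : ℝ, 0 ≤ q → q ≤ 4 → 0 ≤ q' → q' ≤ 4 →
    1 / 4 ≤ m → m ≤ 4 → 1 / 4 ≤ m' → m' ≤ 4 → 0 ≤ p → p ≤ 1 → 0 ≤ p' → p' ≤ 1 →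
    |regPart q m p - regPart q' m' p'| ≤ C * (|q - q'| + |m - m'| + |p - p'|) +
      |q * √q - q' * √q'| * |Real.log p| + |q' * √q' - 1| * |Real.log p - Real.log p'| := by
  refine ⟨4 * (10 + |regProfile 0|) + 80, by linarith [abs_nonneg (regProfile 0)], ?_⟩
  intro q m p q' m' p' hq hq4 hq' hq4' hm hm4 hm' hm4' hp hp1 hp' hp1'
  have hpi := Real.pi_gt_three
  set G := 1 / (4 * π) * Real.log m + regProfile (p / √m)
  set G' := 1 / (4 * π) * Real.log m' + regProfile (p' / √m')
  have hc1 : 1 / (4 * π) ≤ 1 := by rw [div_le_one (by positivity)]; linarith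
  have hc2 : 1 / (2 * π) ≤ 1 := by rw [div_le_one (by positivity)]; linarith
  have hG : |G| ≤ 10 + |regProfile 0| := by
    have h1 : |Real.log m| ≤ 8 := by
      refine (abs_log_le_add_inv (by linarith)).trans ?_
      have : m⁻¹ ≤ (1 / 4)⁻¹ := inv_anti₀ (by norm_num) hm
      norm_num at this; linarith
    have h2 := regProfile_lipschitz (p / √m) 0
    have h3 : |p / √m - 0| ≤ 2 := by
      have : 1 / 2 ≤ √m := Real.le_sqrt_of_sq_le (by linarith)
      rw [sub_zero, abs_of_nonneg (by positivity), div_le_iff₀ (by linarith)]; linarith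
    have h4 : |1 / (4 * π) * Real.log m| ≤ 8 := by
      rw [abs_mul, abs_of_pos (by positivity : 0 < 1 / (4 * π))]
      nlinarith [abs_nonneg (Real.log m)]
    have h5 : |regProfile (p / √m)| ≤ 2 + |regProfile 0| := by
      have := abs_sub_abs_le_abs_sub (regProfile (p / √m)) (regProfile 0); linarith
    refine (abs_add_le _ _).trans ?_; linarith
  have hGG : |G - G'| ≤ 8 * |m - m'| + 2 * |p - p'| := by
    have h1 := abs_log_sub_log_le (by norm_num : (0 : ℝ) < 1 / 4) hm hm'
    have h2 := (regProfile_lipschitz (p / √m) (p' / √m')).trans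
      (div_sqrt_sub_div_sqrt_le hm hm' hp' hp1')
    have e : G - G' = 1 / (4 * π) * (Real.log m - Real.log m') +
        (regProfile (p / √m) - regProfile (p' / √m')) := by simp only [G, G']; ring
    rw [e]
    refine (abs_add_le _ _).trans ?_
    rw [abs_mul, abs_of_pos (by positivity : 0 < 1 / (4 * π))]
    have : 1 / (4 * π) * |Real.log m - Real.log m'| ≤ 1 * ((1 / 4)⁻¹ * |m - m'|) := by gcongr
    rw [show ((1 : ℝ) / 4)⁻¹ = 4 by norm_num] at this
    linarith
  have hF := mul_sqrt_lipschitz hq hq' hq4 hq4'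
  have hF8 : |q' * √q'| ≤ 8 := by
    have h2 : √q' ≤ 2 := by rw [Real.sqrt_le_left (by norm_num)]; linarith
    rw [abs_of_nonneg (by positivity)]; nlinarith [Real.sqrt_nonneg q']
  have e : regPart q m p - regPart q' m' p' = (q * √q - q' * √q') * G + q' * √q' * (G - G') +
      (-(1 / (2 * π)) * ((q * √q - q' * √q') * Real.log p) +
      -(1 / (2 * π)) * ((q' * √q' - 1) * (Real.log p - Real.log p'))) := by
    simp only [regPart, G, G']; ring
  have b : ∀ z : ℝ, |-(1 / (2 * π)) * z| ≤ |z| := by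
    intro z
    rw [abs_mul, abs_neg, abs_of_pos (by positivity : 0 < 1 / (2 * π))]
    nlinarith [abs_nonneg z]
  rw [e]
  have t1 : |(q * √q - q' * √q') * G| ≤ 4 * |q - q'| * (10 + |regProfile 0|) := by
    rw [abs_mul]; gcongr
  have t2 : |q' * √q' * (G - G')| ≤ 8 * (8 * |m - m'| + 2 * |p - p'|) := by
    rw [abs_mul]; gcongr
  have t3 := b ((q * √q - q' * √q') * Real.log p)
  have t4 := b ((q' * √q' - 1) * (Real.log p - Real.log p'))
  rw [abs_mul (q * √q - q' * √q')] at t3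
  rw [abs_mul (q' * √q' - 1)] at t4
  refine (abs_add_le _ _).trans ?_
  refine (add_le_add (abs_add_le _ _) (abs_add_le _ _)).trans ?_
  nlinarith [abs_nonneg (q - q'), abs_nonneg (m - m'), abs_nonneg (p - p'),
    abs_nonneg (regProfile 0), mul_nonneg (abs_nonneg (regProfile 0)) (abs_nonneg (m - m')),
    mul_nonneg (abs_nonneg (regProfile 0)) (abs_nonneg (p - p'))]

theorem re_bounds {X : ℂ} (hX : ‖X - 1‖ ≤ 1 / 2) : 1 / 2 ≤ X.re ∧ X.re ≤ 3 / 2 := by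
  have := (Complex.abs_re_le_norm (X - 1)).trans hX
  rw [Complex.sub_re, Complex.one_re, abs_le] at this
  constructor <;> linarith [this.1, this.2]

theorem ratio_bounds {X Y : ℂ} (hX : ‖X - 1‖ ≤ 1 / 2) (hY : ‖Y - 1‖ ≤ 1 / 2) :
    0 ≤ Y.re / X.re ∧ Y.re / X.re ≤ 4 ∧ 1 / 4 ≤ X.re * Y.re ∧ X.re * Y.re ≤ 4 ∧ ‖X - Y‖ ≤ 1 := by
  obtain ⟨a, b⟩ := re_bounds hX
  obtain ⟨c, d⟩ := re_bounds hY
  refine ⟨by positivity, ?_, by nlinarith, by nlinarith, ?_⟩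
  · rw [div_le_iff₀ (by linarith)]; linarith
  · have := norm_sub_le (X - 1) (Y - 1)
    rw [sub_sub_sub_cancel_right] at this; linarith

theorem abs_re_sub_le (X Y : ℂ) : |X.re - Y.re| ≤ ‖X - Y‖ := by
  simpa using Complex.abs_re_le_norm (X - Y)

theorem abs_ratio_pow_sub_one_le {X Y : ℂ} (hX : ‖X - 1‖ ≤ 1 / 2) (hY : ‖Y - 1‖ ≤ 1 / 2) :
    |Y.re / X.re * √(Y.re / X.re) - 1| ≤ 8 * ‖X - Y‖ ∧ |Y.re / X.re - 1| ≤ 2 * ‖X - Y‖ := by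
  obtain ⟨h1, h2, -, -, -⟩ := ratio_bounds hX hY
  have h := mul_sqrt_lipschitz h1 zero_le_one h2 (by norm_num)
  rw [Real.sqrt_one, mul_one] at h
  have h3 : |Y.re / X.re - 1| ≤ 2 * ‖X - Y‖ := by
    obtain ⟨a, -⟩ := re_bounds hX
    rw [div_sub_one (by linarith), abs_div, abs_of_pos (by linarith : 0 < X.re),
      div_le_iff₀ (by linarith), abs_sub_comm]
    have := abs_re_sub_le X Y
    nlinarith [norm_nonneg (X - Y)]
  exact ⟨by linarith, h3⟩

theorem regKern_sub_le : ∃ C : ℝ, 1 ≤ C ∧ ∀ X Z Y : ℂ, ‖X - 1‖ ≤ 1 / 2 → ‖Z - 1‖ ≤ 1 / 2 →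
    ‖Y - 1‖ ≤ 1 / 2 → |regKern X Y - regKern Z Y| ≤
      C * ‖X - Z‖ * (1 + |Real.log ‖X - Y‖| + |Real.log ‖Z - Y‖|) := by
  obtain ⟨C, hC, h⟩ := regPart_sub_le
  refine ⟨24 * C, by linarith, ?_⟩
  have key : ∀ X Z Y : ℂ, ‖X - 1‖ ≤ 1 / 2 → ‖Z - 1‖ ≤ 1 / 2 →
    ‖Y - 1‖ ≤ 1 / 2 → ‖Z - Y‖ ≤ ‖X - Y‖ → |regKern X Y - regKern Z Y| ≤
      24 * C * ‖X - Z‖ * (1 + |Real.log ‖X - Y‖| + |Real.log ‖Z - Y‖|) := by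
    intro X Z Y hX hZ hY hle
    obtain ⟨a1, a2, a3, a4, a5⟩ := ratio_bounds hX hY
    obtain ⟨b1, b2, b3, b4, b5⟩ := ratio_bounds hZ hY
    have hh := h _ _ _ _ _ _ a1 a2 b1 b2 a3 a4 b3 b4 (norm_nonneg (X - Y)) a5
      (norm_nonneg (Z - Y)) b5
    have hF := mul_sqrt_lipschitz a1 b1 a2 b2
    have hn := norm_nonneg (X - Z)
    obtain ⟨x1, x2⟩ := re_bounds hX
    obtain ⟨z1, z2⟩ := re_bounds hZ
    obtain ⟨y1, y2⟩ := re_bounds hY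
    have hre := abs_re_sub_le X Z
    have hq : |Y.re / X.re - Y.re / Z.re| ≤ 6 * ‖X - Z‖ := by
      rw [div_sub_div _ _ (by linarith) (by linarith), show Y.re * Z.re - X.re * Y.re =
        -(Y.re * (X.re - Z.re)) by ring, abs_div, abs_neg, abs_mul,
        abs_of_pos (by nlinarith : 0 < X.re * Z.re), abs_of_pos (by linarith : 0 < Y.re),
        div_le_iff₀ (by nlinarith)]
      have : 1 / 4 ≤ X.re * Z.re := by nlinarith
      nlinarith [abs_nonneg (X.re - Z.re)]
    have hm : |X.re * Y.re - Z.re * Y.re| ≤ 2 * ‖X - Z‖ := by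
      rw [← sub_mul, abs_mul, abs_of_pos (by linarith : 0 < Y.re)]
      nlinarith [abs_nonneg (X.re - Z.re)]
    have hp : |‖X - Y‖ - ‖Z - Y‖| ≤ ‖X - Z‖ := by
      simpa using abs_norm_sub_norm_le (X - Y) (Z - Y)
    have hl : |Y.re / Z.re * √(Y.re / Z.re) - 1| * |Real.log ‖X - Y‖ - Real.log ‖Z - Y‖| ≤
        8 * ‖X - Z‖ := by
      have h8 := (abs_ratio_pow_sub_one_le hZ hY).1
      rcases (norm_nonneg (Z - Y)).eq_or_lt with h0 | h0
      · rw [← h0, mul_zero] at h8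
        rw [le_antisymm h8 (abs_nonneg _), zero_mul]; positivity
      · have := abs_log_sub_log_le h0 hle le_rfl
        calc _ ≤ 8 * ‖Z - Y‖ * (‖Z - Y‖⁻¹ * |‖X - Y‖ - ‖Z - Y‖|) := by gcongr
          _ = 8 * |‖X - Y‖ - ‖Z - Y‖| := by field_simp
          _ ≤ _ := by gcongr
    have hFl : |Y.re / X.re * √(Y.re / X.re) - Y.re / Z.re * √(Y.re / Z.re)| * |Real.log ‖X - Y‖|
        ≤ 24 * ‖X - Z‖ * |Real.log ‖X - Y‖| := by gcongr; linarith
    have h1 : C * (|Y.re / X.re - Y.re / Z.re| + |X.re * Y.re - Z.re * Y.re| +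
        |‖X - Y‖ - ‖Z - Y‖|) ≤ C * (9 * ‖X - Z‖) := by gcongr; linarith
    have : regKern X Y - regKern Z Y = regPart (Y.re / X.re) (X.re * Y.re) ‖X - Y‖ -
      regPart (Y.re / Z.re) (Z.re * Y.re) ‖Z - Y‖ := rfl
    rw [this]
    refine hh.trans ?_
    have p1 : 0 ≤ ‖X - Z‖ * |Real.log ‖X - Y‖| := by positivity
    have p2 : 0 ≤ ‖X - Z‖ * |Real.log ‖Z - Y‖| := by positivity
    nlinarith [mul_nonneg (by linarith : 0 ≤ C - 1) hn, mul_nonneg (by linarith : 0 ≤ C - 1) p1,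
      mul_nonneg (by linarith : 0 ≤ C - 1) p2]
  intro X Z Y hX hZ hY
  rcases le_total ‖Z - Y‖ ‖X - Y‖ with hle | hle
  · exact key X Z Y hX hZ hY hle
  · have := key Z X Y hZ hX hY hle
    rw [abs_sub_comm, norm_sub_rev X Z]; linarith

theorem regKern_sub_const_le : ∃ C : ℝ, 1 ≤ C ∧ ∀ X Y : ℂ, ‖X - 1‖ ≤ 1 / 2 → ‖Y - 1‖ ≤ 1 / 2 →
    |regKern X Y - regProfile 0| ≤
      C * (‖X - 1‖ + ‖Y - 1‖) + C * ‖X - Y‖ * |Real.log ‖X - Y‖| := by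
  obtain ⟨C, hC, h⟩ := regPart_sub_le
  refine ⟨8 * C, by linarith, ?_⟩
  intro X Y hX hY
  obtain ⟨a1, a2, a3, a4, a5⟩ := ratio_bounds hX hY
  have hh := h _ _ _ 1 1 0 a1 a2 zero_le_one (by norm_num) a3 a4 (by norm_num) (by norm_num)
    (norm_nonneg (X - Y)) a5 le_rfl zero_le_one
  obtain ⟨h8, h9⟩ := abs_ratio_pow_sub_one_le hX hY
  have hm : |X.re * Y.re - 1| ≤ 2 * (‖X - 1‖ + ‖Y - 1‖) := by
    have e1 := abs_re_sub_le X 1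
    have e2 := abs_re_sub_le Y 1
    obtain ⟨y1, y2⟩ := re_bounds hY
    rw [Complex.one_re] at e1 e2
    rw [show X.re * Y.re - 1 = (X.re - 1) * Y.re + (Y.re - 1) by ring]
    refine (abs_add_le _ _).trans ?_
    rw [abs_mul, abs_of_pos (by linarith : 0 < Y.re)]
    nlinarith [abs_nonneg (X.re - 1), norm_nonneg (X - 1), norm_nonneg (Y - 1)]
  have hxy : ‖X - Y‖ ≤ ‖X - 1‖ + ‖Y - 1‖ := by
    have := norm_sub_le (X - 1) (Y - 1)
    rwa [sub_sub_sub_cancel_right] at this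
  have e : regPart 1 1 0 = regProfile 0 := by simp [regPart]
  rw [e] at hh
  simp only [Real.sqrt_one, mul_one, sub_self, abs_zero, zero_mul, add_zero, sub_zero,
    abs_norm] at hh
  refine hh.trans ?_
  have h1 : |Y.re / X.re * √(Y.re / X.re) - 1| * |Real.log ‖X - Y‖| ≤
    8 * ‖X - Y‖ * |Real.log ‖X - Y‖| := by gcongr
  have h2 : C * (|Y.re / X.re - 1| + |X.re * Y.re - 1| + ‖X - Y‖) ≤
    C * (2 * (‖X - 1‖ + ‖Y - 1‖) + 2 * (‖X - 1‖ + ‖Y - 1‖) + (‖X - 1‖ + ‖Y - 1‖)) := by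
    gcongr; linarith
  have p : 0 ≤ ‖X - Y‖ * |Real.log ‖X - Y‖| := by positivity
  nlinarith [norm_nonneg (X - 1), norm_nonneg (Y - 1), mul_nonneg (by linarith : 0 ≤ C - 1) p,
    mul_nonneg (by linarith : 0 ≤ C) (norm_nonneg (X - 1)),
    mul_nonneg (by linarith : 0 ≤ C) (norm_nonneg (Y - 1))]

theorem norm_scaled_le {a : ℝ} {y : ℂ} (ha : 0 ≤ a) (h : a * ‖y‖ ≤ 1 / 2) :
    ‖(1 + (a : ℂ) * y) - 1‖ ≤ 1 / 2 := by
  rwa [add_sub_cancel_left, norm_mul, Complex.norm_real, Real.norm_of_nonneg ha]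

theorem norm_scaled_sub {a : ℝ} (y w : ℂ) (ha : 0 ≤ a) :
    ‖(1 + (a : ℂ) * y) - (1 + (a : ℂ) * w)‖ = a * ‖y - w‖ := by
  rw [add_sub_add_left_eq_sub, ← mul_sub, norm_mul, Complex.norm_real, Real.norm_of_nonneg ha]

theorem re_scaled (a : ℝ) (y : ℂ) : (1 + (a : ℂ) * y).re = 1 + a * y.re := by simp

set_option maxHeartbeats 1000000 in
theorem regKern_scaled_sub_le : ∃ C : ℝ, 1 ≤ C ∧ ∀ a b : ℝ, 0 < a → 0 < b → a ≤ 1 / 8 → b ≤ 1 / 8 →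
    ∀ y w : ℂ, ‖y‖ ≤ 2 → ‖w‖ ≤ 2 →
    |regKern (1 + (a : ℂ) * y) (1 + (a : ℂ) * w) - regKern (1 + (b : ℂ) * y) (1 + (b : ℂ) * w)| ≤
      C * |Real.log a - Real.log b| := by
  obtain ⟨C, hC, h⟩ := regPart_sub_le
  refine ⟨18 * C + 24, by linarith, ?_⟩
  have key : ∀ a b : ℝ, 0 < a → 0 < b → a ≤ 1 / 8 → b ≤ a → ∀ y w : ℂ, ‖y‖ ≤ 2 → ‖w‖ ≤ 2 →
    |regKern (1 + (a : ℂ) * y) (1 + (a : ℂ) * w) - regKern (1 + (b : ℂ) * y) (1 + (b : ℂ) * w)| ≤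
      (18 * C + 24) * |Real.log a - Real.log b| := by
    intro a b ha hb ha8 hba y w hy hw
    have small : ∀ c z, 0 < c → c ≤ a → ‖z‖ ≤ 2 → ‖(1 + (c : ℂ) * z) - 1‖ ≤ 1 / 2 :=
      fun c z hc hca hz => norm_scaled_le hc.le (by nlinarith [norm_nonneg z])
    obtain ⟨a1, a2, a3, a4, a5⟩ := ratio_bounds (small a y ha le_rfl hy) (small a w ha le_rfl hw)
    obtain ⟨b1, b2, b3, b4, b5⟩ := ratio_bounds (small b y hb hba hy) (small b w hb hba hw)
    have hh := h _ _ _ _ _ _ a1 a2 b1 b2 a3 a4 b3 b4 (norm_nonneg _) a5 (norm_nonneg _) b5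
    have hF := mul_sqrt_lipschitz a1 b1 a2 b2
    have hF1 := (abs_ratio_pow_sub_one_le (small b y hb hba hy) (small b w hb hba hw)).1
    have e : ∀ c : ℝ, regKern (1 + (c : ℂ) * y) (1 + (c : ℂ) * w) =
      regPart ((1 + (c : ℂ) * w).re / (1 + (c : ℂ) * y).re)
        ((1 + (c : ℂ) * y).re * (1 + (c : ℂ) * w).re) ‖(1 + (c : ℂ) * y) - (1 + (c : ℂ) * w)‖ :=
      fun c => rfl
    rw [e, e]
    simp only [re_scaled, norm_scaled_sub _ _ ha.le, norm_scaled_sub _ _ hb.le] at *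
    set δ := |Real.log a - Real.log b|
    have hδ : (a - b) ≤ a * δ := by
      have h1 := Real.log_le_sub_one_of_pos (div_pos hb ha)
      rw [Real.log_div hb.ne' ha.ne'] at h1
      have h2 : Real.log a - Real.log b ≤ δ := le_abs_self _
      have h3 : 1 - b / a ≤ δ := by linarith
      have h4 : a - b = a * (1 - b / a) := by field_simp
      rw [h4]; gcongr
    have hδ0 : 0 ≤ δ := abs_nonneg _
    have hyr := (Complex.abs_re_le_norm y).trans hy
    have hwr := (Complex.abs_re_le_norm w).trans hw
    have hsub : ‖y - w‖ ≤ 4 := (norm_sub_le _ _).trans (by linarith)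
    have hn := norm_nonneg (y - w)
    have hrs := abs_re_sub_le w y
    rw [norm_sub_rev] at hrs
    rw [abs_le] at hyr hwr
    have dpos : ∀ c, 0 < c → c ≤ a → 3 / 4 ≤ 1 + c * y.re := by
      intro c hc hca; nlinarith
    have da := dpos a ha le_rfl
    have db := dpos b hb hba
    have hq : |(1 + a * w.re) / (1 + a * y.re) - (1 + b * w.re) / (1 + b * y.re)| ≤
        2 * ‖y - w‖ * (a - b) := by
      rw [div_sub_div _ _ (by linarith) (by linarith), show (1 + a * w.re) * (1 + b * y.re) -
        (1 + a * y.re) * (1 + b * w.re) = (w.re - y.re) * (a - b) by ring, abs_div, abs_mul,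
        abs_of_pos (mul_pos (by linarith) (by linarith) : 0 < (1 + a * y.re) * (1 + b * y.re)),
        abs_of_nonneg (by linarith : 0 ≤ a - b),
        div_le_iff₀ (mul_pos (by linarith) (by linarith))]
      have : 1 / 2 ≤ (1 + a * y.re) * (1 + b * y.re) := by nlinarith
      have h5 : 0 ≤ ‖y - w‖ * (a - b) := mul_nonneg hn (by linarith)
      calc |w.re - y.re| * (a - b) ≤ ‖y - w‖ * (a - b) := by gcongr
        _ ≤ 2 * ‖y - w‖ * (a - b) * ((1 + a * y.re) * (1 + b * y.re)) := by nlinarith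
    have hm : |(1 + a * y.re) * (1 + a * w.re) - (1 + b * y.re) * (1 + b * w.re)| ≤
        5 * (a - b) := by
      rw [show (1 + a * y.re) * (1 + a * w.re) - (1 + b * y.re) * (1 + b * w.re) =
        (a - b) * (y.re + w.re + (a + b) * (y.re * w.re)) by ring, abs_mul,
        abs_of_nonneg (by linarith : 0 ≤ a - b), mul_comm]
      gcongr
      have h6 : |y.re * w.re| ≤ 2 * 2 := by
        rw [abs_mul]; gcongr <;> exact abs_le.2 (by assumption)
      have h7 : |(a + b) * (y.re * w.re)| ≤ 1 := by
        rw [abs_mul, abs_of_pos (by linarith)]; nlinarith [abs_nonneg (y.re * w.re)]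
      rw [abs_le] at h7 ⊢
      constructor <;> linarith [h7.1, h7.2]
    have hp : |a * ‖y - w‖ - b * ‖y - w‖| ≤ 4 * (a - b) := by
      rw [← sub_mul, abs_mul, abs_norm, abs_of_nonneg (by linarith : 0 ≤ a - b)]
      nlinarith
    have hl1 : 8 * ‖y - w‖ * (a - b) * |Real.log (a * ‖y - w‖)| ≤ 16 * δ := by
      have h8 : a * ‖y - w‖ * |Real.log (a * ‖y - w‖)| ≤ 2 := by
        rcases hn.eq_or_lt with h0 | h0
        · simp [← h0]
        have hp0 : 0 < a * ‖y - w‖ := mul_pos ha h0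
        calc _ ≤ a * ‖y - w‖ * (a * ‖y - w‖ + (a * ‖y - w‖)⁻¹) := by
              gcongr; exact abs_log_le_add_inv hp0.le
          _ = (a * ‖y - w‖) ^ 2 + 1 := by field_simp
          _ ≤ 2 := by nlinarith
      calc _ ≤ 8 * ‖y - w‖ * (a * δ) * |Real.log (a * ‖y - w‖)| := by gcongr
        _ = 8 * δ * (a * ‖y - w‖ * |Real.log (a * ‖y - w‖)|) := by ring
        _ ≤ 8 * δ * 2 := by gcongr
        _ = _ := by ring
    have hl2 : |(1 + b * w.re) / (1 + b * y.re) * √((1 + b * w.re) / (1 + b * y.re)) - 1| *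
        |Real.log (a * ‖y - w‖) - Real.log (b * ‖y - w‖)| ≤ 8 * δ := by
      rcases hn.eq_or_lt with h0 | h0
      · simp [← h0, hδ0]
      rw [Real.log_mul ha.ne' h0.ne', Real.log_mul hb.ne' h0.ne', add_sub_add_right_eq_sub]
      calc _ ≤ 8 * (b * ‖y - w‖) * δ := by gcongr
        _ ≤ 8 * 1 * δ := by gcongr
        _ = _ := by ring
    have hab : a - b ≤ δ := hδ.trans (by nlinarith)
    refine hh.trans ?_
    have h9 : C * (|(1 + a * w.re) / (1 + a * y.re) - (1 + b * w.re) / (1 + b * y.re)| +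
        |(1 + a * y.re) * (1 + a * w.re) - (1 + b * y.re) * (1 + b * w.re)| +
        |a * ‖y - w‖ - b * ‖y - w‖|) ≤ C * (18 * δ) := by
      have : 2 * ‖y - w‖ * (a - b) ≤ 2 * 4 * (a - b) := by gcongr
      gcongr; linarith
    have h10 := mul_le_mul_of_nonneg_right (hF.trans (mul_le_mul_of_nonneg_left hq zero_le_four))
      (abs_nonneg (Real.log (a * ‖y - w‖)))
    have h11 : 4 * (2 * ‖y - w‖ * (a - b)) * |Real.log (a * ‖y - w‖)| ≤ 16 * δ := by linarith
    linarith
  intro a b ha hb ha8 hb8 y w hy hw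
  rcases le_total b a with hle | hle
  · exact key a b ha hb ha8 hle y w hy hw
  · have := key b a hb ha hb8 hle y w hy hw
    rwa [abs_sub_comm, abs_sub_comm (Real.log a)]

/-- The measure `dx dy` on `B × B`. -/
abbrev pairMeasure (B : Set ℂ) : Measure (ℂ × ℂ) := (volume.restrict B).prod (volume.restrict B)

theorem ae_pairMeasure {B : Set ℂ} (hB : MeasurableSet B) {P : ℂ × ℂ → Prop}
    (h : ∀ x ∈ B, ∀ y ∈ B, x ≠ y → P (x, y)) : ∀ᵐ p ∂pairMeasure B, P p := by
  have h1 := ae_prod_ne (S := B) (T := B) measurable_id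
  have h2 : ∀ᵐ p ∂pairMeasure B, p ∈ B ×ˢ B := by
    rw [pairMeasure, Measure.prod_restrict]
    exact ae_restrict_mem (hB.prod hB)
  filter_upwards [h1, h2] with p hp hq using h p.1 hq.1 p.2 hq.2 hp

theorem integrable_log_pair {B : Set ℂ} (hB : MeasurableSet B) {R : ℝ}
    (hR : B ⊆ Metric.closedBall 0 R) {α β : ℝ} (hα : 0 < α) (hβ : 0 < β) {g : ℂ × ℂ → ℝ}
    (hg : Measurable g) {M : ℝ} (hM : ∀ x ∈ B, ∀ y ∈ B, |g (x, y)| ≤ M) :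
    Integrable (fun p : ℂ × ℂ => g p * Real.log ‖(α : ℂ) * p.1 - (β : ℂ) * p.2‖)
      (pairMeasure B) := by
  have hv : volume B ≠ ⊤ := (Metric.isBounded_closedBall.subset hR).measure_lt_top.ne
  refine integrable_prod_of_le_inv_norm hB hv hB hv (φ := fun x => ((α / β : ℝ) : ℂ) * x)
    (C := M * ((α + β) * R + β⁻¹))
    (by fun_prop) (hg.mul (Real.measurable_log.comp (by fun_prop))).aestronglyMeasurable ?_
  intro x hx y hy
  have hx' := hR hx
  have hy' := hR hy
  rw [mem_closedBall_zero_iff] at hx' hy'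
  have hR0 : 0 ≤ R := (norm_nonneg x).trans hx'
  have hM0 : 0 ≤ M := (abs_nonneg _).trans (hM x hx y hy)
  have hn : ‖(α : ℂ) * x - (β : ℂ) * y‖ ≤ (α + β) * R := by
    refine (norm_sub_le _ _).trans ?_
    rw [norm_mul, norm_mul, Complex.norm_real, Complex.norm_real, Real.norm_of_nonneg hα.le,
      Real.norm_of_nonneg hβ.le]
    nlinarith
  have hs : ‖(α : ℂ) * x - (β : ℂ) * y‖ = β * ‖((α / β : ℝ) : ℂ) * x - y‖ := by
    have : (α : ℂ) * x - (β : ℂ) * y = (β : ℂ) * (((α / β : ℝ) : ℂ) * x - y) := by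
      have : (β : ℂ) ≠ 0 := by exact_mod_cast hβ.ne'
      push_cast; field_simp
    rw [this, norm_mul, Complex.norm_real, Real.norm_of_nonneg hβ.le]
  rw [abs_mul, mul_assoc]
  refine mul_le_mul (hM x hx y hy) ?_ (abs_nonneg _) hM0
  refine (abs_log_le_add_inv (norm_nonneg _)).trans ?_
  have h2 : (‖(α : ℂ) * x - (β : ℂ) * y‖)⁻¹ = β⁻¹ * ‖((α / β : ℝ) : ℂ) * x - y‖⁻¹ := by
    rw [hs, mul_inv]
  rw [h2]
  have h3 : 0 ≤ ‖((α / β : ℝ) : ℂ) * x - y‖⁻¹ := by positivity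
  have h4 : 0 ≤ (α + β) * R := by positivity
  have h5 : 0 < β⁻¹ := inv_pos.2 hβ
  nlinarith [mul_nonneg h4 h3]

theorem integrable_log_pair_one {B : Set ℂ} (hB : MeasurableSet B) {R : ℝ}
    (hR : B ⊆ Metric.closedBall 0 R) {g : ℂ × ℂ → ℝ}
    (hg : Measurable g) {M : ℝ} (hM : ∀ x ∈ B, ∀ y ∈ B, |g (x, y)| ≤ M) :
    Integrable (fun p : ℂ × ℂ => g p * Real.log ‖p.1 - p.2‖) (pairMeasure B) := by
  simpa using integrable_log_pair hB hR one_pos one_pos hg hM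

/-- The error term in the symmetrized dilation of the logarithmic energy. -/
def logError (B : Set ℂ) (R t : ℝ) : ℝ :=
  ∫ p, Real.log (1 + (2 * R * t) ^ 2 / ‖p.1 - p.2‖ ^ 2) ∂pairMeasure B

theorem log_one_add_sq_le (s : ℝ) : Real.log (1 + s ^ 2) ≤ 2 * |s| := by
  have h : 1 + s ^ 2 ≤ (1 + |s|) ^ 2 := by nlinarith [abs_nonneg s, sq_abs s]
  have h2 := Real.log_le_sub_one_of_pos (by positivity : 0 < 1 + |s|)
  calc Real.log (1 + s ^ 2) ≤ Real.log ((1 + |s|) ^ 2) := Real.log_le_log (by positivity) h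
    _ = 2 * Real.log (1 + |s|) := by rw [Real.log_pow]; norm_num
    _ ≤ _ := by linarith

theorem log_error_bound (R t ρ : ℝ) (hR : 0 ≤ R) (hρ : 0 ≤ ρ) :
    0 ≤ Real.log (1 + (2 * R * t) ^ 2 / ρ ^ 2) ∧
      Real.log (1 + (2 * R * t) ^ 2 / ρ ^ 2) ≤ |t| * (4 * R * ρ⁻¹) := by
  constructor
  · exact Real.log_nonneg (by have : 0 ≤ (2 * R * t) ^ 2 / ρ ^ 2 := by positivity
                              linarith)
  · rw [← div_pow]
    refine (log_one_add_sq_le _).trans (le_of_eq ?_)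
    rw [abs_div, abs_mul, abs_of_nonneg hρ, abs_of_nonneg (by positivity : 0 ≤ 2 * R),
      div_eq_mul_inv]; ring

theorem integrable_logError {B : Set ℂ} (hv : volume B ≠ ⊤) {R : ℝ} (hR : 0 ≤ R) (t : ℝ) :
    Integrable (fun p : ℂ × ℂ => Real.log (1 + (2 * R * t) ^ 2 / ‖p.1 - p.2‖ ^ 2))
      (pairMeasure B) := by
  have h := (integrable_prod_inv_norm hv hv measurable_id).const_mul (|t| * (4 * R))
  refine Integrable.mono' h (Real.measurable_log.comp (by fun_prop)).aestronglyMeasurable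
    (ae_of_all _ fun p => ?_)
  obtain ⟨h1, h2⟩ := log_error_bound R t ‖p.1 - p.2‖ hR (norm_nonneg _)
  rw [Real.norm_of_nonneg h1]; exact h2.trans_eq (by simp only [id]; ring)

theorem tendsto_logError {B : Set ℂ} (hv : volume B ≠ ⊤) {R : ℝ} (hR : 0 ≤ R) :
    Tendsto (fun t => logError B R t / t) (nhdsWithin 0 {0}ᶜ) (nhds 0) := by
  have e : ∀ t, logError B R t / t =
      ∫ p, Real.log (1 + (2 * R * t) ^ 2 / ‖p.1 - p.2‖ ^ 2) / t ∂pairMeasure B := fun t => by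
    rw [integral_div]; rfl
  simp_rw [e]
  have e0 : (0 : ℝ) = ∫ p : ℂ × ℂ, (0 : ℝ) ∂pairMeasure B := by simp
  conv => arg 3; rw [e0]
  refine tendsto_integral_filter_of_dominated_convergence (fun p => 4 * R * ‖p.1 - p.2‖⁻¹)
    (Eventually.of_forall fun t =>
      ((Real.measurable_log.comp (by fun_prop)).div_const t).aestronglyMeasurable) ?_
    ((integrable_prod_inv_norm hv hv measurable_id).const_mul _) ?_
  · refine eventually_nhdsWithin_of_forall fun t ht => ae_of_all _ fun p => ?_
    obtain ⟨h1, h2⟩ := log_error_bound R t ‖p.1 - p.2‖ hR (norm_nonneg _)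
    rw [norm_div, Real.norm_of_nonneg h1, Real.norm_eq_abs, div_le_iff₀ (abs_pos.2 ht)]
    linarith
  · refine ae_of_all _ fun p => ?_
    set ρ := ‖p.1 - p.2‖
    have hb : Tendsto (fun t : ℝ => (2 * R) ^ 2 / ρ ^ 2 * |t|) (nhdsWithin 0 {0}ᶜ) (nhds 0) := by
      refine (Continuous.tendsto' (by fun_prop) 0 _ (by simp)).mono_left nhdsWithin_le_nhds
    refine squeeze_zero_norm' (eventually_nhdsWithin_of_forall fun t ht => ?_) hb
    obtain ⟨h1, -⟩ := log_error_bound R t ρ hR (norm_nonneg _)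
    have hz : 0 ≤ (2 * R * t) ^ 2 / ρ ^ 2 := by positivity
    have h3 := Real.log_le_sub_one_of_pos (by linarith : 0 < 1 + (2 * R * t) ^ 2 / ρ ^ 2)
    rw [norm_div, Real.norm_of_nonneg h1, Real.norm_eq_abs, div_le_iff₀ (abs_pos.2 ht)]
    calc _ ≤ (2 * R * t) ^ 2 / ρ ^ 2 := by linarith
      _ = (2 * R) ^ 2 / ρ ^ 2 * |t| * |t| := by rw [mul_pow, mul_assoc, abs_mul_abs_self]; ring

theorem abs_exp_half_sub_le {t : ℝ} (ht : |t| ≤ 1) :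
    |Real.exp (t / 2) - Real.exp (-(t / 2))| ≤ 2 * |t| := by
  have h2 : |t / 2| ≤ 1 := by rw [abs_div, abs_two]; linarith
  have h1 := Real.abs_exp_sub_one_le h2
  have h3 := Real.abs_exp_sub_one_le (show |-(t / 2)| ≤ 1 by rwa [abs_neg])
  rw [abs_neg] at h3
  rw [abs_div, abs_two] at h1 h3
  have : Real.exp (t / 2) - Real.exp (-(t / 2)) =
    (Real.exp (t / 2) - 1) - (Real.exp (-(t / 2)) - 1) := by ring
  rw [this]
  refine (abs_sub _ _).trans ?_
  linarith

theorem dilated_log_energy_le {B : Set ℂ} (hB : MeasurableSet B) {R : ℝ}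
    (hR : B ⊆ Metric.closedBall 0 R) (hR0 : 0 ≤ R) {g : ℂ × ℂ → ℝ}
    (hg : Measurable g) (hsymm : ∀ p, g p.swap = g p) {M : ℝ}
    (hM : ∀ x ∈ B, ∀ y ∈ B, |g (x, y)| ≤ M) (hg0 : ∀ x ∈ B, ∀ y ∈ B, 0 ≤ g (x, y))
    {t : ℝ} (ht : |t| ≤ 1) :
    ∫ p, g p * Real.log ‖(Real.exp (t / 2) : ℂ) * p.1 - (Real.exp (-(t / 2)) : ℂ) * p.2‖
        ∂pairMeasure B ≤
      ∫ p, g p * Real.log ‖p.1 - p.2‖ ∂pairMeasure B + M / 2 * logError B R t := by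
  have hv : volume B ≠ ⊤ := (Metric.isBounded_closedBall.subset hR).measure_lt_top.ne
  set α := Real.exp (t / 2)
  set β := Real.exp (-(t / 2))
  have hα : 0 < α := Real.exp_pos _
  have hβ : 0 < β := Real.exp_pos _
  have hαβ : α * β = 1 := by rw [← Real.exp_add]; simp
  have hI := integrable_log_pair hB hR hα hβ hg hM
  have hI2 := integrable_log_pair hB hR hβ hα hg hM
  have hI1 := integrable_log_pair_one hB hR hg hM
  have hE := (integrable_logError hv hR0 t).const_mul M
  have hsw : ∫ p, g p * Real.log ‖(α : ℂ) * p.1 - (β : ℂ) * p.2‖ ∂pairMeasure B =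
      ∫ p, g p * Real.log ‖(β : ℂ) * p.1 - (α : ℂ) * p.2‖ ∂pairMeasure B := by
    rw [← integral_prod_swap]
    refine integral_congr_ae (ae_of_all _ fun p => ?_)
    simp only [hsymm, Prod.fst_swap, Prod.snd_swap]
    rw [norm_sub_rev]
  have key : ∫ p, (g p * Real.log ‖(α : ℂ) * p.1 - (β : ℂ) * p.2‖ +
      g p * Real.log ‖(β : ℂ) * p.1 - (α : ℂ) * p.2‖) ∂pairMeasure B ≤
      ∫ p, (2 * (g p * Real.log ‖p.1 - p.2‖) +
        M * Real.log (1 + (2 * R * t) ^ 2 / ‖p.1 - p.2‖ ^ 2)) ∂pairMeasure B := by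
    refine integral_mono_ae (hI.add hI2) ((hI1.const_mul 2).add hE) ?_
    have a1 := ae_prod_ne (S := B) (T := B) (φ := fun x => ((α / β : ℝ) : ℂ) * x) (by fun_prop)
    have a2 := ae_prod_ne (S := B) (T := B) (φ := fun x => ((β / α : ℝ) : ℂ) * x) (by fun_prop)
    have a3 : ∀ᵐ p ∂pairMeasure B, p.1 ∈ B ∧ p.2 ∈ B ∧ p.1 ≠ p.2 :=
      ae_pairMeasure hB fun x hx y hy hne => ⟨hx, hy, hne⟩
    filter_upwards [a1, a2, a3] with p h1 h2 ⟨hp1, hp2, hne⟩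
    obtain ⟨x, y⟩ := p
    simp only at *
    have hαc : (α : ℂ) ≠ 0 := by exact_mod_cast hα.ne'
    have hβc : (β : ℂ) ≠ 0 := by exact_mod_cast hβ.ne'
    have hP : 0 < ‖(α : ℂ) * x - (β : ℂ) * y‖ := by
      rw [norm_pos_iff, sub_ne_zero]; intro h; apply h1
      push_cast; field_simp; exact h
    have hQ : 0 < ‖(β : ℂ) * x - (α : ℂ) * y‖ := by
      rw [norm_pos_iff, sub_ne_zero]; intro h; apply h2
      push_cast; field_simp; exact h
    have hρ : 0 < ‖x - y‖ := norm_pos_iff.2 (sub_ne_zero.2 hne)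
    have hx := hR hp1
    have hy := hR hp2
    rw [mem_closedBall_zero_iff] at hx hy
    have hPQ : ‖(α : ℂ) * x - (β : ℂ) * y‖ * ‖(β : ℂ) * x - (α : ℂ) * y‖ ≤
        ‖x - y‖ ^ 2 + (2 * R * t) ^ 2 := by
      rw [← norm_mul]
      have hc : (α : ℂ) * (β : ℂ) = 1 := by exact_mod_cast hαβ
      have e : ((α : ℂ) * x - (β : ℂ) * y) * ((β : ℂ) * x - (α : ℂ) * y) =
          (x - y) ^ 2 - (((α - β) ^ 2 : ℝ) : ℂ) * (x * y) := by
        push_cast; linear_combination (x - y) ^ 2 * hc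
      rw [e]
      refine (norm_sub_le _ _).trans ?_
      rw [norm_pow, norm_mul, norm_mul, Complex.norm_real, Real.norm_of_nonneg (sq_nonneg _)]
      have h5 := abs_exp_half_sub_le ht
      have h6 : (α - β) ^ 2 ≤ (2 * |t|) ^ 2 := by
        rw [← sq_abs (α - β)]; gcongr
      have h7 : ‖x‖ * ‖y‖ ≤ R * R := by gcongr
      have h8 : (α - β) ^ 2 * (‖x‖ * ‖y‖) ≤ (2 * |t|) ^ 2 * (R * R) := by gcongr
      have h9 : (2 * |t|) ^ 2 * (R * R) = (2 * R * t) ^ 2 := by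
        rw [mul_pow, sq_abs]; ring
      linarith
    have hlog : Real.log ‖(α : ℂ) * x - (β : ℂ) * y‖ + Real.log ‖(β : ℂ) * x - (α : ℂ) * y‖ ≤
        2 * Real.log ‖x - y‖ + Real.log (1 + (2 * R * t) ^ 2 / ‖x - y‖ ^ 2) := by
      rw [← Real.log_mul hP.ne' hQ.ne']
      have h10 : (2 : ℝ) * Real.log ‖x - y‖ = Real.log (‖x - y‖ ^ 2) := by rw [Real.log_pow]; norm_num
      rw [h10, ← Real.log_mul (by positivity) (by positivity)]
      refine Real.log_le_log (by positivity) (hPQ.trans (le_of_eq ?_))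
      field_simp
    have hgp := hg0 x hp1 y hp2
    have hgM := (le_abs_self _).trans (hM x hp1 y hp2)
    have hl0 := (log_error_bound R t ‖x - y‖ hR0 (norm_nonneg _)).1
    nlinarith [mul_le_mul_of_nonneg_left hlog hgp, mul_le_mul_of_nonneg_right hgM hl0]
  rw [integral_add hI hI2, ← hsw, integral_add (hI1.const_mul 2) hE, integral_const_mul,
    integral_const_mul] at key
  change _ ≤ _ + M / 2 * ∫ p, _ ∂_
  linarith

open scoped Pointwise

/-- The logarithmic potential of a planar set. -/
def logPot (B : Set ℂ) (y : ℂ) : ℝ := -(1 / (2 * π)) * ∫ w in B, Real.log ‖y - w‖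

theorem abs_log_sub_log_le_inv {p q : ℝ} (hp : 0 < p) (hq : 0 < q) :
    |Real.log p - Real.log q| ≤ |p - q| * (p⁻¹ + q⁻¹) := by
  rcases le_total p q with h | h
  · refine (abs_log_sub_log_le hp le_rfl h).trans ?_
    have := inv_pos.2 hq
    nlinarith [abs_nonneg (p - q)]
  · refine (abs_log_sub_log_le hq h le_rfl).trans ?_
    have := inv_pos.2 hp
    nlinarith [abs_nonneg (p - q)]

theorem logPot_lipschitz {B : Set ℂ} (hB : MeasurableSet B) (hb : Bornology.IsBounded B)
    (y z : ℂ) : |logPot B y - logPot B z| ≤ (2 + volume.real B / π) * ‖y - z‖ := by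
  have hv : volume B ≠ ⊤ := hb.measure_lt_top.ne
  have hy := inv_norm_sub_setIntegral hv y one_pos
  have hz := inv_norm_sub_setIntegral hv z one_pos
  have e : logPot B y - logPot B z =
      -(1 / (2 * π)) * ∫ w in B, (Real.log ‖y - w‖ - Real.log ‖z - w‖) := by
    rw [integral_sub (integrableOn_log_norm_sub hB hb y) (integrableOn_log_norm_sub hB hb z)]
    simp only [logPot]; ring
  have h : |∫ w in B, (Real.log ‖y - w‖ - Real.log ‖z - w‖)| ≤
      ∫ w in B, ‖y - z‖ * (‖y - w‖⁻¹ + ‖z - w‖⁻¹) := by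
    rw [← Real.norm_eq_abs]
    refine norm_integral_le_of_norm_le ((hy.1.add hz.1).const_mul _) ?_
    refine ae_restrict_of_ae ?_
    filter_upwards [Measure.ae_ne volume y, Measure.ae_ne volume z] with w h1 h2
    refine (abs_log_sub_log_le_inv (norm_pos_iff.2 (sub_ne_zero.2 h1.symm))
      (norm_pos_iff.2 (sub_ne_zero.2 h2.symm))).trans ?_
    gcongr
    simpa using abs_norm_sub_norm_le (y - w) (z - w)
  rw [integral_const_mul, integral_add hy.1 hz.1] at h
  rw [e, abs_mul, abs_neg, abs_of_pos (by positivity : 0 < 1 / (2 * π))]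
  calc _ ≤ 1 / (2 * π) * (‖y - z‖ * ((2 * π * 1 + volume.real B / 1) +
        (2 * π * 1 + volume.real B / 1))) := by
        gcongr
        exact h.trans (by gcongr; exacts [hy.2, hz.2])
    _ = _ := by field_simp; ring

theorem continuous_logPot {B : Set ℂ} (hB : MeasurableSet B) (hb : Bornology.IsBounded B) :
    Continuous (logPot B) := by
  refine (LipschitzWith.of_dist_le_mul (K := Real.toNNReal (2 + volume.real B / π))
    fun y z => ?_).continuous
  rw [Real.coe_toNNReal _ (by positivity), Real.dist_eq, dist_eq_norm]
  exact logPot_lipschitz hB hb y z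

/-- A planar patch of area `π` and centroid `0` which is the positivity set of its logarithmic
potential plus an `ℓ`-Lipschitz perturbation. -/
structure Patch (B : Set ℂ) (R ℓ : ℝ) (e : ℂ → ℝ) : Prop where
  isOpen : IsOpen B
  area : volume.real B = π
  centroid : ∫ w in B, w = 0
  sub : B ⊆ Metric.closedBall 0 R
  one_le : 1 ≤ R
  nonneg : 0 ≤ ℓ
  lip : ∀ x y, ‖x‖ ≤ 2 * R → ‖y‖ ≤ 2 * R → |e x - e y| ≤ ℓ * ‖x - y‖
  mem_iff : ∀ y, ‖y‖ ≤ 2 * R → (y ∈ B ↔ 0 < logPot B y + e y)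

namespace Patch
variable {B : Set ℂ} {R ℓ : ℝ} {e : ℂ → ℝ}

theorem measurableSet (h : Patch B R ℓ e) : MeasurableSet B := h.isOpen.measurableSet
theorem bounded (h : Patch B R ℓ e) : Bornology.IsBounded B :=
  Metric.isBounded_closedBall.subset h.sub
theorem volume_ne_top (h : Patch B R ℓ e) : volume B ≠ ⊤ := h.bounded.measure_lt_top.ne
theorem norm_le (h : Patch B R ℓ e) {y : ℂ} (hy : y ∈ B) : ‖y‖ ≤ R := by simpa using h.sub hy
theorem norm_le_two (h : Patch B R ℓ e) {y : ℂ} (hy : y ∈ B) : ‖y‖ ≤ 2 * R := by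
  linarith [h.norm_le hy, h.one_le]
theorem pos_of_mem (h : Patch B R ℓ e) {y : ℂ} (hy : y ∈ B) : 0 < logPot B y + e y :=
  (h.mem_iff y (h.norm_le_two hy)).1 hy

theorem continuousOn_e (h : Patch B R ℓ e) : ContinuousOn e (Metric.closedBall 0 (2 * R)) := by
  refine (LipschitzOnWith.of_dist_le_mul (K := Real.toNNReal ℓ) fun y hy z hz => ?_).continuousOn
  rw [Real.coe_toNNReal _ h.nonneg, Real.dist_eq, dist_eq_norm]
  exact h.lip y z (by simpa using hy) (by simpa using hz)

theorem continuousOn (h : Patch B R ℓ e) :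
    ContinuousOn (fun y => logPot B y + e y) (Metric.closedBall 0 (2 * R)) :=
  (continuous_logPot h.measurableSet h.bounded).continuousOn.add h.continuousOn_e

theorem sub_two (h : Patch B R ℓ e) : B ⊆ Metric.closedBall 0 (2 * R) :=
  h.sub.trans (Metric.closedBall_subset_closedBall (by linarith [h.one_le]))

theorem integrableOn_e (h : Patch B R ℓ e) : IntegrableOn e B :=
  (h.continuousOn_e.integrableOn_compact (isCompact_closedBall _ _)).mono_set h.sub_two

theorem integrableOn (h : Patch B R ℓ e) : IntegrableOn (fun y => logPot B y + e y) B :=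
  (h.continuousOn.integrableOn_compact (isCompact_closedBall _ _)).mono_set h.sub_two

theorem dilated_integral_le (h : Patch B R ℓ e) {t : ℝ} (ht : Real.exp t ≤ 2) :
    ∫ y in B, (logPot B (Real.exp t • y) + e (Real.exp t • y)) ≤
      Real.exp (-2 * t) * ∫ y in B, (logPot B y + e y) := by
  set V : ℂ → ℝ := fun y => logPot B y + e y
  have hpos := Real.exp_pos t
  have hm : ∀ y ∈ B, Real.exp t • y ∈ Metric.closedBall (0 : ℂ) (2 * R) := by
    intro y hy
    rw [mem_closedBall_zero_iff, norm_smul, Real.norm_of_nonneg hpos.le]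
    have := h.norm_le hy
    exact mul_le_mul ht this (norm_nonneg _) (by norm_num)
  have hVi : Integrable (B.indicator V) := h.integrableOn.integrable_indicator h.measurableSet
  have h1 : IntegrableOn (fun y => V (Real.exp t • y)) B := by
    have hc : ContinuousOn (fun y : ℂ => V (Real.exp t • y)) (Metric.closedBall 0 R) := by
      refine h.continuousOn.comp (by fun_prop) fun y hy => ?_
      rw [mem_closedBall_zero_iff] at hy ⊢
      rw [norm_smul, Real.norm_of_nonneg hpos.le]
      exact mul_le_mul ht hy (norm_nonneg _) (by norm_num)
    exact (hc.integrableOn_compact (isCompact_closedBall _ _)).mono_set h.sub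
  have h2 : IntegrableOn (fun y => B.indicator V (Real.exp t • y)) B :=
    (hVi.comp_smul hpos.ne').integrableOn
  calc ∫ y in B, V (Real.exp t • y) ≤ ∫ y in B, B.indicator V (Real.exp t • y) := by
        refine setIntegral_mono_on h1 h2 h.measurableSet fun y hy => ?_
        by_cases hz : Real.exp t • y ∈ B
        · rw [Set.indicator_of_mem hz]
        · rw [Set.indicator_of_notMem hz]
          have := (h.mem_iff _ (by simpa using hm y hy)).not.1 hz
          exact not_lt.1 this
    _ = (Real.exp t ^ 2)⁻¹ * ∫ y in Real.exp t • B, B.indicator V y := by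
        rw [Measure.setIntegral_comp_smul_of_pos volume _ _ hpos, Complex.finrank_real_complex,
          smul_eq_mul]
    _ ≤ (Real.exp t ^ 2)⁻¹ * ∫ y, B.indicator V y := by
        gcongr
        · exact ae_of_all _ fun y => Set.indicator_nonneg (fun z hz => (h.pos_of_mem hz).le) y
        · exact Measure.restrict_le_self
    _ = _ := by
        rw [integral_indicator h.measurableSet, ← Real.exp_nat_mul, ← Real.exp_neg]
        congr 2; push_cast; ring

theorem dilated_logPot_ge (h : Patch B R ℓ e) {t : ℝ} (ht : |t| ≤ 1) :
    (∫ y in B, logPot B y) - π / 4 * t - logError B R t ≤ ∫ y in B, logPot B (Real.exp t • y) := by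
  have hR0 : 0 ≤ R := by linarith [h.one_le]
  have hv := h.volume_ne_top
  have : IsFiniteMeasure (volume.restrict B) := ⟨by simpa using hv.lt_top⟩
  have hd := dilated_log_energy_le h.measurableSet h.sub hR0 (g := fun _ => 1) measurable_const
    (fun _ => rfl) (M := 1) (by simp) (by simp) ht
  have i1 := integrable_log_pair_one h.measurableSet h.sub (g := fun _ => 1) measurable_const
    (M := 1) (by simp)
  have i2 := integrable_log_pair h.measurableSet h.sub (Real.exp_pos (t / 2))
    (Real.exp_pos (-(t / 2))) (g := fun _ => 1) measurable_const (M := 1) (by simp)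
  have i3 := integrable_log_pair h.measurableSet h.sub (Real.exp_pos t)
    one_pos (g := fun _ => 1) measurable_const (M := 1) (by simp)
  simp only [one_mul, Complex.ofReal_one] at hd i1 i2 i3
  have e1 : ∫ y in B, logPot B y = -(1 / (2 * π)) * ∫ p, Real.log ‖p.1 - p.2‖ ∂pairMeasure B := by
    rw [integral_prod _ i1, ← integral_const_mul]; rfl
  have e2 : ∫ y in B, logPot B (Real.exp t • y) =
      -(1 / (2 * π)) * ∫ p, Real.log ‖(Real.exp t : ℂ) * p.1 - p.2‖ ∂pairMeasure B := by
    rw [integral_prod _ i3, ← integral_const_mul]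
    simp [logPot]
  have e3 : ∫ p, Real.log ‖(Real.exp t : ℂ) * p.1 - p.2‖ ∂pairMeasure B =
      ∫ p, (t / 2 + Real.log ‖(Real.exp (t / 2) : ℂ) * p.1 - (Real.exp (-(t / 2)) : ℂ) * p.2‖)
        ∂pairMeasure B := by
    refine integral_congr_ae ?_
    filter_upwards [ae_prod_ne (S := B) (T := B) (φ := fun x => (Real.exp t : ℂ) * x)
      (by fun_prop)] with p hp
    have hs : (Real.exp t : ℂ) * p.1 - p.2 = (Real.exp (t / 2) : ℂ) *
        ((Real.exp (t / 2) : ℂ) * p.1 - (Real.exp (-(t / 2)) : ℂ) * p.2) := by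
      rw [mul_sub, ← mul_assoc, ← mul_assoc, ← Complex.ofReal_mul, ← Complex.ofReal_mul,
        ← Real.exp_add, ← Real.exp_add]; simp
    have hne : ‖(Real.exp t : ℂ) * p.1 - p.2‖ ≠ 0 := norm_ne_zero_iff.2 (sub_ne_zero.2 hp)
    rw [hs, norm_mul] at hne
    rw [hs, norm_mul, Real.log_mul (left_ne_zero_of_mul hne) (right_ne_zero_of_mul hne),
      Complex.norm_real, Real.norm_of_nonneg (Real.exp_pos _).le, Real.log_exp]
  have e4 : (pairMeasure B).real Set.univ = π * π := by
    rw [pairMeasure, ← Set.univ_prod_univ, measureReal_prod_prod]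
    simp [h.area]
  rw [e1, e2, e3, integral_add (integrable_const _) i2, integral_const, e4, smul_eq_mul]
  have hpi := Real.pi_gt_three
  have hl0 : 0 ≤ logError B R t :=
    integral_nonneg fun p => (log_error_bound R t _ hR0 (norm_nonneg _)).1
  have hc : 1 / (2 * π) * logError B R t ≤ 1 * logError B R t := by
    gcongr; rw [div_le_one (by positivity)]; linarith
  have hd' := mul_le_mul_of_nonneg_left hd (by positivity : 0 ≤ 1 / (2 * π))
  have e5 : -(1 / (2 * π)) * (π * π * (t / 2)) = -(π / 4 * t) := by field_simp; ring
  rw [mul_add, e5]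
  nlinarith

theorem dilated_e_ge (h : Patch B R ℓ e) {t : ℝ} (ht : Real.exp t ≤ 2) :
    (∫ y in B, e y) - π * ℓ * R * |Real.exp t - 1| ≤ ∫ y in B, e (Real.exp t • y) := by
  have hpos := Real.exp_pos t
  have hv := h.volume_ne_top
  have h1 : IntegrableOn (fun y => e (Real.exp t • y)) B := by
    have hc : ContinuousOn (fun y : ℂ => e (Real.exp t • y)) (Metric.closedBall 0 R) := by
      refine h.continuousOn_e.comp (by fun_prop) fun y hy => ?_
      rw [mem_closedBall_zero_iff] at hy ⊢
      rw [norm_smul, Real.norm_of_nonneg hpos.le]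
      exact mul_le_mul ht hy (norm_nonneg _) (by norm_num)
    exact (hc.integrableOn_compact (isCompact_closedBall _ _)).mono_set h.sub
  have h2 : ∫ y in B, (e y - ℓ * R * |Real.exp t - 1|) ≤ ∫ y in B, e (Real.exp t • y) := by
    refine setIntegral_mono_on (h.integrableOn_e.sub (integrableOn_const hv)) h1
      h.measurableSet fun y hy => ?_
    have hy' := h.norm_le hy
    have h3 := h.lip y (Real.exp t • y) (h.norm_le_two hy) (by
      rw [norm_smul, Real.norm_of_nonneg hpos.le]
      exact mul_le_mul ht hy' (norm_nonneg _) (by norm_num))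
    have h4 : ‖y - Real.exp t • y‖ = |Real.exp t - 1| * ‖y‖ := by
      rw [show y - Real.exp t • y = (1 - Real.exp t) • y by rw [sub_smul, one_smul],
        norm_smul, Real.norm_eq_abs, abs_sub_comm]
    rw [h4] at h3
    have h5 : ℓ * (|Real.exp t - 1| * ‖y‖) ≤ ℓ * (|Real.exp t - 1| * R) := by
      have := h.nonneg; gcongr
    linarith [le_abs_self (e y - e (Real.exp t • y))]
  rw [integral_sub h.integrableOn_e (integrableOn_const hv)] at h2
  simp only [integral_const, measureReal_restrict_apply_univ, h.area, smul_eq_mul] at h2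
  linarith

/-- The virial identity for patches, with error controlled by the perturbation. -/
theorem virial (h : Patch B R ℓ e) :
    |(∫ y in B, (logPot B y + e y)) - π / 8| ≤ π * ℓ * R / 2 := by
  set I := ∫ y in B, (logPot B y + e y)
  have hR0 : 0 ≤ R := by linarith [h.one_le]
  have hcont := continuous_logPot h.measurableSet h.bounded
  have iN : ∀ s : ℝ, IntegrableOn (fun y => logPot B (s • y)) B := fun s =>
    ((hcont.comp (by fun_prop : Continuous fun y : ℂ => s • y)).continuousOn.integrableOn_compact
      (isCompact_closedBall 0 R)).mono_set h.sub
  have hI : I = (∫ y in B, logPot B y) + ∫ y in B, e y :=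
    integral_add (by have := iN 1; simp only [one_smul] at this; exact this) h.integrableOn_e
  have main : ∀ t : ℝ, |t| ≤ 1 → Real.exp t ≤ 2 →
      (1 - Real.exp (-2 * t)) * I ≤ π / 4 * t + logError B R t + π * ℓ * R * |Real.exp t - 1| := by
    intro t ht ht2
    have h1 := h.dilated_integral_le ht2
    have h2 := h.dilated_logPot_ge ht
    have h3 := h.dilated_e_ge ht2
    have h4 : IntegrableOn (fun y => e (Real.exp t • y)) B := by
      have hc : ContinuousOn (fun y : ℂ => e (Real.exp t • y)) (Metric.closedBall 0 R) := by
        refine h.continuousOn_e.comp (by fun_prop) fun y hy => ?_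
        rw [mem_closedBall_zero_iff] at hy ⊢
        rw [norm_smul, Real.norm_of_nonneg (Real.exp_pos t).le]
        exact mul_le_mul ht2 hy (norm_nonneg _) (by norm_num)
      exact (hc.integrableOn_compact (isCompact_closedBall _ _)).mono_set h.sub
    rw [integral_add (iN _) h4] at h1
    change _ ≤ _ * I at h1
    linarith
  have d1 : HasDerivAt (fun t : ℝ => 1 - Real.exp (-2 * t)) 2 0 := by
    have := (((hasDerivAt_id (0 : ℝ)).const_mul (-2)).exp).const_sub 1
    exact this.congr_deriv (by simp)
  have d2 : HasDerivAt (fun t : ℝ => Real.exp t - 1) 1 0 := by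
    have := (Real.hasDerivAt_exp 0).sub_const 1
    exact this.congr_deriv (by simp)
  have t1 : Tendsto (fun t : ℝ => (1 - Real.exp (-2 * t)) / t) (nhdsWithin 0 {0}ᶜ) (nhds 2) := by
    have := hasDerivAt_iff_tendsto_slope_zero.1 d1
    simpa [div_eq_inv_mul] using this
  have t2 : Tendsto (fun t : ℝ => |Real.exp t - 1| / |t|) (nhdsWithin 0 {0}ᶜ) (nhds 1) := by
    have := (hasDerivAt_iff_tendsto_slope_zero.1 d2).abs
    simpa [div_eq_inv_mul, abs_mul] using this
  have t3 := tendsto_logError h.volume_ne_top hR0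
  have ev : ∀ᶠ t : ℝ in nhds 0, |t| ≤ 1 ∧ Real.exp t ≤ 2 := by
    have a : ∀ᶠ t : ℝ in nhds 0, |t| < 1 := by
      refine (continuous_abs.tendsto' (0 : ℝ) 0 (by simp)).eventually_lt_const one_pos
    have b : ∀ᶠ t : ℝ in nhds 0, Real.exp t < 2 := by
      refine (Real.continuous_exp.tendsto' 0 1 (by simp)).eventually_lt_const one_lt_two
    filter_upwards [a, b] with t h1 h2 using ⟨h1.le, h2.le⟩
  have gtle : nhdsWithin (0 : ℝ) (Set.Ioi 0) ≤ nhdsWithin 0 {0}ᶜ :=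
    nhdsWithin_mono _ fun t ht => ne_of_gt ht
  have ltle : nhdsWithin (0 : ℝ) (Set.Iio 0) ≤ nhdsWithin 0 {0}ᶜ :=
    nhdsWithin_mono _ fun t ht => ne_of_lt ht
  have up : 2 * I ≤ π / 4 + 0 + π * ℓ * R * 1 := by
    refine le_of_tendsto_of_tendsto ((t1.mono_left gtle).mul_const I)
      (((tendsto_const_nhds (x := π / 4)).add (t3.mono_left gtle)).add
        ((t2.mono_left gtle).const_mul (π * ℓ * R))) ?_
    filter_upwards [self_mem_nhdsWithin, nhdsWithin_le_nhds ev] with t (ht : 0 < t) hev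
    have hm := main t hev.1 hev.2
    have : (π / 4 + logError B R t / t + π * ℓ * R * (|Real.exp t - 1| / |t|)) =
      (π / 4 * t + logError B R t + π * ℓ * R * |Real.exp t - 1|) / t := by
      rw [abs_of_pos ht]; field_simp
    rw [this, div_mul_eq_mul_div]
    gcongr
  have lo : π / 4 + 0 - π * ℓ * R * 1 ≤ 2 * I := by
    refine le_of_tendsto_of_tendsto 
      (((tendsto_const_nhds (x := π / 4)).add (t3.mono_left ltle)).sub
        ((t2.mono_left ltle).const_mul (π * ℓ * R))) ((t1.mono_left ltle).mul_const I) ?_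
    filter_upwards [self_mem_nhdsWithin, nhdsWithin_le_nhds ev] with t (ht : t < 0) hev
    have hm := main t hev.1 hev.2
    have : (π / 4 + logError B R t / t - π * ℓ * R * (|Real.exp t - 1| / |t|)) =
      (π / 4 * t + logError B R t + π * ℓ * R * |Real.exp t - 1|) / t := by
      rw [abs_of_neg ht, div_neg]; have := ht.ne; field_simp; ring
    have h2 : (1 - Real.exp (-2 * t)) / t * I = (1 - Real.exp (-2 * t)) * I / t := by ring
    rw [this, h2]
    exact div_le_div_of_nonpos_of_le ht.le hm
  rw [abs_le]; constructor <;> linarith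

end Patch

theorem integrableOn_log_one_add_sq {S : Set ℂ} (hS : MeasurableSet S) (hv : volume S ≠ ⊤)
    (x : ℂ) (M : ℝ) : IntegrableOn (fun w => Real.log (1 + (M / ‖x - w‖) ^ 2)) S := by
  refine integrableOn_of_le_inv_norm hS hv x (C := 2 * |M|)
    (Real.measurable_log.comp (by fun_prop)).aestronglyMeasurable fun w _ => ?_
  have h := log_one_add_sq_le (M / ‖x - w‖)
  rw [abs_of_nonneg (Real.log_nonneg (by nlinarith [sq_nonneg (M / ‖x - w‖)]))]
  rw [abs_div, abs_norm, div_eq_mul_inv |M|] at h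
  nlinarith [abs_nonneg M]

/-- Averaging the logarithmic potential over a pair of antipodal displacements. -/
theorem logPot_pair_ge {B : Set ℂ} (hB : MeasurableSet B) (hb : Bornology.IsBounded B)
    (x d : ℂ) {M : ℝ} (hd : ‖d‖ ≤ M) :
    2 * logPot B x - 1 / (2 * π) * ∫ w in B, Real.log (1 + (M / ‖x - w‖) ^ 2) ≤
      logPot B (x + d) + logPot B (x - d) := by
  have i1 := integrableOn_log_norm_sub hB hb x
  have i2 := integrableOn_log_norm_sub hB hb (x + d)
  have i3 := integrableOn_log_norm_sub hB hb (x - d)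
  have i4 := integrableOn_log_one_add_sq hB hb.measure_lt_top.ne x M
  have key : (∫ w in B, Real.log ‖x + d - w‖) + ∫ w in B, Real.log ‖x - d - w‖ ≤
      2 * (∫ w in B, Real.log ‖x - w‖) + ∫ w in B, Real.log (1 + (M / ‖x - w‖) ^ 2) := by
    rw [← integral_add i2 i3, ← integral_const_mul, ← integral_add (i1.const_mul 2) i4]
    refine integral_mono_ae (i2.add i3) ((i1.const_mul 2).add i4) (ae_restrict_of_ae ?_)
    filter_upwards [Measure.ae_ne volume x, Measure.ae_ne volume (x + d),
      Measure.ae_ne volume (x - d)] with w h1 h2 h3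
    have p1 : 0 < ‖x - w‖ := norm_pos_iff.2 (sub_ne_zero.2 h1.symm)
    have p2 : 0 < ‖x + d - w‖ := norm_pos_iff.2 (sub_ne_zero.2 h2.symm)
    have p3 : 0 < ‖x - d - w‖ := norm_pos_iff.2 (sub_ne_zero.2 h3.symm)
    have hp : ‖x + d - w‖ ^ 2 + ‖x - d - w‖ ^ 2 = 2 * (‖x - w‖ ^ 2 + ‖d‖ ^ 2) := by
      have := parallelogram_law_with_norm ℝ (x - w) d
      rw [show x - w + d = x + d - w by ring, show x - w - d = x - d - w by ring] at this
      nlinarith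
    have hM : ‖d‖ ^ 2 ≤ M ^ 2 := by gcongr
    have hle : ‖x + d - w‖ * ‖x - d - w‖ ≤ ‖x - w‖ ^ 2 * (1 + (M / ‖x - w‖) ^ 2) := by
      have : ‖x - w‖ ^ 2 * (1 + (M / ‖x - w‖) ^ 2) = ‖x - w‖ ^ 2 + M ^ 2 := by field_simp
      rw [this]
      nlinarith [sq_nonneg (‖x + d - w‖ - ‖x - d - w‖)]
    have := Real.log_le_log (by positivity) hle
    rw [Real.log_mul p2.ne' p3.ne', Real.log_mul (by positivity) (by positivity),
      Real.log_pow] at this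
    exact_mod_cast this
  have := mul_le_mul_of_nonneg_left key (by positivity : 0 ≤ 1 / (2 * π))
  simp only [logPot]
  linarith

namespace Patch
variable {B : Set ℂ} {R ℓ : ℝ} {e : ℂ → ℝ}

theorem nonpos_of_notMem (h : Patch B R ℓ e) {y : ℂ} (hy : ‖y‖ ≤ 2 * R) (hB : y ∉ B) :
    logPot B y + e y ≤ 0 := not_lt.1 ((h.mem_iff y hy).not.1 hB)

/-- Submean-value inequality. -/
theorem le_average (h : Patch B R ℓ e) {x : ℂ} {M : ℝ} (hM : 0 < M) (hx : ‖x‖ + M ≤ 2 * R) :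
    logPot B x + e x ≤ (∫ y in B, (logPot B y + e y)) / (π * M ^ 2) +
      1 / (4 * π) * (∫ w in B, Real.log (1 + (M / ‖x - w‖) ^ 2)) + ℓ * M := by
  set V : ℂ → ℝ := fun y => logPot B y + e y with hV
  set K := ∫ w in B, Real.log (1 + (M / ‖x - w‖) ^ 2)
  set U := Metric.ball (0 : ℂ) M
  have hmem : ∀ d ∈ U, ‖x + d‖ ≤ 2 * R ∧ ‖x - d‖ ≤ 2 * R := by
    intro d hd
    have : ‖d‖ < M := by simpa [U] using hd
    exact ⟨(norm_add_le _ _).trans (by linarith), (norm_sub_le _ _).trans (by linarith)⟩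
  have hc1 : ContinuousOn (fun d => V (x + d)) (Metric.closedBall 0 M) := by
    refine h.continuousOn.comp (by fun_prop) fun d hd => ?_
    rw [mem_closedBall_zero_iff] at hd ⊢
    exact (norm_add_le _ _).trans (by linarith)
  have hc2 : ContinuousOn (fun d => V (x - d)) (Metric.closedBall 0 M) := by
    refine h.continuousOn.comp (by fun_prop) fun d hd => ?_
    rw [mem_closedBall_zero_iff] at hd ⊢
    exact (norm_sub_le _ _).trans (by linarith)
  have i1 : IntegrableOn (fun d => V (x + d)) U :=
    (hc1.integrableOn_compact (isCompact_closedBall _ _)).mono_set Metric.ball_subset_closedBall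
  have i2 : IntegrableOn (fun d => V (x - d)) U :=
    (hc2.integrableOn_compact (isCompact_closedBall _ _)).mono_set Metric.ball_subset_closedBall
  have hVi : Integrable (B.indicator V) := h.integrableOn.integrable_indicator h.measurableSet
  have hnn : ∀ y, 0 ≤ B.indicator V y := fun y =>
    Set.indicator_nonneg (fun z hz => (h.pos_of_mem hz).le) y
  have hle : ∀ y, ‖y‖ ≤ 2 * R → V y ≤ B.indicator V y := by
    intro y hy
    by_cases hz : y ∈ B
    · rw [Set.indicator_of_mem hz]
    · rw [Set.indicator_of_notMem hz]; exact h.nonpos_of_notMem hy hz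
  have hI : ∫ y, B.indicator V y = ∫ y in B, V y := integral_indicator h.measurableSet
  have b1 : ∫ d in U, V (x + d) ≤ ∫ y in B, V y := by
    calc ∫ d in U, V (x + d) ≤ ∫ d in U, B.indicator V (x + d) :=
          setIntegral_mono_on i1 (hVi.comp_add_left x).integrableOn measurableSet_ball
            fun d hd => hle _ (hmem d hd).1
      _ ≤ ∫ d, B.indicator V (x + d) :=
          setIntegral_le_integral (hVi.comp_add_left x) (ae_of_all _ fun d => hnn _)
      _ = _ := by rw [integral_add_left_eq_self, hI]
  have b2 : ∫ d in U, V (x - d) ≤ ∫ y in B, V y := by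
    calc ∫ d in U, V (x - d) ≤ ∫ d in U, B.indicator V (x - d) :=
          setIntegral_mono_on i2 (hVi.comp_sub_left x).integrableOn measurableSet_ball
            fun d hd => hle _ (hmem d hd).2
      _ ≤ ∫ d, B.indicator V (x - d) :=
          setIntegral_le_integral (hVi.comp_sub_left x) (ae_of_all _ fun d => hnn _)
      _ = _ := by rw [integral_sub_left_eq_self, hI]
  have low : ∫ d in U, (2 * V x - 1 / (2 * π) * K - 2 * (ℓ * M)) ≤
      ∫ d in U, (V (x + d) + V (x - d)) := by
    refine setIntegral_mono_on (integrableOn_const measure_ball_lt_top.ne) (i1.add i2)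
      measurableSet_ball fun d hd => ?_
    have hd' : ‖d‖ ≤ M := by simpa [U] using (Metric.ball_subset_closedBall hd)
    have := logPot_pair_ge h.measurableSet h.bounded x d hd'
    have hx' : ‖x‖ ≤ 2 * R := by linarith
    have l1 := h.lip x (x + d) hx' (hmem d hd).1
    have l2 := h.lip x (x - d) hx' (hmem d hd).2
    have hℓ : ℓ * ‖d‖ ≤ ℓ * M := mul_le_mul_of_nonneg_left hd' h.nonneg
    rw [show x - (x + d) = -d by ring, norm_neg] at l1
    rw [show x - (x - d) = d by ring] at l2
    have l3 := le_abs_self (e x - e (x + d))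
    have l4 := le_abs_self (e x - e (x - d))
    simp only [hV]
    change _ - 1 / (2 * π) * K ≤ _ at this
    linarith
  rw [integral_add i1 i2, setIntegral_const, volume_real_ball _ hM.le, smul_eq_mul] at low
  have hp : 0 < π * M ^ 2 := by positivity
  have : π * M ^ 2 * (V x - 1 / (4 * π) * K - ℓ * M) ≤ ∫ y in B, V y := by
    have e1 : 1 / (2 * π) * K = 2 * (1 / (4 * π) * K) := by field_simp; ring
    rw [e1] at low
    linarith
  have := (le_div_iff₀' hp).2 this
  change V x ≤ _
  linarith

end Patch

/-- A connected set reaching from `b` to distance `T₂` contains a point at intermediate distance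
around which its measure is small. -/
theorem exists_low_mass {B : Set ℂ} (hB : MeasurableSet B) (hv : volume B ≠ ⊤)
    (hc : IsPreconnected B) {b c : ℂ} (hb : b ∈ B) (hcB : c ∈ B) {T₁ T₂ : ℝ} (h0 : 0 ≤ T₁)
    (h12 : T₁ < T₂) (h2 : T₂ ≤ ‖c - b‖) {N : ℕ} (hN : 0 < N) :
    ∃ x ∈ B, T₁ ≤ ‖x - b‖ ∧ ‖x - b‖ ≤ T₂ ∧
      volume.real (B ∩ Metric.ball x ((T₂ - T₁) / (2 * N))) ≤ volume.real B / N := by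
  have hN' : (0 : ℝ) < N := by exact_mod_cast hN
  set q := (T₂ - T₁) / (2 * N) with hq
  have hq0 : 0 < q := by rw [hq]; have : 0 < T₂ - T₁ := by linarith
                         positivity
  have hqN : 2 * N * q = T₂ - T₁ := by rw [hq]; field_simp
  have hrad : ∀ i : Fin N, T₁ ≤ T₁ + (2 * i + 1) * q ∧ T₁ + (2 * i + 1) * q ≤ T₂ := by
    intro i
    have hi : (i : ℝ) + 1 ≤ N := by exact_mod_cast i.2
    have hi0 : (0 : ℝ) ≤ i := by positivity
    constructor
    · nlinarith
    · nlinarith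
  have hsel : ∀ i : Fin N, ∃ x ∈ B, ‖x - b‖ = T₁ + (2 * i + 1) * q := by
    intro i
    have := hc.intermediate_value hb hcB (f := fun x => ‖x - b‖) (by fun_prop)
    obtain ⟨x, hx, hx'⟩ := this (show T₁ + (2 * i + 1) * q ∈ Set.Icc ‖b - b‖ ‖c - b‖ by
      rw [sub_self, norm_zero]
      exact ⟨by linarith [(hrad i).1], by linarith [(hrad i).2]⟩)
    exact ⟨x, hx, hx'⟩
  choose x hxB hx using hsel
  have hdisj : Pairwise (Function.onFun Disjoint fun i => B ∩ Metric.ball (x i) q) := by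
    intro i j hij
    refine (Metric.ball_disjoint_ball ?_).mono Set.inter_subset_right Set.inter_subset_right
    have h1 : |(2 * (i : ℝ) + 1) * q - (2 * j + 1) * q| ≤ dist (x i) (x j) := by
      have := abs_norm_sub_norm_le (x i - b) (x j - b)
      rw [hx, hx, sub_sub_sub_cancel_right, ← dist_eq_norm] at this
      convert this using 2; ring
    have h2 : (1 : ℝ) ≤ |(i : ℝ) - j| := by
      have : (1 : ℤ) ≤ |(i : ℤ) - j| := by
        apply Int.one_le_abs
        have : (i : ℕ) ≠ j := fun h => hij (Fin.ext h)
        omega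
      exact_mod_cast this
    have h3 : |(2 * (i : ℝ) + 1) * q - (2 * j + 1) * q| = 2 * q * |(i : ℝ) - j| := by
      rw [← abs_of_pos (by linarith : 0 < 2 * q), ← abs_mul]; congr 1
      ring
    nlinarith
  by_contra! hcon
  have hbig : ∀ i, volume.real B / N < volume.real (B ∩ Metric.ball (x i) q) := fun i =>
    hcon (x i) (hxB i) (by rw [hx]; exact (hrad i).1) (by rw [hx]; exact (hrad i).2)
  have hsum : ∑ i, volume.real (B ∩ Metric.ball (x i) q) ≤ volume.real B := by
    rw [← measureReal_iUnion_fintype hdisj (fun i => hB.inter measurableSet_ball)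
      (fun i => measure_ne_top_of_subset Set.inter_subset_left hv)]
    exact measureReal_mono (Set.iUnion_subset fun i => Set.inter_subset_left) hv
  have : (N : ℝ) * (volume.real B / N) < ∑ i, volume.real (B ∩ Metric.ball (x i) q) := by
    calc (N : ℝ) * (volume.real B / N) = ∑ _i : Fin N, volume.real B / N := by simp
      _ < _ := Finset.sum_lt_sum_of_nonempty ⟨⟨0, hN⟩, Finset.mem_univ _⟩ fun i _ => hbig i
  rw [mul_div_cancel₀ _ hN'.ne'] at this
  linarith

/-- If the centroid of `B` is `0`, then from each `b ∈ B` the set extends to distance at least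
`‖b‖`. -/
theorem exists_far_point {B : Set ℂ} (hB : MeasurableSet B) (hb : Bornology.IsBounded B)
    (h0 : 0 < volume.real B) (hc : ∫ w in B, w = 0) (b : ℂ) :
    ∃ c ∈ B, ‖b‖ ≤ ‖c - b‖ := by
  by_contra! hcon
  have hi : IntegrableOn (fun w : ℂ => w) B := by
    obtain ⟨R, hR⟩ := hb.subset_closedBall 0
    exact (continuous_id.continuousOn.integrableOn_compact (isCompact_closedBall 0 R)).mono_set hR
  have hz : ∫ w in B, ⟪b, w⟫ = 0 := by
    rw [integral_inner hi, hc, inner_zero_right]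
  have hpos : ∀ w ∈ B, 0 < ⟪b, w⟫ := by
    intro w hw
    have h1 := hcon w hw
    have h2 : ‖w - b‖ ^ 2 < ‖b‖ ^ 2 := by gcongr
    rw [norm_sub_sq_real, real_inner_comm] at h2
    nlinarith [sq_nonneg ‖w‖]
  have hi2 : IntegrableOn (fun w : ℂ => ⟪b, w⟫) B := hi.const_inner b
  have := (setIntegral_pos_iff_support_of_nonneg_ae ((ae_restrict_iff' hB).2
    (ae_of_all _ fun w hw => (hpos w hw).le)) hi2).2 (by
      have : (Function.support fun w : ℂ => ⟪b, w⟫) ∩ B = B :=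
        Set.inter_eq_right.2 fun w hw => (hpos w hw).ne'
      rw [this]
      by_contra hcc
      have : volume B = 0 := by simpa using hcc
      simp [measureReal_def, this] at h0)
  linarith

namespace Patch
variable {B : Set ℂ} {R ℓ : ℝ} {e : ℂ → ℝ}

theorem ell_le (h : Patch B R ℓ e) : ℓ ≤ ℓ * R := by nlinarith [h.nonneg, h.one_le]

theorem le_two (h : Patch B R ℓ e) (hs : ℓ * R ≤ 1 / 100) {x : ℂ} (hx : x ∈ B) :
    logPot B x + e x ≤ 2 := by
  have h1 := h.le_average one_pos (by linarith [h.norm_le hx, h.one_le] : ‖x‖ + 1 ≤ 2 * R)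
  have h2 := (abs_le.1 h.virial).2
  have h3 : ∫ w in B, Real.log (1 + (1 / ‖x - w‖) ^ 2) ≤ 6 * π := by
    have hi := inv_norm_sub_setIntegral h.volume_ne_top x one_pos
    calc _ ≤ ∫ w in B, 2 * ‖x - w‖⁻¹ := by
          refine integral_mono (integrableOn_log_one_add_sq h.measurableSet h.volume_ne_top x 1)
            (hi.1.const_mul 2) fun w => ?_
          have := log_one_add_sq_le (1 / ‖x - w‖)
          rw [abs_div, abs_norm, abs_one, one_div ‖x - w‖] at this
          rwa [one_div]
      _ ≤ 2 * (2 * π * 1 + volume.real B / 1) := by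
          rw [integral_const_mul]; gcongr; exact hi.2
      _ = _ := by rw [h.area]; ring
  have hpi := Real.pi_pos
  have h4 : (∫ y in B, (logPot B y + e y)) / (π * 1 ^ 2) ≤ 1 / 8 + 1 / 200 := by
    rw [div_le_iff₀ (by positivity)]; nlinarith
  have h5 : 1 / (4 * π) * (∫ w in B, Real.log (1 + (1 / ‖x - w‖) ^ 2)) ≤ 3 / 2 := by
    calc _ ≤ 1 / (4 * π) * (6 * π) := by gcongr
      _ = _ := by field_simp; norm_num
  linarith [h.ell_le]

theorem exists_dense_point (h : Patch B R ℓ e) (hs : ℓ * R ≤ 1 / 100) (hR : 4 ≤ R) :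
    ∃ x ∈ B, 1 / 10000 ≤ volume.real (B ∩ Metric.ball x 16) := by
  have hpi := Real.pi_gt_three
  have hpi4 := Real.pi_lt_d2
  have hv0 : volume B ≠ 0 := by
    intro h0; have := h.area; simp [measureReal_def, h0, Real.pi_ne_zero.symm] at this
  obtain ⟨x, hx, hxa⟩ := exists_setAverage_le hv0 h.volume_ne_top h.integrableOn
  refine ⟨x, hx, ?_⟩
  rw [setAverage_eq, h.area, smul_eq_mul] at hxa
  have h1 := h.le_average (by norm_num : (0 : ℝ) < 4) (by linarith [h.norm_le hx] : ‖x‖ + 4 ≤ 2 * R)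
  have h2 := (abs_le.1 h.virial).1
  set I := ∫ y in B, (logPot B y + e y)
  have hi := integrableOn_log_one_add_sq h.measurableSet h.volume_ne_top x 4
  set U := Metric.ball x 16
  rw [← integral_inter_add_sdiff (measurableSet_ball (x := x) (ε := 16)) hi] at h1
  have hin : ∫ w in B ∩ U, Real.log (1 + (4 / ‖x - w‖) ^ 2) ≤
      8 * (2 * π * (1 / 100) + volume.real (B ∩ U) / (1 / 100)) := by
    have hv : volume (B ∩ U) ≠ ⊤ := measure_ne_top_of_subset Set.inter_subset_left h.volume_ne_top
    have hj := inv_norm_sub_setIntegral hv x (by norm_num : (0 : ℝ) < 1 / 100)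
    calc _ ≤ ∫ w in B ∩ U, 8 * ‖x - w‖⁻¹ := by
          refine integral_mono (hi.mono_set Set.inter_subset_left)
            (hj.1.const_mul 8) fun w => ?_
          have := log_one_add_sq_le (4 / ‖x - w‖)
          rw [abs_div, abs_norm, abs_of_pos (by norm_num : (0 : ℝ) < 4), div_eq_mul_inv 4] at this
          simp only [div_eq_mul_inv] at this ⊢
          linarith
      _ ≤ _ := by rw [integral_const_mul]; gcongr; exact hj.2
  have hout : ∫ w in B \ U, Real.log (1 + (4 / ‖x - w‖) ^ 2) ≤ π / 16 := by
    have hv : volume (B \ U) ≠ ⊤ := measure_ne_top_of_subset Set.sdiff_subset h.volume_ne_top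
    calc _ ≤ ∫ w in B \ U, (1 / 16 : ℝ) := by
          refine setIntegral_mono_on (hi.mono_set Set.sdiff_subset) (integrableOn_const hv)
            (h.measurableSet.diff measurableSet_ball) fun w hw => ?_
          have hd : 16 ≤ ‖x - w‖ := by
            have := hw.2
            simp only [U, Metric.mem_ball, not_lt, dist_eq_norm] at this
            rwa [norm_sub_rev]
          have h3 : (4 / ‖x - w‖) ^ 2 ≤ 1 / 16 := by
            calc (4 / ‖x - w‖) ^ 2 ≤ (4 / 16) ^ 2 := by gcongr
              _ = _ := by norm_num
          have := Real.log_le_sub_one_of_pos (by positivity : 0 < 1 + (4 / ‖x - w‖) ^ 2)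
          linarith
      _ ≤ _ := by
          rw [setIntegral_const, smul_eq_mul]
          have := measureReal_mono (μ := volume) (Set.sdiff_subset : B \ U ⊆ B) h.volume_ne_top
          rw [h.area] at this
          linarith
  have hI : π * (12 / 100) ≤ I := by nlinarith
  have h3 : ℓ ≤ 1 / 400 := by nlinarith [h.nonneg]
  have h4 : π⁻¹ * I - I / (π * 4 ^ 2) = 15 / 16 * (I / π) := by field_simp; ring
  have h5 : 12 / 100 ≤ I / π := by rw [le_div_iff₀ (by positivity)]; linarith
  have h6 : 1 / 10 ≤ 1 / (4 * π) * ((∫ w in B ∩ U, Real.log (1 + (4 / ‖x - w‖) ^ 2)) +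
      ∫ w in B \ U, Real.log (1 + (4 / ‖x - w‖) ^ 2)) := by linarith
  rw [one_div_mul_eq_div, le_div_iff₀ (by positivity)] at h6
  linarith

end Patch

theorem log_one_add_mul_inv_le {T d : ℝ} (hT : 0 ≤ T) (hd : 0 < d) :
    Real.log (1 + T / d) ≤ Real.log (1 + T) + d⁻¹ := by
  have h1 : 1 + T / d ≤ (1 + T) * (1 + d⁻¹) := by
    rw [div_eq_mul_inv]; have := inv_pos.2 hd; nlinarith
  have h2 := Real.log_le_log (by positivity) h1
  rw [Real.log_mul (by positivity) (by positivity)] at h2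
  linarith [Real.log_le_sub_one_of_pos (by positivity : 0 < 1 + d⁻¹)]

theorem log_ratio_lower_bound {x z w : ℂ} {T N : ℝ} (hT : 32 ≤ T) (hN : 1 ≤ N)
    (h1 : T ≤ ‖x - z‖) (h2 : ‖x - z‖ ≤ 2 * T) (hx : x ≠ w) (hz : z ≠ w) :
    (Metric.ball z 16).indicator (fun _ => Real.log (T / 32)) w -
      (Metric.ball x (T / (2 * N))).indicator (fun _ => Real.log (1 + 2 * T)) w -
      Real.log (1 + 4 * N) - ‖x - w‖⁻¹ ≤ Real.log ‖x - w‖ - Real.log ‖z - w‖ := by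
  have p1 : 0 < ‖x - w‖ := norm_pos_iff.2 (sub_ne_zero.2 hx)
  have p2 : 0 < ‖z - w‖ := norm_pos_iff.2 (sub_ne_zero.2 hz)
  have q1 := inv_pos.2 p1
  have l1 : 0 ≤ Real.log (1 + 2 * T) := Real.log_nonneg (by linarith)
  have l2 : 0 ≤ Real.log (1 + 4 * N) := Real.log_nonneg (by linarith)
  have l3 : 0 ≤ Real.log (T / 32) := Real.log_nonneg (by linarith)
  have tri : ‖x - z‖ ≤ ‖x - w‖ + ‖z - w‖ := by
    rw [norm_sub_rev z w]; simpa using norm_add_le (x - w) (w - z)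
  have tri2 : ‖z - w‖ ≤ ‖x - w‖ + ‖x - z‖ := by
    have := norm_sub_le (x - w) (x - z); simpa [sub_sub_sub_cancel_left] using this
  have hi1 : (Metric.ball x (T / (2 * N))).indicator (fun _ => Real.log (1 + 2 * T)) w ≥ 0 :=
    Set.indicator_nonneg (fun _ _ => l1) _
  by_cases h0 : w ∈ Metric.ball z 16
  · rw [Set.indicator_of_mem h0]
    have h0' : ‖z - w‖ < 16 := by simpa [dist_eq_norm, norm_sub_rev] using h0
    have h3 : T / 32 ≤ ‖x - w‖ / ‖z - w‖ := by
      calc T / 32 ≤ (T - 16) / 16 := by linarith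
        _ ≤ ‖x - w‖ / ‖z - w‖ := by
          gcongr
          · linarith
    have h4 := Real.log_le_log (by positivity) h3
    rw [Real.log_div p1.ne' p2.ne'] at h4
    linarith
  rw [Set.indicator_of_notMem h0]
  have hf : -Real.log (1 + 2 * T / ‖x - w‖) ≤ Real.log ‖x - w‖ - Real.log ‖z - w‖ := by
    have : ‖z - w‖ ≤ (1 + 2 * T / ‖x - w‖) * ‖x - w‖ := by
      rw [add_mul, div_mul_cancel₀ _ p1.ne']; linarith
    have := Real.log_le_log p2 this
    rw [Real.log_mul (by positivity) p1.ne'] at this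
    linarith
  by_cases h5 : w ∈ Metric.ball x (T / (2 * N))
  · rw [Set.indicator_of_mem h5]
    have := log_one_add_mul_inv_le (by linarith : 0 ≤ 2 * T) p1
    linarith
  · have h5' : T / (2 * N) ≤ ‖x - w‖ := by
      simpa [dist_eq_norm, norm_sub_rev] using h5
    have h6 : 2 * T / ‖x - w‖ ≤ 4 * N := by
      rw [div_le_iff₀ p1]; rw [div_le_iff₀ (by positivity)] at h5'; nlinarith
    have := Real.log_le_log (by positivity) (by linarith : 1 + 2 * T / ‖x - w‖ ≤ 1 + 4 * N)
    linarith

namespace Patch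

/-- Connected patches have universally bounded radius. -/
theorem exists_radius_bound : ∃ R₀ : ℝ, ∀ (B : Set ℂ) (R ℓ : ℝ) (e : ℂ → ℝ), Patch B R ℓ e →
    IsPreconnected B → ℓ * R ≤ 1 / 100 → 4 ≤ R → B ⊆ Metric.closedBall 0 R₀ := by
  set N : ℕ := 10 ^ 5 with hN
  have hNr : (N : ℝ) = 10 ^ 5 := by rw [hN]; norm_num
  set K : ℝ := 20000 * (24 + 4 * Real.log (1 + 4 * N) + 2 * Real.log 32 + Real.log 3) with hK
  refine ⟨4 * max 32 (Real.exp K), fun B R ℓ e h hc hs hR => ?_⟩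
  have hpi := Real.pi_gt_three
  have hpi4 := Real.pi_lt_d2
  obtain ⟨z, hz, hzv⟩ := h.exists_dense_point hs hR
  have key : ∀ y ∈ B, ‖y - z‖ ≤ 2 * max 32 (Real.exp K) := by
    intro y hy
    set T := ‖y - z‖ / 2 with hT
    rcases lt_or_ge T 32 with hlt | hge
    · linarith [le_max_left 32 (Real.exp K)]
    obtain ⟨x, hx, hx1, hx2, hxv⟩ := exists_low_mass h.measurableSet h.volume_ne_top hc hz hy
      (T₁ := T) (T₂ := 2 * T) (by linarith) (by linarith) (by rw [hT]; linarith) (N := N)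
      (by rw [hN]; norm_num)
    rw [show 2 * T - T = T by ring, h.area] at hxv
    have V1 := h.pos_of_mem hx
    have V2 := h.le_two hs hz
    have V3 := h.lip z x (h.norm_le_two hz) (h.norm_le_two hx)
    have V4 : ℓ * ‖z - x‖ ≤ 2 / 100 := by
      have : ‖z - x‖ ≤ 2 * R := (norm_sub_le _ _).trans (by linarith [h.norm_le hz, h.norm_le hx])
      nlinarith [h.nonneg]
    have V5 : logPot B z - logPot B x ≤ 21 / 10 := by
      linarith [(abs_le.1 V3).1]
    have i1 := integrableOn_log_norm_sub h.measurableSet h.bounded x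
    have i2 := integrableOn_log_norm_sub h.measurableSet h.bounded z
    have V6 : ∫ w in B, (Real.log ‖x - w‖ - Real.log ‖z - w‖) ≤ 14 := by
      rw [integral_sub i1 i2]
      simp only [logPot] at V5
      have : 1 / (2 * π) * ((∫ w in B, Real.log ‖x - w‖) - ∫ w in B, Real.log ‖z - w‖) ≤ 21 / 10 := by
        linarith
      rw [one_div_mul_eq_div, div_le_iff₀ (by positivity)] at this
      linarith
    have i3 := inv_norm_sub_setIntegral h.volume_ne_top x one_pos
    have hfin : ∀ c : ℝ, IntegrableOn (fun _ : ℂ => c) B := fun c =>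
      integrableOn_const h.volume_ne_top
    have i4 := (hfin (Real.log (T / 32))).indicator (measurableSet_ball (x := z) (ε := 16))
    have i5 := (hfin (Real.log (1 + 2 * T))).indicator
      (measurableSet_ball (x := x) (ε := T / (2 * N)))
    have i6 : IntegrableOn (fun w => (Metric.ball z 16).indicator (fun _ => Real.log (T / 32)) w -
        (Metric.ball x (T / (2 * N))).indicator (fun _ => Real.log (1 + 2 * T)) w) B := i4.sub i5
    have i7 : IntegrableOn (fun w => (Metric.ball z 16).indicator (fun _ => Real.log (T / 32)) w -
        (Metric.ball x (T / (2 * N))).indicator (fun _ => Real.log (1 + 2 * T)) w -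
        Real.log (1 + 4 * N)) B := i6.sub (hfin _)
    have V7 : ∫ w in B, ((Metric.ball z 16).indicator (fun _ => Real.log (T / 32)) w -
        (Metric.ball x (T / (2 * N))).indicator (fun _ => Real.log (1 + 2 * T)) w -
        Real.log (1 + 4 * N) - ‖x - w‖⁻¹) ≤
        ∫ w in B, (Real.log ‖x - w‖ - Real.log ‖z - w‖) := by
      refine integral_mono_ae (i7.sub i3.1) (i1.sub i2)
        (ae_restrict_of_ae ?_)
      filter_upwards [Measure.ae_ne volume x, Measure.ae_ne volume z] with w h1 h2
      exact log_ratio_lower_bound hge (by rw [hNr]; norm_num) hx1 hx2 h1.symm h2.symm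
    rw [integral_sub i7 i3.1, integral_sub i6 (hfin _),
      integral_sub i4 i5, setIntegral_indicator measurableSet_ball,
      setIntegral_indicator measurableSet_ball, setIntegral_const, setIntegral_const,
      setIntegral_const, h.area, smul_eq_mul, smul_eq_mul, smul_eq_mul] at V7
    have V8 := i3.2
    rw [h.area] at V8
    have l1 : 0 ≤ Real.log (1 + 2 * T) := Real.log_nonneg (by linarith)
    have l3 : 0 ≤ Real.log (T / 32) := Real.log_nonneg (by linarith)
    have l2 : 0 ≤ Real.log (1 + 4 * N) := Real.log_nonneg (by rw [hNr]; norm_num)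
    have W1 := mul_le_mul_of_nonneg_right hzv l3
    have W2 := mul_le_mul_of_nonneg_right (hxv.trans
      (by rw [hNr]; norm_num; linarith : π / N ≤ 1 / 20000)) l1
    rw [Real.log_div (by linarith) (by norm_num)] at W1 V7
    have W3 : Real.log (1 + 2 * T) ≤ Real.log 3 + Real.log T := by
      rw [← Real.log_mul (by norm_num) (by linarith)]
      exact Real.log_le_log (by linarith) (by linarith)
    have W4 : Real.log T ≤ K := by
      have : π * Real.log (1 + 4 * N) ≤ 4 * Real.log (1 + 4 * N) := by gcongr; linarith
      have l32 : 0 ≤ Real.log 32 := Real.log_nonneg (by norm_num)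
      have l3' : 0 ≤ Real.log 3 := Real.log_nonneg (by norm_num)
      have a1 : 1 / 10000 * (Real.log T - Real.log 32) ≤
          14 + 3 * π + π * Real.log (1 + 4 * N) + 1 / 20000 * Real.log (1 + 2 * T) := by
        linarith
      rw [hK]
      clear_value N T
      generalize Real.log (1 + 4 * (N : ℝ)) = q1 at *
      generalize Real.log (1 + 2 * T) = q2 at *
      linarith only [a1, this, l32, l3', W3, hpi4]
    have W5 : T ≤ Real.exp K := (Real.log_le_iff_le_exp (by linarith)).1 W4
    linarith [le_max_right 32 (Real.exp K)]
  obtain ⟨c, hcB, hcz⟩ := exists_far_point h.measurableSet h.bounded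
    (by rw [h.area]; positivity) h.centroid z
  intro y hy
  rw [mem_closedBall_zero_iff]
  have := norm_add_le (y - z) z
  rw [sub_add_cancel] at this
  linarith [key y hy, key c hcB]

end Patch

/-- Reflection across the line `⟪u, y⟫ = lam`. -/
def lineRefl (u : ℂ) (lam : ℝ) (y : ℂ) : ℂ := y + (2 * (lam - ⟪u, y⟫)) • u

theorem inner_lineRefl {u : ℂ} (hu : ‖u‖ = 1) (lam : ℝ) (y : ℂ) :
    ⟪u, lineRefl u lam y⟫ = 2 * lam - ⟪u, y⟫ := by
  rw [lineRefl, inner_add_right, real_inner_smul_right, real_inner_self_eq_norm_sq, hu]; ring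

theorem lineRefl_lineRefl {u : ℂ} (hu : ‖u‖ = 1) (lam : ℝ) (y : ℂ) :
    lineRefl u lam (lineRefl u lam y) = y := by
  conv_lhs => rw [lineRefl, inner_lineRefl hu, lineRefl]
  rw [add_assoc, ← add_smul, show 2 * (lam - ⟪u, y⟫) + 2 * (lam - (2 * lam - ⟪u, y⟫)) = 0 by ring,
    zero_smul, add_zero]

theorem norm_sub_lineRefl_sq {u : ℂ} (hu : ‖u‖ = 1) (lam : ℝ) (z w : ℂ) :
    ‖lineRefl u lam z - w‖ ^ 2 = ‖z - w‖ ^ 2 - 4 * (⟪u, z⟫ - lam) * (lam - ⟪u, w⟫) := by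
  have : lineRefl u lam z - w = (z - w) + (2 * (lam - ⟪u, z⟫)) • u := by rw [lineRefl]; ring
  rw [this, norm_add_sq_real, real_inner_smul_right, norm_smul, hu, real_inner_comm u (z - w),
    inner_sub_right, mul_one, Real.norm_eq_abs, sq_abs]
  ring

theorem norm_lineRefl_sub {u : ℂ} (hu : ‖u‖ = 1) (lam : ℝ) (z w : ℂ) :
    ‖lineRefl u lam z - w‖ = ‖z - lineRefl u lam w‖ := by
  have h1 := norm_sub_lineRefl_sq hu lam z w
  have h2 := norm_sub_lineRefl_sq hu lam w z
  rw [norm_sub_rev (lineRefl u lam w) z, norm_sub_rev w z] at h2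
  have : ‖lineRefl u lam z - w‖ ^ 2 = ‖z - lineRefl u lam w‖ ^ 2 := by rw [h1, h2]; ring
  exact (sq_eq_sq₀ (norm_nonneg _) (norm_nonneg _)).1 this

theorem norm_lineRefl_le {u : ℂ} (hu : ‖u‖ = 1) {lam : ℝ} (hlam : 0 ≤ lam) {z : ℂ}
    (hz : lam ≤ ⟪u, z⟫) : ‖lineRefl u lam z‖ ≤ ‖z‖ := by
  have := norm_sub_lineRefl_sq hu lam z 0
  simp only [sub_zero, inner_zero_right] at this
  exact (sq_le_sq₀ (norm_nonneg _) (norm_nonneg _)).1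
    (by rw [this]; nlinarith [mul_nonneg (sub_nonneg.2 hz) hlam])

theorem lineRefl_eq {u : ℂ} (hu : ‖u‖ = 1) (lam : ℝ) (y : ℂ) :
    lineRefl u lam y = (ℝ ∙ u)ᗮ.reflection y + (2 * lam) • u := by
  rw [Submodule.reflection_orthogonal_apply, Submodule.reflection_singleton_apply, hu, lineRefl]
  simp only [RCLike.ofReal_real_eq_id, id, one_pow, div_one, Complex.real_smul, nsmul_eq_mul]
  push_cast; ring

theorem measurePreserving_lineRefl {u : ℂ} (hu : ‖u‖ = 1) (lam : ℝ) :
    MeasurePreserving (lineRefl u lam) volume volume := by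
  have : lineRefl u lam = (fun y => y + (2 * lam) • u) ∘ (ℝ ∙ u)ᗮ.reflection := by
    ext y : 1; exact lineRefl_eq hu lam y
  rw [this]
  exact (measurePreserving_add_right volume _).comp
    (LinearIsometryEquiv.measurePreserving (ℝ ∙ u)ᗮ.reflection)

theorem measurable_lineRefl (u : ℂ) (lam : ℝ) : Measurable (lineRefl u lam) := by
  unfold lineRefl; fun_prop

theorem lineRefl_involutive {u : ℂ} (hu : ‖u‖ = 1) (lam : ℝ) :
    Function.Involutive (lineRefl u lam) := lineRefl_lineRefl hu lam

theorem measurableEmbedding_lineRefl {u : ℂ} (hu : ‖u‖ = 1) (lam : ℝ) :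
    MeasurableEmbedding (lineRefl u lam) :=
  (MeasurableEquiv.mk (lineRefl_involutive hu lam).toPerm (measurable_lineRefl u lam)
    (measurable_lineRefl u lam)).measurableEmbedding

/-- The integral over `B` of a function odd under a reflection only sees the asymmetric part. -/
theorem setIntegral_odd_lineRefl {u : ℂ} (hu : ‖u‖ = 1) (lam : ℝ) {B : Set ℂ}
    (hB : MeasurableSet B) {f : ℂ → ℝ} (hf : IntegrableOn f B)
    (hodd : ∀ w, f (lineRefl u lam w) = -f w) :
    ∫ w in B, f w = ∫ w in B \ lineRefl u lam ⁻¹' B, f w := by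
  have hm : MeasurableSet (lineRefl u lam ⁻¹' B) := measurable_lineRefl u lam hB
  rw [← integral_inter_add_sdiff hm hf]
  have h := (measurePreserving_lineRefl hu lam).setIntegral_preimage_emb
    (measurableEmbedding_lineRefl hu lam) f (B ∩ lineRefl u lam ⁻¹' B)
  have hs : lineRefl u lam ⁻¹' (B ∩ lineRefl u lam ⁻¹' B) = B ∩ lineRefl u lam ⁻¹' B := by
    ext w; simp [lineRefl_lineRefl hu, and_comm]
  simp only [hs, hodd, integral_neg] at h
  linarith

/-- The points of `B` beyond the line `⟪u, y⟫ = lam` whose reflection is not in `B`. -/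
def badCap (B : Set ℂ) (u : ℂ) (lam : ℝ) : Set ℂ :=
  {w | w ∈ B ∧ lam < ⟪u, w⟫ ∧ lineRefl u lam w ∉ B}

theorem measurableSet_badCap {B : Set ℂ} (hB : MeasurableSet B) (u : ℂ) (lam : ℝ) :
    MeasurableSet (badCap B u lam) := by
  refine hB.inter (MeasurableSet.inter ?_ (measurable_lineRefl u lam hB).compl)
  have : Measurable fun w : ℂ => ⟪u, w⟫ := by fun_prop
  exact measurableSet_lt measurable_const this

theorem log_sub_log_ge {p q : ℝ} (hp : 0 < p) (hq : 0 < q) :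
    (p - q) / p ≤ Real.log p - Real.log q := by
  have := Real.one_sub_inv_le_log_of_pos (div_pos hp hq)
  rw [Real.log_div hp.ne' hq.ne', inv_div] at this
  rwa [sub_div, div_self hp.ne']

namespace Patch
variable {B : Set ℂ} {R ℓ : ℝ} {e : ℂ → ℝ}

theorem integral_inner (h : Patch B R ℓ e) (u : ℂ) (lam : ℝ) :
    IntegrableOn (fun w => lam - ⟪u, w⟫) B ∧ ∫ w in B, (lam - ⟪u, w⟫) = π * lam := by
  have hi : IntegrableOn (fun w : ℂ => w) B :=
    (continuous_id.continuousOn.integrableOn_compact (isCompact_closedBall 0 R)).mono_set h.sub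
  have hi2 : IntegrableOn (fun w : ℂ => ⟪u, w⟫) B := hi.const_inner u
  have hc : IntegrableOn (fun _ : ℂ => lam) B := integrableOn_const h.volume_ne_top
  refine ⟨hc.sub hi2, ?_⟩
  rw [integral_sub hc hi2, _root_.integral_inner hi, h.centroid, inner_zero_right,
    setIntegral_const, h.area, smul_eq_mul, sub_zero]

/-- The basic moving-plane estimate. -/
theorem badCap_estimate (h : Patch B R ℓ e) {u : ℂ} (hu : ‖u‖ = 1) {lam ρ : ℝ} (hlam : 0 < lam)
    (hρ : 0 < ρ) {z : ℂ} (hz : z ∈ badCap B u lam) :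
    π * lam / (2 * R ^ 2) < 4 * π * ℓ +
      2 * (2 * π * ρ + volume.real (badCap B u lam) / ρ) := by
  obtain ⟨hzB, hzl, hyB⟩ := hz
  set y := lineRefl u lam z with hy
  set q := ⟪u, z⟫ - lam with hq
  have hq0 : 0 < q := sub_pos.2 hzl
  have hR : 0 < R := by linarith [h.one_le]
  have hyz : ‖y‖ ≤ ‖z‖ := norm_lineRefl_le hu hlam.le hzl.le
  have hyR : ‖y‖ ≤ 2 * R := hyz.trans (h.norm_le_two hzB)
  have hdist : ‖z - y‖ = 2 * q := by
    have : z - y = (2 * q) • u := by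
      rw [hy, lineRefl, hq, sub_add_cancel_left, ← neg_smul]; congr 1; ring
    rw [this, norm_smul, hu, mul_one, Real.norm_of_nonneg (by positivity)]
  have hS := measurableSet_badCap h.measurableSet u lam
  have hSB : badCap B u lam ⊆ B := fun w hw => hw.1
  set c := q / (2 * R ^ 2) with hc
  have hc0 : 0 < c := by positivity
  set φ : ℂ → ℝ := fun w => Real.log ‖z - w‖ - Real.log ‖y - w‖ with hφ
  have iφ : IntegrableOn φ B := (integrableOn_log_norm_sub h.measurableSet h.bounded z).sub
    (integrableOn_log_norm_sub h.measurableSet h.bounded y)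
  obtain ⟨iψ, eψ⟩ := h.integral_inner u lam
  set f : ℂ → ℝ := fun w => φ w - c * (lam - ⟪u, w⟫) with hf
  have if' : IntegrableOn f B := iφ.sub (iψ.const_mul c)
  have hodd : ∀ w, f (lineRefl u lam w) = -f w := by
    intro w
    simp only [hf, hφ, inner_lineRefl hu, ← norm_lineRefl_sub hu]
    rw [← hy, hy, lineRefl_lineRefl hu]; ring
  have e1 : ∫ w in B, f w = (∫ w in B, φ w) - c * (π * lam) := by
    rw [integral_sub iφ (iψ.const_mul c), integral_const_mul, eψ]
  have e2 := setIntegral_odd_lineRefl hu lam h.measurableSet if' hodd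
  set D := B \ lineRefl u lam ⁻¹' B
  have hD : MeasurableSet D := h.measurableSet.diff (measurable_lineRefl u lam h.measurableSet)
  have hv : volume (badCap B u lam) ≠ ⊤ := measure_ne_top_of_subset hSB h.volume_ne_top
  have hj := inv_norm_sub_setIntegral hv z hρ
  have e3 : -(2 * q * ∫ w in badCap B u lam, ‖z - w‖⁻¹) ≤ ∫ w in D, f w := by
    rw [← integral_const_mul, ← integral_neg, ← integral_indicator hS, ← integral_indicator hD]
    have i1 : Integrable ((badCap B u lam).indicator fun w => -(2 * q * ‖z - w‖⁻¹)) :=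
      IntegrableOn.integrable_indicator (hj.1.const_mul _).neg hS
    have i2 : Integrable (D.indicator f) :=
      (if'.mono_set Set.sdiff_subset).integrable_indicator hD
    refine integral_mono_ae i1 i2 ?_
    filter_upwards [Measure.ae_ne volume z, Measure.ae_ne volume y] with w h1 h2
    have p1 : 0 < ‖z - w‖ := norm_pos_iff.2 (sub_ne_zero.2 h1.symm)
    have p2 : 0 < ‖y - w‖ := norm_pos_iff.2 (sub_ne_zero.2 h2.symm)
    have hsq := norm_sub_lineRefl_sq hu lam z w
    rw [← hy, ← hq] at hsq
    by_cases hw : w ∈ badCap B u lam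
    · have hwD : w ∈ D := ⟨hw.1, hw.2.2⟩
      rw [Set.indicator_of_mem hw, Set.indicator_of_mem hwD]
      have k1 := log_sub_log_ge p1 p2
      have k2 : -(2 * q) ≤ ‖z - w‖ - ‖y - w‖ := by
        have := abs_norm_sub_norm_le (z - w) (y - w)
        rw [sub_sub_sub_cancel_right, hdist] at this
        exact (abs_le.1 this).1
      have k3 : -(2 * q * ‖z - w‖⁻¹) ≤ (‖z - w‖ - ‖y - w‖) / ‖z - w‖ := by
        rw [div_eq_mul_inv, ← neg_mul]; gcongr
      have k4 : c * (lam - ⟪u, w⟫) ≤ 0 :=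
        mul_nonpos_of_nonneg_of_nonpos hc0.le (by linarith [hw.2.1])
      simp only [hf, hφ]; linarith
    · rw [Set.indicator_of_notMem hw]
      by_cases hwD : w ∈ D
      · rw [Set.indicator_of_mem hwD]
        have hwl : 0 ≤ lam - ⟪u, w⟫ := by
          by_contra hcon
          exact hw ⟨hwD.1, by linarith, hwD.2⟩
        have hzw : ‖z - w‖ ≤ 2 * R :=
          (norm_sub_le _ _).trans (by linarith [h.norm_le hzB, h.norm_le hwD.1])
        have k0 : 0 ≤ 4 * q * (lam - ⟪u, w⟫) := by positivity
        have k5 : ‖y - w‖ ≤ ‖z - w‖ :=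
          (sq_le_sq₀ (norm_nonneg _) (norm_nonneg _)).1 (by linarith)
        have k1 := log_sub_log_ge p1 p2
        have k6 : c * (lam - ⟪u, w⟫) ≤ (‖z - w‖ - ‖y - w‖) / ‖z - w‖ := by
          rw [le_div_iff₀ p1, hc, div_mul_eq_mul_div, div_mul_eq_mul_div,
            div_le_iff₀ (by positivity)]
          have k7 : (‖z - w‖ - ‖y - w‖) * (‖z - w‖ + ‖y - w‖) = 4 * (q * (lam - ⟪u, w⟫)) := by
            linarith
          have k8 : (‖z - w‖ - ‖y - w‖) * (‖z - w‖ + ‖y - w‖) ≤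
              (‖z - w‖ - ‖y - w‖) * (2 * ‖z - w‖) := by
            apply mul_le_mul_of_nonneg_left <;> linarith
          have k9 : (‖z - w‖ - ‖y - w‖) * (‖z - w‖ * ‖z - w‖) ≤
              (‖z - w‖ - ‖y - w‖) * (2 * R * (2 * R)) := by
            apply mul_le_mul_of_nonneg_left _ (by linarith)
            gcongr
          nlinarith
        simp only [hf, hφ]; linarith
      · rw [Set.indicator_of_notMem hwD]
  have V1 := h.pos_of_mem hzB
  have V2 := h.nonpos_of_notMem hyR hyB
  have V3 := (abs_le.1 (h.lip z y (h.norm_le_two hzB) hyR)).2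
  rw [hdist] at V3
  have V4 : logPot B z - logPot B y = -(1 / (2 * π)) * ∫ w in B, φ w := by
    rw [integral_sub (integrableOn_log_norm_sub h.measurableSet h.bounded z)
      (integrableOn_log_norm_sub h.measurableSet h.bounded y)]
    simp only [logPot]; ring
  have V5 : 1 / (2 * π) * ∫ w in B, φ w < ℓ * (2 * q) := by linarith
  rw [one_div_mul_eq_div, div_lt_iff₀ (by positivity)] at V5
  have V6 : 2 * q * ∫ w in badCap B u lam, ‖z - w‖⁻¹ ≤
      2 * q * (2 * π * ρ + volume.real (badCap B u lam) / ρ) := by gcongr; exact hj.2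
  have V7 : q * (π * lam / (2 * R ^ 2)) < q * (4 * π * ℓ +
      2 * (2 * π * ρ + volume.real (badCap B u lam) / ρ)) := by
    have : c * (π * lam) = q * (π * lam / (2 * R ^ 2)) := by rw [hc]; ring
    rw [← this]
    linarith
  exact lt_of_mul_lt_mul_left V7 hq0.le

end Patch

theorem volume_real_vertical_strip_le {R a b : ℝ} (hR : 0 ≤ R) (hab : a ≤ b) :
    volume.real {w : ℂ | a < w.re ∧ w.re ≤ b ∧ ‖w‖ ≤ R} ≤ 2 * R * (b - a) := by
  have hsub : {w : ℂ | a < w.re ∧ w.re ≤ b ∧ ‖w‖ ≤ R} ⊆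
      Complex.measurableEquivRealProd ⁻¹' (Set.Ioc a b ×ˢ Set.Icc (-R) R) := by
    rintro w ⟨h1, h2, h3⟩
    exact ⟨⟨h1, h2⟩, abs_le.1 ((Complex.abs_im_le_norm w).trans h3)⟩
  have hv : volume (Complex.measurableEquivRealProd ⁻¹' (Set.Ioc a b ×ˢ Set.Icc (-R) R)) =
      ENNReal.ofReal (b - a) * ENNReal.ofReal (R - -R) := by
    rw [Complex.volume_preserving_equiv_real_prod.measure_preimage
      (measurableSet_Ioc.prod measurableSet_Icc).nullMeasurableSet, Measure.volume_eq_prod,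
      Measure.prod_prod, Real.volume_Ioc, Real.volume_Icc]
  refine (measureReal_mono hsub (by rw [hv]; finiteness)).trans ?_
  rw [measureReal_def, hv, ENNReal.toReal_mul, ENNReal.toReal_ofReal (by linarith),
    ENNReal.toReal_ofReal (by linarith)]
  linarith

theorem volume_real_strip_le {u : ℂ} (hu : ‖u‖ = 1) {R a b : ℝ} (hR : 0 ≤ R) (hab : a ≤ b) :
    volume.real {w : ℂ | a < ⟪u, w⟫ ∧ ⟪u, w⟫ ≤ b ∧ ‖w‖ ≤ R} ≤ 2 * R * (b - a) := by
  let s : Circle := ⟨(starRingEnd ℂ) u, by simp [Submonoid.unitSphere, hu]⟩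
  have hmp := LinearIsometryEquiv.measurePreserving (rotation s)
  have hpre : {w : ℂ | a < ⟪u, w⟫ ∧ ⟪u, w⟫ ≤ b ∧ ‖w‖ ≤ R} =
      rotation s ⁻¹' {w : ℂ | a < w.re ∧ w.re ≤ b ∧ ‖w‖ ≤ R} := by
    ext w
    have h1 : (rotation s w).re = ⟪u, w⟫ := by
      rw [rotation_apply, Complex.inner, mul_comm]
    have h2 : ‖rotation s w‖ = ‖w‖ := (rotation s).norm_map w
    simp only [Set.mem_ofPred_eq, Set.mem_preimage, h1, h2]
  have hms : MeasurableSet {w : ℂ | a < w.re ∧ w.re ≤ b ∧ ‖w‖ ≤ R} :=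
    (measurableSet_lt measurable_const Complex.measurable_re).inter
      ((measurableSet_le Complex.measurable_re measurable_const).inter
        (measurableSet_le measurable_norm measurable_const))
  rw [hpre, measureReal_def, hmp.measure_preimage hms.nullMeasurableSet]
  exact volume_real_vertical_strip_le hR hab

theorem tendsto_volume_diff_translate {B : Set ℂ} (hB : IsOpen B) (hv : volume B ≠ ⊤) :
    Tendsto (fun v : ℂ => volume.real (B \ {w | w + v ∈ B})) (nhds 0) (nhds 0) := by
  have hm : ∀ v : ℂ, MeasurableSet (B \ {w | w + v ∈ B}) := fun v =>
    hB.measurableSet.diff (hB.preimage (by fun_prop : Continuous fun w : ℂ => w + v)).measurableSet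
  have h1 : Tendsto (fun v : ℂ => ∫ w, (B \ {w | w + v ∈ B}).indicator (fun _ => (1 : ℝ)) w)
      (nhds 0) (nhds (∫ _ : ℂ, (0 : ℝ))) := by
    refine tendsto_integral_filter_of_dominated_convergence (B.indicator fun _ => (1 : ℝ)) ?_ ?_ ?_ ?_
    · exact Eventually.of_forall fun v =>
        (measurable_const.indicator (hm v)).aestronglyMeasurable
    · refine Eventually.of_forall fun v => ae_of_all _ fun w => ?_
      rw [Real.norm_of_nonneg (Set.indicator_nonneg (fun _ _ => zero_le_one) _)]
      exact Set.indicator_le_indicator_of_subset Set.sdiff_subset (fun _ => zero_le_one) w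
    · exact IntegrableOn.integrable_indicator (integrableOn_const hv) hB.measurableSet
    · refine ae_of_all _ fun w => ?_
      refine tendsto_const_nhds.congr' ?_
      by_cases hw : w ∈ B
      · have : Tendsto (fun v : ℂ => w + v) (nhds 0) (nhds w) :=
          (by fun_prop : Continuous fun v : ℂ => w + v).tendsto' _ _ (by simp)
        filter_upwards [this.eventually (hB.mem_nhds hw)] with v hv'
        exact (Set.indicator_of_notMem (fun h => h.2 hv') _).symm
      · refine Eventually.of_forall fun v => ?_
        exact (Set.indicator_of_notMem (fun h => hw h.1) _).symm
  simp only [integral_zero] at h1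
  refine h1.congr fun v => ?_
  rw [integral_indicator (hm v), setIntegral_const]; simp

namespace Patch
variable {B : Set ℂ} {R ℓ : ℝ} {e : ℂ → ℝ}

theorem volume_badCap_le (h : Patch B R ℓ e) {u : ℂ} (hu : ‖u‖ = 1) {a b : ℝ} (hab : a ≤ b)
    (hb : badCap B u b = ∅) :
    volume.real (badCap B u a) ≤ 2 * R * (b - a) +
      volume.real (B \ {w | w + (-(2 * (b - a)) • u) ∈ B}) := by
  have hR : 0 ≤ R := by linarith [h.one_le]
  set v : ℂ := -(2 * (b - a)) • u
  have hm : MeasurableSet (B \ {w | w + v ∈ B}) := h.measurableSet.diff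
    (h.isOpen.preimage (by fun_prop : Continuous fun w : ℂ => w + v)).measurableSet
  have hsub : badCap B u a ⊆ {w : ℂ | a < ⟪u, w⟫ ∧ ⟪u, w⟫ ≤ b ∧ ‖w‖ ≤ R} ∪
      lineRefl u b ⁻¹' (B \ {w | w + v ∈ B}) := by
    rintro w ⟨h1, h2, h3⟩
    by_cases h4 : ⟪u, w⟫ ≤ b
    · exact Or.inl ⟨h2, h4, h.norm_le h1⟩
    · right
      have h5 : lineRefl u b w ∈ B := by
        by_contra hcon
        have : w ∈ badCap B u b := ⟨h1, not_le.1 h4, hcon⟩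
        simp [hb] at this
      refine ⟨h5, ?_⟩
      have : lineRefl u b w + v = lineRefl u a w := by
        simp only [lineRefl, v, add_assoc, ← add_smul]; congr 2; ring
      simpa [this] using h3
  have hpre : volume (lineRefl u b ⁻¹' (B \ {w | w + v ∈ B})) = volume (B \ {w | w + v ∈ B}) :=
    (measurePreserving_lineRefl hu b).measure_preimage hm.nullMeasurableSet
  have hfin : volume (B \ {w | w + v ∈ B}) ≠ ⊤ :=
    measure_ne_top_of_subset Set.sdiff_subset h.volume_ne_top
  have hfin2 : volume {w : ℂ | a < ⟪u, w⟫ ∧ ⟪u, w⟫ ≤ b ∧ ‖w‖ ≤ R} ≠ ⊤ :=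
    measure_ne_top_of_subset (show {w : ℂ | a < ⟪u, w⟫ ∧ ⟪u, w⟫ ≤ b ∧ ‖w‖ ≤ R} ⊆
      Metric.closedBall 0 R from fun w hw => by simpa using hw.2.2)
      measure_closedBall_lt_top.ne
  refine (measureReal_mono hsub (measure_union_lt_top hfin2.lt_top
    (hpre ▸ hfin.lt_top)).ne).trans ((measureReal_union_le _ _).trans ?_)
  refine add_le_add (volume_real_strip_le hu hR hab) (le_of_eq ?_)
  rw [measureReal_def, measureReal_def, hpre]

theorem badCap_eq_empty (h : Patch B R ℓ e) {u : ℂ} (hu : ‖u‖ = 1) {c : ℝ} (hc : 0 < c)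
    (hℓ : 16 * R ^ 2 * ℓ ≤ c) {lam : ℝ} (hlam : c ≤ lam) : badCap B u lam = ∅ := by
  have hR : 0 < R := by linarith [h.one_le]
  set ρ := c / (32 * R ^ 2) with hρ
  have hρ0 : 0 < ρ := by positivity
  set η := π * ρ * ρ / 2 with hη
  have hη0 : 0 < η := by have := Real.pi_pos; positivity
  have small : ∀ lam, c ≤ lam → volume.real (badCap B u lam) ≤ η → badCap B u lam = ∅ := by
    intro lam hl hs
    by_contra hne
    obtain ⟨z, hz⟩ := Set.nonempty_iff_ne_empty.2 hne
    have h1 := h.badCap_estimate hu (hc.trans_le hl) hρ0 hz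
    have h2 : volume.real (badCap B u lam) / ρ ≤ π * ρ / 2 := by
      rw [div_le_iff₀ hρ0]; rw [hη] at hs; linarith
    have h3 : π * c / (2 * R ^ 2) ≤ π * lam / (2 * R ^ 2) := by have := Real.pi_pos; gcongr
    have h4 : π * c / (2 * R ^ 2) = 16 * π * ρ := by rw [hρ]; field_simp; ring
    have h5 : ℓ ≤ 2 * ρ := by
      rw [hρ, ← mul_div_assoc, le_div_iff₀ (by positivity)]; linarith
    have h6 : 4 * π * ℓ ≤ 4 * π * (2 * ρ) := by have := Real.pi_pos; gcongr
    nlinarith [mul_pos Real.pi_pos hρ0]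
  have ht : Tendsto (fun δ : ℝ => 2 * R * δ + volume.real (B \ {w | w + (-(2 * δ) • u) ∈ B}))
      (nhds 0) (nhds (2 * R * 0 + 0)) := by
    refine ((tendsto_id).const_mul _).add
      ((tendsto_volume_diff_translate h.isOpen h.volume_ne_top).comp ?_)
    exact (by fun_prop : Continuous fun δ : ℝ => -(2 * δ) • u).tendsto' _ _ (by simp)
  rw [mul_zero, add_zero] at ht
  obtain ⟨δ, hδ0, hδ⟩ := Metric.eventually_nhds_iff.1 (ht.eventually_lt_const hη0)
  have ind : ∀ n : ℕ, ∀ lam, c ≤ lam → R - n * (δ / 2) ≤ lam → badCap B u lam = ∅ := by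
    intro n
    induction n with
    | zero =>
      intro lam _ hl
      refine Set.eq_empty_iff_forall_notMem.2 fun w hw => ?_
      have h1 := real_inner_le_norm u w
      rw [hu, one_mul] at h1
      have := h.norm_le hw.1
      have := hw.2.1
      simp at hl
      linarith
    | succ n ih =>
      intro lam hcl hl
      have h1 := ih (lam + δ / 2) (by linarith) (by push_cast at hl; linarith)
      have h2 := h.volume_badCap_le hu (by linarith : lam ≤ lam + δ / 2) h1
      rw [add_sub_cancel_left] at h2
      have h3 := @hδ (δ / 2) (by
        rw [Real.dist_eq, sub_zero, abs_of_pos (by positivity)]; linarith)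
      exact small lam hcl (h2.trans h3.le)
  obtain ⟨n, hn⟩ := exists_nat_ge (R / (δ / 2))
  rw [div_le_iff₀ (by positivity)] at hn
  exact ind n lam hlam (by linarith)

/-- Points significantly closer to the origin than some point of the patch are in the patch. -/
theorem mem_of_norm_lt (h : Patch B R ℓ e) {c : ℝ} (hc : 0 < c) (hℓ : 16 * R ^ 2 * ℓ ≤ c)
    {z x : ℂ} (hz : z ∈ B) (hx : ‖x‖ + 2 * c ≤ ‖z‖) : x ∈ B := by
  have hne : z - x ≠ 0 := by
    intro h0; rw [sub_eq_zero] at h0; subst h0; linarith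
  have hd : 0 < ‖z - x‖ := norm_pos_iff.2 hne
  set u : ℂ := ‖z - x‖⁻¹ • (z - x) with hu'
  have hu : ‖u‖ = 1 := by rw [hu', norm_smul, norm_inv, norm_norm, inv_mul_cancel₀ hd.ne']
  set lam := (‖z‖ ^ 2 - ‖x‖ ^ 2) / (2 * ‖z - x‖) with hlam
  have hzu : ⟪u, z⟫ = (‖z‖ ^ 2 - ⟪x, z⟫) / ‖z - x‖ := by
    rw [hu', real_inner_smul_left, inner_sub_left, real_inner_self_eq_norm_sq]; ring
  have hsq : ‖z - x‖ ^ 2 = ‖z‖ ^ 2 - 2 * ⟪x, z⟫ + ‖x‖ ^ 2 := by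
    rw [norm_sub_sq_real, real_inner_comm]
  have hdiff : ⟪u, z⟫ - lam = ‖z - x‖ / 2 := by
    rw [hzu, hlam]; field_simp; rw [hsq]; ring
  have hcl : c ≤ lam := by
    rw [hlam, le_div_iff₀ (by positivity)]
    have h1 : ‖z - x‖ ≤ ‖z‖ + ‖x‖ := norm_sub_le _ _
    nlinarith [norm_nonneg x, norm_nonneg z]
  have hrefl : lineRefl u lam z = x := by
    rw [lineRefl, show 2 * (lam - ⟪u, z⟫) = -‖z - x‖ by linarith, hu', smul_smul, neg_mul,
      mul_inv_cancel₀ hd.ne', neg_one_smul]; ring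
  by_contra hcon
  have : z ∈ badCap B u lam := ⟨hz, by linarith, by rwa [hrefl]⟩
  rw [h.badCap_eq_empty hu hc hℓ hcl] at this
  exact this

/-- A patch with small perturbation is close to the unit disc. -/
theorem sandwich (h : Patch B R ℓ e) {τ : ℝ} (hτ : 0 < τ) (hℓ : 32 * R ^ 2 * ℓ ≤ τ) :
    Metric.ball 0 (1 - τ) ⊆ B ∧ B ⊆ Metric.closedBall 0 (1 + τ) := by
  have key : ∀ z ∈ B, ∀ x, ‖x‖ + τ ≤ ‖z‖ → x ∈ B := fun z hz x hx =>
    h.mem_of_norm_lt (c := τ / 2) (by positivity) (by linarith) hz (by linarith)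
  have hpi := Real.pi_pos
  constructor
  · intro x hx
    rw [mem_ball_zero_iff] at hx
    by_contra hcon
    have hsub : B ⊆ Metric.ball 0 (‖x‖ + τ) := by
      intro z hz
      rw [mem_ball_zero_iff]
      by_contra hge
      exact hcon (key z hz x (not_lt.1 hge))
    have := measureReal_mono (μ := volume) hsub measure_ball_lt_top.ne
    rw [h.area, volume_real_ball _ (by positivity)] at this
    have h2 : (‖x‖ + τ) ^ 2 < 1 := by
      have : ‖x‖ + τ < 1 := by linarith
      have := norm_nonneg x
      nlinarith
    nlinarith
  · intro z hz
    rw [mem_closedBall_zero_iff]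
    by_contra hgt
    push Not at hgt
    have hsub : Metric.ball (0 : ℂ) (‖z‖ - τ) ⊆ B := by
      intro x hx
      rw [mem_ball_zero_iff] at hx
      exact key z hz x (by linarith)
    have := measureReal_mono (μ := volume) hsub h.volume_ne_top
    rw [h.area, volume_real_ball _ (by linarith)] at this
    have h2 : 1 < (‖z‖ - τ) ^ 2 := by nlinarith
    nlinarith

end Patch

/-- The chord length between the points of angles `0` and `t` of the unit circle. -/
def chord (t : ℝ) : ℝ := 2 * |Real.sin (t / 2)|

theorem chord_nonneg (t : ℝ) : 0 ≤ chord t := by unfold chord; positivity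

theorem chord_le_two (t : ℝ) : chord t ≤ 2 := by
  unfold chord; linarith [Real.abs_sin_le_one (t / 2)]

theorem chord_neg (t : ℝ) : chord (-t) = chord t := by
  unfold chord; rw [neg_div, Real.sin_neg, abs_neg]

theorem norm_exp_sub_exp (s t : ℝ) :
    ‖Complex.exp (s * Complex.I) - Complex.exp (t * Complex.I)‖ = chord (s - t) := by
  have h : Complex.exp (s * Complex.I) - Complex.exp (t * Complex.I) =
      Complex.exp (t * Complex.I) * (Complex.exp (Complex.I * ((s - t : ℝ) : ℂ)) - 1) := by
    rw [mul_sub, ← Complex.exp_add, mul_one]; congr 2; push_cast; ring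
  rw [h, norm_mul, Complex.norm_exp_ofReal_mul_I, one_mul, Complex.norm_exp_I_mul_ofReal_sub_one,
    Real.norm_eq_abs, abs_mul, abs_two, chord]

theorem chord_periodic : Function.Periodic chord (2 * π) := by
  intro t
  unfold chord
  rw [show (t + 2 * π) / 2 = t / 2 + π by ring, Real.sin_add_pi, abs_neg]

theorem intervalIntegrable_inv_sqrt_chord (a b : ℝ) :
    IntervalIntegrable (fun t => (√(chord t))⁻¹) volume a b := by
  have hpi := Real.pi_pos
  have h0 : IntervalIntegrable (fun t => (√(chord t))⁻¹) volume 0 π := by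
    have hr : IntervalIntegrable (fun t : ℝ => t ^ (-(1 / 2) : ℝ)) volume 0 π :=
      intervalIntegral.intervalIntegrable_rpow' (by norm_num)
    refine (hr.const_mul ((√(2 / π))⁻¹)).mono_fun ?_ ?_
    · exact (by unfold chord; fun_prop : Measurable fun t => (√(chord t))⁻¹).aestronglyMeasurable
    · refine (ae_restrict_mem measurableSet_uIoc).mono fun t ht => ?_
      rw [Set.uIoc_of_le hpi.le] at ht
      have ht0 : 0 < t := ht.1
      have h1 := Real.mul_abs_le_abs_sin (x := t / 2) (by
        rw [abs_of_pos (by positivity)]; linarith [ht.2])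
      rw [abs_of_pos (by positivity : 0 < t / 2)] at h1
      have h2 : 2 / π * t ≤ chord t := by unfold chord; linarith
      beta_reduce
      rw [Real.norm_of_nonneg (by positivity), Real.norm_of_nonneg (by positivity),
        Real.rpow_neg ht0.le, ← Real.sqrt_eq_rpow, ← mul_inv, ← Real.sqrt_mul (by positivity)]
      gcongr
  have h1 : IntervalIntegrable (fun t => (√(chord t))⁻¹) volume (-π) 0 := by
    have := h0.symm.comp_sub_left 0
    simpa [zero_sub, chord_neg] using this
  have hper : Function.Periodic (fun t => (√(chord t))⁻¹) (2 * π) := fun t => by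
    simp only [chord_periodic t]
  refine hper.intervalIntegrable (by positivity) (t := -π) ?_ a b
  rw [show -π + 2 * π = π by ring]
  exact h1.trans h0

/-- The integral of the inverse square root of the chord length over the circle. -/
def chordConst : ℝ := ∫ t in (-π)..π, (√(chord t))⁻¹

theorem integrableOn_inv_sqrt_chord (φ : ℝ) :
    IntegrableOn (fun t => (√(chord (t - φ)))⁻¹) (Set.Ioc (-π) π) := by
  have := (intervalIntegrable_inv_sqrt_chord (-π - φ) (π - φ)).comp_sub_right φ
  simp only [sub_add_cancel] at this
  exact (intervalIntegrable_iff_integrableOn_Ioc_of_le (by linarith [Real.pi_pos])).1 this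

theorem integral_inv_sqrt_chord (φ : ℝ) :
    ∫ t in Set.Ioc (-π) π, (√(chord (t - φ)))⁻¹ = chordConst := by
  have hper : Function.Periodic (fun t => (√(chord t))⁻¹) (2 * π) := fun t => by
    simp only [chord_periodic t]
  rw [← intervalIntegral.integral_of_le (by linarith [Real.pi_pos]),
    intervalIntegral.integral_comp_sub_right (fun t => (√(chord t))⁻¹)]
  have := hper.intervalIntegral_add_eq (-π - φ) (-π)
  rwa [show -π - φ + 2 * π = π - φ by ring, show -π + 2 * π = π by ring] at this

theorem chordConst_nonneg : 0 ≤ chordConst :=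
  intervalIntegral.integral_nonneg (by linarith [Real.pi_pos]) fun _ _ => by positivity

/-- The density of the angular distribution of the area of `S`. -/
def angularDensity (S : Set ℂ) (θ : ℝ) : ENNReal :=
  ∫⁻ ρ in Set.Ioi (0 : ℝ), ENNReal.ofReal ρ *
    S.indicator 1 ((ρ : ℂ) * (Real.cos θ + Real.sin θ * Complex.I))

theorem measurable_angularDensity {S : Set ℂ} (hS : MeasurableSet S) :
    Measurable (angularDensity S) := by
  have h : Measurable (fun p : ℝ × ℝ => ENNReal.ofReal p.2 *
      S.indicator (1 : ℂ → ENNReal) ((p.2 : ℂ) * (Real.cos p.1 + Real.sin p.1 * Complex.I))) := by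
    refine (by fun_prop : Measurable fun p : ℝ × ℝ => ENNReal.ofReal p.2).mul ?_
    exact (measurable_one.indicator hS).comp (by fun_prop)
  exact h.lintegral_prod_right'

theorem map_arg_restrict {S : Set ℂ} (hS : MeasurableSet S) :
    (volume.restrict S).map Complex.arg =
      (volume.restrict (Set.Ioc (-π) π)).withDensity (angularDensity S) := by
  have hd := measurable_angularDensity hS
  ext T hT
  rw [Measure.map_apply Complex.measurable_arg hT, withDensity_apply _ hT,
    Measure.restrict_apply (Complex.measurable_arg hT)]
  have hm : MeasurableSet (Complex.arg ⁻¹' T ∩ S) := (Complex.measurable_arg hT).inter hS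
  rw [← lintegral_indicator_one hm, ← Complex.lintegral_comp_polarCoord_symm,
    show polarCoord.target = Set.Ioi (0 : ℝ) ×ˢ Set.Ioo (-π) π from rfl, Measure.volume_eq_prod, ← Measure.prod_restrict,
    ← Measure.restrict_congr_set (Ioo_ae_eq_Ioc (μ := volume) (a := -π) (b := π)),
    lintegral_prod_symm']
  · rw [← lintegral_indicator hT]
    refine setLIntegral_congr_fun measurableSet_Ioo fun θ hθ => ?_
    by_cases hθT : θ ∈ T
    · rw [Set.indicator_of_mem hθT]
      refine setLIntegral_congr_fun measurableSet_Ioi fun ρ hρ => ?_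
      simp only [Complex.polarCoord_symm_apply, smul_eq_mul]
      congr 1
      have ha := Complex.arg_mul_cos_add_sin_mul_I (r := ρ) (θ := θ) hρ ⟨hθ.1, hθ.2.le⟩
      by_cases hs : (ρ : ℂ) * (Real.cos θ + Real.sin θ * Complex.I) ∈ S
      · have hs' : (ρ : ℂ) * (Real.cos θ + Real.sin θ * Complex.I) ∈ Complex.arg ⁻¹' T ∩ S := by
          refine ⟨?_, hs⟩
          rw [Set.mem_preimage]
          push_cast
          rwa [ha]
        rw [Set.indicator_of_mem hs, Set.indicator_of_mem hs']
      · rw [Set.indicator_of_notMem hs, Set.indicator_of_notMem fun h => hs h.2]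
    · rw [Set.indicator_of_notMem hθT, lintegral_eq_zero_iff']
      · refine (ae_restrict_mem measurableSet_Ioi).mono fun ρ hρ => ?_
        have ha := Complex.arg_mul_cos_add_sin_mul_I (r := ρ) (θ := θ) hρ ⟨hθ.1, hθ.2.le⟩
        simp only [Complex.polarCoord_symm_apply, smul_eq_mul]
        rw [Set.indicator_of_notMem, mul_zero]; rfl
        rintro ⟨h, -⟩
        rw [Set.mem_preimage] at h
        push_cast at h
        rw [ha] at h
        exact hθT h
      · refine Measurable.aemeasurable ?_
        simp only [Complex.polarCoord_symm_apply]
        refine (by fun_prop : Measurable fun p : ℝ => ENNReal.ofReal p).smul ?_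
        exact (measurable_one.indicator hm).comp (by fun_prop)
  · simp only [Complex.polarCoord_symm_apply]
    refine (by fun_prop : Measurable fun p : ℝ × ℝ => ENNReal.ofReal p.1).smul ?_
    exact (measurable_one.indicator hm).comp (by fun_prop)

/-- The real valued angular density of the area of `S`. -/
def angularWidth (S : Set ℂ) (θ : ℝ) : ℝ := (angularDensity S θ).toReal

theorem angularDensity_mono {S T : Set ℂ} (h : S ⊆ T) (θ : ℝ) :
    angularDensity S θ ≤ angularDensity T θ := by
  unfold angularDensity
  gcongr with ρ

theorem angularDensity_le {S : Set ℂ} (hb : S ⊆ Metric.closedBall 0 2) (θ : ℝ) :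
    angularDensity S θ ≤ 4 := by
  have h : angularDensity S θ ≤
      ∫⁻ ρ in Set.Ioi (0 : ℝ), (Set.Ioc (0 : ℝ) 2).indicator (fun _ => 2) ρ := by
    refine setLIntegral_mono' measurableSet_Ioi fun ρ hρ => ?_
    by_cases hs : (ρ : ℂ) * (Real.cos θ + Real.sin θ * Complex.I) ∈ S
    · have h1 := hb hs
      have h2 : ‖(Real.cos θ + Real.sin θ * Complex.I : ℂ)‖ = 1 := by
        push_cast; exact Complex.norm_cos_add_sin_mul_I θ
      rw [mem_closedBall_zero_iff, norm_mul, h2, mul_one, Complex.norm_real,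
        Real.norm_of_nonneg (le_of_lt hρ)] at h1
      rw [Set.indicator_of_mem hs, Set.indicator_of_mem (show ρ ∈ Set.Ioc 0 2 from ⟨hρ, h1⟩),
        Pi.one_apply, mul_one]
      exact (ENNReal.ofReal_le_ofReal h1).trans (by simp)
    · rw [Set.indicator_of_notMem hs, mul_zero]; exact bot_le
  refine h.trans ?_
  rw [lintegral_indicator_const measurableSet_Ioc, Measure.restrict_apply measurableSet_Ioc,
    Set.inter_eq_left.2 Set.Ioc_subset_Ioi_self, Real.volume_Ioc]
  norm_num

theorem measurable_angularWidth {S : Set ℂ} (hS : MeasurableSet S) :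
    Measurable (angularWidth S) := (measurable_angularDensity hS).ennreal_toReal

theorem angularWidth_nonneg (S : Set ℂ) (θ : ℝ) : 0 ≤ angularWidth S θ := ENNReal.toReal_nonneg

theorem angularWidth_le {S : Set ℂ} (hb : S ⊆ Metric.closedBall 0 2) (θ : ℝ) :
    angularWidth S θ ≤ 4 :=
  (ENNReal.toReal_mono (by simp) (angularDensity_le hb θ)).trans (by simp)

theorem angularWidth_mono {S T : Set ℂ} (h : S ⊆ T) (hb : T ⊆ Metric.closedBall 0 2) (θ : ℝ) :
    angularWidth S θ ≤ angularWidth T θ :=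
  ENNReal.toReal_mono ((angularDensity_le hb θ).trans_lt (by simp)).ne (angularDensity_mono h θ)

theorem setIntegral_arg {E : Type*} [NormedAddCommGroup E] [NormedSpace ℝ E] {S : Set ℂ}
    (hS : MeasurableSet S) (hb : S ⊆ Metric.closedBall 0 2) {F : ℝ → E}
    (hF : StronglyMeasurable F) :
    ∫ y in S, F (Complex.arg y) = ∫ θ in Set.Ioc (-π) π, angularWidth S θ • F θ := by
  rw [← integral_map Complex.measurable_arg.aemeasurable hF.aestronglyMeasurable,
    map_arg_restrict hS, integral_withDensity_eq_integral_toReal_smul (measurable_angularDensity hS)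
      (ae_of_all _ fun θ => (angularDensity_le hb θ).trans_lt (by simp))]
  rfl

theorem integrableOn_arg {E : Type*} [NormedAddCommGroup E] [NormedSpace ℝ E] {S : Set ℂ}
    (hS : MeasurableSet S) (hb : S ⊆ Metric.closedBall 0 2) {F : ℝ → E}
    (hF : StronglyMeasurable F) (hi : IntegrableOn F (Set.Ioc (-π) π)) :
    IntegrableOn (fun y => F (Complex.arg y)) S := by
  have h : Integrable F ((volume.restrict S).map Complex.arg) := by
    rw [map_arg_restrict hS, integrable_withDensity_iff_integrable_smul'
      (measurable_angularDensity hS)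
      (ae_of_all _ fun θ => (angularDensity_le hb θ).trans_lt (by simp))]
    refine Integrable.mono' (hi.norm.const_mul 4)
      ((measurable_angularWidth hS).stronglyMeasurable.smul hF).aestronglyMeasurable
      (ae_of_all _ fun θ => ?_)
    rw [norm_smul, Real.norm_of_nonneg ENNReal.toReal_nonneg]
    gcongr
    exact angularWidth_le hb θ
  exact (integrable_map_measure hF.aestronglyMeasurable Complex.measurable_arg.aemeasurable).1 h

/-- The integral of the squared angular density. -/
def angularEnergy (S : Set ℂ) : ℝ := ∫ θ in Set.Ioc (-π) π, angularWidth S θ ^ 2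

theorem angularEnergy_nonneg (S : Set ℂ) : 0 ≤ angularEnergy S :=
  integral_nonneg fun _ => sq_nonneg _

theorem integrableOn_of_bounded_Ioc {f : ℝ → ℝ} (hf : Measurable f) {C : ℝ}
    (hC : ∀ θ, |f θ| ≤ C) : IntegrableOn f (Set.Ioc (-π) π) :=
  Integrable.mono' (integrable_const C) hf.aestronglyMeasurable (ae_of_all _ hC)

theorem angularWidth_sq_le {S : Set ℂ} (hb : S ⊆ Metric.closedBall 0 2) (θ : ℝ) :
    |angularWidth S θ ^ 2| ≤ 16 := by
  rw [abs_of_nonneg (sq_nonneg _)]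
  nlinarith [angularWidth_le hb θ, angularWidth_nonneg S θ]

theorem integrableOn_angularWidth_sq {S : Set ℂ} (hS : MeasurableSet S)
    (hb : S ⊆ Metric.closedBall 0 2) :
    IntegrableOn (fun θ => angularWidth S θ ^ 2) (Set.Ioc (-π) π) :=
  integrableOn_of_bounded_Ioc ((measurable_angularWidth hS).pow_const 2) (angularWidth_sq_le hb)

theorem angularEnergy_eq {S : Set ℂ} (hS : MeasurableSet S) (hb : S ⊆ Metric.closedBall 0 2) :
    ∫ y in S, angularWidth S (Complex.arg y) = angularEnergy S := by
  rw [setIntegral_arg hS hb (measurable_angularWidth hS).stronglyMeasurable]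
  simp [angularEnergy, sq]

theorem measurable_inv_sqrt_chord : Measurable fun t => (√(chord t))⁻¹ := by
  unfold chord; fun_prop

/-- Weighted Cauchy--Schwarz for the logarithmic type singularity. -/
theorem setIntegral_arg_quarter_le {S : Set ℂ} (hS : MeasurableSet S)
    (hb : S ⊆ Metric.closedBall 0 2) (φ : ℝ) {s : ℝ} (hs : 0 < s) :
    IntegrableOn (fun w => 1 + (√(√(chord (Complex.arg w - φ))))⁻¹) S ∧
    ∫ w in S, (1 + (√(√(chord (Complex.arg w - φ))))⁻¹) ≤
      s * (2 * π + chordConst) + angularEnergy S / s := by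
  have hm := (measurable_inv_sqrt_chord.comp (measurable_id.sub_const φ))
  have hm4 : Measurable fun t => 1 + (√(√(chord (t - φ))))⁻¹ := by
    unfold chord; fun_prop
  have hsq : ∀ t, (1 + (√(√(chord (t - φ))))⁻¹) ^ 2 ≤ 2 * (1 + (√(chord (t - φ)))⁻¹) := by
    intro t
    have h1 : ((√(√(chord (t - φ))))⁻¹) ^ 2 = (√(chord (t - φ)))⁻¹ := by
      rw [inv_pow, Real.sq_sqrt (Real.sqrt_nonneg _)]
    nlinarith [sq_nonneg ((√(√(chord (t - φ))))⁻¹ - 1)]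
  have hi : IntegrableOn (fun t => 1 + (√(chord (t - φ)))⁻¹) (Set.Ioc (-π) π) :=
    (integrable_const 1).add (integrableOn_inv_sqrt_chord φ)
  have hi4 : IntegrableOn (fun t => 1 + (√(√(chord (t - φ))))⁻¹) (Set.Ioc (-π) π) := by
    refine Integrable.mono' (hi.const_mul 2) hm4.aestronglyMeasurable (ae_of_all _ fun t => ?_)
    rw [Real.norm_of_nonneg (by positivity)]
    have h0 : 0 ≤ (√(√(chord (t - φ))))⁻¹ := by positivity
    nlinarith [hsq t]
  refine ⟨integrableOn_arg hS hb hm4.stronglyMeasurable hi4, ?_⟩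
  rw [setIntegral_arg hS hb hm4.stronglyMeasurable]
  have hw := integrableOn_angularWidth_sq hS hb
  have hle : ∫ θ in Set.Ioc (-π) π, angularWidth S θ • (1 + (√(√(chord (θ - φ))))⁻¹) ≤
      ∫ θ in Set.Ioc (-π) π, (s * (1 + (√(chord (θ - φ)))⁻¹) + s⁻¹ * angularWidth S θ ^ 2) := by
    refine integral_mono_of_nonneg (ae_of_all _ fun θ => ?_)
      ((hi.const_mul s).add (hw.const_mul s⁻¹)) (ae_of_all _ fun θ => ?_)
    · have := angularWidth_nonneg S θ
      simp only [Pi.zero_apply]; positivity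
    · have h1 := hsq θ
      set f := 1 + (√(√(chord (θ - φ))))⁻¹
      set H := angularWidth S θ
      have h2 : H * f ≤ s * f ^ 2 / 2 + s⁻¹ * H ^ 2 := by
        have h3 : s * (H * f) ≤ s * (s * f ^ 2 / 2 + s⁻¹ * H ^ 2) := by
          have : s * (s * f ^ 2 / 2 + s⁻¹ * H ^ 2) = (s * f) ^ 2 / 2 + H ^ 2 := by field_simp
          rw [this]; nlinarith [sq_nonneg (s * f - H), sq_nonneg H]
        exact le_of_mul_le_mul_left h3 hs
      simp only [smul_eq_mul]
      nlinarith
  refine hle.trans (le_of_eq ?_)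
  rw [integral_add (hi.const_mul s) (hw.const_mul s⁻¹), integral_const_mul, integral_const_mul,
    integral_add (integrable_const 1) (integrableOn_inv_sqrt_chord φ), integral_inv_sqrt_chord]
  have h1 : ∫ _ in Set.Ioc (-π) π, (1 : ℝ) = 2 * π := by
    rw [setIntegral_const, Real.volume_real_Ioc_of_le (by linarith [Real.pi_pos])]
    simp only [smul_eq_mul]; ring
  rw [angularEnergy, div_eq_inv_mul, h1]

/-- Schur's test for the chordal singularity. -/
theorem chord_energy_le {S : Set ℂ} (hS : MeasurableSet S) (hb : S ⊆ Metric.closedBall 0 2) :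
    Integrable (fun p : ℂ × ℂ => (√(chord (Complex.arg p.2 - Complex.arg p.1)))⁻¹)
      (pairMeasure S) ∧
    ∫ p, (√(chord (Complex.arg p.2 - Complex.arg p.1)))⁻¹ ∂(pairMeasure S) ≤
      chordConst * angularEnergy S := by
  have hfin : IsFiniteMeasure (volume.restrict S) :=
    ⟨by rw [Measure.restrict_apply_univ]
        exact (measure_mono hb).trans_lt measure_closedBall_lt_top⟩
  have hm1 : ∀ φ, StronglyMeasurable fun t => (√(chord (t - φ)))⁻¹ := fun φ =>
    (by unfold chord; fun_prop : Measurable fun t => (√(chord (t - φ)))⁻¹).stronglyMeasurable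
  have hm2 : Measurable fun p : ℂ × ℂ => (√(chord (Complex.arg p.2 - Complex.arg p.1)))⁻¹ :=
    measurable_inv_sqrt_chord.comp ((Complex.measurable_arg.comp measurable_snd).sub
      (Complex.measurable_arg.comp measurable_fst))
  have hmr : Measurable fun p : ℝ × ℝ => (√(chord (p.2 - p.1)))⁻¹ :=
    measurable_inv_sqrt_chord.comp (measurable_snd.sub measurable_fst)
  set ν := (volume : Measure ℝ).restrict (Set.Ioc (-π) π) with hν
  set H := angularWidth S
  have hH := measurable_angularWidth hS
  have hHi := integrableOn_angularWidth_sq hS hb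
  set G : ℝ → ℝ := fun φ => ∫ θ, H θ * (√(chord (θ - φ)))⁻¹ ∂ν with hG
  have hslice : ∀ y : ℂ, ∫ w in S, (√(chord (Complex.arg w - Complex.arg y)))⁻¹ =
      G (Complex.arg y) := fun y => setIntegral_arg hS hb (hm1 _)
  have hkint : Integrable (fun p : ℝ × ℝ => (√(chord (p.2 - p.1)))⁻¹) (ν.prod ν) := by
    rw [integrable_prod_iff hmr.aestronglyMeasurable]
    refine ⟨ae_of_all _ fun x => integrableOn_inv_sqrt_chord x, ?_⟩
    have : (fun x => ∫ y, ‖(√(chord ((x, y).2 - (x, y).1)))⁻¹‖ ∂ν) = fun _ => chordConst := by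
      funext x
      rw [← integral_inv_sqrt_chord x]
      exact integral_congr_ae (ae_of_all _ fun y => Real.norm_of_nonneg (by positivity))
    rw [this]; exact integrable_const _
  have hint1 : Integrable (fun p : ℝ × ℝ => H p.1 ^ 2 * (√(chord (p.2 - p.1)))⁻¹) (ν.prod ν) := by
    refine hkint.bdd_mul (c := 16) ((hH.comp measurable_fst).pow_const 2).aestronglyMeasurable
      (ae_of_all _ fun p => ?_)
    exact angularWidth_sq_le hb p.1
  have hint2 : Integrable (fun p : ℝ × ℝ => H p.2 ^ 2 * (√(chord (p.2 - p.1)))⁻¹) (ν.prod ν) := by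
    refine hkint.bdd_mul (c := 16) ((hH.comp measurable_snd).pow_const 2).aestronglyMeasurable
      (ae_of_all _ fun p => ?_)
    exact angularWidth_sq_le hb p.2
  have hv1 : ∫ p, H p.1 ^ 2 * (√(chord (p.2 - p.1)))⁻¹ ∂(ν.prod ν) =
      chordConst * angularEnergy S := by
    rw [integral_prod _ hint1]
    simp only [integral_const_mul]
    rw [angularEnergy, ← integral_const_mul]
    refine integral_congr_ae (ae_of_all _ fun x => ?_)
    simp only
    rw [integral_inv_sqrt_chord x, mul_comm]
  have hv2 : ∫ p, H p.2 ^ 2 * (√(chord (p.2 - p.1)))⁻¹ ∂(ν.prod ν) =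
      chordConst * angularEnergy S := by
    rw [← integral_prod_swap, ← hv1]
    refine integral_congr_ae (ae_of_all _ fun p => ?_)
    simp only [Prod.fst_swap, Prod.snd_swap]
    rw [← chord_neg, neg_sub]
  have hint : Integrable (fun p : ℝ × ℝ => H p.1 * (H p.2 * (√(chord (p.2 - p.1)))⁻¹))
      (ν.prod ν) := by
    refine Integrable.mono' (hint1.add hint2)
      ((hH.comp measurable_fst).mul ((hH.comp measurable_snd).mul hmr)).aestronglyMeasurable
      (ae_of_all _ fun p => ?_)
    have h1 := angularWidth_nonneg S p.1
    have h2 := angularWidth_nonneg S p.2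
    rw [Real.norm_of_nonneg (by positivity), ← mul_assoc, Pi.add_apply, ← add_mul]
    gcongr
    nlinarith
  have hle : ∫ p, H p.1 * (H p.2 * (√(chord (p.2 - p.1)))⁻¹) ∂(ν.prod ν) ≤
      chordConst * angularEnergy S := by
    have : ∫ p, H p.1 * (H p.2 * (√(chord (p.2 - p.1)))⁻¹) ∂(ν.prod ν) ≤
        ∫ p, (1 / 2 * (H p.1 ^ 2 * (√(chord (p.2 - p.1)))⁻¹) +
          1 / 2 * (H p.2 ^ 2 * (√(chord (p.2 - p.1)))⁻¹)) ∂(ν.prod ν) := by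
      refine integral_mono hint ((hint1.const_mul _).add (hint2.const_mul _)) fun p => ?_
      simp only
      rw [← mul_assoc, ← mul_assoc, ← mul_assoc, ← add_mul]
      gcongr
      nlinarith [sq_nonneg (H p.1 - H p.2)]
    refine this.trans (le_of_eq ?_)
    rw [integral_add (hint1.const_mul _) (hint2.const_mul _), integral_const_mul,
      integral_const_mul, hv1, hv2]; ring
  have hGm : StronglyMeasurable G := by
    refine StronglyMeasurable.integral_prod_right (f := fun φ θ => H θ * (√(chord (θ - φ)))⁻¹) ?_
    exact ((hH.comp measurable_snd).mul hmr).stronglyMeasurable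
  have hGi : Integrable (fun x => H x * G x) ν := by
    refine hint.integral_prod_left.congr (ae_of_all _ fun x => ?_)
    simp only [hG, integral_const_mul]
  have hGint : Integrable G ν := by
    have h4 : Integrable (fun p : ℝ × ℝ => H p.2 * (√(chord (p.2 - p.1)))⁻¹) (ν.prod ν) := by
      refine hkint.bdd_mul (c := 4) (hH.comp measurable_snd).aestronglyMeasurable
        (ae_of_all _ fun p => ?_)
      rw [Real.norm_of_nonneg (angularWidth_nonneg _ _)]; exact angularWidth_le hb _
    exact h4.integral_prod_left
  have hI : Integrable (fun p : ℂ × ℂ => (√(chord (Complex.arg p.2 - Complex.arg p.1)))⁻¹)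
      (pairMeasure S) := by
    unfold pairMeasure
    rw [integrable_prod_iff hm2.aestronglyMeasurable]
    have h5 : ∀ y : ℂ, Integrable (fun w => (√(chord (Complex.arg w - Complex.arg y)))⁻¹)
        (volume.restrict S) := fun y =>
      integrableOn_arg (F := fun t => (√(chord (t - Complex.arg y)))⁻¹) hS hb (hm1 _)
        (integrableOn_inv_sqrt_chord _)
    refine ⟨ae_of_all _ h5, ?_⟩
    refine (integrableOn_arg hS hb hGm hGint).congr (ae_of_all _ fun y => ?_)
    simp only
    rw [← hslice y]
    refine integral_congr_ae (ae_of_all _ fun w => ?_)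
    have h0 : 0 ≤ (√(chord (Complex.arg w - Complex.arg y)))⁻¹ := by positivity
    exact (Real.norm_of_nonneg h0).symm
  refine ⟨hI, ?_⟩
  unfold pairMeasure at hI ⊢
  rw [integral_prod _ hI]
  simp only [hslice]
  rw [setIntegral_arg hS hb hGm]
  refine le_trans (le_of_eq ?_) hle
  rw [integral_prod _ hint]
  refine integral_congr_ae (ae_of_all _ fun x => ?_)
  simp only [hG, integral_const_mul, smul_eq_mul]
  rfl

/-- The difference of the indicator functions of two sets. -/
def signedInd (S₁ S₂ : Set ℂ) (y : ℂ) : ℝ := S₁.indicator 1 y - S₂.indicator 1 y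

theorem abs_signedInd_le (S₁ S₂ : Set ℂ) (y : ℂ) : |signedInd S₁ S₂ y| ≤ 1 := by
  unfold signedInd
  by_cases h1 : y ∈ S₁ <;> by_cases h2 : y ∈ S₂ <;> simp [h1, h2]

theorem measurable_signedInd {S₁ S₂ : Set ℂ} (h1 : MeasurableSet S₁) (h2 : MeasurableSet S₂) :
    Measurable (signedInd S₁ S₂) :=
  (measurable_one.indicator h1).sub (measurable_one.indicator h2)

theorem integral_signedInd_smul {E : Type*} [NormedAddCommGroup E] [NormedSpace ℝ E]
    {S₁ S₂ : Set ℂ} (h1 : MeasurableSet S₁) (h2 : MeasurableSet S₂) {f : ℂ → E}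
    (hf : IntegrableOn f (S₁ ∪ S₂)) :
    ∫ y in S₁ ∪ S₂, signedInd S₁ S₂ y • f y = (∫ y in S₁, f y) - ∫ y in S₂, f y := by
  have e1 : ∀ y, signedInd S₁ S₂ y • f y = S₁.indicator f y - S₂.indicator f y := by
    intro y
    unfold signedInd
    by_cases h1 : y ∈ S₁ <;> by_cases h2 : y ∈ S₂ <;> simp [h1, h2]
  simp only [e1]
  rw [integral_sub (Integrable.indicator hf h1) (Integrable.indicator hf h2),
    setIntegral_indicator h1, setIntegral_indicator h2,
    Set.inter_eq_right.2 Set.subset_union_left, Set.inter_eq_right.2 Set.subset_union_right]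

/-- Bessel's inequality in the form of the sum over the positive frequencies. -/
theorem bessel_pos {h : ℝ → ℝ} (hm : Measurable h) {C : ℝ} (hC : ∀ θ, |h θ| ≤ C) :
    ∃ T, HasSum (fun n : ℕ => ‖∫ θ in Set.Ioc (-π) π,
      (h θ : ℂ) * Complex.exp (((n + 1 : ℕ) * θ : ℝ) * Complex.I)‖ ^ 2) T ∧
      T ≤ π * ∫ θ in Set.Ioc (-π) π, h θ ^ 2 := by
  have hpi := Real.pi_pos
  have hab : -π < π := by linarith
  set c : ℤ → ℂ := fun n => ∫ θ in Set.Ioc (-π) π, (h θ : ℂ) *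
    Complex.exp ((n * θ : ℝ) * Complex.I) with hc
  have hL2 : MemLp (fun θ => (h θ : ℂ)) 2 (volume.restrict (Set.Ioc (-π) π)) :=
    MemLp.of_bound (Complex.measurable_ofReal.comp hm).aestronglyMeasurable C
      (ae_of_all _ fun θ => by simpa using hC θ)
  have hs := hasSum_sq_fourierCoeffOn hab hL2
  have hco : ∀ n : ℤ, fourierCoeffOn hab (fun θ => (h θ : ℂ)) n = (1 / (2 * π)) • c (-n) := by
    intro n
    rw [fourierCoeffOn_eq_integral, intervalIntegral.integral_of_le hab.le,
      show π - -π = 2 * π by ring]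
    congr 1
    refine integral_congr_ae (ae_of_all _ fun θ => ?_)
    simp only [smul_eq_mul]
    rw [fourier_coe_apply, mul_comm]
    congr 2
    push_cast
    field_simp
  have hnorm : ∀ n, ‖c (-n)‖ = ‖c n‖ := by
    intro n
    rw [← Complex.norm_conj (c n)]
    congr 1
    simp only [hc]
    rw [← integral_conj]
    refine integral_congr_ae (ae_of_all _ fun θ => ?_)
    simp only [map_mul, Complex.conj_ofReal, ← Complex.exp_conj, Complex.conj_I]
    congr 2
    push_cast; ring
  have hs2 : HasSum (fun n : ℤ => ‖c n‖ ^ 2) (2 * π * ∫ θ in Set.Ioc (-π) π, h θ ^ 2) := by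
    have h1 := hs.mul_left ((2 * π) ^ 2)
    have e1 : (fun n : ℤ => (2 * π) ^ 2 * ‖fourierCoeffOn hab (fun θ => (h θ : ℂ)) n‖ ^ 2) =
        fun n : ℤ => ‖c n‖ ^ 2 := by
      funext n
      rw [hco, norm_smul, hnorm, Real.norm_of_nonneg (by positivity)]
      field_simp
    rw [e1] at h1
    have e3 : (2 * π) ^ 2 * (π - -π)⁻¹ • ∫ θ in (-π)..π, ‖(h θ : ℂ)‖ ^ 2 =
        2 * π * ∫ θ in Set.Ioc (-π) π, h θ ^ 2 := by
      rw [intervalIntegral.integral_of_le hab.le, show π - -π = 2 * π by ring]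
      simp only [Complex.norm_real, Real.norm_eq_abs, sq_abs, smul_eq_mul]
      field_simp
    rwa [e3] at h1
  have h3 := hs2.nat_add_neg_add_one
  have hsum : Summable fun n : ℕ => ‖c ((n + 1 : ℕ) : ℤ)‖ ^ 2 :=
    hs2.summable.comp_injective (i := fun n : ℕ => ((n + 1 : ℕ) : ℤ))
      fun a b hab => by simpa using hab
  have hsum0 : Summable fun n : ℕ => ‖c (n : ℤ)‖ ^ 2 :=
    hs2.summable.comp_injective (i := fun n : ℕ => (n : ℤ)) fun a b hab => by simpa using hab
  refine ⟨∑' n : ℕ, ‖c ((n + 1 : ℕ) : ℤ)‖ ^ 2, ?_, ?_⟩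
  · have := hsum.hasSum
    simpa only [hc, Int.cast_natCast] using this
  · have e2 : (fun n : ℕ => ‖c n‖ ^ 2 + ‖c (-((n : ℤ) + 1))‖ ^ 2) =
        fun n : ℕ => ‖c n‖ ^ 2 + ‖c ((n + 1 : ℕ) : ℤ)‖ ^ 2 := by
      funext n; rw [hnorm]; push_cast; rfl
    rw [e2] at h3
    have h4 := (hsum0.hasSum.add hsum.hasSum).unique h3
    rw [hsum0.tsum_eq_zero_add] at h4
    have := sq_nonneg ‖c ((0 : ℕ) : ℤ)‖
    linarith

theorem angularCoeff_eq {S₁ S₂ : Set ℂ} (h1 : MeasurableSet S₁) (h2 : MeasurableSet S₂)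
    (hb : S₁ ∪ S₂ ⊆ Metric.closedBall 0 2) (n : ℕ) :
    ∫ y in S₁ ∪ S₂, (signedInd S₁ S₂ y : ℂ) * Complex.exp ((n * Complex.arg y : ℝ) * Complex.I) =
    ∫ θ in Set.Ioc (-π) π, ((angularWidth S₁ θ - angularWidth S₂ θ : ℝ) : ℂ) *
      Complex.exp ((n * θ : ℝ) * Complex.I) := by
  have hF : Measurable fun θ : ℝ => Complex.exp ((n * θ : ℝ) * Complex.I) := by fun_prop
  have hFi : IntegrableOn (fun θ : ℝ => Complex.exp ((n * θ : ℝ) * Complex.I)) (Set.Ioc (-π) π) :=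
    Integrable.mono' (integrable_const 1) hF.aestronglyMeasurable
      (ae_of_all _ fun θ => (Complex.norm_exp_ofReal_mul_I _).le)
  have hb1 := Set.subset_union_left.trans hb
  have hb2 := Set.subset_union_right.trans hb
  have e1 := integral_signedInd_smul h1 h2 (integrableOn_arg (h1.union h2) hb
    hF.stronglyMeasurable hFi)
  simp only [Complex.real_smul] at e1
  rw [e1, setIntegral_arg h1 hb1 hF.stronglyMeasurable, setIntegral_arg h2 hb2
    hF.stronglyMeasurable]
  have i1 : ∀ {S : Set ℂ}, MeasurableSet S → S ⊆ Metric.closedBall 0 2 →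
      IntegrableOn (fun θ : ℝ => angularWidth S θ • Complex.exp ((n * θ : ℝ) * Complex.I))
        (Set.Ioc (-π) π) := fun hS hb => by
    refine Integrable.mono' (integrable_const 4)
      ((measurable_angularWidth hS).smul hF).aestronglyMeasurable (ae_of_all _ fun θ => ?_)
    rw [norm_smul, Complex.norm_exp_ofReal_mul_I, mul_one,
      Real.norm_of_nonneg (angularWidth_nonneg _ _)]
    exact angularWidth_le hb θ
  rw [← integral_sub (i1 h1 hb1) (i1 h2 hb2)]
  refine integral_congr_ae (ae_of_all _ fun θ => ?_)
  simp only [Complex.real_smul]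
  push_cast; ring

/-- The logarithmic interaction on a circle pair, in terms of angular frequencies. -/
theorem circle_energy_le {S₁ S₂ : Set ℂ} (h1 : MeasurableSet S₁) (h2 : MeasurableSet S₂)
    (hb : S₁ ∪ S₂ ⊆ Metric.closedBall 0 2) {q : ℝ} (hq0 : 0 ≤ q) (hq1 : q < 1) :
    ∫ p, signedInd S₁ S₂ p.1 * signedInd S₁ S₂ p.2 *
      (-log ‖1 - q * Complex.exp ((Complex.arg p.2 - Complex.arg p.1 : ℝ) * Complex.I)‖)
      ∂(pairMeasure (S₁ ∪ S₂)) ≤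
    π / 2 * angularEnergy (S₁ ∪ S₂) + 1 / 2 * ‖∫ y in S₁ ∪ S₂, (signedInd S₁ S₂ y : ℂ) *
      Complex.exp (Complex.arg y * Complex.I)‖ ^ 2 := by
  set S := S₁ ∪ S₂ with hS
  set ζ := signedInd S₁ S₂
  have hSm : MeasurableSet S := h1.union h2
  have hζ : Measurable ζ := measurable_signedInd h1 h2
  have hfin : IsFiniteMeasure (volume.restrict S) :=
    ⟨by rw [Measure.restrict_apply_univ]
        exact (measure_mono hb).trans_lt measure_closedBall_lt_top⟩
  set c : ℕ → ℂ := fun n => ∫ y in S, (ζ y : ℂ) *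
    Complex.exp ((n * Complex.arg y : ℝ) * Complex.I) with hc
  set u : ℕ → ℂ → ℂ := fun n y => (ζ y : ℂ) * Complex.exp ((n * Complex.arg y : ℝ) * Complex.I)
  have hum : ∀ n, Measurable (u n) := fun n =>
    (Complex.measurable_ofReal.comp hζ).mul (by
      have := Complex.measurable_arg
      fun_prop)
  have hun : ∀ n y, ‖u n y‖ ≤ 1 := fun n y => by
    simp only [u, norm_mul, Complex.norm_exp_ofReal_mul_I, mul_one, Complex.norm_real]
    exact abs_signedInd_le _ _ _
  set K : ℕ → ℂ × ℂ → ℂ := fun n p => ((q ^ n / n : ℝ) : ℂ) *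
    ((starRingEnd ℂ) (u n p.1) * u n p.2) with hK
  have hKm : ∀ n, Measurable (K n) := fun n =>
    ((Complex.continuous_conj.measurable.comp ((hum n).comp measurable_fst)).mul
      ((hum n).comp measurable_snd)).const_mul _
  have hqn : ∀ n : ℕ, 0 ≤ q ^ n / n := fun n => by positivity
  have hqn' : ∀ n : ℕ, q ^ n / n ≤ q ^ n := fun n => by
    rcases Nat.eq_zero_or_pos n with rfl | hn
    · simp
    · exact div_le_self (by positivity) (by exact_mod_cast hn)
  have hKn : ∀ n p, ‖K n p‖ ≤ q ^ n := fun n p => by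
    simp only [K, norm_mul, Complex.norm_real, Complex.norm_conj, Real.norm_of_nonneg (hqn n)]
    have := mul_le_one₀ (hun n p.1) (norm_nonneg _) (hun n p.2)
    nlinarith [hqn n, hqn' n]
  have hKi : ∀ n, Integrable (K n) (pairMeasure S) := fun n =>
    Integrable.mono' (integrable_const (q ^ n)) (hKm n).aestronglyMeasurable
      (ae_of_all _ (hKn n))
  have hKint : ∀ n, ∫ p, (K n p).re ∂(pairMeasure S) = q ^ n / n * ‖c n‖ ^ 2 := by
    intro n
    have e1 : ∫ p, K n p ∂(pairMeasure S) = ((q ^ n / n : ℝ) : ℂ) *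
        ((starRingEnd ℂ) (c n) * c n) := by
      simp only [hK]
      rw [integral_const_mul]
      congr 1
      rw [integral_prod_mul (fun y => (starRingEnd ℂ) (u n y)) (u n), integral_conj]
    have e2 : ∫ p, (K n p).re ∂(pairMeasure S) = (∫ p, K n p ∂(pairMeasure S)).re :=
      Complex.reCLM.integral_comp_comm (hKi n)
    rw [e2, e1, ← Complex.normSq_eq_conj_mul_self, Complex.normSq_eq_norm_sq, ← Complex.ofReal_mul,
      Complex.ofReal_re]
  have hsum := hasSum_integral_of_summable_integral_norm (μ := pairMeasure S)
    (F := fun n p => (K n p).re) (fun n => (hKi n).re) (by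
      refine Summable.of_nonneg_of_le (fun n => integral_nonneg fun _ => norm_nonneg _)
        (fun n => ?_) ((summable_geometric_of_lt_one hq0 hq1).mul_right
          ((pairMeasure S).real Set.univ))
      calc ∫ p, ‖(K n p).re‖ ∂(pairMeasure S) ≤ ∫ _, q ^ n ∂(pairMeasure S) := by
            refine integral_mono (hKi n).re.norm (integrable_const _) fun p => ?_
            exact (Complex.abs_re_le_norm _).trans (hKn n p)
        _ = _ := by rw [integral_const, smul_eq_mul, mul_comm])
  have hpt : ∀ p : ℂ × ℂ, ∑' n, (K n p).re = ζ p.1 * ζ p.2 *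
      (-log ‖1 - q * Complex.exp ((Complex.arg p.2 - Complex.arg p.1 : ℝ) * Complex.I)‖) := by
    intro p
    set z : ℂ := q * Complex.exp ((Complex.arg p.2 - Complex.arg p.1 : ℝ) * Complex.I)
    have hz : ‖z‖ < 1 := by
      simp only [z, norm_mul, Complex.norm_exp_ofReal_mul_I, mul_one, Complex.norm_real]
      rwa [Real.norm_of_nonneg hq0]
    have h3 := (Complex.hasSum_taylorSeries_neg_log hz).mul_left ((ζ p.1 * ζ p.2 : ℝ) : ℂ)
    have h4 : ∀ n : ℕ, ((ζ p.1 * ζ p.2 : ℝ) : ℂ) * (z ^ n / n) = K n p := by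
      intro n
      simp only [K, u, z, mul_pow, ← Complex.exp_nat_mul, map_mul, Complex.conj_ofReal,
        ← Complex.exp_conj, Complex.conj_I]
      have : Complex.exp (n * ((Complex.arg p.2 - Complex.arg p.1 : ℝ) * Complex.I)) =
          Complex.exp ((n * Complex.arg p.1 : ℝ) * -Complex.I) *
          Complex.exp ((n * Complex.arg p.2 : ℝ) * Complex.I) := by
        rw [← Complex.exp_add]; congr 1; push_cast; ring
      rw [this]; push_cast; ring
    simp only [h4] at h3
    have h5 := (Complex.hasSum_re h3).tsum_eq
    rw [h5, Complex.re_ofReal_mul, Complex.neg_re, Complex.log_re]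
  simp only [hKint, hpt] at hsum
  set h : ℝ → ℝ := fun θ => angularWidth S₁ θ - angularWidth S₂ θ
  have hb1 : S₁ ⊆ S := Set.subset_union_left
  have hb2 : S₂ ⊆ S := Set.subset_union_right
  have hhS : ∀ θ, |h θ| ≤ angularWidth S θ := fun θ => by
    have a1 := angularWidth_mono hb1 hb θ
    have a2 := angularWidth_mono hb2 hb θ
    have a3 := angularWidth_nonneg S₁ θ
    have a4 := angularWidth_nonneg S₂ θ
    exact abs_le.2 ⟨by simp only [h]; linarith, by simp only [h]; linarith⟩
  have hhm : Measurable h := (measurable_angularWidth h1).sub (measurable_angularWidth h2)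
  obtain ⟨T, hT, hTle⟩ := bessel_pos hhm fun θ => (hhS θ).trans (angularWidth_le hb θ)
  have hcT : HasSum (fun n : ℕ => ‖c (n + 1)‖ ^ 2) T := by
    convert hT using 4 with n
    exact angularCoeff_eq h1 h2 hb (n + 1)
  have hQ : T ≤ π * angularEnergy S := by
    refine hTle.trans (mul_le_mul_of_nonneg_left ?_ Real.pi_pos.le)
    refine integral_mono_of_nonneg (ae_of_all _ fun θ => sq_nonneg _)
      (integrableOn_angularWidth_sq hSm hb) (ae_of_all _ fun θ => ?_)
    exact sq_le_sq' (by linarith [abs_le.1 (hhS θ), angularWidth_nonneg S θ])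
      (by linarith [abs_le.1 (hhS θ)])
  have hshift := (hasSum_nat_add_iff' 1).2 hsum
  simp only [Finset.range_one, Finset.sum_singleton, Nat.cast_zero, div_zero, zero_mul,
    sub_zero] at hshift
  have h1T : HasSum (fun n : ℕ => 1 / 2 * ‖c (n + 1)‖ ^ 2 +
      if n = 0 then 1 / 2 * ‖c 1‖ ^ 2 else 0) (1 / 2 * T + 1 / 2 * ‖c 1‖ ^ 2) :=
    (hcT.mul_left _).add (by simpa using hasSum_ite_eq (0 : ℕ) (1 / 2 * ‖c 1‖ ^ 2))
  have hfinal := hasSum_le (fun n => ?_) hshift h1T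
  · have hc1 : c 1 = ∫ y in S, (ζ y : ℂ) * Complex.exp (Complex.arg y * Complex.I) := by
      simp [hc]
    rw [hc1] at hfinal
    refine hfinal.trans ?_
    linarith
  · rcases Nat.eq_zero_or_pos n with rfl | hn
    · simp only [zero_add, pow_one, Nat.cast_one, div_one, if_true]
      nlinarith [sq_nonneg ‖c 1‖]
    · rw [if_neg hn.ne', add_zero]
      refine mul_le_mul_of_nonneg_right ?_ (sq_nonneg _)
      have h6 : q ^ (n + 1) ≤ 1 := pow_le_one₀ hq0 hq1.le
      have h7 : (2 : ℝ) ≤ ((n + 1 : ℕ) : ℝ) := by exact_mod_cast Nat.succ_le_succ hn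
      rw [div_le_iff₀ (by positivity)]
      linarith

theorem norm_smul_sub_smul_sq {e f : ℂ} (he : ‖e‖ = 1) (hf : ‖f‖ = 1) (r s : ℝ) :
    ‖(r : ℂ) * e - s * f‖ ^ 2 = (r - s) ^ 2 + r * s * ‖e - f‖ ^ 2 := by
  rw [← Complex.real_smul, ← Complex.real_smul, norm_sub_sq_real, norm_sub_sq_real e f,
    norm_smul, norm_smul, he, hf, real_inner_smul_left, real_inner_smul_right, Real.norm_eq_abs,
    Real.norm_eq_abs, mul_one, mul_one, sq_abs, sq_abs]
  ring

theorem norm_sub_sq_polar (y w : ℂ) :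
    ‖y - w‖ ^ 2 = (‖y‖ - ‖w‖) ^ 2 + ‖y‖ * ‖w‖ * chord (Complex.arg w - Complex.arg y) ^ 2 := by
  have h := norm_smul_sub_smul_sq (Complex.norm_exp_ofReal_mul_I (Complex.arg y))
    (Complex.norm_exp_ofReal_mul_I (Complex.arg w)) ‖y‖ ‖w‖
  rw [Complex.norm_mul_exp_arg_mul_I, Complex.norm_mul_exp_arg_mul_I, norm_exp_sub_exp] at h
  rw [h, ← chord_neg (Complex.arg w - _), neg_sub]

theorem norm_one_sub_mul_exp_sq (q γ : ℝ) :
    ‖1 - q * Complex.exp (γ * Complex.I)‖ ^ 2 = (1 - q) ^ 2 + q * chord γ ^ 2 := by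
  have h := norm_smul_sub_smul_sq (e := 1) (by simp)
    (Complex.norm_exp_ofReal_mul_I γ) 1 q
  have h2 := norm_exp_sub_exp 0 γ
  simp only [Complex.ofReal_zero, zero_mul, Complex.exp_zero, zero_sub, chord_neg] at h2
  simpa [h2] using h

theorem log_one_add_le_two_sqrt {x : ℝ} (hx : 0 ≤ x) : log (1 + x) ≤ 2 * √x := by
  have h1 : 1 + x ≤ (1 + √x) ^ 2 := by
    nlinarith [Real.sq_sqrt hx, Real.sqrt_nonneg x]
  calc log (1 + x) ≤ log ((1 + √x) ^ 2) := Real.log_le_log (by linarith) h1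
    _ = 2 * log (1 + √x) := by rw [Real.log_pow]; norm_num
    _ ≤ 2 * √x := by
      have := Real.log_le_sub_one_of_pos (show 0 < 1 + √x by positivity)
      linarith

theorem abs_log_sub_log_circle_le {τ : ℝ} (hτ : 0 < τ) (hτ' : τ ≤ 1 / 2) {y w : ℂ}
    (hy : 1 - τ ≤ ‖y‖ ∧ ‖y‖ ≤ 1 + τ) (hw : 1 - τ ≤ ‖w‖ ∧ ‖w‖ ≤ 1 + τ)
    (hv : 0 < chord (Complex.arg w - Complex.arg y)) :
    |log ‖y - w‖ - log ‖1 - ((1 - τ : ℝ) : ℂ) *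
        Complex.exp ((Complex.arg w - Complex.arg y : ℝ) * Complex.I)‖| ≤
      4 * τ + 2 * √(2 * τ) * (√(chord (Complex.arg w - Complex.arg y)))⁻¹ := by
  have hP := norm_sub_sq_polar y w
  have hQ := norm_one_sub_mul_exp_sq (1 - τ) (Complex.arg w - Complex.arg y)
  set v := chord (Complex.arg w - Complex.arg y)
  set P := ‖y - w‖
  set Q := ‖1 - ((1 - τ : ℝ) : ℂ) * Complex.exp ((Complex.arg w - Complex.arg y : ℝ) * Complex.I)‖
  have hP0 : 0 ≤ P := norm_nonneg _
  have hQ0 : 0 ≤ Q := norm_nonneg _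
  have hlo : 0 < (1 - τ) * v := by have : 0 < 1 - τ := by linarith
                                   positivity
  have hyw1 : (1 - τ) ^ 2 ≤ ‖y‖ * ‖w‖ := by nlinarith [hy.1, hw.1]
  have hyw2 : ‖y‖ * ‖w‖ ≤ (1 + τ) ^ 2 := by nlinarith [hy.2, hw.2, norm_nonneg y, norm_nonneg w]
  have hd : (‖y‖ - ‖w‖) ^ 2 ≤ (2 * τ) ^ 2 := sq_le_sq' (by linarith) (by linarith)
  have hv2 : 0 < v ^ 2 := by positivity
  have p1 : (1 - τ) * v ≤ P := by
    refine le_of_sq_le_sq ?_ hP0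
    rw [hP]; nlinarith [sq_nonneg (‖y‖ - ‖w‖)]
  have q1 : (1 - τ) * v ≤ Q := by
    refine le_of_sq_le_sq ?_ hQ0
    rw [hQ]; nlinarith [sq_nonneg τ, mul_pos hτ hv2]
  have p2 : P ≤ (1 + τ) * (v + 2 * τ) := by
    refine le_of_sq_le_sq ?_ (by positivity)
    rw [hP]
    have : ‖y‖ * ‖w‖ * v ^ 2 ≤ (1 + τ) ^ 2 * v ^ 2 := by gcongr
    nlinarith [mul_pos hτ hv, mul_pos hτ hτ, mul_pos (mul_pos hτ hτ) hτ,
      mul_pos (mul_pos hτ hτ) hv, mul_pos (mul_pos hτ hτ) (mul_pos hτ hτ),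
      mul_pos (mul_pos hτ hτ) (mul_pos hτ hv)]
  have q2 : Q ≤ (1 + τ) * (v + 2 * τ) := by
    refine le_of_sq_le_sq ?_ (by positivity)
    rw [hQ]
    nlinarith [mul_pos hτ hv, mul_pos hτ hτ, mul_pos (mul_pos hτ hτ) hτ, mul_pos hτ hv2,
      mul_pos (mul_pos hτ hτ) hv, mul_pos (mul_pos hτ hτ) (mul_pos hτ hτ),
      mul_pos (mul_pos hτ hτ) (mul_pos hτ hv), mul_pos (mul_pos hτ hτ) hv2]
  have hl1 := Real.log_le_log hlo p1
  have hl2 := Real.log_le_log hlo q1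
  have hl3 := Real.log_le_log (hlo.trans_le p1) p2
  have hl4 := Real.log_le_log (hlo.trans_le q1) q2
  have hdiff : log ((1 + τ) * (v + 2 * τ)) - log ((1 - τ) * v) ≤
      4 * τ + 2 * √(2 * τ) * (√v)⁻¹ := by
    have e1 : v + 2 * τ = v * (1 + 2 * τ / v) := by field_simp
    have e2 : 1 + τ = (1 - τ) * (1 + 2 * τ / (1 - τ)) := by
      have : (1 - τ) ≠ 0 := by linarith
      field_simp; ring
    have hτ1 : 0 < 1 - τ := by linarith
    have hx : 0 < 1 + 2 * τ / (1 - τ) := by positivity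
    have hx' : 0 < 1 + 2 * τ / v := by positivity
    rw [Real.log_mul (by positivity) (by positivity), Real.log_mul hτ1.ne' hv.ne', e1,
      Real.log_mul hv.ne' hx'.ne', e2, Real.log_mul hτ1.ne' hx.ne']
    have h1 := Real.log_le_sub_one_of_pos hx
    have h2 : 2 * τ / (1 - τ) ≤ 4 * τ := by rw [div_le_iff₀ hτ1]; nlinarith
    have h3 := log_one_add_le_two_sqrt (show 0 ≤ 2 * τ / v by positivity)
    rw [Real.sqrt_div (by positivity)] at h3
    have h4 : √(2 * τ) / √v = √(2 * τ) * (√v)⁻¹ := div_eq_mul_inv _ _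
    rw [h4] at h3
    linarith
  rw [abs_le]; constructor <;> linarith

theorem ae_chord_pos_right {S : Set ℂ} (hS : MeasurableSet S) (y : ℂ) :
    ∀ᵐ w ∂volume.restrict S, 0 < chord (Complex.arg w - Complex.arg y) := by
  have h1 : ∀ᵐ w ∂volume.restrict S, Complex.arg w ≠ Complex.arg y := by
    have : (volume.restrict S).map Complex.arg {Complex.arg y} = 0 := by
      rw [map_arg_restrict hS, withDensity_apply _ (measurableSet_singleton _)]
      refine setLIntegral_measure_zero _ _ ?_
      exact le_antisymm ((Measure.restrict_apply_le _ _).trans (by simp)) (by positivity)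
    rw [Measure.map_apply Complex.measurable_arg (measurableSet_singleton _)] at this
    rw [ae_iff]
    convert this using 2
    ext w; simp
  filter_upwards [h1] with w hw
  unfold chord
  have h2 : Real.sin ((Complex.arg w - Complex.arg y) / 2) ≠ 0 := by
    intro h0
    have ha := Complex.neg_pi_lt_arg y
    have hb := Complex.arg_le_pi y
    have hc := Complex.neg_pi_lt_arg w
    have hd := Complex.arg_le_pi w
    rw [Real.sin_eq_zero_iff_of_lt_of_lt (by linarith) (by linarith)] at h0
    exact hw (by linarith)
  positivity

theorem ae_chord_pos {S : Set ℂ} (hS : MeasurableSet S) :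
    ∀ᵐ p ∂pairMeasure S, 0 < chord (Complex.arg p.2 - Complex.arg p.1) := by
  have hm : MeasurableSet {p : ℂ × ℂ | 0 < chord (Complex.arg p.2 - Complex.arg p.1)} := by
    have hc : Measurable chord := by unfold chord; fun_prop
    exact measurableSet_lt measurable_const (hc.comp
      ((Complex.measurable_arg.comp measurable_snd).sub
        (Complex.measurable_arg.comp measurable_fst)))
  exact (Measure.ae_prod_mem_iff_ae_ae_mem hm).2 (ae_of_all _ fun y => ae_chord_pos_right hS y)

theorem sq_volume_le_angularEnergy {S : Set ℂ} (hS : MeasurableSet S)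
    (hb : S ⊆ Metric.closedBall 0 2) : volume.real S ^ 2 ≤ 2 * π * angularEnergy S := by
  have hpi := Real.pi_pos
  set H := angularWidth S
  have hvol : volume.real S = ∫ θ in Set.Ioc (-π) π, H θ := by
    have := setIntegral_arg hS hb (F := fun _ => (1 : ℝ)) stronglyMeasurable_const
    simpa using this
  have hHi : IntegrableOn H (Set.Ioc (-π) π) :=
    integrableOn_of_bounded_Ioc (measurable_angularWidth hS) (C := 4) fun θ => by
      rw [abs_of_nonneg (angularWidth_nonneg _ _)]; exact angularWidth_le hb θ
  have hHs := integrableOn_angularWidth_sq hS hb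
  set m := volume.real S / (2 * π) with hm
  have h0 : 0 ≤ ∫ θ in Set.Ioc (-π) π, (H θ ^ 2 - 2 * m * H θ + m ^ 2) :=
    integral_nonneg fun θ => by
      show 0 ≤ H θ ^ 2 - 2 * m * H θ + m ^ 2
      nlinarith [sq_nonneg (H θ - m)]
  have hA : IntegrableOn (fun θ => H θ ^ 2 - 2 * m * H θ) (Set.Ioc (-π) π) :=
    hHs.sub (hHi.const_mul _)
  rw [integral_add hA (integrable_const _),
    integral_sub hHs (hHi.const_mul _), integral_const_mul, ← hvol, setIntegral_const,
    Real.volume_real_Ioc_of_le (by linarith), smul_eq_mul] at h0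
  have h1 : volume.real S = 2 * π * m := by rw [hm]; field_simp
  have h2 : (∫ θ in Set.Ioc (-π) π, H θ ^ 2) = angularEnergy S := rfl
  rw [h2, h1] at h0
  rw [h1]
  nlinarith

theorem isFiniteMeasure_restrict {S : Set ℂ} {R : ℝ} (hb : S ⊆ Metric.closedBall 0 R) :
    IsFiniteMeasure (volume.restrict S) :=
  ⟨by rw [Measure.restrict_apply_univ]
      exact (measure_mono hb).trans_lt measure_closedBall_lt_top⟩

theorem integrable_log_circle {S : Set ℂ} (hb : S ⊆ Metric.closedBall 0 2) {g : ℂ × ℂ → ℝ}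
    (hg : Measurable g) (hg1 : ∀ p, |g p| ≤ 1) {q : ℝ} (hq0 : 0 ≤ q) (hq1 : q < 1) :
    Integrable (fun p : ℂ × ℂ => g p *
      (-log ‖1 - q * Complex.exp ((Complex.arg p.2 - Complex.arg p.1 : ℝ) * Complex.I)‖))
      (pairMeasure S) := by
  have hfin := isFiniteMeasure_restrict hb
  have hfin2 : IsFiniteMeasure (pairMeasure S) := by unfold pairMeasure; infer_instance
  refine Integrable.of_bound (C := 1 * (2 + (1 - q)⁻¹)) ?_ (ae_of_all _ fun p => ?_)
  · refine (hg.mul (Measurable.neg (Real.measurable_log.comp ?_))).aestronglyMeasurable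
    have h3 : Measurable fun p : ℂ × ℂ => Complex.arg p.2 - Complex.arg p.1 :=
      (Complex.measurable_arg.comp measurable_snd).sub
        (Complex.measurable_arg.comp measurable_fst)
    exact (measurable_const.sub (measurable_const.mul (Complex.measurable_exp.comp
      ((Complex.measurable_ofReal.comp h3).mul measurable_const)))).norm
  · set z := (q : ℂ) * Complex.exp ((Complex.arg p.2 - Complex.arg p.1 : ℝ) * Complex.I)
    have hz : ‖z‖ = q := by
      rw [norm_mul, Complex.norm_exp_ofReal_mul_I, mul_one, Complex.norm_real,
        Real.norm_of_nonneg hq0]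
    have h1 : 1 - q ≤ ‖1 - z‖ := by
      have := norm_sub_norm_le (1 : ℂ) z
      rwa [norm_one, hz] at this
    have h2 : ‖1 - z‖ ≤ 2 := by
      have := norm_sub_le (1 : ℂ) z
      rw [norm_one, hz] at this; linarith
    have hq : 0 < 1 - q := by linarith
    rw [norm_mul, Real.norm_eq_abs, norm_neg, Real.norm_eq_abs]
    refine mul_le_mul (hg1 p) ((abs_log_le_add_inv (norm_nonneg _)).trans ?_) (abs_nonneg _)
      zero_le_one
    gcongr

theorem norm_first_coeff_le {S₁ S₂ : Set ℂ} (h1 : MeasurableSet S₁) (h2 : MeasurableSet S₂)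
    (hb : S₁ ∪ S₂ ⊆ Metric.closedBall 0 2) {τ : ℝ}
    (hτ : ∀ y ∈ S₁ ∪ S₂, |1 - ‖y‖| ≤ τ) (hc : ∫ y in S₁, y = ∫ y in S₂, y) :
    ‖∫ y in S₁ ∪ S₂, (signedInd S₁ S₂ y : ℂ) * Complex.exp (Complex.arg y * Complex.I)‖ ≤
      τ * volume.real (S₁ ∪ S₂) := by
  have hfin := isFiniteMeasure_restrict hb
  have hS := h1.union h2
  have hvol : volume (S₁ ∪ S₂) < ⊤ := (measure_mono hb).trans_lt measure_closedBall_lt_top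
  have hid : IntegrableOn (fun y : ℂ => y) (S₁ ∪ S₂) :=
    (continuous_id.continuousOn.integrableOn_compact (isCompact_closedBall 0 2)).mono_set hb
  have h0 : ∫ y in S₁ ∪ S₂, (signedInd S₁ S₂ y : ℂ) * y = 0 := by
    have := integral_signedInd_smul h1 h2 hid
    simp only [Complex.real_smul] at this
    rw [this, hc, sub_self]
  have hζ : Measurable fun y => (signedInd S₁ S₂ y : ℂ) :=
    Complex.measurable_ofReal.comp (measurable_signedInd h1 h2)
  have hζ1 : ∀ y, ‖(signedInd S₁ S₂ y : ℂ)‖ ≤ 1 := fun y => by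
    rw [Complex.norm_real]; exact abs_signedInd_le _ _ _
  have hme : Measurable fun y : ℂ => Complex.exp (Complex.arg y * Complex.I) :=
    Complex.measurable_exp.comp
      ((Complex.measurable_ofReal.comp Complex.measurable_arg).mul measurable_const)
  have hi1 : IntegrableOn (fun y => (signedInd S₁ S₂ y : ℂ) *
      Complex.exp (Complex.arg y * Complex.I)) (S₁ ∪ S₂) := by
    refine Integrable.of_bound (C := 1) (hζ.mul hme).aestronglyMeasurable (ae_of_all _ fun y => ?_)
    rw [norm_mul, Complex.norm_exp_ofReal_mul_I, mul_one]; exact hζ1 y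
  have hi2 : IntegrableOn (fun y => (signedInd S₁ S₂ y : ℂ) * y) (S₁ ∪ S₂) :=
    hid.bdd_mul hζ.aestronglyMeasurable (ae_of_all _ hζ1)
  rw [← sub_zero (∫ y in S₁ ∪ S₂, _ * _), ← h0, ← integral_sub hi1 hi2]
  refine norm_setIntegral_le_of_norm_le_const hvol fun y hy => ?_
  rw [← mul_sub, norm_mul]
  have e : Complex.exp (Complex.arg y * Complex.I) - y =
      ((1 - ‖y‖ : ℝ) : ℂ) * Complex.exp (Complex.arg y * Complex.I) := by
    have := Complex.norm_mul_exp_arg_mul_I y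
    push_cast
    linear_combination this
  rw [e, norm_mul, Complex.norm_exp_ofReal_mul_I, mul_one, Complex.norm_real (1 - ‖y‖), Real.norm_eq_abs]
  have := mul_le_mul (hζ1 y) (hτ y hy) (abs_nonneg _) zero_le_one
  linarith

/-- The logarithmic energy of a signed indicator supported near the unit circle, with vanishing
first moment, is controlled by its angular energy. -/
theorem log_energy_le : ∃ τ₀ : ℝ, 0 < τ₀ ∧ τ₀ ≤ 1 / 2 ∧ ∀ τ, 0 < τ → τ ≤ τ₀ → ∀ S₁ S₂ : Set ℂ,
    MeasurableSet S₁ → MeasurableSet S₂ →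
    (∀ y ∈ S₁ ∪ S₂, 1 - τ ≤ ‖y‖ ∧ ‖y‖ ≤ 1 + τ) → (∫ y in S₁, y = ∫ y in S₂, y) →
    ∫ p, signedInd S₁ S₂ p.1 * signedInd S₁ S₂ p.2 * (-log ‖p.1 - p.2‖)
      ∂(pairMeasure (S₁ ∪ S₂)) ≤ 0.6 * π * angularEnergy (S₁ ∪ S₂) := by
  have hC := chordConst_nonneg
  have hpi := Real.pi_gt_three
  refine ⟨min (1 / 200) ((0.05 / (chordConst + 1)) ^ 2 / 2), by positivity,
    (min_le_left _ _).trans (by norm_num), fun τ hτ hτ₀ S₁ S₂ h1 h2 hann hc => ?_⟩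
  have hτ1 : τ ≤ 1 / 200 := hτ₀.trans (min_le_left _ _)
  have hτ2 : τ ≤ (0.05 / (chordConst + 1)) ^ 2 / 2 := hτ₀.trans (min_le_right _ _)
  have hsq : √(2 * τ) * chordConst ≤ 0.05 := by
    have h3 : √(2 * τ) ≤ 0.05 / (chordConst + 1) :=
      Real.sqrt_le_iff.2 ⟨by positivity, by linarith⟩
    rw [le_div_iff₀ (by positivity)] at h3
    nlinarith [Real.sqrt_nonneg (2 * τ)]
  have hb : S₁ ∪ S₂ ⊆ Metric.closedBall 0 2 := fun y hy => by
    rw [mem_closedBall_zero_iff]; linarith [(hann y hy).2]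
  have hS := h1.union h2
  have hfin := isFiniteMeasure_restrict hb
  have hfin2 : IsFiniteMeasure (pairMeasure (S₁ ∪ S₂)) := by unfold pairMeasure; infer_instance
  set S := S₁ ∪ S₂ with hSdef
  set ζ := signedInd S₁ S₂
  have hζm : Measurable fun p : ℂ × ℂ => ζ p.1 * ζ p.2 :=
    ((measurable_signedInd h1 h2).comp measurable_fst).mul
      ((measurable_signedInd h1 h2).comp measurable_snd)
  have hζ1 : ∀ p : ℂ × ℂ, |ζ p.1 * ζ p.2| ≤ 1 := fun p => by
    rw [abs_mul]
    exact mul_le_one₀ (abs_signedInd_le _ _ _) (abs_nonneg _) (abs_signedInd_le _ _ _)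
  have hi1 : Integrable (fun p : ℂ × ℂ => ζ p.1 * ζ p.2 * (-log ‖p.1 - p.2‖)) (pairMeasure S) := by
    have := (integrable_log_pair_one hS hb hζm (M := 1) fun x _ y _ => hζ1 (x, y)).neg
    exact this.congr (ae_of_all _ fun p => by simp)
  have hi2 := integrable_log_circle hb hζm hζ1 (q := 1 - τ) (by linarith) (by linarith)
  obtain ⟨hi3, hch⟩ := chord_energy_le hS hb
  have hcirc := circle_energy_le h1 h2 hb (q := 1 - τ) (by linarith) (by linarith)
  have hcoef := norm_first_coeff_le h1 h2 hb (τ := τ)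
    (fun y hy => abs_le.2 ⟨by linarith [(hann y hy).2], by linarith [(hann y hy).1]⟩) hc
  have hvol := sq_volume_le_angularEnergy hS hb
  have hQ0 := angularEnergy_nonneg S
  have hi4 : Integrable (fun p : ℂ × ℂ => 4 * τ + 2 * √(2 * τ) *
      (√(chord (Complex.arg p.2 - Complex.arg p.1)))⁻¹) (pairMeasure S) :=
    (integrable_const _).add (hi3.const_mul _)
  have hkey := integral_mono_ae hi1 (hi2.add hi4) (by
    have hmem : ∀ᵐ p ∂pairMeasure S, p.1 ∈ S ∧ p.2 ∈ S :=
      ae_pairMeasure hS fun x hx y hy _ => ⟨hx, hy⟩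
    filter_upwards [ae_chord_pos hS, hmem] with p hp hpm
    have h5 := abs_log_sub_log_circle_le hτ (by linarith) (hann _ hpm.1) (hann _ hpm.2) hp
    set X := log ‖p.1 - p.2‖
    set Y := log ‖1 - ((1 - τ : ℝ) : ℂ) *
        Complex.exp ((Complex.arg p.2 - Complex.arg p.1 : ℝ) * Complex.I)‖
    show ζ p.1 * ζ p.2 * -X ≤ ζ p.1 * ζ p.2 * -Y + (4 * τ + 2 * √(2 * τ) *
      (√(chord (Complex.arg p.2 - Complex.arg p.1)))⁻¹)
    have h6 : ζ p.1 * ζ p.2 * (Y - X) ≤ |X - Y| := by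
      refine (le_abs_self _).trans ?_
      rw [abs_mul, abs_sub_comm]
      exact mul_le_of_le_one_left (abs_nonneg _) (hζ1 p)
    linarith)
  have e5 : ∫ p, (4 * τ + 2 * √(2 * τ) * (√(chord (Complex.arg p.2 - Complex.arg p.1)))⁻¹)
      ∂(pairMeasure S) ≤ 4 * τ * volume.real S ^ 2 +
      2 * √(2 * τ) * (chordConst * angularEnergy S) := by
    rw [integral_add (integrable_const _) (hi3.const_mul _), integral_const, integral_const_mul]
    have : (pairMeasure S).real Set.univ = volume.real S ^ 2 := by
      rw [pairMeasure, ← Set.univ_prod_univ, measureReal_prod_prod,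
        measureReal_restrict_apply MeasurableSet.univ, Set.univ_inter, sq]
    rw [this, smul_eq_mul]
    have := mul_le_mul_of_nonneg_left hch (show 0 ≤ 2 * √(2 * τ) by positivity)
    linarith
  have e6 : ∫ p, ((fun p : ℂ × ℂ => ζ p.1 * ζ p.2 * -log ‖1 - ((1 - τ : ℝ) : ℂ) *
        Complex.exp ((Complex.arg p.2 - Complex.arg p.1 : ℝ) * Complex.I)‖) + fun p : ℂ × ℂ =>
        4 * τ + 2 * √(2 * τ) * (√(chord (Complex.arg p.2 - Complex.arg p.1)))⁻¹) p
      ∂(pairMeasure S) = _ := integral_add hi2 hi4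
  rw [e6] at hkey
  have hcoef2 := pow_le_pow_left₀ (norm_nonneg _) hcoef 2
  have hV0 := sq_nonneg (volume.real S)
  generalize volume.real S = v at *
  generalize angularEnergy S = Q at *
  have hA : 1 / 2 * (τ * v) ^ 2 + 4 * τ * v ^ 2 ≤ 0.05 * π * Q := by
    have : 1 / 2 * (τ * v) ^ 2 + 4 * τ * v ^ 2 = (τ ^ 2 / 2 + 4 * τ) * v ^ 2 := by ring
    rw [this]
    have h7 : τ ^ 2 / 2 + 4 * τ ≤ 0.021 := by nlinarith
    have h8 : (τ ^ 2 / 2 + 4 * τ) * v ^ 2 ≤ 0.021 * (2 * π * Q) := by gcongr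
    nlinarith [mul_nonneg Real.pi_pos.le hQ0]
  have hB : 2 * √(2 * τ) * (chordConst * Q) ≤ 0.1 * Q := by nlinarith
  nlinarith

theorem circleAverage_log_rotate {y w : ℂ} (h : ‖w‖ < ‖y‖) :
    circleAverage (fun z => log ‖y - z * w‖) 0 1 = log ‖y‖ := by
  have := InnerProductSpace.HarmonicOnNhd.circleAverage_eq (f := fun z : ℂ => log ‖y - z * w‖)
    (c := 0) (R := 1) ?_
  · simpa using this
  · intro x hx
    apply AnalyticAt.harmonicAt_log_norm (by fun_prop)
    intro h0
    rw [abs_one, mem_closedBall_zero_iff] at hx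
    have : ‖y‖ = ‖x‖ * ‖w‖ := by rw [← norm_mul, sub_eq_zero.1 h0]
    nlinarith [norm_nonneg w]

theorem setIntegral_ball_rotate {E : Type*} [NormedAddCommGroup E] [NormedSpace ℝ E]
    (f : ℂ → E) (r θ : ℝ) :
    ∫ w in Metric.ball 0 r, f (Complex.exp (θ * Complex.I) * w) = ∫ w in Metric.ball 0 r, f w := by
  set ρ := rotation (Circle.exp θ)
  have h := (ρ.measurePreserving).setIntegral_preimage_emb
    ρ.toHomeomorph.measurableEmbedding f (Metric.ball 0 r)
  rw [← h]
  have : (ρ ⁻¹' Metric.ball 0 r) = Metric.ball 0 r := by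
    ext w; simp
  rw [this]
  simp [ρ, rotation_apply, Circle.coe_exp]

/-- The logarithmic potential of a disc outside that disc. -/
theorem setIntegral_log_ball {r : ℝ} (hr : 0 ≤ r) {y : ℂ} (hy : r < ‖y‖) :
    ∫ w in Metric.ball 0 r, log ‖y - w‖ = π * r ^ 2 * log ‖y‖ := by
  have hpi := Real.pi_pos
  set U := Metric.ball (0 : ℂ) r
  have hfin := isFiniteMeasure_restrict (S := U) Metric.ball_subset_closedBall
  set F : ℂ → ℝ → ℝ := fun w θ => log ‖y - Complex.exp (θ * Complex.I) * w‖ with hF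
  have e1 : ∀ w ∈ U, ∫ θ in Set.Ioc 0 (2 * π), F w θ = 2 * π * log ‖y‖ := by
    intro w hw
    have h1 := circleAverage_log_rotate (y := y) (w := w) (by
      rw [mem_ball_zero_iff] at hw; linarith)
    rw [circleAverage, intervalIntegral.integral_of_le (by positivity), smul_eq_mul] at h1
    simp only [circleMap_zero, Complex.ofReal_one, one_mul] at h1
    rw [← h1]; field_simp
    rfl
  have hint : Integrable (Function.uncurry F)
      ((volume.restrict U).prod (volume.restrict (Set.Ioc 0 (2 * π)))) := by
    refine Integrable.of_bound (C := 2 * ‖y‖ + (‖y‖ - r)⁻¹) ?_ ?_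
    · refine (Real.measurable_log.comp ?_).aestronglyMeasurable
      fun_prop
    · rw [Measure.prod_restrict]
      refine (ae_restrict_mem (measurableSet_ball.prod measurableSet_Ioc)).mono fun p hp => ?_
      have hw : ‖p.1‖ < r := by simpa [U] using hp.1
      have hn : ‖Complex.exp (p.2 * Complex.I) * p.1‖ = ‖p.1‖ := by
        rw [norm_mul, Complex.norm_exp_ofReal_mul_I, one_mul]
      have h1 := norm_sub_norm_le y (Complex.exp (p.2 * Complex.I) * p.1)
      have h2 := norm_sub_le y (Complex.exp (p.2 * Complex.I) * p.1)
      rw [hn] at h1 h2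
      refine (abs_log_le_add_inv (norm_nonneg _)).trans ?_
      have h3 : 0 < ‖y‖ - r := by linarith
      refine add_le_add (by linarith) (inv_anti₀ h3 (by linarith))
  have h2 := integral_integral_swap hint
  rw [setIntegral_congr_fun measurableSet_ball e1] at h2
  simp only [hF] at h2
  have e3 : ∀ θ : ℝ, ∫ w in U, log ‖y - Complex.exp (θ * Complex.I) * w‖ =
      ∫ w in U, log ‖y - w‖ := fun θ => setIntegral_ball_rotate (fun z => log ‖y - z‖) r θ
  simp only [e3] at h2
  rw [setIntegral_const, setIntegral_const, volume_real_ball _ hr,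
    Real.volume_real_Ioc_of_le (by positivity), smul_eq_mul, smul_eq_mul, sub_zero] at h2
  have : 2 * π * (∫ w in U, log ‖y - w‖) = 2 * π * (π * r ^ 2 * log ‖y‖) := by
    rw [← h2]; ring
  exact mul_left_cancel₀ (by positivity) this

/-- Strict radial decay of the logarithmic potential of a nearly circular patch. -/
theorem logPot_slope {B : Set ℂ} (hB : MeasurableSet B) {τ : ℝ} (hτ : 0 < τ) (hτ' : τ ≤ 1 / 40000)
    (hin : Metric.ball 0 (1 - τ) ⊆ B) (hout : B ⊆ Metric.closedBall 0 (1 + τ)) {ω : ℂ}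
    (hω : ‖ω‖ = 1) {ρ₁ ρ₂ : ℝ} (h1 : 1 - τ ≤ ρ₁) (h12 : ρ₁ ≤ ρ₂) (h2 : ρ₂ ≤ 1 + τ)
    (hvol : volume.real B = π) :
    0.46 * (ρ₂ - ρ₁) ≤ logPot B (ρ₁ * ω) - logPot B (ρ₂ * ω) := by
  have hpi := Real.pi_pos
  have hbd : Bornology.IsBounded B := Metric.isBounded_closedBall.subset hout
  set r := 1 - 2 * τ with hr
  have hr0 : 0 < r := by rw [hr]; linarith
  set U := Metric.ball (0 : ℂ) r with hU
  have hUB : U ⊆ B := (Metric.ball_subset_ball (by linarith)).trans hin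
  have n1 : ‖(ρ₁ : ℂ) * ω‖ = ρ₁ := by
    rw [norm_mul, hω, mul_one, Complex.norm_real, Real.norm_of_nonneg (by linarith)]
  have n2 : ‖(ρ₂ : ℂ) * ω‖ = ρ₂ := by
    rw [norm_mul, hω, mul_one, Complex.norm_real, Real.norm_of_nonneg (by linarith)]
  have n12 : ‖(ρ₁ : ℂ) * ω - ρ₂ * ω‖ = ρ₂ - ρ₁ := by
    rw [← sub_mul, norm_mul, hω, mul_one, ← Complex.ofReal_sub, Complex.norm_real,
      Real.norm_eq_abs, abs_of_nonpos (by linarith), neg_sub]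
  have split : ∀ y : ℂ, r < ‖y‖ → ∫ w in B, log ‖y - w‖ =
      π * r ^ 2 * log ‖y‖ + ∫ w in B \ U, log ‖y - w‖ := by
    intro y hy
    rw [← setIntegral_log_ball hr0.le hy, ← hU]
    have := integral_inter_add_sdiff (s := B) (t := U) measurableSet_ball
      (integrableOn_log_norm_sub hB hbd y)
    rw [Set.inter_eq_self_of_subset_right hUB] at this
    exact this.symm
  have hN : volume.real (B \ U) ≤ 4 * π * τ := by
    rw [measureReal_sdiff hUB measurableSet_ball hbd.measure_lt_top.ne, hvol, hU,
      volume_real_ball _ hr0.le, hr]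
    nlinarith [mul_pos hpi (mul_pos hτ hτ)]
  have hNm := hB.diff (measurableSet_ball (x := (0 : ℂ)) (ε := r))
  have hNb : Bornology.IsBounded (B \ U) := hbd.subset Set.sdiff_subset
  have hs := Real.sqrt_pos.2 hτ
  have hss := Real.mul_self_sqrt hτ.le
  set s := √τ
  have hinv : ∀ y, ∫ w in B \ U, ‖y - w‖⁻¹ ≤ 6 * π * s := fun y => by
    refine (inv_norm_sub_setIntegral hNb.measure_lt_top.ne y hs).2.trans ?_
    have : volume.real (B \ U) / s ≤ 4 * π * s := by
      rw [div_le_iff₀ hs]; nlinarith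
    linarith
  have i1 := integrableOn_log_norm_sub hNm hNb (ρ₁ * ω)
  have i2 := integrableOn_log_norm_sub hNm hNb (ρ₂ * ω)
  have j1 := (inv_norm_sub_setIntegral hNb.measure_lt_top.ne (ρ₁ * ω) hs).1
  have j2 := (inv_norm_sub_setIntegral hNb.measure_lt_top.ne (ρ₂ * ω) hs).1
  have hrest : |(∫ w in B \ U, log ‖ρ₂ * ω - w‖) - ∫ w in B \ U, log ‖ρ₁ * ω - w‖| ≤
      (ρ₂ - ρ₁) * (12 * π * s) := by
    rw [← integral_sub i2 i1, ← Real.norm_eq_abs]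
    have h3 : IntegrableOn (fun w => (ρ₂ - ρ₁) * (‖ρ₂ * ω - w‖⁻¹ + ‖ρ₁ * ω - w‖⁻¹)) (B \ U) :=
      (j2.add j1).const_mul _
    refine (norm_integral_le_of_norm_le h3 (ae_restrict_of_ae ?_)).trans ?_
    · filter_upwards [Measure.ae_ne volume (ρ₁ * ω), Measure.ae_ne volume (ρ₂ * ω)] with w w1 w2
      have p1 : 0 < ‖ρ₁ * ω - w‖ := norm_pos_iff.2 (sub_ne_zero.2 w1.symm)
      have p2 : 0 < ‖ρ₂ * ω - w‖ := norm_pos_iff.2 (sub_ne_zero.2 w2.symm)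
      refine (abs_log_sub_log_le_inv p2 p1).trans ?_
      gcongr
      refine (abs_norm_sub_norm_le _ _).trans (le_of_eq ?_)
      rw [sub_sub_sub_cancel_right, norm_sub_rev, n12]
    · rw [integral_const_mul, integral_add j2 j1]
      have := hinv (ρ₁ * ω)
      have := hinv (ρ₂ * ω)
      have h0 : 0 ≤ ρ₂ - ρ₁ := by linarith
      gcongr
      linarith
  have hlog : (ρ₂ - ρ₁) / (1 + τ) ≤ log ρ₂ - log ρ₁ := by
    have p1 : 0 < ρ₁ := by linarith
    have p2 : 0 < ρ₂ := by linarith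
    rw [← Real.log_div p2.ne' p1.ne']
    have := Real.one_sub_inv_le_log_of_pos (div_pos p2 p1)
    rw [inv_div] at this
    refine le_trans ?_ this
    rw [div_le_iff₀ (by linarith)]
    have : (1 - ρ₁ / ρ₂) * ρ₂ = ρ₂ - ρ₁ := by field_simp
    rw [← this]
    have h4 : 0 ≤ 1 - ρ₁ / ρ₂ := by rw [sub_nonneg, div_le_one p2]; exact h12
    gcongr
  rw [logPot, logPot, split _ (by rw [n1]; linarith), split _ (by rw [n2]; linarith), n1, n2]
  have hs2 : s ≤ 1 / 200 := by
    exact Real.sqrt_le_iff.2 ⟨by norm_num, hτ'.trans (by norm_num)⟩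
  set I₁ := ∫ w in B \ U, log ‖ρ₁ * ω - w‖
  set I₂ := ∫ w in B \ U, log ‖ρ₂ * ω - w‖
  have e : -(1 / (2 * π)) * (π * r ^ 2 * log ρ₁ + I₁) - -(1 / (2 * π)) * (π * r ^ 2 * log ρ₂ + I₂) =
      r ^ 2 / 2 * (log ρ₂ - log ρ₁) + 1 / (2 * π) * (I₂ - I₁) := by field_simp; ring
  rw [e]
  have h5 : -(6 * s * (ρ₂ - ρ₁)) ≤ 1 / (2 * π) * (I₂ - I₁) := by
    have := (abs_le.1 hrest).1
    have h6 : 1 / (2 * π) * (-((ρ₂ - ρ₁) * (12 * π * s))) ≤ 1 / (2 * π) * (I₂ - I₁) := by gcongr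
    refine le_trans (le_of_eq ?_) h6
    field_simp; ring
  have h7 : 0.499 * (ρ₂ - ρ₁) ≤ r ^ 2 / 2 * (log ρ₂ - log ρ₁) := by
    refine le_trans ?_ (mul_le_mul_of_nonneg_left hlog (by positivity))
    rw [mul_div_assoc', le_div_iff₀ (by linarith)]
    have : 0.499 * (1 + τ) ≤ r ^ 2 / 2 := by rw [hr]; nlinarith
    nlinarith
  nlinarith

theorem angularWidth_le_of_slice {S : Set ℂ} {θ M a b : ℝ} (hM : 0 ≤ M) (hab : a ≤ b)
    (h : ∀ ρ : ℝ, 0 < ρ → (ρ : ℂ) * (Real.cos θ + Real.sin θ * Complex.I) ∈ S →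
      ρ ≤ M ∧ a ≤ ρ ∧ ρ ≤ b) : angularWidth S θ ≤ M * (b - a) := by
  have h1 : angularDensity S θ ≤
      ∫⁻ ρ, (Set.Icc a b).indicator (fun _ => ENNReal.ofReal M) ρ := by
    refine (setLIntegral_mono' measurableSet_Ioi fun ρ hρ => ?_).trans
      (setLIntegral_le_lintegral (Set.Ioi (0 : ℝ)) _)
    by_cases hs : (ρ : ℂ) * (Real.cos θ + Real.sin θ * Complex.I) ∈ S
    · obtain ⟨h2, h3, h4⟩ := h ρ hρ hs
      rw [Set.indicator_of_mem hs, Set.indicator_of_mem (Set.mem_Icc.2 ⟨h3, h4⟩), Pi.one_apply,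
        mul_one]
      exact ENNReal.ofReal_le_ofReal h2
    · rw [Set.indicator_of_notMem hs, mul_zero]
      exact bot_le
  rw [lintegral_indicator measurableSet_Icc, setLIntegral_const, Real.volume_Icc,
    ← ENNReal.ofReal_mul hM] at h1
  exact ENNReal.toReal_le_of_le_ofReal (mul_nonneg hM (by linarith)) h1

/-- A nearly circular set described as the positivity set of a radially decreasing function. -/
structure RoundPatch (B : Set ℂ) (V : ℂ → ℝ) (g τ : ℝ) : Prop where
  measurableSet : MeasurableSet B
  inner : Metric.ball 0 (1 - τ) ⊆ B
  outer : B ⊆ Metric.closedBall 0 (1 + τ)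
  mem_iff : ∀ y, ‖y‖ ≤ 2 → (y ∈ B ↔ 0 < V y)
  slope : ∀ ω : ℂ, ‖ω‖ = 1 → ∀ ρ₁ ρ₂ : ℝ, 1 - τ ≤ ρ₁ → ρ₁ ≤ ρ₂ → ρ₂ ≤ 1 + τ →
    g * (ρ₂ - ρ₁) ≤ V (ρ₁ * ω) - V (ρ₂ * ω)

namespace RoundPatch
variable {B₁ B₂ : Set ℂ} {V₁ V₂ : ℂ → ℝ} {g τ : ℝ}

theorem mem_annulus_left (h1 : RoundPatch B₁ V₁ g τ) (h2 : RoundPatch B₂ V₂ g τ) {y : ℂ}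
    (hy : y ∈ B₁ \ B₂) : 1 - τ ≤ ‖y‖ ∧ ‖y‖ ≤ 1 + τ := by
  refine ⟨?_, mem_closedBall_zero_iff.1 (h1.outer hy.1)⟩
  by_contra hc
  exact hy.2 (h2.inner (mem_ball_zero_iff.2 (not_le.1 hc)))

theorem mem_annulus (h1 : RoundPatch B₁ V₁ g τ) (h2 : RoundPatch B₂ V₂ g τ) {y : ℂ}
    (hy : y ∈ B₁ \ B₂ ∪ B₂ \ B₁) : 1 - τ ≤ ‖y‖ ∧ ‖y‖ ≤ 1 + τ :=
  hy.elim (mem_annulus_left h1 h2) (mem_annulus_left h2 h1)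

theorem angularWidth_le_left (h1 : RoundPatch B₁ V₁ g τ) (h2 : RoundPatch B₂ V₂ g τ)
    (hg : 0 < g) (hτ : 0 < τ) (hτ' : τ ≤ 1 / 2) {y : ℂ} (hy : y ∈ B₁ \ B₂) :
    g * angularWidth (B₁ \ B₂ ∪ B₂ \ B₁) (Complex.arg y) ≤ (1 + τ) * (V₁ y - V₂ y) := by
  set θ := Complex.arg y
  set ω : ℂ := Real.cos θ + Real.sin θ * Complex.I with hω
  have hω1 : ‖ω‖ = 1 := by rw [hω]; push_cast; exact Complex.norm_cos_add_sin_mul_I θ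
  have hyω : y = (‖y‖ : ℂ) * ω := by
    rw [hω]; push_cast
    exact (Complex.norm_mul_cos_add_sin_mul_I y).symm
  have hya := mem_annulus_left h1 h2 hy
  have hV1 : 0 < V₁ y := (h1.mem_iff y (by linarith)).1 hy.1
  have hV2 : V₂ y ≤ 0 := not_lt.1 ((h2.mem_iff y (by linarith)).not.1 hy.2)
  have key : ∀ ρ : ℝ, 0 < ρ → (ρ : ℂ) * ω ∈ B₁ \ B₂ ∪ B₂ \ B₁ →
      ρ ≤ 1 + τ ∧ ‖y‖ + V₂ y / g ≤ ρ ∧ ρ ≤ ‖y‖ + V₁ y / g := by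
    intro ρ hρ hmem
    have hn : ‖(ρ : ℂ) * ω‖ = ρ := by
      rw [norm_mul, hω1, mul_one, Complex.norm_real, Real.norm_of_nonneg hρ.le]
    have hann := mem_annulus h1 h2 hmem
    rw [hn] at hann
    have hn2 : ‖(ρ : ℂ) * ω‖ ≤ 2 := by rw [hn]; linarith
    have s1 := fun hle => h1.slope ω hω1 ρ ‖y‖ hann.1 hle hya.2
    have s2 := fun hle => h2.slope ω hω1 ρ ‖y‖ hann.1 hle hya.2
    have t1 := fun hle => h1.slope ω hω1 ‖y‖ ρ hya.1 hle hann.2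
    have t2 := fun hle => h2.slope ω hω1 ‖y‖ ρ hya.1 hle hann.2
    rw [← hyω] at s1 s2 t1 t2
    refine ⟨hann.2, ?_⟩
    have hV : 0 < V₁ (ρ * ω) ∧ V₂ (ρ * ω) ≤ 0 := by
      rcases hmem with hm | hm
      · exact ⟨(h1.mem_iff _ hn2).1 hm.1, not_lt.1 ((h2.mem_iff _ hn2).not.1 hm.2)⟩
      · exfalso
        have u2 := (h2.mem_iff _ hn2).1 hm.1
        have u1 := not_lt.1 ((h1.mem_iff _ hn2).not.1 hm.2)
        rcases le_total ρ ‖y‖ with hle | hle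
        · have := s1 hle
          have : 0 ≤ g * (‖y‖ - ρ) := mul_nonneg hg.le (by linarith)
          linarith
        · have := t2 hle
          have : 0 ≤ g * (ρ - ‖y‖) := mul_nonneg hg.le (by linarith)
          linarith
    have d1 : 0 ≤ V₁ y / g := by positivity
    have d2 : V₂ y / g ≤ 0 := div_nonpos_of_nonpos_of_nonneg hV2 hg.le
    rcases le_total ρ ‖y‖ with hle | hle
    · refine ⟨?_, by linarith⟩
      have := s2 hle
      have : V₂ y / g ≤ -(‖y‖ - ρ) := by rw [div_le_iff₀ hg]; nlinarith
      linarith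
    · refine ⟨by linarith, ?_⟩
      have := t1 hle
      have : ρ - ‖y‖ ≤ V₁ y / g := by rw [le_div_iff₀ hg]; nlinarith
      linarith
  have h3 := angularWidth_le_of_slice (by linarith)
    (by have : V₂ y / g ≤ V₁ y / g := by gcongr; linarith
        linarith) key
  calc g * angularWidth (B₁ \ B₂ ∪ B₂ \ B₁) θ
      ≤ g * ((1 + τ) * (‖y‖ + V₁ y / g - (‖y‖ + V₂ y / g))) := by gcongr
    _ = (1 + τ) * (V₁ y - V₂ y) := by field_simp; ring

theorem angularWidth_le_signed (h1 : RoundPatch B₁ V₁ g τ) (h2 : RoundPatch B₂ V₂ g τ)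
    (hg : 0 < g) (hτ : 0 < τ) (hτ' : τ ≤ 1 / 2) {y : ℂ} (hy : y ∈ B₁ \ B₂ ∪ B₂ \ B₁) :
    g * angularWidth (B₁ \ B₂ ∪ B₂ \ B₁) (Complex.arg y) ≤
      (1 + τ) * (signedInd (B₁ \ B₂) (B₂ \ B₁) y * (V₁ y - V₂ y)) := by
  rcases hy with hy | hy
  · have : signedInd (B₁ \ B₂) (B₂ \ B₁) y = 1 := by
      simp [signedInd, hy.1, hy.2]
    rw [this, one_mul]
    exact angularWidth_le_left h1 h2 hg hτ hτ' hy
  · have : signedInd (B₁ \ B₂) (B₂ \ B₁) y = -1 := by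
      simp [signedInd, hy.1, hy.2]
    rw [this, Set.union_comm]
    have := angularWidth_le_left h2 h1 hg hτ hτ' hy
    linarith

end RoundPatch

theorem le_sqrt_of_forall_le {X c Q : ℝ} (hc : 0 ≤ c) (hQ : 0 ≤ Q)
    (h : ∀ s, 0 < s → X ≤ s * c + Q / s) : X ≤ (c + 1) * √Q := by
  rcases hQ.eq_or_lt with h0 | h0
  · rw [← h0, Real.sqrt_zero, mul_zero]
    refine le_of_forall_pos_le_add fun η hη => ?_
    have := h (η / (c + 1)) (by positivity)
    rw [← h0, zero_div, add_zero] at this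
    refine this.trans ?_
    rw [zero_add, div_mul_eq_mul_div, div_le_iff₀ (by positivity)]
    nlinarith
  · have := h (√Q) (Real.sqrt_pos.2 h0)
    rw [Real.div_sqrt] at this
    linarith

theorem chord_le_norm_sub {y w : ℂ} :
    ‖w‖ * chord (Complex.arg w - Complex.arg y) ≤ 2 * ‖y - w‖ := by
  have h := norm_sub_sq_polar y w
  have h0 := chord_nonneg (Complex.arg w - Complex.arg y)
  have h2 := chord_le_two (Complex.arg w - Complex.arg y)
  set v := chord (Complex.arg w - Complex.arg y)
  refine le_of_sq_le_sq ?_ (by positivity)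
  have hp := norm_nonneg y
  have hq := norm_nonneg w
  have hk0 : 0 ≤ v ^ 2 := by positivity
  have hk4 : v ^ 2 ≤ 4 := by nlinarith
  have hpq := mul_nonneg hp hq
  rw [mul_pow, mul_pow, h]
  rcases le_total (v ^ 2) 2 with h3 | h3
  · nlinarith [sq_nonneg (‖y‖ - ‖w‖ * (1 - v ^ 2 / 2)),
      mul_nonneg (mul_nonneg hk0 (show 0 ≤ 3 - v ^ 2 by linarith)) (sq_nonneg ‖w‖)]
  · nlinarith [mul_nonneg hpq (show 0 ≤ v ^ 2 - 2 by linarith), sq_nonneg ‖y‖,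
      mul_nonneg (sq_nonneg ‖w‖) (show 0 ≤ 4 - v ^ 2 by linarith)]

theorem abs_log_le_quarter {v t : ℝ} (hv : 0 < v) (h1 : v ≤ 4 * t) (h2 : t ≤ 4) :
    |log t| ≤ 8 * (1 + (√(√v))⁻¹) := by
  have ht : 0 < t := by linarith
  have hs : 0 < √v := Real.sqrt_pos.2 hv
  have hss : 0 < √(√v) := Real.sqrt_pos.2 hs
  have e1 : log v = 4 * log (√(√v)) := by
    rw [Real.log_sqrt hs.le, Real.log_sqrt hv.le]; ring
  have h3 := Real.one_sub_inv_le_log_of_pos hss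
  have h4 : log v ≤ log (4 * t) := Real.log_le_log hv h1
  have h5 : log (4 : ℝ) ≤ 3 := (Real.log_le_sub_one_of_pos (by norm_num)).trans (by norm_num)
  have h6 : log t ≤ log 4 := Real.log_le_log ht h2
  rw [Real.log_mul (by norm_num) ht.ne'] at h4
  have h7 : 0 < (√(√v))⁻¹ := by positivity
  rw [abs_le]; constructor <;> linarith

theorem setIntegral_abs_log_le : ∃ C : ℝ, 0 ≤ C ∧ ∀ S : Set ℂ, MeasurableSet S →
    (∀ w ∈ S, 1 / 2 ≤ ‖w‖ ∧ ‖w‖ ≤ 2) → ∀ y : ℂ, ‖y‖ ≤ 2 →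
    ∫ w in S, |log ‖y - w‖| ≤ C * √(angularEnergy S) := by
  have hC := chordConst_nonneg
  have hpi := Real.pi_pos
  refine ⟨8 * (2 * π + chordConst + 1), by positivity, fun S hS hann y hy => ?_⟩
  have hb : S ⊆ Metric.closedBall 0 2 := fun w hw => mem_closedBall_zero_iff.2 (hann w hw).2
  rw [mul_assoc, ← div_le_iff₀' (by norm_num)]
  refine le_sqrt_of_forall_le (by positivity) (angularEnergy_nonneg S) fun s hs => ?_
  rw [div_le_iff₀' (by norm_num)]
  obtain ⟨hi, hle⟩ := setIntegral_arg_quarter_le hS hb (Complex.arg y) hs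
  refine le_trans ?_ (mul_le_mul_of_nonneg_left hle (by norm_num))
  rw [← integral_const_mul]
  refine integral_mono_ae
    (integrableOn_log_norm_sub hS (Metric.isBounded_closedBall.subset hb) y).abs
    (hi.const_mul 8) ?_
  filter_upwards [ae_chord_pos_right hS y, ae_restrict_mem hS] with w hw hwS
  have h1 := chord_le_norm_sub (y := y) (w := w)
  have h2 := (hann w hwS).1
  refine abs_log_le_quarter hw ?_ ((norm_sub_le y w).trans (by linarith [(hann w hwS).2]))
  nlinarith

theorem continuous_regProfile : Continuous regProfile :=
  (LipschitzWith.of_dist_le_mul (K := 1) fun s t => by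
    simpa [Real.dist_eq] using regProfile_lipschitz s t).continuous

theorem measurable_regKern : Measurable fun p : ℂ × ℂ => regKern p.1 p.2 := by
  have h1 : Measurable fun p : ℂ × ℂ => p.2.re / p.1.re :=
    (Complex.measurable_re.comp measurable_snd).div (Complex.measurable_re.comp measurable_fst)
  have h2 : Measurable fun p : ℂ × ℂ => p.1.re * p.2.re :=
    (Complex.measurable_re.comp measurable_fst).mul (Complex.measurable_re.comp measurable_snd)
  have h3 : Measurable fun p : ℂ × ℂ => ‖p.1 - p.2‖ := by fun_prop
  have h4 : Measurable fun p : ℂ × ℂ => regProfile (‖p.1 - p.2‖ / √(p.1.re * p.2.re)) :=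
    continuous_regProfile.measurable.comp (h3.div h2.sqrt)
  unfold regKern regPart
  exact ((h1.mul h1.sqrt).mul (((Real.measurable_log.comp h2).const_mul _).add h4)).sub
    ((((h1.mul h1.sqrt).sub_const 1).const_mul _).mul (Real.measurable_log.comp h3))

theorem measurable_regKern_scaled (a : ℝ) :
    Measurable fun p : ℂ × ℂ => regKern (1 + (a : ℂ) * p.1) (1 + (a : ℂ) * p.2) :=
  measurable_regKern.comp (f := fun p : ℂ × ℂ => (1 + (a : ℂ) * p.1, 1 + (a : ℂ) * p.2))
    (by fun_prop)

theorem measurable_regKern_scaled_right (a : ℝ) (y : ℂ) :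
    Measurable fun w : ℂ => regKern (1 + (a : ℂ) * y) (1 + (a : ℂ) * w) :=
  (measurable_regKern_scaled a).comp (f := fun w : ℂ => (y, w)) (by fun_prop)

/-- The potential generated by the regular part of the ring kernel, in scaled variables. -/
def regPot (B : Set ℂ) (a : ℝ) (y : ℂ) : ℝ :=
  ∫ w in B, regKern (1 + (a : ℂ) * y) (1 + (a : ℂ) * w)

/-- The difference between the scaled ring potential and the logarithmic potential. -/
def ringCorr (B : Set ℂ) (a β m : ℝ) (y : ℂ) : ℝ :=
  -Real.log a / 2 + regPot B a y - β - m / (1 + a * y.re) ^ 2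

/-- The relative stream function in scaled variables. -/
def ringPot (B : Set ℂ) (a β m : ℝ) (y : ℂ) : ℝ := logPot B y + ringCorr B a β m y

/-- The scaled cross-section of a vortex ring: an open connected set of area `π` and centroid `0`,
which is the positivity set of its relative stream function. -/
structure Ring (B : Set ℂ) (a β m : ℝ) : Prop where
  isOpen : IsOpen B
  preconnected : IsPreconnected B
  area : volume.real B = π
  centroid : ∫ w in B, w = 0
  pos : 0 < a
  le : a ≤ 1 / 4
  beta_nonneg : 0 ≤ β
  m_nonneg : 0 ≤ m
  small : ∀ y ∈ B, a * ‖y‖ ≤ 1 / 4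
  mem_iff : ∀ y, a * ‖y‖ ≤ 1 / 2 → (y ∈ B ↔ 0 < ringPot B a β m y)

theorem regKern_bounded : ∃ K : ℝ, 1 ≤ K ∧ ∀ a : ℝ, 0 < a → ∀ y w : ℂ, a * ‖y‖ ≤ 1 / 2 →
    a * ‖w‖ ≤ 1 / 2 → |regKern (1 + (a : ℂ) * y) (1 + (a : ℂ) * w)| ≤ K := by
  obtain ⟨C, hC, h⟩ := regKern_sub_const_le
  refine ⟨2 * C + |regProfile 0|, by linarith [abs_nonneg (regProfile 0)], fun a ha y w hy hw => ?_⟩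
  have h1 := norm_scaled_le ha.le hy
  have h2 := norm_scaled_le ha.le hw
  have h3 := h _ _ h1 h2
  set X := 1 + (a : ℂ) * y
  set Y := 1 + (a : ℂ) * w
  have h4 : ‖X - Y‖ ≤ 1 := by
    have : X - Y = (X - 1) - (Y - 1) := by ring
    rw [this]; linarith [norm_sub_le (X - 1) (Y - 1)]
  have h5 : ‖X - Y‖ * |Real.log ‖X - Y‖| ≤ 1 := by
    rcases (norm_nonneg (X - Y)).eq_or_lt with h0 | h0
    · rw [← h0]; simp
    · have := (Real.abs_log_mul_self_lt _ h0 h4).le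
      rwa [abs_mul, abs_of_pos h0, mul_comm] at this
  have h6 : |regKern X Y| ≤ |regKern X Y - regProfile 0| + |regProfile 0| := by
    simpa using abs_add_le (regKern X Y - regProfile 0) (regProfile 0)
  nlinarith

namespace Ring
variable {B : Set ℂ} {a β m : ℝ}

theorem measurableSet (h : Ring B a β m) : MeasurableSet B := h.isOpen.measurableSet

theorem bounded (h : Ring B a β m) : Bornology.IsBounded B := by
  refine Metric.isBounded_closedBall (x := (0 : ℂ)) (r := 1 / 4 / a) |>.subset fun y hy => ?_
  rw [mem_closedBall_zero_iff, le_div_iff₀ h.pos, mul_comm]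
  exact h.small y hy

theorem volume_ne_top (h : Ring B a β m) : volume B ≠ ⊤ := h.bounded.measure_lt_top.ne

theorem one_le_neg_log (h : Ring B a β m) : 1 ≤ -Real.log a := by
  have h1 : Real.log a ≤ Real.log (1 / 4) := Real.log_le_log h.pos h.le
  have h2 : Real.log (1 / 4) = -(2 * Real.log 2) := by
    rw [show (1 / 4 : ℝ) = (2 ^ 2)⁻¹ by norm_num, Real.log_inv, Real.log_pow]; norm_num
  linarith [Real.log_two_gt_d9]

theorem inv_norm (h : Ring B a β m) (x : ℂ) :
    IntegrableOn (fun w : ℂ => ‖x - w‖⁻¹) B ∧ ∫ w in B, ‖x - w‖⁻¹ ≤ 3 * π := by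
  have := inv_norm_sub_setIntegral h.volume_ne_top x one_pos
  refine ⟨this.1, this.2.trans ?_⟩
  rw [h.area]; linarith

theorem nonempty (h : Ring B a β m) : B.Nonempty := by
  rw [Set.nonempty_iff_ne_empty]
  rintro rfl
  have := h.area
  simp at this
  exact Real.pi_ne_zero this.symm

/-- On `B × {a‖y‖ ≤ 1/2}` the logarithm of the scaled distance is nonpositive. -/
theorem abs_log_scaled_le (h : Ring B a β m) {x w : ℂ} (hx : a * ‖x‖ ≤ 1 / 2) (hw : w ∈ B) :
    |Real.log (a * ‖x - w‖)| ≤ -Real.log a + ‖x - w‖⁻¹ := by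
  have ha := h.pos
  have hl := h.one_le_neg_log
  rcases (norm_nonneg (x - w)).eq_or_lt with h0 | h0
  · rw [← h0]; simp; linarith
  · have h1 : a * ‖x - w‖ ≤ 1 := by
      have := norm_sub_le x w
      nlinarith [h.small w hw]
    rw [abs_of_nonpos (Real.log_nonpos (by positivity) h1), Real.log_mul ha.ne' h0.ne']
    have h2 := Real.log_le_sub_one_of_pos (inv_pos.2 h0)
    rw [Real.log_inv] at h2
    linarith

theorem half (h : Ring B a β m) {w : ℂ} (hw : w ∈ B) : a * ‖w‖ ≤ 1 / 2 := by
  linarith [h.small w hw]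

theorem integrableOn_regKern (h : Ring B a β m) {y : ℂ} (hy : a * ‖y‖ ≤ 1 / 2) :
    IntegrableOn (fun w => regKern (1 + (a : ℂ) * y) (1 + (a : ℂ) * w)) B := by
  obtain ⟨K, -, hb⟩ := regKern_bounded
  refine Integrable.mono' (integrableOn_const h.volume_ne_top (C := K))
    (measurable_regKern_scaled_right a y).aestronglyMeasurable ?_
  exact (ae_restrict_iff' h.measurableSet).2 (ae_of_all _ fun w hw => hb a h.pos y w hy (h.half hw))

theorem logPot_le (h : Ring B a β m) (x : ℂ) : logPot B x ≤ 3 / 2 := by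
  have hi := h.inv_norm x
  have h1 : ∫ w in B, -Real.log ‖x - w‖ ≤ ∫ w in B, ‖x - w‖⁻¹ := by
    refine integral_mono (integrableOn_log_norm_sub h.measurableSet h.bounded x).neg hi.1
      fun w => ?_
    beta_reduce
    rcases (norm_nonneg (x - w)).eq_or_lt with h0 | h0
    · rw [← h0]; simp
    · have h2 := Real.log_le_sub_one_of_pos (inv_pos.2 h0)
      rw [Real.log_inv] at h2
      linarith
  rw [integral_neg] at h1
  have hpi := Real.pi_pos
  rw [logPot, neg_mul, ← mul_neg, div_mul_eq_mul_div, one_mul, div_le_iff₀ (by positivity)]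
  linarith [hi.2]

end Ring

theorem Ring.regPot_bounded : ∃ K : ℝ, 1 ≤ K ∧ ∀ B a β m, Ring B a β m → ∀ y : ℂ,
    a * ‖y‖ ≤ 1 / 2 → |regPot B a y| ≤ K := by
  obtain ⟨K, hK, hb⟩ := regKern_bounded
  refine ⟨K * π, by nlinarith [Real.pi_gt_three], fun B a β m h y hy => ?_⟩
  have := norm_setIntegral_le_of_norm_le_const (μ := volume) (s := B) (C := K)
    (f := fun w => regKern (1 + (a : ℂ) * y) (1 + (a : ℂ) * w)) h.volume_ne_top.lt_top
    fun w hw => by rw [Real.norm_eq_abs]; exact hb a h.pos y w hy (h.half hw)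
  rwa [h.area] at this

theorem abs_inv_sq_sub_inv_sq_le {u v : ℝ} (hu : 1 / 2 ≤ u) (hv : 1 / 2 ≤ v) :
    |1 / u ^ 2 - 1 / v ^ 2| ≤ 16 * |u - v| := by
  have hu0 : 0 < u := by linarith
  have hv0 : 0 < v := by linarith
  have e : 1 / u ^ 2 - 1 / v ^ 2 = (v - u) * (u⁻¹ * v⁻¹ ^ 2 + u⁻¹ ^ 2 * v⁻¹) := by
    field_simp; ring
  have h1 : u⁻¹ ≤ 2 := by rw [inv_le_comm₀ hu0 two_pos]; linarith
  have h2 : v⁻¹ ≤ 2 := by rw [inv_le_comm₀ hv0 two_pos]; linarith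
  have h3 : 0 < u⁻¹ := inv_pos.2 hu0
  have h4 : 0 < v⁻¹ := inv_pos.2 hv0
  have h5 : u⁻¹ * v⁻¹ ^ 2 ≤ 2 * 2 ^ 2 := by gcongr
  have h6 : u⁻¹ ^ 2 * v⁻¹ ≤ 2 ^ 2 * 2 := by gcongr
  rw [e, abs_mul, abs_sub_comm, abs_of_pos (by positivity : 0 < u⁻¹ * v⁻¹ ^ 2 + u⁻¹ ^ 2 * v⁻¹),
    mul_comm]
  gcongr; linarith

theorem half_le_re {a : ℝ} {y : ℂ} (ha : 0 ≤ a) (hy : a * ‖y‖ ≤ 1 / 2) :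
    1 / 2 ≤ 1 + a * y.re ∧ 1 + a * y.re ≤ 3 / 2 := by
  rw [← re_scaled]
  exact re_bounds (norm_scaled_le ha hy)

theorem Ring.ringCorr_lip : ∃ C : ℝ, 1 ≤ C ∧ ∀ B a β m, Ring B a β m → ∀ x y : ℂ,
    a * ‖x‖ ≤ 1 / 2 → a * ‖y‖ ≤ 1 / 2 →
    |ringCorr B a β m x - ringCorr B a β m y| ≤ C * (a * (1 - Real.log a + m)) * ‖x - y‖ := by
  obtain ⟨C, hC, hT⟩ := regKern_sub_le
  refine ⟨7 * π * C + 16, by nlinarith [Real.pi_gt_three], fun B a β m h x y hx hy => ?_⟩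
  have ha := h.pos
  have hl := h.one_le_neg_log
  have hpi := Real.pi_pos
  have h1 : |regPot B a x - regPot B a y| ≤ 7 * π * C * (a * (1 - Real.log a)) * ‖x - y‖ := by
    rw [regPot, regPot, ← integral_sub (h.integrableOn_regKern hx) (h.integrableOn_regKern hy)]
    have hix := h.inv_norm x
    have hiy := h.inv_norm y
    have hi : IntegrableOn (fun w => C * (a * ‖x - y‖) *
        ((1 + 2 * -Real.log a) + (‖x - w‖⁻¹ + ‖y - w‖⁻¹))) B :=
      ((integrableOn_const h.volume_ne_top).add (hix.1.add hiy.1)).const_mul _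
    have hb : |∫ w in B, (regKern (1 + (a : ℂ) * x) (1 + (a : ℂ) * w) -
        regKern (1 + (a : ℂ) * y) (1 + (a : ℂ) * w))| ≤ ∫ w in B, C * (a * ‖x - y‖) *
        ((1 + 2 * -Real.log a) + (‖x - w‖⁻¹ + ‖y - w‖⁻¹)) := by
      rw [← Real.norm_eq_abs]
      refine norm_integral_le_of_norm_le hi ?_
      refine (ae_restrict_iff' h.measurableSet).2 (ae_of_all _ fun w hw => ?_)
      refine (hT _ _ _ (norm_scaled_le ha.le hx) (norm_scaled_le ha.le hy)
        (norm_scaled_le ha.le (h.half hw))).trans ?_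
      rw [norm_scaled_sub _ _ ha.le, norm_scaled_sub _ _ ha.le, norm_scaled_sub _ _ ha.le]
      gcongr ?_ * ?_
      linarith [h.abs_log_scaled_le hx hw, h.abs_log_scaled_le hy hw]
    have hc : IntegrableOn (fun _ : ℂ => 1 + 2 * -Real.log a) B :=
      integrableOn_const h.volume_ne_top
    have hs : IntegrableOn (fun w : ℂ => ‖x - w‖⁻¹ + ‖y - w‖⁻¹) B := hix.1.add hiy.1
    rw [integral_const_mul, integral_add hc hs,
      integral_add hix.1 hiy.1, setIntegral_const, h.area, smul_eq_mul] at hb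
    refine hb.trans ?_
    have : π * (1 + 2 * -Real.log a) + (∫ w in B, ‖x - w‖⁻¹) + ∫ w in B, ‖y - w‖⁻¹ ≤
      7 * π * (1 - Real.log a) := by nlinarith [hix.2, hiy.2]
    calc _ ≤ C * (a * ‖x - y‖) * (7 * π * (1 - Real.log a)) := by
          gcongr; linarith
      _ = _ := by ring
  have h2 : |m / (1 + a * x.re) ^ 2 - m / (1 + a * y.re) ^ 2| ≤ 16 * (a * m) * ‖x - y‖ := by
    have h3 := abs_inv_sq_sub_inv_sq_le (half_le_re ha.le hx).1 (half_le_re ha.le hy).1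
    have h4 : |(1 + a * x.re) - (1 + a * y.re)| ≤ a * ‖x - y‖ := by
      rw [show (1 + a * x.re) - (1 + a * y.re) = a * (x.re - y.re) by ring, abs_mul,
        abs_of_pos ha]
      gcongr; exact abs_re_sub_le x y
    have e : m / (1 + a * x.re) ^ 2 - m / (1 + a * y.re) ^ 2 =
      m * (1 / (1 + a * x.re) ^ 2 - 1 / (1 + a * y.re) ^ 2) := by ring
    rw [e, abs_mul, abs_of_nonneg h.m_nonneg]
    have := h.m_nonneg
    calc _ ≤ m * (16 * (a * ‖x - y‖)) := by gcongr; exact h3.trans (by gcongr)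
      _ = _ := by ring
  have e : ringCorr B a β m x - ringCorr B a β m y = (regPot B a x - regPot B a y) -
      (m / (1 + a * x.re) ^ 2 - m / (1 + a * y.re) ^ 2) := by simp only [ringCorr]; ring
  rw [e]
  refine (abs_sub _ _).trans ((add_le_add h1 h2).trans ?_)
  have hm := h.m_nonneg
  have k1 : 0 ≤ a * m * ‖x - y‖ := by positivity
  have k2 : 0 ≤ a * (1 - Real.log a) * ‖x - y‖ := mul_nonneg (mul_nonneg ha.le (by linarith)) (norm_nonneg _)
  have k3 : 0 ≤ π * C * (a * m * ‖x - y‖) := by positivity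
  nlinarith

theorem Ring.params_le : ∃ C : ℝ, 1 ≤ C ∧ ∀ B a β m, Ring B a β m →
    m ≤ C * (1 - Real.log a) ∧ β ≤ C * (1 - Real.log a) := by
  obtain ⟨K, hK, hb⟩ := Ring.regPot_bounded
  refine ⟨2 * (2 + K), by linarith, fun B a β m h => ?_⟩
  obtain ⟨b, hbB⟩ := h.nonempty
  have hl := h.one_le_neg_log
  have h1 := (h.mem_iff b (h.half hbB)).1 hbB
  have h2 := h.logPot_le b
  have h3 := (abs_le.1 (hb B a β m h b (h.half hbB))).2
  simp only [ringPot, ringCorr] at h1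
  have h0 : |a * b.re| ≤ 1 / 4 := by
    rw [abs_mul, abs_of_pos h.pos]
    exact (mul_le_mul_of_nonneg_left (Complex.abs_re_le_norm b) h.pos.le).trans (h.small b hbB)
  rw [abs_le] at h0
  have h4 : (1 + a * b.re) ^ 2 ≤ 2 := by nlinarith
  have h5 : 0 < (1 + a * b.re) ^ 2 := pow_pos (by linarith) 2
  have h6 : m / 2 ≤ m / (1 + a * b.re) ^ 2 := by have := h.m_nonneg; gcongr
  have h7 : (0:ℝ) ≤ m := h.m_nonneg
  have h8 := h.beta_nonneg
  constructor <;> nlinarith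

theorem Ring.logPot_add_le {B : Set ℂ} {a β m : ℝ} (h : Ring B a β m) (x : ℂ) {q N : ℝ}
    (hq : 0 < q) (haq : a * q ≤ 1) (hv : volume.real (B ∩ Metric.ball x q) ≤ π / N) :
    logPot B x + -Real.log a / 2 ≤ (-Real.log a - Real.log q) / 2 + -Real.log a / (2 * N) + 3 / 2 := by
  have hpi := Real.pi_pos
  have hl := h.one_le_neg_log
  have hi := h.inv_norm x
  set L := -Real.log a with hL
  have hLq : 0 ≤ L - Real.log q := by
    have := Real.log_nonpos (by have := h.pos; positivity) haq
    rw [Real.log_mul h.pos.ne' hq.ne'] at this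
    linarith
  have i1 : IntegrableOn (fun w => L - Real.log ‖x - w‖) B :=
    (integrableOn_const h.volume_ne_top).sub (integrableOn_log_norm_sub h.measurableSet h.bounded x)
  have i2 : IntegrableOn (fun _ : ℂ => L - Real.log q) B := integrableOn_const h.volume_ne_top
  have i3 : IntegrableOn ((Metric.ball x q).indicator fun _ : ℂ => L) B :=
    (integrableOn_const h.volume_ne_top).indicator measurableSet_ball
  have i4 : IntegrableOn (fun w => (L - Real.log q) + (Metric.ball x q).indicator (fun _ => L) w) B :=
    i2.add i3
  have i5 : IntegrableOn (fun _ : ℂ => L) B := integrableOn_const h.volume_ne_top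
  have hle : ∫ w in B, (L - Real.log ‖x - w‖) ≤
      ∫ w in B, ((L - Real.log q) + (Metric.ball x q).indicator (fun _ => L) w + ‖x - w‖⁻¹) := by
    refine integral_mono i1 (i4.add hi.1) fun w => ?_
    beta_reduce
    have hinv : 0 ≤ ‖x - w‖⁻¹ := by positivity
    by_cases hw : w ∈ Metric.ball x q
    · rw [Set.indicator_of_mem hw]
      have : -Real.log ‖x - w‖ ≤ ‖x - w‖⁻¹ := by
        rcases (norm_nonneg (x - w)).eq_or_lt with h0 | h0
        · rw [← h0]; simp
        · have h2 := Real.log_le_sub_one_of_pos (inv_pos.2 h0)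
          rw [Real.log_inv] at h2
          linarith
      linarith
    · rw [Set.indicator_of_notMem hw]
      rw [Metric.mem_ball, dist_comm, dist_eq_norm, not_lt] at hw
      linarith [Real.log_le_log hq hw]
  rw [integral_add i4 hi.1, integral_add i2 i3, integral_sub i5
    (integrableOn_log_norm_sub h.measurableSet h.bounded x), setIntegral_const, setIntegral_const,
    setIntegral_indicator measurableSet_ball, setIntegral_const, h.area, smul_eq_mul, smul_eq_mul,
    smul_eq_mul] at hle
  have hN : volume.real (B ∩ Metric.ball x q) * L ≤ π / N * L := by gcongr
  have e : logPot B x + L / 2 = (π * L - ∫ w in B, Real.log ‖x - w‖) / (2 * π) := by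
    rw [logPot]; field_simp; ring
  rw [e, div_le_iff₀ (by positivity)]
  have e2 : ((L - Real.log q) / 2 + L / (2 * N) + 3 / 2) * (2 * π) =
    π * (L - Real.log q) + π / N * L + 3 * π := by
    rcases eq_or_ne N 0 with rfl | hN0
    · simp; ring
    · field_simp
  rw [e2]; linarith [hi.2]

theorem Ring.exists_norm_le {c : ℝ} (hc : 0 < c) : ∃ C : ℝ, 1 ≤ C ∧ ∀ B a β m, Ring B a β m →
    c * -Real.log a ≤ β → ∀ b ∈ B, a * ‖b‖ ≤ C * Real.exp (c * Real.log a) := by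
  obtain ⟨K, hK, hb⟩ := Ring.regPot_bounded
  obtain ⟨N, hN⟩ := exists_nat_gt (1 / c)
  have hNr : (0 : ℝ) < N := lt_trans (by positivity) hN
  have hN0 : 0 < N := by exact_mod_cast hNr
  have hN1 : (1 : ℝ) ≤ N := by exact_mod_cast hN0
  have hexp : 1 ≤ Real.exp (3 + 2 * K) := Real.one_le_exp (by linarith)
  refine ⟨2 * N * Real.exp (3 + 2 * K), by nlinarith, fun B a β m h hβ b hbB => ?_⟩
  have hpi := Real.pi_pos
  have ha := h.pos
  have hl := h.one_le_neg_log
  rcases eq_or_ne b 0 with rfl | hb0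
  · rw [norm_zero, mul_zero]; positivity
  have hn : 0 < ‖b‖ := norm_pos_iff.2 hb0
  obtain ⟨y, hyB, hy⟩ := exists_far_point h.measurableSet h.bounded (by rw [h.area]; exact hpi)
    h.centroid b
  obtain ⟨x, hxB, -, -, hx⟩ := exists_low_mass h.measurableSet h.volume_ne_top h.preconnected
    hbB hyB le_rfl hn hy hN0
  rw [sub_zero, h.area] at hx
  set q := ‖b‖ / (2 * N) with hq
  have hq0 : 0 < q := by positivity
  have haq : a * q = a * ‖b‖ / (2 * N) := by rw [hq]; ring
  have haq1 : a * q ≤ 1 := by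
    rw [haq, div_le_one (by positivity)]
    linarith [h.small b hbB]
  have h1 := h.logPot_add_le x hq0 haq1 hx
  have h2 := (h.mem_iff x (h.half hxB)).1 hxB
  have h3 := (abs_le.1 (hb B a β m h x (h.half hxB))).2
  have h4 : 0 ≤ m / (1 + a * x.re) ^ 2 := div_nonneg h.m_nonneg (sq_nonneg _)
  simp only [ringPot, ringCorr] at h2
  have h5 : -Real.log a / (2 * N) ≤ c * -Real.log a / 2 := by
    rw [div_le_iff₀ (by positivity)]
    rw [div_lt_iff₀ hc] at hN
    nlinarith
  have h6 : Real.log (a * q) ≤ c * Real.log a + (3 + 2 * K) := by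
    rw [Real.log_mul ha.ne' hq0.ne']
    linarith
  rw [Real.log_le_iff_le_exp (by positivity), Real.exp_add, haq, div_le_iff₀ (by positivity)] at h6
  linarith

theorem tendsto_self_mul_one_sub_log :
    Tendsto (fun a : ℝ => a * (1 - Real.log a)) (nhdsWithin 0 (Set.Ioi 0)) (nhds 0) := by
  have h1 : Tendsto (fun a : ℝ => a) (nhdsWithin 0 (Set.Ioi 0)) (nhds 0) :=
    tendsto_id.mono_left nhdsWithin_le_nhds
  have h2 := tendsto_log_mul_rpow_nhdsGT_zero one_pos
  have := h1.sub h2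
  simp only [Real.rpow_one, sub_zero] at this
  exact this.congr fun a => by ring

theorem tendsto_exp_mul_one_sub_log {c : ℝ} (hc : 0 < c) :
    Tendsto (fun a : ℝ => Real.exp (c * Real.log a) * (1 - Real.log a))
      (nhdsWithin 0 (Set.Ioi 0)) (nhds 0) := by
  have h1 : Tendsto (fun a : ℝ => a ^ c) (nhdsWithin 0 (Set.Ioi 0)) (nhds 0) := by
    have := (Real.continuousAt_rpow_const (0 : ℝ) c (Or.inr hc.le)).tendsto
    rw [Real.zero_rpow hc.ne'] at this
    exact this.mono_left nhdsWithin_le_nhds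
  have := h1.sub (tendsto_log_mul_rpow_nhdsGT_zero hc)
  rw [sub_zero] at this
  refine this.congr' ?_
  filter_upwards [self_mem_nhdsWithin] with a ha
  rw [Real.rpow_def_of_pos ha, mul_comm (Real.log a) c]; ring

theorem Ring.patch {B : Set ℂ} {a β m R ℓ : ℝ} (h : Ring B a β m) (hR : 1 ≤ R)
    (haR : a * (2 * R) ≤ 1 / 2) (hsub : B ⊆ Metric.closedBall 0 R) (hℓ : 0 ≤ ℓ)
    (hlip : ∀ x y : ℂ, a * ‖x‖ ≤ 1 / 2 → a * ‖y‖ ≤ 1 / 2 →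
      |ringCorr B a β m x - ringCorr B a β m y| ≤ ℓ * ‖x - y‖) :
    Patch B R ℓ (ringCorr B a β m) where
  isOpen := h.isOpen
  area := h.area
  centroid := h.centroid
  sub := hsub
  one_le := hR
  nonneg := hℓ
  lip x y hx hy := hlip x y ((mul_le_mul_of_nonneg_left hx h.pos.le).trans haR)
    ((mul_le_mul_of_nonneg_left hy h.pos.le).trans haR)
  mem_iff y hy := h.mem_iff y ((mul_le_mul_of_nonneg_left hy h.pos.le).trans haR)

theorem Ring.roundPatch {c τ : ℝ} (hc : 0 < c) (hτ : 0 < τ) (hτ' : τ ≤ 1 / 40000) :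
    ∀ᶠ a in nhdsWithin (0 : ℝ) (Set.Ioi 0), ∀ B β m, Ring B a β m → c * -Real.log a ≤ β →
      RoundPatch B (ringPot B a β m) 0.45 τ := by
  obtain ⟨C₁, hC₁, hlip⟩ := Ring.ringCorr_lip
  obtain ⟨C₂, hC₂, hpar⟩ := Ring.params_le
  obtain ⟨C₃, hC₃, hnorm⟩ := Ring.exists_norm_le hc
  obtain ⟨R₀, hR₀⟩ := Patch.exists_radius_bound
  set R₁ := max R₀ 4 with hR₁
  have hR₁4 : 4 ≤ R₁ := le_max_right _ _
  set D := C₁ * (1 + C₂) with hD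
  have hD1 : 1 ≤ D := by nlinarith
  have t1 : Tendsto (fun a : ℝ => D * (a * (1 - Real.log a))) (nhdsWithin 0 (Set.Ioi 0)) (nhds 0) := by
    simpa using tendsto_self_mul_one_sub_log.const_mul D
  have t2 : Tendsto (fun a : ℝ => D * C₃ * (Real.exp (c * Real.log a) * (1 - Real.log a)))
      (nhdsWithin 0 (Set.Ioi 0)) (nhds 0) := by
    simpa using (tendsto_exp_mul_one_sub_log hc).const_mul (D * C₃)
  have hη : 0 < min (1 / 400) (τ / (32 * R₁ ^ 2)) := by positivity
  filter_upwards [t1.eventually (gt_mem_nhds hη),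
    t2.eventually (gt_mem_nhds (by norm_num : (0 : ℝ) < 1 / 400)), self_mem_nhdsWithin,
    (tendsto_id.mono_left nhdsWithin_le_nhds : Tendsto id (nhdsWithin (0 : ℝ) (Set.Ioi 0))
      (nhds 0)).eventually (gt_mem_nhds (by positivity : 0 < 1 / (4 * R₁)))]
    with a h1 h2 ha0 ha1 B β m h hβ
  have ha : 0 < a := ha0
  have hl := h.one_le_neg_log
  rw [id, lt_div_iff₀ (by positivity)] at ha1
  set ℓ := D * (a * (1 - Real.log a)) with hℓ
  rw [lt_min_iff, lt_div_iff₀ (by positivity : 0 < 32 * R₁ ^ 2)] at h1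
  have hℓ0 : 0 ≤ ℓ := by
    have : 0 ≤ 1 - Real.log a := by linarith
    positivity
  have hL : ∀ x y : ℂ, a * ‖x‖ ≤ 1 / 2 → a * ‖y‖ ≤ 1 / 2 →
      |ringCorr B a β m x - ringCorr B a β m y| ≤ ℓ * ‖x - y‖ := by
    intro x y hx hy
    refine (hlip B a β m h x y hx hy).trans ?_
    have : C₁ * (a * (1 - Real.log a + m)) ≤ ℓ := by
      have h3 := (hpar B a β m h).1
      calc C₁ * (a * (1 - Real.log a + m)) ≤
            C₁ * (a * (1 - Real.log a + C₂ * (1 - Real.log a))) := by gcongr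
        _ = ℓ := by rw [hℓ, hD]; ring
    gcongr
  set M := C₃ * Real.exp (c * Real.log a) with hM
  have hM0 : 0 < M := by positivity
  have hM1 : D * M * (1 - Real.log a) < 1 / 400 := by
    calc _ = _ := by rw [hM]; ring
      _ < _ := h2
  have hM2 : M ≤ 1 / 400 := by
    have : M * 1 ≤ D * M * (1 - Real.log a) := by
      have : 1 * M ≤ D * M := by gcongr
      nlinarith
    linarith
  set R := max 4 (M / a) with hR
  have haR : a * R = max (a * 4) M := by
    rw [hR, mul_max_of_nonneg _ _ ha.le, mul_div_cancel₀ _ ha.ne']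
  have hR4 : 4 ≤ R := le_max_left _ _
  have haR2 : a * (2 * R) ≤ 1 / 2 := by
    have : a * R ≤ 1 / 4 := by
      rw [haR]
      exact max_le (by nlinarith) (by linarith)
    linarith
  have hℓR : ℓ * R ≤ 1 / 100 := by
    have : ℓ * R = D * (1 - Real.log a) * max (a * 4) M := by rw [← haR, hℓ]; ring
    have hpos : 0 ≤ D * (1 - Real.log a) := mul_nonneg (by linarith) (by linarith)
    rw [this, mul_max_of_nonneg _ _ hpos]
    refine max_le ?_ ?_
    · have : D * (1 - Real.log a) * (a * 4) = 4 * ℓ := by rw [hℓ]; ring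
      rw [this]; linarith [h1.1]
    · have : D * (1 - Real.log a) * M = D * M * (1 - Real.log a) := by ring
      rw [this]; linarith
  have hsub : B ⊆ Metric.closedBall 0 R := fun b hb => by
    rw [mem_closedBall_zero_iff]
    refine le_trans ?_ (le_max_right _ _)
    rw [le_div_iff₀ ha, mul_comm]
    exact hnorm B a β m h hβ b hb
  have hP := h.patch (by linarith) haR2 hsub hℓ0 hL
  have hB := hR₀ B R ℓ _ hP h.preconnected hℓR hR4
  have hP' := h.patch (R := R₁) (by linarith) (by linarith)
    (hB.trans (Metric.closedBall_subset_closedBall (le_max_left _ _))) hℓ0 hL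
  obtain ⟨hin, hout⟩ := hP'.sandwich hτ (by linarith [h1.2])
  have ha2 : ∀ y : ℂ, ‖y‖ ≤ 2 → a * ‖y‖ ≤ 1 / 2 := fun y hy => by nlinarith
  refine ⟨h.measurableSet, hin, hout, fun y hy => h.mem_iff y (ha2 y hy), ?_⟩
  intro ω hω ρ₁ ρ₂ k1 k2 k3
  have hs := logPot_slope h.measurableSet hτ hτ' hin hout hω k1 k2 k3 h.area
  have hn : ∀ ρ : ℝ, 1 - τ ≤ ρ → ρ ≤ 1 + τ → a * ‖(ρ : ℂ) * ω‖ ≤ 1 / 2 := fun ρ l1 l2 =>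
    ha2 _ (by rw [norm_mul, hω, mul_one, Complex.norm_real, Real.norm_of_nonneg] <;> linarith)
  have he := (abs_le.1 (hL _ _ (hn ρ₁ k1 (by linarith)) (hn ρ₂ (by linarith) k3))).1
  have hd : ‖(ρ₁ : ℂ) * ω - (ρ₂ : ℂ) * ω‖ = ρ₂ - ρ₁ := by
    rw [← sub_mul, norm_mul, hω, mul_one, ← Complex.ofReal_sub, Complex.norm_real, Real.norm_eq_abs,
      abs_sub_comm, abs_of_nonneg (by linarith)]
  rw [hd] at he
  simp only [ringPot]
  nlinarith [h1.1]

/-- The scale-invariant distance of two points after a relative dilation by `exp t`. -/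
def dilDist (t : ℝ) (p : ℂ × ℂ) : ℝ :=
  ‖(Real.exp (t / 2) : ℂ) * p.1 - (Real.exp (-(t / 2)) : ℂ) * p.2‖ / √(p.1.re * p.2.re)

/-- The symmetric weight `(x₁ x₁')^{3/2}`. -/
def axisWeight (p : ℂ × ℂ) : ℝ := p.1.re * p.2.re * √(p.1.re * p.2.re)

theorem measurable_reProd : Measurable fun p : ℂ × ℂ => p.1.re * p.2.re :=
  (Complex.measurable_re.comp measurable_fst).mul (Complex.measurable_re.comp measurable_snd)

theorem measurable_axisWeight : Measurable axisWeight :=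
  measurable_reProd.mul measurable_reProd.sqrt

theorem measurable_dilDist (t : ℝ) : Measurable (dilDist t) :=
  Measurable.div (by fun_prop) measurable_reProd.sqrt

theorem axisWeight_swap (p : ℂ × ℂ) : axisWeight p.swap = axisWeight p := by
  simp [axisWeight, mul_comm]

theorem dilDist_swap (t : ℝ) (p : ℂ × ℂ) : dilDist t p.swap = dilDist (-t) p := by
  simp only [dilDist, Prod.fst_swap, Prod.snd_swap, neg_div, neg_neg, mul_comm p.2.re]
  rw [norm_sub_rev]

/-- Dilation about the axis turns the ring kernel into a symmetric expression. -/
theorem re_mul_ringKern_dilated {x x' : ℂ} (hx : 0 < x.re) (hx' : 0 < x'.re) (t : ℝ) :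
    x.re * ((Real.exp t • x).re ^ 2 * ringKern (Real.exp t • x) x') =
      Real.exp (t / 2) * (axisWeight (x, x') * ringProfile (dilDist t (x, x'))) := by
  set E := Real.exp (t / 2) with hE
  have hE0 : 0 < E := Real.exp_pos _
  have he : Real.exp t = E ^ 2 := by rw [hE, ← Real.exp_nat_mul]; congr 1; push_cast; ring
  have hEi : Real.exp (-(t / 2)) = E⁻¹ := by rw [hE, Real.exp_neg]
  have hre : (Real.exp t • x).re = E ^ 2 * x.re := by
    rw [he, Complex.real_smul, Complex.re_ofReal_mul]
  have hP : 0 < x.re * x'.re := mul_pos hx hx'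
  have hs := Real.sqrt_pos.2 hP
  have s1 : √(x'.re / (E ^ 2 * x.re)) = √(x.re * x'.re) / (E * x.re) := by
    have : x'.re / (E ^ 2 * x.re) = (√(x.re * x'.re) / (E * x.re)) ^ 2 := by
      rw [div_pow, Real.sq_sqrt hP.le]; field_simp
    rw [this, Real.sqrt_sq (by positivity)]
  have s2 : √(E ^ 2 * x.re * x'.re) = E * √(x.re * x'.re) := by
    rw [mul_assoc, Real.sqrt_mul (by positivity), Real.sqrt_sq hE0.le]
  have hEC : (E : ℂ) ≠ 0 := by exact_mod_cast hE0.ne'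
  have s3 : ‖Real.exp t • x - x'‖ = E * ‖(E : ℂ) * x - ((E⁻¹ : ℝ) : ℂ) * x'‖ := by
    have : Real.exp t • x - x' = (E : ℂ) * ((E : ℂ) * x - ((E⁻¹ : ℝ) : ℂ) * x') := by
      rw [he, Complex.real_smul]; push_cast; field_simp
    rw [this, norm_mul, Complex.norm_real, Real.norm_of_nonneg hE0.le]
  rw [ringKern, hre, s1, s2, s3, dilDist, axisWeight, hEi, ← hE,
    mul_div_mul_left _ _ hE0.ne']
  set Φ := ringProfile (‖(E : ℂ) * x - ((E⁻¹ : ℝ) : ℂ) * x'‖ / √(x.re * x'.re))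
  field_simp

/-- A set near the point `1` of the right half-plane, of mass scaled by `c`, which is the
positivity set of its relative stream function. -/
structure AxisPatch (S : Set ℂ) (c β m : ℝ) : Prop where
  measurableSet : MeasurableSet S
  sub : S ⊆ Metric.closedBall 1 (1 / 4)
  nonneg : 0 ≤ c
  mem_iff : ∀ x, ‖x - 1‖ ≤ 1 / 2 → (x ∈ S ↔ 0 < c * (∫ x' in S, ringKern x x') - β - m / x.re ^ 2)

namespace AxisPatch
variable {S : Set ℂ} {c β m : ℝ}

theorem sub_two (h : AxisPatch S c β m) : S ⊆ Metric.closedBall 0 2 := fun x hx => by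
  have h1 := h.sub hx
  rw [Metric.mem_closedBall, dist_eq_norm] at h1
  rw [mem_closedBall_zero_iff]
  have h2 := norm_add_le (x - 1) 1
  rw [sub_add_cancel, norm_one] at h2
  linarith

theorem norm_le (h : AxisPatch S c β m) {x : ℂ} (hx : x ∈ S) : ‖x‖ ≤ 2 := by
  simpa using h.sub_two hx

theorem bounded (h : AxisPatch S c β m) : Bornology.IsBounded S :=
  Metric.isBounded_closedBall.subset h.sub

theorem volume_ne_top (h : AxisPatch S c β m) : volume S ≠ ⊤ := h.bounded.measure_lt_top.ne

theorem finite (h : AxisPatch S c β m) : IsFiniteMeasure (volume.restrict S) :=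
  ⟨by simpa using h.volume_ne_top.lt_top⟩

theorem re_bounds (h : AxisPatch S c β m) {x : ℂ} (hx : x ∈ S) : 3 / 4 ≤ x.re ∧ x.re ≤ 5 / 4 := by
  have h1 := h.sub hx
  rw [Metric.mem_closedBall, dist_eq_norm] at h1
  have h2 := abs_le.1 ((abs_re_sub_le x 1).trans h1)
  rw [Complex.one_re] at h2
  constructor <;> linarith

theorem prod_bounds (h : AxisPatch S c β m) {x y : ℂ} (hx : x ∈ S) (hy : y ∈ S) :
    1 / 4 ≤ x.re * y.re ∧ x.re * y.re ≤ 2 ∧ 1 / 2 ≤ √(x.re * y.re) ∧ √(x.re * y.re) ≤ 2 := by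
  have hx := h.re_bounds hx
  have hy := h.re_bounds hy
  have h1 : 1 / 4 ≤ x.re * y.re := by nlinarith
  have h2 : x.re * y.re ≤ 2 := by nlinarith
  exact ⟨h1, h2, Real.le_sqrt_of_sq_le (by linarith), Real.sqrt_le_iff.2 ⟨by norm_num, by linarith⟩⟩

theorem axisWeight_bounds (h : AxisPatch S c β m) {x y : ℂ} (hx : x ∈ S) (hy : y ∈ S) :
    0 ≤ axisWeight (x, y) ∧ |axisWeight (x, y)| ≤ 4 := by
  obtain ⟨h1, h2, h3, h4⟩ := h.prod_bounds hx hy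
  have h0 : 0 ≤ axisWeight (x, y) := mul_nonneg (by linarith) (by linarith)
  refine ⟨h0, ?_⟩
  rw [abs_of_nonneg h0]
  simp only [axisWeight]
  nlinarith

theorem dilDist_sub_le (h : AxisPatch S c β m) {x y : ℂ} (hx : x ∈ S) (hy : y ∈ S) {t : ℝ}
    (ht : |t| ≤ 1) : |dilDist t (x, y) - dilDist 0 (x, y)| ≤ 8 * |t| := by
  obtain ⟨-, -, h3, -⟩ := h.prod_bounds hx hy
  have hn := h.norm_le hx
  have hn' := h.norm_le hy
  have h2 : |t / 2| ≤ 1 := by rw [abs_div, abs_two]; linarith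
  have e1 := Real.abs_exp_sub_one_le h2
  have e2 := Real.abs_exp_sub_one_le (show |-(t / 2)| ≤ 1 by rwa [abs_neg])
  rw [abs_neg] at e2
  rw [abs_div, abs_two] at e1 e2
  simp only [dilDist, zero_div, neg_zero, Real.exp_zero, Complex.ofReal_one, one_mul]
  rw [← sub_div, abs_div, abs_of_pos (by linarith : 0 < √(x.re * y.re)), div_le_iff₀ (by linarith)]
  have hd : |‖(Real.exp (t / 2) : ℂ) * x - (Real.exp (-(t / 2)) : ℂ) * y‖ - ‖x - y‖| ≤
      |Real.exp (t / 2) - 1| * ‖x‖ + |Real.exp (-(t / 2)) - 1| * ‖y‖ := by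
    refine (abs_norm_sub_norm_le _ _).trans ?_
    have e : (Real.exp (t / 2) : ℂ) * x - (Real.exp (-(t / 2)) : ℂ) * y - (x - y) =
      ((Real.exp (t / 2) - 1 : ℝ) : ℂ) * x - ((Real.exp (-(t / 2)) - 1 : ℝ) : ℂ) * y := by
      push_cast; ring
    rw [e]
    refine (norm_sub_le _ _).trans (le_of_eq ?_)
    rw [norm_mul, norm_mul, Complex.norm_real, Complex.norm_real, Real.norm_eq_abs, Real.norm_eq_abs]
  have k1 : |Real.exp (t / 2) - 1| * ‖x‖ ≤ |t| * 2 := by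
    exact mul_le_mul (by linarith) hn (norm_nonneg _) (abs_nonneg _)
  have k2 : |Real.exp (-(t / 2)) - 1| * ‖y‖ ≤ |t| * 2 := by
    exact mul_le_mul (by linarith) hn' (norm_nonneg _) (abs_nonneg _)
  have := abs_nonneg t
  nlinarith

theorem exists_regProfile_le (h : AxisPatch S c β m) (t : ℝ) : ∃ K : ℝ, 0 ≤ K ∧ ∀ x ∈ S, ∀ y ∈ S,
    |axisWeight (x, y) * regProfile (dilDist t (x, y))| ≤ K := by
  set D := 4 * (Real.exp (t / 2) + Real.exp (-(t / 2))) with hD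
  have hp1 := Real.exp_pos (t / 2)
  have hp2 := Real.exp_pos (-(t / 2))
  refine ⟨4 * (|regProfile 0| + D), by positivity, fun x hx y hy => ?_⟩
  obtain ⟨-, -, h3, -⟩ := h.prod_bounds hx hy
  have hn := h.norm_le hx
  have hn' := h.norm_le hy
  have h1 : |dilDist t (x, y)| ≤ D := by
    simp only [dilDist]
    rw [abs_div, abs_norm, abs_of_pos (by linarith : 0 < √(x.re * y.re)), div_le_iff₀ (by linarith)]
    refine (norm_sub_le _ _).trans ?_
    rw [norm_mul, norm_mul, Complex.norm_real, Complex.norm_real, Real.norm_of_nonneg hp1.le,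
      Real.norm_of_nonneg hp2.le]
    have : 0 < D := by positivity
    nlinarith
  have h2 := regProfile_lipschitz (dilDist t (x, y)) 0
  rw [sub_zero] at h2
  have h4 := abs_sub_abs_le_abs_sub (regProfile (dilDist t (x, y))) (regProfile 0)
  rw [abs_mul]
  gcongr
  · exact (h.axisWeight_bounds hx hy).2
  · linarith

theorem integrable_bounded (h : AxisPatch S c β m) {f : ℂ × ℂ → ℝ} (hf : Measurable f) {K : ℝ}
    (hK : ∀ x ∈ S, ∀ y ∈ S, |f (x, y)| ≤ K) : Integrable f (pairMeasure S) := by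
  have := h.finite
  have : IsFiniteMeasure (pairMeasure S) := by unfold pairMeasure; infer_instance
  refine Integrable.mono' (integrable_const K) hf.aestronglyMeasurable ?_
  exact ae_pairMeasure h.measurableSet fun x hx y hy _ => hK x hx y hy

theorem integrable_regProfile (h : AxisPatch S c β m) (t : ℝ) :
    Integrable (fun p => axisWeight p * regProfile (dilDist t p)) (pairMeasure S) := by
  obtain ⟨K, -, hK⟩ := h.exists_regProfile_le t
  exact h.integrable_bounded
    (measurable_axisWeight.mul (continuous_regProfile.measurable.comp (measurable_dilDist t))) hK

/-- The regular part of the dilated energy. -/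
def regEnergy (S : Set ℂ) (t : ℝ) : ℝ :=
  ∫ p, axisWeight p * regProfile (dilDist t p) ∂pairMeasure S

/-- The dilated energy. -/
def dilEnergy (S : Set ℂ) (t : ℝ) : ℝ :=
  ∫ p, axisWeight p * ringProfile (dilDist t p) ∂pairMeasure S

theorem regEnergy_neg (h : AxisPatch S c β m) (t : ℝ) : regEnergy S (-t) = regEnergy S t := by
  have := h.finite
  rw [regEnergy, regEnergy, pairMeasure]
  rw [← integral_prod_swap]
  simp only [axisWeight_swap, dilDist_swap, neg_neg]

theorem tendsto_regEnergy (h : AxisPatch S c β m) :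
    Tendsto (fun t => (regEnergy S t - regEnergy S 0) / t) (nhdsWithin 0 {0}ᶜ) (nhds 0) := by
  have := h.finite
  have : IsFiniteMeasure (pairMeasure S) := by unfold pairMeasure; infer_instance
  set f : ℝ → ℂ × ℂ → ℝ := fun t p => axisWeight p * regProfile (dilDist t p) with hf
  have hi : ∀ t, Integrable (f t) (pairMeasure S) := h.integrable_regProfile
  have e : ∀ t, (regEnergy S t - regEnergy S 0) / t =
      ∫ p, (f t p + f (-t) p - 2 * f 0 p) / 2 / t ∂pairMeasure S := fun t => by
    have h1 : Integrable (fun p => f t p + f (-t) p) (pairMeasure S) := (hi t).add (hi (-t))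
    rw [integral_div, integral_div, integral_sub h1 ((hi 0).const_mul 2), integral_add (hi t) (hi _),
      integral_const_mul]
    change _ = (regEnergy S t + regEnergy S (-t) - 2 * regEnergy S 0) / 2 / t
    rw [h.regEnergy_neg]; ring
  simp_rw [e]
  have e0 : nhds (0 : ℝ) = nhds (∫ _ : ℂ × ℂ, (0 : ℝ) ∂pairMeasure S) := by simp
  refine Tendsto.mono_right (y := nhds (∫ _ : ℂ × ℂ, (0 : ℝ) ∂pairMeasure S)) ?_ e0.ge
  refine tendsto_integral_filter_of_dominated_convergence (fun _ => 32) ?_ ?_ (integrable_const _) ?_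
  · refine Eventually.of_forall fun t => ?_
    have h1 : Integrable (fun p => f t p + f (-t) p - 2 * f 0 p) (pairMeasure S) :=
      ((hi t).add (hi (-t))).sub ((hi 0).const_mul 2)
    exact ((h1.div_const 2).div_const t).aestronglyMeasurable
  · have ev : ∀ᶠ t : ℝ in nhds 0, |t| < 1 :=
      (continuous_abs.tendsto' (0 : ℝ) 0 (by simp)).eventually_lt_const one_pos
    filter_upwards [nhdsWithin_le_nhds ev, self_mem_nhdsWithin] with t ht ht0
    refine ae_pairMeasure h.measurableSet fun x hx y hy _ => ?_
    have ht0' : 0 < |t| := abs_pos.2 ht0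
    have hw := (h.axisWeight_bounds hx hy)
    have hl : ∀ s, |s| ≤ 1 → |f s (x, y) - f 0 (x, y)| ≤ 32 * |s| := by
      intro s hs
      simp only [hf]
      rw [← mul_sub, abs_mul]
      calc _ ≤ 4 * (8 * |s|) := by
            gcongr
            · exact hw.2
            · exact (regProfile_lipschitz _ _).trans (h.dilDist_sub_le hx hy hs)
        _ = _ := by ring
    have l1 := hl t ht.le
    have l2 := hl (-t) (by rw [abs_neg]; exact ht.le)
    rw [abs_neg] at l2
    rw [Real.norm_eq_abs, abs_div, abs_div, abs_two, div_le_iff₀ ht0', div_le_iff₀ two_pos]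
    rw [abs_le] at *
    constructor <;> linarith [l1.1, l1.2, l2.1, l2.2]
  · refine ae_pairMeasure h.measurableSet fun x hx y hy hne => ?_
    obtain ⟨-, -, h3, -⟩ := h.prod_bounds hx hy
    have d0 : 0 < dilDist 0 (x, y) := by
      simp only [dilDist, zero_div, neg_zero, Real.exp_zero, Complex.ofReal_one, one_mul]
      exact div_pos (norm_pos_iff.2 (sub_ne_zero.2 hne)) (by linarith)
    have hd : DifferentiableAt ℝ (fun t => f t (x, y)) 0 := by
      refine DifferentiableAt.const_mul ?_ _
      refine DifferentiableAt.comp (0 : ℝ) (regProfile_differentiableAt d0) ?_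
      simp only [dilDist]
      refine DifferentiableAt.div_const ?_ _
      refine DifferentiableAt.norm ℝ ?_ ?_
      · have a1 : DifferentiableAt ℝ (fun t : ℝ => (Real.exp (t / 2) : ℂ)) 0 :=
          (Complex.ofRealCLM.differentiableAt).comp (0 : ℝ)
            ((differentiableAt_id.div_const (2 : ℝ)).exp)
        have a2 : DifferentiableAt ℝ (fun t : ℝ => (Real.exp (-(t / 2)) : ℂ)) 0 :=
          (Complex.ofRealCLM.differentiableAt).comp (0 : ℝ)
            ((differentiableAt_id.div_const (2 : ℝ)).neg.exp)
        exact (a1.mul_const x).sub (a2.mul_const y)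
      · simpa [sub_eq_zero] using hne
    have h1 := hd.hasDerivAt
    have h1' : HasDerivAt (fun t => f t (x, y)) (deriv (fun t => f t (x, y)) 0) (-0) := by
      rw [neg_zero]; exact h1
    have h2 : HasDerivAt (fun t => f (-t) (x, y)) (-deriv (fun t => f t (x, y)) 0) 0 := by
      have := HasDerivAt.scomp (0 : ℝ) h1' (hasDerivAt_neg (0 : ℝ))
      exact this.congr_deriv (by simp)
    have h4 : HasDerivAt (fun t => (f t (x, y) + f (-t) (x, y) - 2 * f 0 (x, y)) / 2) 0 0 :=
      (((h1.add h2).sub_const (2 * f 0 (x, y))).div_const 2).congr_deriv (by simp)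
    have h5 := hasDerivAt_iff_tendsto_slope_zero.1 h4
    refine h5.congr fun t => ?_
    simp only [zero_add, neg_zero, smul_eq_mul]
    ring
  
theorem ringProfile_ae (h : AxisPatch S c β m) (t : ℝ) : ∀ᵐ p ∂pairMeasure S,
    axisWeight p * ringProfile (dilDist t p) =
      -(1 / (2 * π)) * (axisWeight p *
        Real.log ‖(Real.exp (t / 2) : ℂ) * p.1 - (Real.exp (-(t / 2)) : ℂ) * p.2‖) +
      1 / (4 * π) * (axisWeight p * Real.log (p.1.re * p.2.re)) +
      axisWeight p * regProfile (dilDist t p) := by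
  have a2 : ∀ᵐ p ∂pairMeasure S, (Real.exp t : ℂ) * p.1 ≠ p.2 :=
    ae_prod_ne (S := S) (T := S) (φ := fun x => (Real.exp t : ℂ) * x) (by fun_prop)
  filter_upwards [a2, ae_pairMeasure (P := fun p => p.1 ∈ S ∧ p.2 ∈ S) h.measurableSet
    fun x hx y hy _ => ⟨hx, hy⟩] with p hp hS
  obtain ⟨b1, -, b3, -⟩ := h.prod_bounds hS.1 hS.2
  have hn : 0 < ‖(Real.exp (t / 2) : ℂ) * p.1 - (Real.exp (-(t / 2)) : ℂ) * p.2‖ := by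
    rw [norm_pos_iff, sub_ne_zero]
    intro he
    refine hp ?_
    have := congrArg (fun z => (Real.exp (t / 2) : ℂ) * z) he
    beta_reduce at this
    rw [← mul_assoc, ← mul_assoc, ← Complex.ofReal_mul, ← Complex.ofReal_mul, ← Real.exp_add,
      ← Real.exp_add] at this
    simpa using this
  have hs : 0 < √(p.1.re * p.2.re) := by linarith
  simp only [dilDist]
  rw [ringProfile_eq (div_pos hn hs), Real.log_div hn.ne' hs.ne', Real.log_sqrt (by linarith)]
  field_simp; ring

theorem integrable_log_re (h : AxisPatch S c β m) :
    Integrable (fun p => axisWeight p * Real.log (p.1.re * p.2.re)) (pairMeasure S) := by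
  refine h.integrable_bounded (K := 4 * 4)
    (measurable_axisWeight.mul (Real.measurable_log.comp measurable_reProd)) fun x hx y hy => ?_
  obtain ⟨b1, b2, -, -⟩ := h.prod_bounds hx hy
  rw [abs_mul]
  gcongr
  · exact (h.axisWeight_bounds hx hy).2
  · have h1 := Real.log_le_sub_one_of_pos (by linarith : 0 < x.re * y.re)
    have h2 := Real.one_sub_inv_le_log_of_pos (by linarith : 0 < x.re * y.re)
    have h3 : (x.re * y.re)⁻¹ ≤ 4 := by rw [inv_le_comm₀ (by linarith) (by norm_num)]; linarith
    rw [abs_le]; constructor <;> linarith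

theorem integrable_log (h : AxisPatch S c β m) (t : ℝ) : Integrable (fun p => axisWeight p *
    Real.log ‖(Real.exp (t / 2) : ℂ) * p.1 - (Real.exp (-(t / 2)) : ℂ) * p.2‖) (pairMeasure S) :=
  integrable_log_pair h.measurableSet h.sub_two (Real.exp_pos _) (Real.exp_pos _)
    measurable_axisWeight fun _ hx _ hy => (h.axisWeight_bounds hx hy).2

theorem integrable_ringProfile (h : AxisPatch S c β m) (t : ℝ) :
    Integrable (fun p => axisWeight p * ringProfile (dilDist t p)) (pairMeasure S) :=
  ((((h.integrable_log t).const_mul _).add (h.integrable_log_re.const_mul _)).add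
    (h.integrable_regProfile t)).congr ((h.ringProfile_ae t).mono fun _ hp => hp.symm)

theorem dilEnergy_eq (h : AxisPatch S c β m) (t : ℝ) : dilEnergy S t =
    -(1 / (2 * π)) * (∫ p, axisWeight p *
        Real.log ‖(Real.exp (t / 2) : ℂ) * p.1 - (Real.exp (-(t / 2)) : ℂ) * p.2‖ ∂pairMeasure S) +
      1 / (4 * π) * (∫ p, axisWeight p * Real.log (p.1.re * p.2.re) ∂pairMeasure S) +
      regEnergy S t := by
  have i1 := (h.integrable_log t).const_mul (-(1 / (2 * π)))
  have i2 := h.integrable_log_re.const_mul (1 / (4 * π))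
  have i3 : Integrable (fun p : ℂ × ℂ => -(1 / (2 * π)) * (axisWeight p *
        Real.log ‖(Real.exp (t / 2) : ℂ) * p.1 - (Real.exp (-(t / 2)) : ℂ) * p.2‖) +
      1 / (4 * π) * (axisWeight p * Real.log (p.1.re * p.2.re))) (pairMeasure S) := i1.add i2
  rw [dilEnergy, integral_congr_ae (h.ringProfile_ae t),
    integral_add i3 (h.integrable_regProfile t), ← integral_const_mul,
    ← integral_const_mul, ← integral_add i1 i2]
  rfl

theorem dilEnergy_ge (h : AxisPatch S c β m) {t : ℝ} (ht : |t| ≤ 1) :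
    dilEnergy S 0 - logError S 2 t + (regEnergy S t - regEnergy S 0) ≤ dilEnergy S t := by
  have hd := dilated_log_energy_le h.measurableSet h.sub_two zero_le_two measurable_axisWeight
    axisWeight_swap (M := 4) (fun x hx y hy => (h.axisWeight_bounds hx hy).2)
    (fun x hx y hy => (h.axisWeight_bounds hx hy).1) ht
  rw [h.dilEnergy_eq t, h.dilEnergy_eq 0]
  simp only [zero_div, neg_zero, Real.exp_zero, Complex.ofReal_one, one_mul]
  have hl0 : 0 ≤ logError S 2 t :=
    integral_nonneg fun p => (log_error_bound 2 t _ zero_le_two (norm_nonneg _)).1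
  have hpi := Real.pi_gt_three
  have hc : 1 / (2 * π) * (4 / 2 * logError S 2 t) ≤ 1 * logError S 2 t := by
    rw [← mul_assoc]
    gcongr
    rw [div_mul_eq_mul_div, div_le_one (by positivity)]; linarith
  have hd' := mul_le_mul_of_nonneg_left hd (by positivity : 0 ≤ 1 / (2 * π))
  rw [mul_add] at hd'
  linarith

end AxisPatch

namespace AxisPatch
variable {S : Set ℂ} {c β m : ℝ}

/-- The relative stream function of an axis patch, divided by the squared distance to the axis. -/
def relStream (S : Set ℂ) (c β m : ℝ) (x : ℂ) : ℝ :=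
  c * (∫ x' in S, ringKern x x') - β - m / x.re ^ 2

theorem continuousOn_pow_re_integrable (h : AxisPatch S c β m) (n : ℕ) :
    IntegrableOn (fun x : ℂ => x.re ^ n) S :=
  ((Complex.continuous_re.pow n).continuousOn.integrableOn_compact
    (isCompact_closedBall (1 : ℂ) (1 / 4))).mono_set h.sub

theorem dilated_relStream_eq (h : AxisPatch S c β m) (t : ℝ) {x : ℂ} (hx : x ∈ S) :
    x.re * ((Real.exp t • x).re ^ 2 * relStream S c β m (Real.exp t • x)) =
      c * Real.exp (t / 2) * (∫ x' in S, axisWeight (x, x') * ringProfile (dilDist t (x, x'))) -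
        β * Real.exp (2 * t) * x.re ^ 3 - m * x.re ^ 1 := by
  have hx0 : 0 < x.re := by linarith [(h.re_bounds hx).1]
  have hre : (Real.exp t • x).re = Real.exp t * x.re := by
    rw [Complex.real_smul, Complex.re_ofReal_mul]
  have hi : x.re * ((Real.exp t • x).re ^ 2 * ∫ x' in S, ringKern (Real.exp t • x) x') =
      Real.exp (t / 2) * ∫ x' in S, axisWeight (x, x') * ringProfile (dilDist t (x, x')) := by
    rw [← integral_const_mul, ← integral_const_mul, ← integral_const_mul]
    exact setIntegral_congr_fun h.measurableSet fun x' hx' =>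
      re_mul_ringKern_dilated hx0 (by linarith [(h.re_bounds hx').1]) t
  have he : Real.exp (2 * t) = Real.exp t ^ 2 := by
    rw [← Real.exp_nat_mul]; norm_num
  have hm : x.re * ((Real.exp t * x.re) ^ 2 * (m / (Real.exp t * x.re) ^ 2)) = m * x.re ^ 1 := by
    have := Real.exp_pos t
    field_simp
  rw [relStream, mul_assoc c, ← hi, he, ← hm, hre]
  ring

theorem integrableOn_dilated (h : AxisPatch S c β m) (t : ℝ) : IntegrableOn
    (fun x : ℂ => x.re * ((Real.exp t • x).re ^ 2 * relStream S c β m (Real.exp t • x))) S := by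
  have := h.finite
  have i1 := ((h.integrable_ringProfile t).integral_prod_left).const_mul (c * Real.exp (t / 2))
  have i2 := (h.continuousOn_pow_re_integrable 3).const_mul (β * Real.exp (2 * t))
  have i3 := (h.continuousOn_pow_re_integrable 1).const_mul m
  refine IntegrableOn.congr_fun (i1.sub i2 |>.sub i3) (fun x hx => ?_) h.measurableSet
  exact (h.dilated_relStream_eq t hx).symm

theorem integral_dilated_eq (h : AxisPatch S c β m) (t : ℝ) :
    ∫ x in S, x.re * ((Real.exp t • x).re ^ 2 * relStream S c β m (Real.exp t • x)) =
      c * Real.exp (t / 2) * dilEnergy S t - β * Real.exp (2 * t) * (∫ x in S, x.re ^ 3) -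
        m * ∫ x in S, x.re ^ 1 := by
  have := h.finite
  have i1 := ((h.integrable_ringProfile t).integral_prod_left).const_mul (c * Real.exp (t / 2))
  have i2 := (h.continuousOn_pow_re_integrable 3).const_mul (β * Real.exp (2 * t))
  have i3 := (h.continuousOn_pow_re_integrable 1).const_mul m
  have i4 : Integrable (fun x : ℂ => c * Real.exp (t / 2) *
      (∫ x' in S, axisWeight (x, x') * ringProfile (dilDist t (x, x'))) -
        β * Real.exp (2 * t) * x.re ^ 3) (volume.restrict S) := i1.sub i2
  rw [setIntegral_congr_fun h.measurableSet fun x hx => h.dilated_relStream_eq t hx,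
    integral_sub i4 i3, integral_sub i1 i2, integral_const_mul, integral_const_mul,
    integral_const_mul, dilEnergy, pairMeasure, integral_prod _ (h.integrable_ringProfile t)]

theorem integral_dilated_le (h : AxisPatch S c β m) {t : ℝ} (ht : |Real.exp t - 1| ≤ 1 / 8) :
    ∫ x in S, x.re * ((Real.exp t • x).re ^ 2 * relStream S c β m (Real.exp t • x)) ≤
      Real.exp (-3 * t) * ∫ x in S, x.re ^ 3 * relStream S c β m x := by
  set V := relStream S c β m
  set F : ℂ → ℝ := fun x => x.re ^ 3 * V x with hF
  have hpos := Real.exp_pos t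
  have hre : ∀ x : ℂ, (Real.exp t • x).re = Real.exp t * x.re := fun x => by
    rw [Complex.real_smul, Complex.re_ofReal_mul]
  have hFi : IntegrableOn F S := by
    refine (h.integrableOn_dilated 0).congr_fun (fun x _ => ?_) h.measurableSet
    simp only [Real.exp_zero, one_smul, hF, V]; ring
  have hFi' : Integrable (S.indicator F) := hFi.integrable_indicator h.measurableSet
  have hrew : ∀ x : ℂ, x.re * ((Real.exp t • x).re ^ 2 * V (Real.exp t • x)) =
      (Real.exp t)⁻¹ * F (Real.exp t • x) := fun x => by
    simp only [hF, hre]; field_simp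
  have hnear : ∀ x ∈ S, ‖x - 1‖ ≤ 1 / 2 := fun x hx => by
    have := h.sub hx
    rw [Metric.mem_closedBall, dist_eq_norm] at this
    linarith
  have h1 := h.integrableOn_dilated t
  have h2 : IntegrableOn (fun x => (Real.exp t)⁻¹ * S.indicator F (Real.exp t • x)) S :=
    ((hFi'.comp_smul hpos.ne').integrableOn).const_mul _
  calc ∫ x in S, x.re * ((Real.exp t • x).re ^ 2 * V (Real.exp t • x))
      ≤ ∫ x in S, (Real.exp t)⁻¹ * S.indicator F (Real.exp t • x) := by
        refine setIntegral_mono_on h1 h2 h.measurableSet fun x hx => ?_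
        by_cases hz : Real.exp t • x ∈ S
        · rw [Set.indicator_of_mem hz, hrew]
        · rw [Set.indicator_of_notMem hz, mul_zero]
          have hn : ‖Real.exp t • x - 1‖ ≤ 1 / 2 := by
            have e : Real.exp t • x - 1 = (Real.exp t - 1) • x + (x - 1) := by
              rw [sub_smul, one_smul]; ring
            have h3 := h.sub hx
            rw [Metric.mem_closedBall, dist_eq_norm] at h3
            rw [e]
            refine (norm_add_le _ _).trans ?_
            rw [norm_smul, Real.norm_eq_abs]
            have := mul_le_mul ht (h.norm_le hx) (norm_nonneg _) (by norm_num)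
            linarith
          have hV := not_lt.1 ((h.mem_iff _ hn).not.1 hz)
          have hx0 : 0 < x.re := by linarith [(h.re_bounds hx).1]
          exact mul_nonpos_of_nonneg_of_nonpos hx0.le
            (mul_nonpos_of_nonneg_of_nonpos (sq_nonneg _) hV)
    _ = (Real.exp t)⁻¹ * ((Real.exp t ^ 2)⁻¹ * ∫ x in Real.exp t • S, S.indicator F x) := by
        rw [integral_const_mul, Measure.setIntegral_comp_smul_of_pos volume _ _ hpos,
          Complex.finrank_real_complex, smul_eq_mul]
    _ ≤ (Real.exp t)⁻¹ * ((Real.exp t ^ 2)⁻¹ * ∫ x, S.indicator F x) := by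
        gcongr
        · refine ae_of_all _ fun x => Set.indicator_nonneg (fun z hz => ?_) x
          have hz0 : 0 < z.re := by linarith [(h.re_bounds hz).1]
          exact mul_nonneg (by positivity) ((h.mem_iff z (hnear z hz)).1 hz).le
        · exact Measure.restrict_le_self
    _ = _ := by
        rw [integral_indicator h.measurableSet, ← mul_assoc, ← mul_inv, ← pow_succ',
          ← Real.exp_nat_mul, ← Real.exp_neg]
        congr 2; push_cast; ring

/-- If `f ≤ r` near `0` with `f 0 = 0`, `f` differentiable at `0` and `r = o(t)`, then `f'(0) = 0`. -/
theorem deriv_eq_zero_of_le {f r : ℝ → ℝ} {d : ℝ} (hf : HasDerivAt f d 0) (h0 : f 0 = 0)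
    (hr : Tendsto (fun t => r t / t) (nhdsWithin 0 {0}ᶜ) (nhds 0))
    (hle : ∀ᶠ t in nhds 0, f t ≤ r t) : d = 0 := by
  have t1 : Tendsto (fun t : ℝ => f t / t) (nhdsWithin 0 {0}ᶜ) (nhds d) := by
    have := hasDerivAt_iff_tendsto_slope_zero.1 hf
    simpa [div_eq_inv_mul, h0] using this
  have gtle : nhdsWithin (0 : ℝ) (Set.Ioi 0) ≤ nhdsWithin 0 {0}ᶜ :=
    nhdsWithin_mono _ fun t ht => ne_of_gt ht
  have ltle : nhdsWithin (0 : ℝ) (Set.Iio 0) ≤ nhdsWithin 0 {0}ᶜ :=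
    nhdsWithin_mono _ fun t ht => ne_of_lt ht
  refine le_antisymm ?_ ?_
  · refine le_of_tendsto_of_tendsto (t1.mono_left gtle) (hr.mono_left gtle) ?_
    filter_upwards [self_mem_nhdsWithin, nhdsWithin_le_nhds hle] with t (ht : 0 < t) hev
    gcongr
  · refine le_of_tendsto_of_tendsto (hr.mono_left ltle) (t1.mono_left ltle) ?_
    filter_upwards [self_mem_nhdsWithin, nhdsWithin_le_nhds hle] with t (ht : t < 0) hev
    exact div_le_div_of_nonpos_of_le ht.le hev

/-- The virial identity for dilations centred on the axis of symmetry. -/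
theorem axis_virial (h : AxisPatch S c β m) :
    7 * ∫ x in S, x.re ^ 3 * relStream S c β m x =
      3 * β * (∫ x in S, x.re ^ 3) - m * ∫ x in S, x.re ^ 1 := by
  set I := ∫ x in S, x.re ^ 3 * relStream S c β m x with hI
  set P := ∫ x in S, x.re ^ 3
  set M := ∫ x in S, x.re ^ 1
  set J := dilEnergy S 0 with hJ
  have hI0 : I = c * J - β * P - m * M := by
    have := h.integral_dilated_eq 0
    simp only [Real.exp_zero, one_smul, zero_div, mul_zero, mul_one] at this
    rw [← this, hI]
    exact setIntegral_congr_fun h.measurableSet fun x _ => by ring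
  have ev : ∀ᶠ t : ℝ in nhds 0, |t| ≤ 1 ∧ |Real.exp t - 1| ≤ 1 / 8 := by
    have a : ∀ᶠ t : ℝ in nhds 0, |t| < 1 / 16 :=
      (continuous_abs.tendsto' (0 : ℝ) 0 (by simp)).eventually_lt_const (by norm_num)
    filter_upwards [a] with t h1
    have := Real.abs_exp_sub_one_le (by linarith : |t| ≤ 1)
    constructor <;> linarith
  set r : ℝ → ℝ := fun t => c * Real.exp (t / 2) *
    (logError S 2 t - (regEnergy S t - regEnergy S 0)) with hr
  have hrt : Tendsto (fun t => r t / t) (nhdsWithin 0 {0}ᶜ) (nhds 0) := by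
    have h1 : Tendsto (fun t : ℝ => c * Real.exp (t / 2)) (nhdsWithin 0 {0}ᶜ) (nhds (c * 1)) := by
      refine Tendsto.mono_left ?_ nhdsWithin_le_nhds
      have : Continuous fun t : ℝ => c * Real.exp (t / 2) := by fun_prop
      simpa using this.tendsto 0
    have h2 := h1.mul ((tendsto_logError h.volume_ne_top zero_le_two).sub h.tendsto_regEnergy)
    simp only [sub_zero, mul_zero] at h2
    exact h2.congr fun t => by simp only [hr]; ring
  have hd : HasDerivAt (fun t : ℝ => c * J * Real.exp (t / 2) - β * P * Real.exp (2 * t) - m * M -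
      Real.exp (-3 * t) * I) (c * J * (1 / 2) - β * P * 2 + 3 * I) 0 := by
    have d1 := (((hasDerivAt_id (0 : ℝ)).div_const 2).exp).const_mul (c * J)
    have d2 := (((hasDerivAt_id (0 : ℝ)).const_mul 2).exp).const_mul (β * P)
    have d3 := (((hasDerivAt_id (0 : ℝ)).const_mul (-3)).exp).mul_const I
    exact (((d1.sub d2).sub_const (m * M)).sub d3).congr_deriv (by simp)
  have hz := deriv_eq_zero_of_le hd (by simp [hI0]) hrt (by
    filter_upwards [ev] with t ht
    have h1 := h.integral_dilated_le ht.2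
    rw [h.integral_dilated_eq t, ← hI] at h1
    have h2 := mul_le_mul_of_nonneg_left (h.dilEnergy_ge ht.1)
      (mul_nonneg h.nonneg (Real.exp_pos (t / 2)).le)
    simp only [hr]
    nlinarith)
  rw [hI0] at hz ⊢
  linarith

end AxisPatch

theorem setIntegral_comp_affine {E : Type*} [NormedAddCommGroup E] [NormedSpace ℝ E] {q : ℝ}
    (hq : 0 < q) (p : ℂ) (f : ℂ → E) (S : Set ℂ) :
    ∫ y in (fun y : ℂ => p + (q : ℂ) * y) ⁻¹' S, f (p + (q : ℂ) * y) = (q ^ 2)⁻¹ • ∫ x in S, f x := by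
  have h := Measure.setIntegral_comp_smul_of_pos volume (fun x => f (p + x))
    ((fun y : ℂ => p + (q : ℂ) * y) ⁻¹' S) hq
  have e : q • ((fun y : ℂ => p + (q : ℂ) * y) ⁻¹' S) = (fun x => p + x) ⁻¹' S := by
    ext x
    rw [Set.mem_smul_set_iff_inv_smul_mem₀ hq.ne', Set.mem_preimage, Set.mem_preimage,
      Complex.real_smul, ← mul_assoc, ← Complex.ofReal_mul, mul_inv_cancel₀ hq.ne',
      Complex.ofReal_one, one_mul]
  rw [e, Complex.finrank_real_complex, (measurePreserving_add_left volume p).setIntegral_preimage_emb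
    (MeasurableEquiv.addLeft p).measurableEmbedding] at h
  rw [← h]
  simp only [Complex.real_smul]

theorem setIntegral_ringKern_scaled {B : Set ℂ} {a : ℝ} (hB : MeasurableSet B)
    (hvol : volume.real B = π) (ha : 0 < a) (hs : ∀ y ∈ B, a * ‖y‖ ≤ 1 / 4) {y : ℂ}
    (hy : a * ‖y‖ ≤ 1 / 2) :
    ∫ w in B, ringKern (1 + (a : ℂ) * y) (1 + (a : ℂ) * w) =
      -Real.log a / 2 + logPot B y + regPot B a y := by
  have hpi := Real.pi_pos
  have hv : volume B ≠ ⊤ := fun h => by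
    rw [measureReal_def, h, ENNReal.toReal_top] at hvol
    exact hpi.ne hvol
  have hb : Bornology.IsBounded B := by
    refine Metric.isBounded_closedBall (x := (0 : ℂ)) (r := 1 / 4 / a) |>.subset fun y hy => ?_
    rw [mem_closedBall_zero_iff, le_div_iff₀ ha, mul_comm]
    exact hs y hy
  have hhalf : ∀ w ∈ B, a * ‖w‖ ≤ 1 / 2 := fun w hw => by linarith [hs w hw]
  obtain ⟨K, -, hK⟩ := regKern_bounded
  have hreg : IntegrableOn (fun w => regKern (1 + (a : ℂ) * y) (1 + (a : ℂ) * w)) B := by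
    refine Integrable.mono' (integrableOn_const hv (C := K))
      (measurable_regKern_scaled_right a y).aestronglyMeasurable ?_
    exact (ae_restrict_iff' hB).2 (ae_of_all _ fun w hw => hK a ha y w hy (hhalf w hw))
  have hlog := integrableOn_log_norm_sub hB hb y
  have hc : IntegrableOn (fun _ : ℂ => -(1 / (2 * π)) * Real.log a) B := integrableOn_const hv
  have hl : IntegrableOn (fun w : ℂ => -(1 / (2 * π)) * Real.log ‖y - w‖) B := hlog.const_mul _
  have hcl : IntegrableOn (fun w : ℂ => -(1 / (2 * π)) * Real.log a +
    -(1 / (2 * π)) * Real.log ‖y - w‖) B := hc.add hl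
  have hcongr : ∫ w in B, ringKern (1 + (a : ℂ) * y) (1 + (a : ℂ) * w) = ∫ w in B,
      (-(1 / (2 * π)) * Real.log a + -(1 / (2 * π)) * Real.log ‖y - w‖ +
        regKern (1 + (a : ℂ) * y) (1 + (a : ℂ) * w)) := by
    refine setIntegral_congr_ae hB ?_
    filter_upwards [Measure.ae_ne volume y] with w hwy hw
    have hne : 0 < ‖y - w‖ := norm_pos_iff.2 (sub_ne_zero.2 hwy.symm)
    have hxy : (1 + (a : ℂ) * y) ≠ 1 + (a : ℂ) * w := fun h => by
      have h1 := norm_scaled_sub y w ha.le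
      rw [h, sub_self, norm_zero] at h1
      have := mul_pos ha hne
      linarith
    rw [ringKern_eq (by rw [re_scaled]; linarith [(half_le_re ha.le hy).1])
      (by rw [re_scaled]; linarith [(half_le_re ha.le (hhalf w hw)).1]) hxy,
      norm_scaled_sub _ _ ha.le, Real.log_mul ha.ne' hne.ne']
    ring
  rw [hcongr, integral_add hcl hreg, integral_add hc hl, setIntegral_const, hvol, smul_eq_mul,
    integral_const_mul, logPot, regPot]
  field_simp

/-- The virial identity for dilations centred on the axis, in the scaled variables of a ring. -/
theorem Ring.axis_virial {B : Set ℂ} {a β m : ℝ} (h : Ring B a β m) :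
    7 * ∫ y in B, (1 + a * y.re) ^ 3 * ringPot B a β m y =
      3 * β * (∫ y in B, (1 + a * y.re) ^ 3) - m * π := by
  have ha := h.pos
  have hac : (a : ℂ) ≠ 0 := Complex.ofReal_ne_zero.2 ha.ne'
  set S : Set ℂ := (fun x : ℂ => (x - 1) / a) ⁻¹' B with hS
  have hpre : (fun y : ℂ => 1 + (a : ℂ) * y) ⁻¹' S = B := by
    ext y
    simp only [hS, Set.mem_preimage, add_sub_cancel_left, mul_div_cancel_left₀ _ hac]
  have hmem : ∀ y, 1 + (a : ℂ) * y ∈ S ↔ y ∈ B := fun y => by rw [← hpre]; rfl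
  have hx : ∀ x : ℂ, x = 1 + (a : ℂ) * ((x - 1) / a) := fun x => by field_simp; ring
  have hnx : ∀ x : ℂ, a * ‖(x - 1) / (a : ℂ)‖ = ‖x - 1‖ := fun x => by
    rw [norm_div, Complex.norm_real, Real.norm_of_nonneg ha.le]; field_simp
  have hint : ∀ f : ℂ → ℝ, ∫ x in S, f x = a ^ 2 * ∫ y in B, f (1 + (a : ℂ) * y) := fun f => by
    have := setIntegral_comp_affine ha 1 f S
    rw [hpre] at this
    rw [this, smul_eq_mul, mul_inv_cancel_left₀ (pow_ne_zero 2 ha.ne')]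
  have hrel : ∀ y : ℂ, a * ‖y‖ ≤ 1 / 2 →
      AxisPatch.relStream S (a ^ 2)⁻¹ β m (1 + (a : ℂ) * y) = ringPot B a β m y := fun y hy => by
    rw [AxisPatch.relStream, hint, inv_mul_cancel_left₀ (pow_ne_zero 2 ha.ne'), re_scaled,
      setIntegral_ringKern_scaled h.measurableSet h.area ha h.small hy, ringPot, ringCorr]
    ring
  have hA : AxisPatch S (a ^ 2)⁻¹ β m := by
    refine ⟨(by fun_prop : Measurable fun x : ℂ => (x - 1) / a) h.measurableSet, fun x hxS => ?_,
      by positivity, fun x hx1 => ?_⟩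
    · rw [Metric.mem_closedBall, dist_eq_norm, ← hnx]
      exact h.small _ hxS
    · have hy : a * ‖(x - 1) / (a : ℂ)‖ ≤ 1 / 2 := by rwa [hnx]
      have h1 := hrel _ hy
      rw [← hx, AxisPatch.relStream] at h1
      rw [h1]
      exact h.mem_iff _ hy
  have hv := hA.axis_virial
  rw [hint, hint, hint] at hv
  have h1 : ∫ y in B, (1 + (a : ℂ) * y).re ^ 3 * AxisPatch.relStream S (a ^ 2)⁻¹ β m (1 + (a : ℂ) * y)
      = ∫ y in B, (1 + a * y.re) ^ 3 * ringPot B a β m y :=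
    setIntegral_congr_fun h.measurableSet fun y hy => by
      rw [hrel y (h.half hy), re_scaled]
  have h2 : ∫ y in B, (1 + (a : ℂ) * y).re ^ 1 = π := by
    have hi : IntegrableOn (fun y : ℂ => y) B :=
      (continuous_id.continuousOn.integrableOn_compact
        h.bounded.isCompact_closure).mono_set subset_closure
    have hir : IntegrableOn (fun y : ℂ => a * y.re) B := hi.re.const_mul a
    have hc : IntegrableOn (fun _ : ℂ => (1 : ℝ)) B := integrableOn_const h.volume_ne_top
    have h0 : ∫ y in B, y.re = 0 := by
      have := integral_re (𝕜 := ℂ) hi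
      rw [h.centroid] at this
      simpa using this
    simp only [re_scaled, pow_one]
    rw [integral_add hc hir, setIntegral_const, h.area, integral_const_mul, h0, smul_eq_mul]
    ring
  rw [h1, h2] at hv
  simp only [re_scaled] at hv
  have ha2 : a ^ 2 ≠ 0 := pow_ne_zero 2 ha.ne'
  apply mul_left_cancel₀ ha2
  linarith

theorem self_mul_one_sub_log_le {a : ℝ} (ha : 0 < a) : a * (1 - Real.log a) ≤ 1 := by
  have h := Real.log_le_sub_one_of_pos (inv_pos.2 ha)
  rw [Real.log_inv] at h
  have h2 := mul_le_mul_of_nonneg_left h ha.le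
  rw [mul_sub, mul_inv_cancel₀ ha.ne'] at h2
  linarith

theorem sub_le_mul_abs_log_sub {a b : ℝ} (ha : 0 < a) (hb : 0 < b) :
    b - a ≤ b * |Real.log a - Real.log b| := by
  have h := Real.one_sub_inv_le_log_of_pos (div_pos hb ha)
  rw [Real.log_div hb.ne' ha.ne', inv_div] at h
  have h2 : 1 - a / b ≤ |Real.log a - Real.log b| := by
    rw [abs_sub_comm]; exact h.trans (le_abs_self _)
  calc b - a = b * (1 - a / b) := by field_simp
    _ ≤ _ := by gcongr

/-- Two nearly round rings, the first one being the thinner. -/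
structure RingPair (B₁ B₂ : Set ℂ) (a₁ a₂ β₁ β₂ m₁ m₂ τ : ℝ) : Prop where
  left : Ring B₁ a₁ β₁ m₁
  right : Ring B₂ a₂ β₂ m₂
  le : a₁ ≤ a₂
  le_eighth : a₂ ≤ 1 / 8
  round_left : RoundPatch B₁ (ringPot B₁ a₁ β₁ m₁) 0.45 τ
  round_right : RoundPatch B₂ (ringPot B₂ a₂ β₂ m₂) 0.45 τ
  tau_pos : 0 < τ
  tau_le : τ ≤ 1 / 40000

/-- The symmetric difference of two sets. -/
def symDiff (B₁ B₂ : Set ℂ) : Set ℂ := B₁ \ B₂ ∪ B₂ \ B₁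

/-- The signed indicator of the symmetric difference of two sets. -/
def signDiff (B₁ B₂ : Set ℂ) : ℂ → ℝ := signedInd (B₁ \ B₂) (B₂ \ B₁)

/-- The `L²` size of the angular width of the symmetric difference. -/
def gap (B₁ B₂ : Set ℂ) : ℝ := √(angularEnergy (symDiff B₁ B₂))

theorem gap_nonneg (B₁ B₂ : Set ℂ) : 0 ≤ gap B₁ B₂ := Real.sqrt_nonneg _

theorem sq_gap (B₁ B₂ : Set ℂ) : gap B₁ B₂ ^ 2 = angularEnergy (symDiff B₁ B₂) :=
  Real.sq_sqrt (angularEnergy_nonneg _)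

theorem continuousOn_ringPot {B : Set ℂ} {a β m : ℝ} (h : Ring B a β m) :
    ContinuousOn (ringPot B a β m) {y | a * ‖y‖ ≤ 1 / 2} := by
  obtain ⟨C, hC, hlip⟩ := Ring.ringCorr_lip
  refine (continuous_logPot h.measurableSet h.bounded).continuousOn.add ?_
  refine (LipschitzOnWith.of_dist_le_mul
    (K := Real.toNNReal (C * (a * (1 - Real.log a + m)))) fun x hx y hy => ?_).continuousOn
  have h1 := h.one_le_neg_log
  have h2 := h.m_nonneg
  have h3 := h.pos
  rw [Real.coe_toNNReal _ (mul_nonneg (by linarith) (mul_nonneg h3.le (by linarith))),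
    Real.dist_eq, dist_eq_norm]
  exact hlip B a β m h x y hx hy

namespace RingPair
variable {B₁ B₂ : Set ℂ} {a₁ a₂ β₁ β₂ m₁ m₂ τ : ℝ}

theorem le_two_left (h : RingPair B₁ B₂ a₁ a₂ β₁ β₂ m₁ m₂ τ) {y : ℂ} (hy : ‖y‖ ≤ 2) :
    a₁ * ‖y‖ ≤ 1 / 2 := by
  have h1 := h.left.pos
  have h2 := h.le
  have h3 := h.le_eighth
  nlinarith [norm_nonneg y]

theorem le_two_right (h : RingPair B₁ B₂ a₁ a₂ β₁ β₂ m₁ m₂ τ) {y : ℂ} (hy : ‖y‖ ≤ 2) :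
    a₂ * ‖y‖ ≤ 1 / 2 := by
  have h1 := h.right.pos
  have h3 := h.le_eighth
  nlinarith [norm_nonneg y]

theorem sub_left (h : RingPair B₁ B₂ a₁ a₂ β₁ β₂ m₁ m₂ τ) : B₁ ⊆ Metric.closedBall 0 2 :=
  h.round_left.outer.trans (Metric.closedBall_subset_closedBall (by linarith [h.tau_le]))

theorem sub_right (h : RingPair B₁ B₂ a₁ a₂ β₁ β₂ m₁ m₂ τ) : B₂ ⊆ Metric.closedBall 0 2 :=
  h.round_right.outer.trans (Metric.closedBall_subset_closedBall (by linarith [h.tau_le]))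

theorem measurable_diff_left (h : RingPair B₁ B₂ a₁ a₂ β₁ β₂ m₁ m₂ τ) : MeasurableSet (B₁ \ B₂) :=
  h.left.measurableSet.diff h.right.measurableSet

theorem measurable_diff_right (h : RingPair B₁ B₂ a₁ a₂ β₁ β₂ m₁ m₂ τ) : MeasurableSet (B₂ \ B₁) :=
  h.right.measurableSet.diff h.left.measurableSet

theorem measurableSet (h : RingPair B₁ B₂ a₁ a₂ β₁ β₂ m₁ m₂ τ) : MeasurableSet (symDiff B₁ B₂) :=
  h.measurable_diff_left.union h.measurable_diff_right

theorem measurable_sign (h : RingPair B₁ B₂ a₁ a₂ β₁ β₂ m₁ m₂ τ) : Measurable (signDiff B₁ B₂) :=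
  measurable_signedInd h.measurable_diff_left h.measurable_diff_right

theorem annulus (h : RingPair B₁ B₂ a₁ a₂ β₁ β₂ m₁ m₂ τ) {y : ℂ} (hy : y ∈ symDiff B₁ B₂) :
    1 - τ ≤ ‖y‖ ∧ ‖y‖ ≤ 1 + τ :=
  RoundPatch.mem_annulus h.round_left h.round_right hy

theorem sub_two (h : RingPair B₁ B₂ a₁ a₂ β₁ β₂ m₁ m₂ τ) :
    symDiff B₁ B₂ ⊆ Metric.closedBall 0 2 := fun y hy => by
  rw [mem_closedBall_zero_iff]
  linarith [(h.annulus hy).2, h.tau_le]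

theorem bounded (h : RingPair B₁ B₂ a₁ a₂ β₁ β₂ m₁ m₂ τ) :
    Bornology.IsBounded (symDiff B₁ B₂) :=
  Metric.isBounded_closedBall.subset h.sub_two

theorem volume_ne_top (h : RingPair B₁ B₂ a₁ a₂ β₁ β₂ m₁ m₂ τ) : volume (symDiff B₁ B₂) ≠ ⊤ :=
  h.bounded.measure_lt_top.ne

theorem volume_le (h : RingPair B₁ B₂ a₁ a₂ β₁ β₂ m₁ m₂ τ) :
    volume.real (symDiff B₁ B₂) ≤ 3 * gap B₁ B₂ := by
  have h1 := sq_volume_le_angularEnergy h.measurableSet h.sub_two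
  rw [← sq_gap] at h1
  have h0 := gap_nonneg B₁ B₂
  have hpi := Real.pi_lt_d2
  refine le_of_sq_le_sq (h1.trans ?_) (by positivity)
  nlinarith [sq_nonneg (gap B₁ B₂)]

/-- Integrals over the two cross-sections differ by the signed integral over the symmetric
difference. -/
theorem integral_sub_eq (h : RingPair B₁ B₂ a₁ a₂ β₁ β₂ m₁ m₂ τ) {E : Type*}
    [NormedAddCommGroup E] [NormedSpace ℝ E] {f : ℂ → E} (h1 : IntegrableOn f B₁)
    (h2 : IntegrableOn f B₂) :
    (∫ y in B₁, f y) - ∫ y in B₂, f y = ∫ y in symDiff B₁ B₂, signDiff B₁ B₂ y • f y := by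
  rw [symDiff, signDiff, integral_signedInd_smul h.measurable_diff_left h.measurable_diff_right
    ((h1.mono_set Set.sdiff_subset).union (h2.mono_set Set.sdiff_subset)),
    ← integral_inter_add_sdiff h.right.measurableSet h1,
    ← integral_inter_add_sdiff h.left.measurableSet h2, Set.inter_comm B₂ B₁]
  abel

theorem integral_sign (h : RingPair B₁ B₂ a₁ a₂ β₁ β₂ m₁ m₂ τ) :
    ∫ y in symDiff B₁ B₂, signDiff B₁ B₂ y = 0 := by
  have h1 := h.integral_sub_eq (f := fun _ => (1 : ℝ)) (integrableOn_const h.left.volume_ne_top)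
    (integrableOn_const h.right.volume_ne_top)
  simpa [h.left.area, h.right.area] using h1.symm

theorem integrableOn_id {B : Set ℂ} (hB : B ⊆ Metric.closedBall 0 2) :
    IntegrableOn (fun y : ℂ => y) B :=
  (continuous_id.continuousOn.integrableOn_compact (isCompact_closedBall 0 2)).mono_set hB

theorem integral_diff_eq (h : RingPair B₁ B₂ a₁ a₂ β₁ β₂ m₁ m₂ τ) :
    ∫ y in B₁ \ B₂, y = ∫ y in B₂ \ B₁, y := by
  have i1 := integrableOn_id h.sub_left
  have i2 := integrableOn_id h.sub_right
  have e1 := integral_inter_add_sdiff h.right.measurableSet i1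
  have e2 := integral_inter_add_sdiff h.left.measurableSet i2
  rw [h.left.centroid] at e1
  rw [h.right.centroid, Set.inter_comm] at e2
  exact add_left_cancel (e1.trans e2.symm)

/-- A bounded function integrated against the signed indicator. -/
theorem abs_integral_sign_le (h : RingPair B₁ B₂ a₁ a₂ β₁ β₂ m₁ m₂ τ) {f : ℂ → ℝ} {K : ℝ}
    (hK : 0 ≤ K) (hf : ∀ y ∈ symDiff B₁ B₂, |f y| ≤ K) :
    |∫ y in symDiff B₁ B₂, signDiff B₁ B₂ y * f y| ≤ 3 * K * gap B₁ B₂ := by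
  have h1 := norm_setIntegral_le_of_norm_le_const (μ := volume) (s := symDiff B₁ B₂) (C := K)
    (f := fun y => signDiff B₁ B₂ y * f y) h.volume_ne_top.lt_top fun y hy => by
      rw [Real.norm_eq_abs, abs_mul]
      have := abs_signedInd_le (B₁ \ B₂) (B₂ \ B₁) y
      calc _ ≤ 1 * K := by gcongr; exacts [this, hf y hy]
        _ = K := one_mul K
  have h2 := mul_le_mul_of_nonneg_left h.volume_le hK
  rw [Real.norm_eq_abs] at h1
  linarith

theorem integrableOn_continuousOn {B : Set ℂ} (hB : B ⊆ Metric.closedBall 0 2) {f : ℂ → ℝ}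
    (hf : ContinuousOn f (Metric.closedBall 0 2)) : IntegrableOn f B :=
  (hf.integrableOn_compact (isCompact_closedBall 0 2)).mono_set hB

theorem continuousOn_left (h : RingPair B₁ B₂ a₁ a₂ β₁ β₂ m₁ m₂ τ) :
    ContinuousOn (ringPot B₁ a₁ β₁ m₁) (Metric.closedBall 0 2) :=
  (continuousOn_ringPot h.left).mono fun _ hy => h.le_two_left (mem_closedBall_zero_iff.1 hy)

theorem continuousOn_right (h : RingPair B₁ B₂ a₁ a₂ β₁ β₂ m₁ m₂ τ) :
    ContinuousOn (ringPot B₂ a₂ β₂ m₂) (Metric.closedBall 0 2) :=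
  (continuousOn_ringPot h.right).mono fun _ hy => h.le_two_right (mem_closedBall_zero_iff.1 hy)

end RingPair

theorem integrableOn_regKern_of_sub {B : Set ℂ} (hB : MeasurableSet B)
    (hs : B ⊆ Metric.closedBall 0 2) {a : ℝ} (ha : 0 < a) (ha' : a ≤ 1 / 8) {y : ℂ} (hy : ‖y‖ ≤ 2) :
    IntegrableOn (fun w => regKern (1 + (a : ℂ) * y) (1 + (a : ℂ) * w)) B := by
  obtain ⟨K, -, hK⟩ := regKern_bounded
  have hv : volume B ≠ ⊤ := (Metric.isBounded_closedBall.subset hs).measure_lt_top.ne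
  have h2 : ∀ z : ℂ, ‖z‖ ≤ 2 → a * ‖z‖ ≤ 1 / 2 := fun z hz => by nlinarith [norm_nonneg z]
  refine Integrable.mono' (integrableOn_const hv (C := K))
    (measurable_regKern_scaled_right a y).aestronglyMeasurable ?_
  exact (ae_restrict_iff' hB).2 (ae_of_all _ fun w hw =>
    hK a ha y w (h2 y hy) (h2 w (mem_closedBall_zero_iff.1 (hs hw))))

namespace RingPair
variable {B₁ B₂ : Set ℂ} {a₁ a₂ β₁ β₂ m₁ m₂ τ : ℝ}

theorem logPot_sub (h : RingPair B₁ B₂ a₁ a₂ β₁ β₂ m₁ m₂ τ) (y : ℂ) :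
    logPot B₁ y - logPot B₂ y = -(1 / (2 * π)) * ∫ w in symDiff B₁ B₂,
      signDiff B₁ B₂ w * Real.log ‖y - w‖ := by
  have := h.integral_sub_eq (integrableOn_log_norm_sub h.left.measurableSet h.left.bounded y)
    (integrableOn_log_norm_sub h.right.measurableSet h.right.bounded y)
  simp only [smul_eq_mul] at this
  rw [← this, logPot, logPot]
  ring

theorem annulus_half (h : RingPair B₁ B₂ a₁ a₂ β₁ β₂ m₁ m₂ τ) :
    ∀ w ∈ symDiff B₁ B₂, 1 / 2 ≤ ‖w‖ ∧ ‖w‖ ≤ 2 := fun w hw => by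
  have := h.annulus hw
  have := h.tau_le
  constructor <;> linarith

theorem regPot_sub_same_le : ∃ C : ℝ, 1 ≤ C ∧ ∀ B₁ B₂ a₁ a₂ β₁ β₂ m₁ m₂ τ,
    RingPair B₁ B₂ a₁ a₂ β₁ β₂ m₁ m₂ τ → ∀ y : ℂ, ‖y‖ ≤ 2 →
    |regPot B₁ a₁ y - regPot B₂ a₁ y| ≤ C * (a₁ * (1 - Real.log a₁) * gap B₁ B₂) := by
  obtain ⟨C, hC, hT⟩ := regKern_sub_const_le
  obtain ⟨D, hD, hlog⟩ := setIntegral_abs_log_le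
  refine ⟨24 * C + 4 * C * D, by nlinarith, fun B₁ B₂ a₁ a₂ β₁ β₂ m₁ m₂ τ h y hy => ?_⟩
  have ha := h.left.pos
  have ha8 : a₁ ≤ 1 / 8 := h.le.trans h.le_eighth
  have hl := h.left.one_le_neg_log
  have hG := gap_nonneg B₁ B₂
  have j1 := integrableOn_regKern_of_sub h.left.measurableSet h.sub_left ha ha8 hy
  have j2 := integrableOn_regKern_of_sub h.right.measurableSet h.sub_right ha ha8 hy
  have c1 : IntegrableOn (fun _ : ℂ => regProfile 0) B₁ := integrableOn_const h.left.volume_ne_top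
  have c2 : IntegrableOn (fun _ : ℂ => regProfile 0) B₂ := integrableOn_const h.right.volume_ne_top
  have e := h.integral_sub_eq (j1.sub c1) (j2.sub c2)
  simp only [Pi.sub_apply, smul_eq_mul] at e
  rw [integral_sub j1 c1, integral_sub j2 c2, setIntegral_const, setIntegral_const, h.left.area,
    h.right.area] at e
  have e2 : regPot B₁ a₁ y - regPot B₂ a₁ y = ∫ w in symDiff B₁ B₂, signDiff B₁ B₂ w *
      (regKern (1 + (a₁ : ℂ) * y) (1 + (a₁ : ℂ) * w) - regProfile 0) := by
    rw [← e, regPot, regPot]; ring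
  have hil := (integrableOn_log_norm_sub h.measurableSet h.bounded y).abs
  have hc : IntegrableOn (fun _ : ℂ => C * a₁ * (8 * (1 - Real.log a₁))) (symDiff B₁ B₂) :=
    integrableOn_const h.volume_ne_top
  have hil' : IntegrableOn (fun w : ℂ => C * a₁ * 4 * |Real.log ‖y - w‖|) (symDiff B₁ B₂) :=
    hil.const_mul _
  have hb : |∫ w in symDiff B₁ B₂, signDiff B₁ B₂ w *
      (regKern (1 + (a₁ : ℂ) * y) (1 + (a₁ : ℂ) * w) - regProfile 0)| ≤ ∫ w in symDiff B₁ B₂,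
      (C * a₁ * (8 * (1 - Real.log a₁)) + C * a₁ * 4 * |Real.log ‖y - w‖|) := by
    rw [← Real.norm_eq_abs]
    refine norm_integral_le_of_norm_le (hc.add hil') ?_
    filter_upwards [ae_restrict_mem h.measurableSet, Measure.ae_ne (volume.restrict _) y]
      with w hwS hwy
    have hw : ‖w‖ ≤ 2 := (h.annulus_half w hwS).2
    have hne : 0 < ‖y - w‖ := norm_pos_iff.2 (sub_ne_zero.2 hwy.symm)
    have h4 : ‖y - w‖ ≤ 4 := by linarith [norm_sub_le y w]
    have hk := hT _ _ (norm_scaled_le ha.le (h.le_two_left hy)) (norm_scaled_le ha.le (h.le_two_left hw))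
    have n0 : ∀ z : ℂ, ‖(1 + (a₁ : ℂ) * z) - 1‖ = a₁ * ‖z‖ := fun z => by
      rw [add_sub_cancel_left, norm_mul, Complex.norm_real, Real.norm_of_nonneg ha.le]
    rw [norm_scaled_sub _ _ ha.le, n0, n0] at hk
    have hlg : |Real.log (a₁ * ‖y - w‖)| ≤ -Real.log a₁ + |Real.log ‖y - w‖| := by
      rw [Real.log_mul ha.ne' hne.ne']
      refine (abs_add_le _ _).trans ?_
      rw [abs_of_nonpos (by linarith : Real.log a₁ ≤ 0)]
    rw [Real.norm_eq_abs, abs_mul]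
    have hs1 := abs_signedInd_le (B₁ \ B₂) (B₂ \ B₁) w
    have hL : 0 ≤ -Real.log a₁ + |Real.log ‖y - w‖| := by
      linarith [abs_nonneg (Real.log ‖y - w‖)]
    calc |signDiff B₁ B₂ w| * |regKern (1 + (a₁ : ℂ) * y) (1 + (a₁ : ℂ) * w) - regProfile 0|
        ≤ 1 * (C * (a₁ * 2 + a₁ * 2) + C * (a₁ * 4) * (-Real.log a₁ + |Real.log ‖y - w‖|)) := by
          refine mul_le_mul hs1 (hk.trans ?_) (abs_nonneg _) zero_le_one
          gcongr
      _ ≤ _ := by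
          have : 0 ≤ C * a₁ * (-Real.log a₁) :=
            mul_nonneg (by positivity) (by linarith)
          have : 0 ≤ C * a₁ := by positivity
          nlinarith
  rw [integral_add hc hil', setIntegral_const, integral_const_mul, smul_eq_mul] at hb
  have hl2 := hlog _ h.measurableSet h.annulus_half y hy
  have hv := h.volume_le
  rw [e2]
  have hX : 0 ≤ C * a₁ * (8 * (1 - Real.log a₁)) := mul_nonneg (by positivity) (by linarith)
  have k1 := mul_le_mul_of_nonneg_right hv hX
  have k2 := mul_le_mul_of_nonneg_left hl2 (by positivity : 0 ≤ C * a₁ * 4)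
  have k3 : 0 ≤ C * a₁ * 4 * (D * gap B₁ B₂) * -Real.log a₁ :=
    mul_nonneg (by positivity) (by linarith)
  change _ ≤ C * a₁ * 4 * (D * gap B₁ B₂) at k2
  nlinarith

theorem regPot_sub_le : ∃ C : ℝ, 1 ≤ C ∧ ∀ B₁ B₂ a₁ a₂ β₁ β₂ m₁ m₂ τ,
    RingPair B₁ B₂ a₁ a₂ β₁ β₂ m₁ m₂ τ → ∀ y : ℂ, ‖y‖ ≤ 2 →
    |regPot B₁ a₁ y - regPot B₂ a₂ y| ≤ C * (a₁ * (1 - Real.log a₁) * gap B₁ B₂) +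
      C * |Real.log a₁ - Real.log a₂| := by
  obtain ⟨C, hC, h1⟩ := regPot_sub_same_le
  obtain ⟨D, hD, h2⟩ := regKern_scaled_sub_le
  refine ⟨C + 4 * D, by linarith, fun B₁ B₂ a₁ a₂ β₁ β₂ m₁ m₂ τ h y hy => ?_⟩
  have ha := h.left.pos
  have ha8 : a₁ ≤ 1 / 8 := h.le.trans h.le_eighth
  have hl := h.left.one_le_neg_log
  have hG := gap_nonneg B₁ B₂
  have j1 := integrableOn_regKern_of_sub h.right.measurableSet h.sub_right ha ha8 hy
  have j2 := integrableOn_regKern_of_sub h.right.measurableSet h.sub_right h.right.pos h.le_eighth hy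
  have k1 := h1 _ _ _ _ _ _ _ _ _ h y hy
  have k2 : |regPot B₂ a₁ y - regPot B₂ a₂ y| ≤ D * |Real.log a₁ - Real.log a₂| * π := by
    rw [regPot, regPot, ← integral_sub j1 j2, ← h.right.area, ← Real.norm_eq_abs]
    refine norm_setIntegral_le_of_norm_le_const h.right.volume_ne_top.lt_top fun w hw => ?_
    rw [Real.norm_eq_abs]
    exact h2 a₁ a₂ ha h.right.pos ha8 h.le_eighth y w hy
      (mem_closedBall_zero_iff.1 (h.sub_right hw))
  have k3 := abs_sub_le (regPot B₁ a₁ y) (regPot B₂ a₁ y) (regPot B₂ a₂ y)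
  have hδ := abs_nonneg (Real.log a₁ - Real.log a₂)
  have k4 : 0 ≤ D * (a₁ * (1 - Real.log a₁) * gap B₁ B₂) :=
    mul_nonneg (by linarith) (mul_nonneg (mul_nonneg ha.le (by linarith)) hG)
  have k5 : 0 ≤ C * |Real.log a₁ - Real.log a₂| := by positivity
  have k6 : D * |Real.log a₁ - Real.log a₂| * π ≤ D * |Real.log a₁ - Real.log a₂| * 4 := by
    gcongr; exact Real.pi_le_four
  linarith

theorem flux_sub_le : ∃ C : ℝ, 1 ≤ C ∧ ∀ B₁ B₂ a₁ a₂ β₁ β₂ m₁ m₂ τ,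
    RingPair B₁ B₂ a₁ a₂ β₁ β₂ m₁ m₂ τ → ∀ y : ℂ, ‖y‖ ≤ 2 →
    |m₁ / (1 + a₁ * y.re) ^ 2 - m₂ / (1 + a₂ * y.re) ^ 2 - (m₁ - m₂)| ≤
      C * |Real.log a₁ - Real.log a₂| + C * (a₁ * |m₁ - m₂|) := by
  obtain ⟨C, hC, hpar⟩ := Ring.params_le
  refine ⟨32 * C, by linarith, fun B₁ B₂ a₁ a₂ β₁ β₂ m₁ m₂ τ h y hy => ?_⟩
  have ha := h.left.pos
  have hb := h.right.pos
  have hre : |y.re| ≤ 2 := (Complex.abs_re_le_norm y).trans hy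
  have u1 := (half_le_re ha.le (h.le_two_left hy)).1
  have u2 := (half_le_re hb.le (h.le_two_right hy)).1
  have v1 := abs_inv_sq_sub_inv_sq_le u1 (by norm_num : (1 / 2 : ℝ) ≤ 1)
  have v2 := abs_inv_sq_sub_inv_sq_le u1 u2
  have hm2 := h.right.m_nonneg
  have hδ := abs_nonneg (Real.log a₁ - Real.log a₂)
  have w1 : |1 + a₁ * y.re - 1| ≤ a₁ * 2 := by
    rw [add_sub_cancel_left, abs_mul, abs_of_pos ha]; gcongr
  have w2 : |1 + a₁ * y.re - (1 + a₂ * y.re)| ≤ a₂ * |Real.log a₁ - Real.log a₂| * 2 := by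
    rw [show 1 + a₁ * y.re - (1 + a₂ * y.re) = -((a₂ - a₁) * y.re) by ring, abs_neg, abs_mul,
      abs_of_nonneg (by linarith [h.le])]
    have := sub_le_mul_abs_log_sub ha hb
    gcongr
  have e : m₁ / (1 + a₁ * y.re) ^ 2 - m₂ / (1 + a₂ * y.re) ^ 2 - (m₁ - m₂) =
    (m₁ - m₂) * (1 / (1 + a₁ * y.re) ^ 2 - 1 / 1 ^ 2) +
      m₂ * (1 / (1 + a₁ * y.re) ^ 2 - 1 / (1 + a₂ * y.re) ^ 2) := by ring
  have hm2a : m₂ * a₂ ≤ C := by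
    have h1 := (hpar _ _ _ _ h.right).1
    have h2 := self_mul_one_sub_log_le hb
    calc m₂ * a₂ ≤ C * (1 - Real.log a₂) * a₂ := by gcongr
      _ = C * (a₂ * (1 - Real.log a₂)) := by ring
      _ ≤ C * 1 := by gcongr
      _ = C := mul_one C
  rw [e]
  refine (abs_add_le _ _).trans ?_
  rw [abs_mul, abs_mul, abs_of_nonneg hm2]
  have x1 : |m₁ - m₂| * |1 / (1 + a₁ * y.re) ^ 2 - 1 / 1 ^ 2| ≤ |m₁ - m₂| * (16 * (a₁ * 2)) := by
    gcongr; exact v1.trans (by gcongr)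
  have x2 : m₂ * |1 / (1 + a₁ * y.re) ^ 2 - 1 / (1 + a₂ * y.re) ^ 2| ≤
      m₂ * (16 * (a₂ * |Real.log a₁ - Real.log a₂| * 2)) := by
    gcongr; exact v2.trans (by gcongr)
  have x3 := mul_le_mul_of_nonneg_right hm2a hδ
  have x4 : 0 ≤ a₁ * |m₁ - m₂| := by positivity
  nlinarith

/-- The potential difference of two nearly round rings, up to an additive constant, is the
logarithmic potential of the signed indicator up to a small error. -/
theorem ringPot_sub_le : ∃ C : ℝ, 1 ≤ C ∧ ∀ B₁ B₂ a₁ a₂ β₁ β₂ m₁ m₂ τ,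
    RingPair B₁ B₂ a₁ a₂ β₁ β₂ m₁ m₂ τ → ∀ y : ℂ, ‖y‖ ≤ 2 →
    |ringPot B₁ a₁ β₁ m₁ y - ringPot B₂ a₂ β₂ m₂ y - -(1 / (2 * π)) * (∫ w in symDiff B₁ B₂,
      signDiff B₁ B₂ w * Real.log ‖y - w‖) -
      (-(Real.log a₁ - Real.log a₂) / 2 - (β₁ - β₂) - (m₁ - m₂))| ≤
      C * (a₁ * (1 - Real.log a₁) * gap B₁ B₂ + |Real.log a₁ - Real.log a₂| + a₁ * |m₁ - m₂|) := by
  obtain ⟨C, hC, h1⟩ := regPot_sub_le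
  obtain ⟨D, hD, h2⟩ := flux_sub_le
  refine ⟨C + D, by linarith, fun B₁ B₂ a₁ a₂ β₁ β₂ m₁ m₂ τ h y hy => ?_⟩
  have k1 := h1 _ _ _ _ _ _ _ _ _ h y hy
  have k2 := h2 _ _ _ _ _ _ _ _ _ h y hy
  have ha := h.left.pos
  have hl := h.left.one_le_neg_log
  have x1 : 0 ≤ D * (a₁ * (1 - Real.log a₁) * gap B₁ B₂) :=
    mul_nonneg (by linarith) (mul_nonneg (mul_nonneg ha.le (by linarith)) (gap_nonneg _ _))
  have x2 : 0 ≤ C * (a₁ * |m₁ - m₂|) := by positivity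
  have e : ringPot B₁ a₁ β₁ m₁ y - ringPot B₂ a₂ β₂ m₂ y - -(1 / (2 * π)) *
      (∫ w in symDiff B₁ B₂, signDiff B₁ B₂ w * Real.log ‖y - w‖) -
      (-(Real.log a₁ - Real.log a₂) / 2 - (β₁ - β₂) - (m₁ - m₂)) =
      (regPot B₁ a₁ y - regPot B₂ a₂ y) -
        (m₁ / (1 + a₁ * y.re) ^ 2 - m₂ / (1 + a₂ * y.re) ^ 2 - (m₁ - m₂)) := by
    rw [← h.logPot_sub y]
    simp only [ringPot, ringCorr]
    ring
  rw [e]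
  refine (abs_sub _ _).trans ?_
  linarith

end RingPair

namespace RingPair
variable {B₁ B₂ : Set ℂ} {a₁ a₂ β₁ β₂ m₁ m₂ τ : ℝ}

theorem integrable_pair (h : RingPair B₁ B₂ a₁ a₂ β₁ β₂ m₁ m₂ τ) :
    Integrable (fun p : ℂ × ℂ => signDiff B₁ B₂ p.1 * signDiff B₁ B₂ p.2 * Real.log ‖p.1 - p.2‖)
      (pairMeasure (symDiff B₁ B₂)) := by
  refine integrable_log_pair_one h.measurableSet h.sub_two
    ((h.measurable_sign.comp measurable_fst).mul (h.measurable_sign.comp measurable_snd)) (M := 1)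
    fun x _ y _ => ?_
  have h1 := abs_signedInd_le (B₁ \ B₂) (B₂ \ B₁) x
  have h2 := abs_signedInd_le (B₁ \ B₂) (B₂ \ B₁) y
  rw [abs_mul]
  calc _ ≤ (1 : ℝ) * 1 := mul_le_mul h1 h2 (abs_nonneg _) zero_le_one
    _ = 1 := one_mul 1

theorem integrableOn_sign_mul (h : RingPair B₁ B₂ a₁ a₂ β₁ β₂ m₁ m₂ τ) {f : ℂ → ℝ}
    (hf : IntegrableOn f (symDiff B₁ B₂)) :
    IntegrableOn (fun y => signDiff B₁ B₂ y * f y) (symDiff B₁ B₂) :=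
  hf.bdd_mul h.measurable_sign.aestronglyMeasurable (c := 1)
    (ae_of_all _ fun y => by rw [Real.norm_eq_abs]; exact abs_signedInd_le _ _ y)

theorem integrable_sub (h : RingPair B₁ B₂ a₁ a₂ β₁ β₂ m₁ m₂ τ) :
    IntegrableOn (fun y => ringPot B₁ a₁ β₁ m₁ y - ringPot B₂ a₂ β₂ m₂ y) (symDiff B₁ B₂) :=
  integrableOn_continuousOn h.sub_two (h.continuousOn_left.sub h.continuousOn_right)

theorem width_le (h : RingPair B₁ B₂ a₁ a₂ β₁ β₂ m₁ m₂ τ) :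
    0.45 * gap B₁ B₂ ^ 2 ≤ (1 + τ) * ∫ y in symDiff B₁ B₂,
      signDiff B₁ B₂ y * (ringPot B₁ a₁ β₁ m₁ y - ringPot B₂ a₂ β₂ m₂ y) := by
  rw [sq_gap, ← angularEnergy_eq h.measurableSet h.sub_two, ← integral_const_mul,
    ← integral_const_mul]
  refine integral_mono_of_nonneg (ae_of_all _ fun y => ?_)
    ((h.integrableOn_sign_mul h.integrable_sub).const_mul _) ?_
  · exact mul_nonneg (by norm_num) (angularWidth_nonneg _ _)
  · filter_upwards [ae_restrict_mem h.measurableSet] with y hy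
    exact RoundPatch.angularWidth_le_signed h.round_left h.round_right (by norm_num) h.tau_pos
      (by linarith [h.tau_le]) hy

theorem gap_le : ∃ C : ℝ, 1 ≤ C ∧ ∃ τ₀ : ℝ, 0 < τ₀ ∧ ∀ B₁ B₂ a₁ a₂ β₁ β₂ m₁ m₂ τ,
    RingPair B₁ B₂ a₁ a₂ β₁ β₂ m₁ m₂ τ → τ ≤ τ₀ → C * (a₁ * (1 - Real.log a₁)) ≤ 1 →
    gap B₁ B₂ ≤ C * (|Real.log a₁ - Real.log a₂| + a₁ * |m₁ - m₂|) := by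
  obtain ⟨C, hC, hF⟩ := ringPot_sub_le
  obtain ⟨τ₀, hτ₀, -, hlog⟩ := log_energy_le
  refine ⟨100 * C, by linarith, τ₀, hτ₀, fun B₁ B₂ a₁ a₂ β₁ β₂ m₁ m₂ τ h hτ hsmall => ?_⟩
  have hpi := Real.pi_pos
  set S := symDiff B₁ B₂ with hS
  set ζ := signDiff B₁ B₂ with hζ
  set G := gap B₁ B₂ with hG
  set D : ℂ → ℝ := fun y => ringPot B₁ a₁ β₁ m₁ y - ringPot B₂ a₂ β₂ m₂ y with hD
  set U : ℂ → ℝ := fun y => ∫ w in S, ζ w * Real.log ‖y - w‖ with hU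
  set c₀ : ℝ := -(Real.log a₁ - Real.log a₂) / 2 - (β₁ - β₂) - (m₁ - m₂) with hc₀
  set X := |Real.log a₁ - Real.log a₂| + a₁ * |m₁ - m₂| with hX
  have hG0 : 0 ≤ G := gap_nonneg _ _
  have ha := h.left.pos
  have hl := h.left.one_le_neg_log
  have hX0 : 0 ≤ X := by positivity
  have hη : 0 ≤ a₁ * (1 - Real.log a₁) := mul_nonneg ha.le (by linarith)
  have hI := h.integrable_pair
  have hUeq : ∀ y, (∫ w in S, ζ y * ζ w * Real.log ‖y - w‖) = ζ y * U y := fun y => by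
    rw [hU, ← integral_const_mul]
    exact integral_congr_ae (ae_of_all _ fun w => mul_assoc _ _ _)
  have iU : IntegrableOn (fun y => ζ y * U y) S := by
    have := hI.integral_prod_left
    exact this.congr (ae_of_all _ hUeq)
  have hlogE := hlog τ h.tau_pos hτ _ _ h.measurable_diff_left h.measurable_diff_right
    (fun y hy => h.annulus hy) h.integral_diff_eq
  have hEU : ∫ y in S, ζ y * U y = -∫ p, ζ p.1 * ζ p.2 * (-Real.log ‖p.1 - p.2‖) ∂(pairMeasure S) := by
    have : ∫ p, ζ p.1 * ζ p.2 * (-Real.log ‖p.1 - p.2‖) ∂(pairMeasure S) =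
        -∫ p, ζ p.1 * ζ p.2 * Real.log ‖p.1 - p.2‖ ∂(pairMeasure S) := by
      rw [← integral_neg]; congr 1; funext p; ring
    rw [this, neg_neg, pairMeasure, integral_prod _ hI]
    exact integral_congr_ae (ae_of_all _ fun y => (hUeq y).symm)
  have hEU' : -(1 / (2 * π)) * ∫ y in S, ζ y * U y ≤ 0.3 * G ^ 2 := by
    rw [hEU, hG, sq_gap, neg_mul_neg, div_mul_eq_mul_div, one_mul, div_le_iff₀ (by positivity)]
    calc _ ≤ _ := hlogE
      _ = _ := by rw [symDiff]; ring
  have iD : IntegrableOn (fun y => ζ y * D y) S := h.integrableOn_sign_mul h.integrable_sub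
  have iU' : IntegrableOn (fun y => -(1 / (2 * π)) * (ζ y * U y)) S := iU.const_mul _
  have iζ : IntegrableOn (fun y => c₀ * ζ y) S := by
    have : IntegrableOn (fun _ : ℂ => (1 : ℝ)) S := integrableOn_const h.volume_ne_top
    exact ((h.integrableOn_sign_mul this).congr (ae_of_all _ fun y => mul_one _)).const_mul c₀
  have iDU : IntegrableOn (fun y => ζ y * D y - -(1 / (2 * π)) * (ζ y * U y)) S := iD.sub iU'
  set K := C * (a₁ * (1 - Real.log a₁) * G + |Real.log a₁ - Real.log a₂| + a₁ * |m₁ - m₂|) with hK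
  have hK0 : 0 ≤ K := by positivity
  have hrem : |∫ y in S, ζ y * (D y - -(1 / (2 * π)) * U y - c₀)| ≤ 3 * K * G :=
    h.abs_integral_sign_le hK0 fun y hy => hF _ _ _ _ _ _ _ _ _ h y (h.annulus_half y hy).2
  have hexp : ∫ y in S, ζ y * (D y - -(1 / (2 * π)) * U y - c₀) =
      (∫ y in S, ζ y * D y) - -(1 / (2 * π)) * ∫ y in S, ζ y * U y := by
    have e : ∀ y, ζ y * (D y - -(1 / (2 * π)) * U y - c₀) =
      ζ y * D y - -(1 / (2 * π)) * (ζ y * U y) - c₀ * ζ y := fun y => by ring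
    simp only [e]
    rw [integral_sub iDU iζ, integral_sub iD iU', integral_const_mul, integral_const_mul,
      h.integral_sign, mul_zero, sub_zero]
  rw [hexp] at hrem
  have hw := h.width_le
  have h1 : ∫ y in S, ζ y * D y ≤ 0.3 * G ^ 2 + 3 * K * G := by
    have := (abs_le.1 hrem).2
    linarith
  have hτ1 := h.tau_pos
  have hτ2 := h.tau_le
  have h2 : 0.45 * G ^ 2 ≤ (1 + τ) * (0.3 * G ^ 2 + 3 * K * G) :=
    hw.trans (by gcongr)
  have h3 : (1 + τ) * (0.3 * G ^ 2 + 3 * K * G) ≤ 1.1 * (0.3 * G ^ 2 + 3 * K * G) := by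
    gcongr; linarith
  have hKX : K = C * (a₁ * (1 - Real.log a₁)) * G + C * X := by rw [hK, hX]; ring
  rcases hG0.eq_or_lt with h0 | h0
  · rw [← h0]; positivity
  · have h4 : 0.12 * G ≤ 3.3 * K := by
      refine le_of_mul_le_mul_right ?_ h0
      nlinarith
    have h5 : C * (a₁ * (1 - Real.log a₁)) * G ≤ 0.01 * G := by
      gcongr; linarith
    nlinarith [mul_nonneg (by linarith : 0 ≤ C) hX0]

end RingPair

theorem closure_subset_nonneg {B : Set ℂ} {V : ℂ → ℝ} (hB : B ⊆ Metric.closedBall 0 2)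
    (hV : ContinuousOn V (Metric.closedBall 0 2)) (hpos : ∀ y ∈ B, 0 < V y) :
    closure B ⊆ Metric.closedBall 0 2 ∩ V ⁻¹' Set.Ici 0 :=
  closure_minimal (fun y hy => ⟨hB hy, (hpos y hy).le⟩)
    (hV.preimage_isClosed_of_isClosed Metric.isClosed_closedBall isClosed_Ici)

theorem frontier_nonempty_of_sub {B : Set ℂ} (hB : B ⊆ Metric.closedBall 0 2) (hne : B.Nonempty) :
    (frontier B).Nonempty := by
  refine nonempty_frontier_iff.2 ⟨hne, fun h => ?_⟩
  have : (3 : ℂ) ∈ B := h ▸ Set.mem_univ _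
  have := mem_closedBall_zero_iff.1 (hB this)
  norm_num at this

/-- The potentials of two positivity sets of the same area are not strictly ordered. -/
theorem exists_le_of_volume_eq {B₁ B₂ : Set ℂ} {V₁ V₂ : ℂ → ℝ} (ho : IsOpen B₁)
    (hne : B₁.Nonempty) (hm : MeasurableSet B₂) (h1 : B₁ ⊆ Metric.closedBall 0 2)
    (h2 : B₂ ⊆ Metric.closedBall 0 2) (hvol : volume.real B₁ = volume.real B₂)
    (hV₁ : ∀ y, ‖y‖ ≤ 2 → (y ∈ B₁ ↔ 0 < V₁ y)) (hV₂ : ∀ y, ‖y‖ ≤ 2 → (y ∈ B₂ ↔ 0 < V₂ y))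
    (hc : ContinuousOn V₂ (Metric.closedBall 0 2)) : ∃ y, ‖y‖ ≤ 2 ∧ V₁ y ≤ V₂ y := by
  by_contra! hlt
  have hsub : B₂ ⊆ B₁ := fun y hy => by
    have hy2 := mem_closedBall_zero_iff.1 (h2 hy)
    exact (hV₁ y hy2).2 (((hV₂ y hy2).1 hy).trans (hlt y hy2))
  have hfin : volume B₁ ≠ ⊤ := (Metric.isBounded_closedBall.subset h1).measure_lt_top.ne
  have hzero : volume (B₁ \ B₂) = 0 := by
    have := measureReal_sdiff (μ := volume) hsub hm (h₁ := hfin)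
    rw [hvol, sub_self, measureReal_eq_zero_iff (measure_ne_top_of_subset Set.sdiff_subset hfin)]
      at this
    exact this
  obtain ⟨z, hz⟩ := frontier_nonempty_of_sub h1 hne
  rw [ho.frontier_eq] at hz
  have hz2 : z ∈ closure B₂ := by
    rw [_root_.mem_closure_iff]
    intro o hoo hzo
    by_contra hempty
    have hn : (o ∩ B₁).Nonempty := _root_.mem_closure_iff.1 hz.1 o hoo hzo
    refine ((hoo.inter ho).measure_pos volume hn).ne' (measure_mono_null (t := B₁ \ B₂)
      (fun y hy => ⟨hy.2, fun hy2 =>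
      hempty ⟨y, hy.1, hy2⟩⟩) hzero)
  have hz3 := closure_subset_nonneg h2 hc (fun y hy =>
    (hV₂ y (mem_closedBall_zero_iff.1 (h2 hy))).1 hy) hz2
  have hzn := mem_closedBall_zero_iff.1 hz3.1
  exact hz.2 ((hV₁ z hzn).2 (lt_of_le_of_lt hz3.2 (hlt z hzn)))

/-- The relative stream function of a nearly round ring is bounded near its cross-section. -/
theorem abs_ringPot_le : ∃ C : ℝ, 1 ≤ C ∧ ∀ B a β m τ, Ring B a β m → a ≤ 1 / 8 → τ ≤ 1 →
    RoundPatch B (ringPot B a β m) 0.45 τ → ∀ y : ℂ, ‖y‖ ≤ 2 → |ringPot B a β m y| ≤ C := by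
  obtain ⟨C, hC, hlip⟩ := Ring.ringCorr_lip
  obtain ⟨D, hD, hpar⟩ := Ring.params_le
  refine ⟨12 + C * (1 + D) * 4, by nlinarith, fun B a β m τ h ha hτ hr y hy => ?_⟩
  have hap := h.pos
  have hs : ∀ z : ℂ, ‖z‖ ≤ 2 → a * ‖z‖ ≤ 1 / 2 := fun z hz => by nlinarith [norm_nonneg z]
  have hB : B ⊆ Metric.closedBall 0 2 :=
    hr.outer.trans (Metric.closedBall_subset_closedBall (by linarith))
  have hcont : ContinuousOn (ringPot B a β m) (Metric.closedBall 0 2) :=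
    (continuousOn_ringPot h).mono fun _ hy => hs _ (mem_closedBall_zero_iff.1 hy)
  obtain ⟨z, hz⟩ := frontier_nonempty_of_sub hB h.nonempty
  rw [h.isOpen.frontier_eq] at hz
  have hz3 := closure_subset_nonneg hB hcont (fun y hy =>
    (hr.mem_iff y (mem_closedBall_zero_iff.1 (hB hy))).1 hy) hz.1
  have hzn := mem_closedBall_zero_iff.1 hz3.1
  have hz0 : ringPot B a β m z = 0 :=
    le_antisymm (not_lt.1 ((hr.mem_iff z hzn).not.1 hz.2)) hz3.2
  have hyz : ‖y - z‖ ≤ 4 := by linarith [norm_sub_le y z]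
  have k1 := logPot_lipschitz h.measurableSet h.bounded y z
  rw [h.area, div_self Real.pi_ne_zero] at k1
  have k2 := hlip B a β m h y z (hs y hy) (hs z hzn)
  have k3 : a * (1 - Real.log a + m) ≤ 1 + D := by
    have := self_mul_one_sub_log_le hap
    calc a * (1 - Real.log a + m) ≤ a * (1 - Real.log a + D * (1 - Real.log a)) := by
          gcongr; exact (hpar B a β m h).1
      _ = (1 + D) * (a * (1 - Real.log a)) := by ring
      _ ≤ (1 + D) * 1 := by gcongr
      _ = 1 + D := mul_one _
  have k4 : C * (a * (1 - Real.log a + m)) * ‖y - z‖ ≤ C * (1 + D) * 4 := by gcongr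
  have e : ringPot B a β m y = (logPot B y - logPot B z) +
      (ringCorr B a β m y - ringCorr B a β m z) + ringPot B a β m z := by
    simp only [ringPot]; ring
  rw [e, hz0, add_zero]
  refine (abs_add_le _ _).trans ?_
  linarith

namespace RingPair
variable {B₁ B₂ : Set ℂ} {a₁ a₂ β₁ β₂ m₁ m₂ τ : ℝ}

theorem ringPot_sub_const_le : ∃ C : ℝ, 1 ≤ C ∧ ∀ B₁ B₂ a₁ a₂ β₁ β₂ m₁ m₂ τ,
    RingPair B₁ B₂ a₁ a₂ β₁ β₂ m₁ m₂ τ → ∀ y : ℂ, ‖y‖ ≤ 2 →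
    |ringPot B₁ a₁ β₁ m₁ y - ringPot B₂ a₂ β₂ m₂ y -
      (-(Real.log a₁ - Real.log a₂) / 2 - (β₁ - β₂) - (m₁ - m₂))| ≤
      C * (gap B₁ B₂ + |Real.log a₁ - Real.log a₂| + a₁ * |m₁ - m₂|) := by
  obtain ⟨C, hC, hF⟩ := ringPot_sub_le
  obtain ⟨D, hD, hlog⟩ := setIntegral_abs_log_le
  refine ⟨C + D, by linarith, fun B₁ B₂ a₁ a₂ β₁ β₂ m₁ m₂ τ h y hy => ?_⟩
  have ha := h.left.pos
  have hG := gap_nonneg B₁ B₂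
  have k1 := hF _ _ _ _ _ _ _ _ _ h y hy
  have k2 : a₁ * (1 - Real.log a₁) * gap B₁ B₂ ≤ 1 * gap B₁ B₂ := by
    gcongr; exact self_mul_one_sub_log_le ha
  have k3 : |-(1 / (2 * π)) * ∫ w in symDiff B₁ B₂, signDiff B₁ B₂ w * Real.log ‖y - w‖| ≤
      D * gap B₁ B₂ := by
    have h1 : |∫ w in symDiff B₁ B₂, signDiff B₁ B₂ w * Real.log ‖y - w‖| ≤ D * gap B₁ B₂ := by
      refine le_trans ?_ (hlog _ h.measurableSet h.annulus_half y hy)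
      rw [← Real.norm_eq_abs]
      refine norm_integral_le_of_norm_le
        (integrableOn_log_norm_sub h.measurableSet h.bounded y).abs (ae_of_all _ fun w => ?_)
      rw [Real.norm_eq_abs, abs_mul]
      exact mul_le_of_le_one_left (abs_nonneg _) (abs_signedInd_le _ _ _)
    rw [abs_mul, abs_neg, abs_of_pos (by positivity)]
    refine (mul_le_of_le_one_left (abs_nonneg _) ?_).trans h1
    rw [div_le_one (by positivity)]
    linarith [Real.pi_gt_three]
  set U := -(1 / (2 * π)) * ∫ w in symDiff B₁ B₂, signDiff B₁ B₂ w * Real.log ‖y - w‖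
  have k4 : 0 ≤ D * (|Real.log a₁ - Real.log a₂| + a₁ * |m₁ - m₂|) := by positivity
  have k5 : C * (a₁ * (1 - Real.log a₁) * gap B₁ B₂) ≤ C * (1 * gap B₁ B₂) := by gcongr
  rw [abs_le] at k1 k3 ⊢
  constructor <;> linarith [k1.1, k1.2, k3.1, k3.2]

theorem ringPot_sub_sup_le : ∃ C : ℝ, 1 ≤ C ∧ ∀ B₁ B₂ a₁ a₂ β₁ β₂ m₁ m₂ τ,
    RingPair B₁ B₂ a₁ a₂ β₁ β₂ m₁ m₂ τ →
    |(β₁ - β₂) + (m₁ - m₂)| ≤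
      C * (gap B₁ B₂ + |Real.log a₁ - Real.log a₂| + a₁ * |m₁ - m₂|) ∧
    ∀ y : ℂ, ‖y‖ ≤ 2 → |ringPot B₁ a₁ β₁ m₁ y - ringPot B₂ a₂ β₂ m₂ y| ≤
      C * (gap B₁ B₂ + |Real.log a₁ - Real.log a₂| + a₁ * |m₁ - m₂|) := by
  obtain ⟨C, hC, hF⟩ := ringPot_sub_const_le
  refine ⟨2 * C, by linarith, fun B₁ B₂ a₁ a₂ β₁ β₂ m₁ m₂ τ h => ?_⟩
  have hk := hF _ _ _ _ _ _ _ _ _ h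
  have ha := h.left.pos
  have hG := gap_nonneg B₁ B₂
  obtain ⟨y, hy, hy'⟩ := exists_le_of_volume_eq h.left.isOpen h.left.nonempty h.right.measurableSet
    h.sub_left h.sub_right (h.left.area.trans h.right.area.symm) h.round_left.mem_iff
    h.round_right.mem_iff h.continuousOn_right
  obtain ⟨z, hz, hz'⟩ := exists_le_of_volume_eq h.right.isOpen h.right.nonempty h.left.measurableSet
    h.sub_right h.sub_left (h.right.area.trans h.left.area.symm) h.round_right.mem_iff
    h.round_left.mem_iff h.continuousOn_left
  have ky := abs_le.1 (hk y hy)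
  have kz := abs_le.1 (hk z hz)
  have hδ : 0 ≤ a₁ * |m₁ - m₂| := by positivity
  have hd := le_abs_self (Real.log a₁ - Real.log a₂)
  have hd' := neg_abs_le (Real.log a₁ - Real.log a₂)
  have hd0 := abs_nonneg (Real.log a₁ - Real.log a₂)
  set Γ := gap B₁ B₂ + |Real.log a₁ - Real.log a₂| + a₁ * |m₁ - m₂| with hΓ
  have hΓδ : |Real.log a₁ - Real.log a₂| ≤ C * Γ := by
    have : |Real.log a₁ - Real.log a₂| ≤ Γ := by rw [hΓ]; linarith
    nlinarith
  refine ⟨?_, fun w hw => ?_⟩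
  · rw [abs_le]; constructor <;> linarith [ky.1, ky.2, kz.1, kz.2]
  · have kw := abs_le.1 (hk w hw)
    rw [abs_le]; constructor <;> linarith [ky.1, ky.2, kz.1, kz.2, kw.1, kw.2]

end RingPair

theorem abs_cube_sub_cube_le {u v : ℝ} (hu : 0 ≤ u) (hu' : u ≤ 3 / 2) (hv : 0 ≤ v)
    (hv' : v ≤ 3 / 2) : |u ^ 3 - v ^ 3| ≤ 7 * |u - v| := by
  have e : u ^ 3 - v ^ 3 = (u ^ 2 + u * v + v ^ 2) * (u - v) := by ring
  rw [e, abs_mul, abs_of_nonneg (by positivity)]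
  gcongr
  nlinarith

namespace RingPair
variable {B₁ B₂ : Set ℂ} {a₁ a₂ β₁ β₂ m₁ m₂ τ : ℝ}

theorem abs_re_cube_sub_le (h : RingPair B₁ B₂ a₁ a₂ β₁ β₂ m₁ m₂ τ) {y : ℂ} (hy : ‖y‖ ≤ 2) :
    |(1 + a₁ * y.re) ^ 3 - (1 + a₂ * y.re) ^ 3| ≤ 14 * (a₂ * |Real.log a₁ - Real.log a₂|) := by
  have ha := h.left.pos
  have hb := h.right.pos
  have hre : |y.re| ≤ 2 := (Complex.abs_re_le_norm y).trans hy
  obtain ⟨u1, u2⟩ := half_le_re ha.le (h.le_two_left hy)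
  obtain ⟨v1, v2⟩ := half_le_re hb.le (h.le_two_right hy)
  refine (abs_cube_sub_cube_le (by linarith) u2 (by linarith) v2).trans ?_
  rw [show 1 + a₁ * y.re - (1 + a₂ * y.re) = -((a₂ - a₁) * y.re) by ring, abs_neg, abs_mul,
    abs_of_nonneg (by linarith [h.le])]
  have := sub_le_mul_abs_log_sub ha hb
  have hn : 0 ≤ a₂ - a₁ := by linarith [h.le]
  calc 7 * ((a₂ - a₁) * |y.re|) ≤ 7 * (a₂ * |Real.log a₁ - Real.log a₂| * 2) := by gcongr
    _ = _ := by ring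

theorem abs_re_cube_sub_one_le {a : ℝ} (ha : 0 ≤ a) {y : ℂ} (hy : ‖y‖ ≤ 2)
    (hs : a * ‖y‖ ≤ 1 / 2) : |(1 + a * y.re) ^ 3 - 1| ≤ 14 * a := by
  have hre : |y.re| ≤ 2 := (Complex.abs_re_le_norm y).trans hy
  obtain ⟨u1, u2⟩ := half_le_re ha hs
  have := abs_cube_sub_cube_le (v := 1) (by linarith) u2 (by norm_num) (by norm_num)
  rw [one_pow, add_sub_cancel_left, abs_mul, abs_of_nonneg ha] at this
  nlinarith

theorem integrableOn_re_cube {B : Set ℂ} (hB : B ⊆ Metric.closedBall 0 2) (a : ℝ) :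
    IntegrableOn (fun y : ℂ => (1 + a * y.re) ^ 3) B :=
  integrableOn_continuousOn hB (by fun_prop)

theorem abs_setIntegral_left_le (h : RingPair B₁ B₂ a₁ a₂ β₁ β₂ m₁ m₂ τ) {f : ℂ → ℝ} {K : ℝ}
    (hf : ∀ y : ℂ, ‖y‖ ≤ 2 → |f y| ≤ K) : |∫ y in B₁, f y| ≤ K * π := by
  rw [← h.left.area, ← Real.norm_eq_abs]
  exact norm_setIntegral_le_of_norm_le_const h.left.volume_ne_top.lt_top
    fun y hy => hf y (mem_closedBall_zero_iff.1 (h.sub_left hy))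

theorem moment_left_le (h : RingPair B₁ B₂ a₁ a₂ β₁ β₂ m₁ m₂ τ) :
    |(∫ y in B₁, (1 + a₁ * y.re) ^ 3) - π| ≤ 14 * a₁ * π := by
  have e : (∫ y in B₁, (1 + a₁ * y.re) ^ 3) - π = ∫ y in B₁, ((1 + a₁ * y.re) ^ 3 - 1) := by
    rw [integral_sub (integrableOn_re_cube h.sub_left a₁)
      (integrableOn_const h.left.volume_ne_top), setIntegral_const, smul_eq_mul, h.left.area,
      mul_one]
  rw [e]
  exact h.abs_setIntegral_left_le fun y hy =>
    abs_re_cube_sub_one_le h.left.pos.le hy (h.le_two_left hy)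

theorem moment_sub_le (h : RingPair B₁ B₂ a₁ a₂ β₁ β₂ m₁ m₂ τ) :
    |(∫ y in B₁, (1 + a₁ * y.re) ^ 3) - ∫ y in B₂, (1 + a₂ * y.re) ^ 3| ≤
      14 * (a₂ * |Real.log a₁ - Real.log a₂|) * π + 3 * (14 * a₂) * gap B₁ B₂ := by
  have i1 := integrableOn_re_cube h.sub_left a₁
  have i2 := integrableOn_re_cube h.sub_left a₂
  have i3 := integrableOn_re_cube h.sub_right a₂
  have c1 : IntegrableOn (fun _ : ℂ => (1 : ℝ)) B₁ := integrableOn_const h.left.volume_ne_top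
  have c2 : IntegrableOn (fun _ : ℂ => (1 : ℝ)) B₂ := integrableOn_const h.right.volume_ne_top
  have j1 : IntegrableOn (fun y : ℂ => (1 + a₂ * y.re) ^ 3 - 1) B₁ := i2.sub c1
  have j2 : IntegrableOn (fun y : ℂ => (1 + a₂ * y.re) ^ 3 - 1) B₂ := i3.sub c2
  have e1 : ∫ y in B₁, ((1 + a₁ * y.re) ^ 3 - (1 + a₂ * y.re) ^ 3) =
      (∫ y in B₁, (1 + a₁ * y.re) ^ 3) - ∫ y in B₁, (1 + a₂ * y.re) ^ 3 := integral_sub i1 i2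
  have e2 : ∫ y in B₁, ((1 + a₂ * y.re) ^ 3 - 1) = (∫ y in B₁, (1 + a₂ * y.re) ^ 3) - π := by
    rw [integral_sub i2 c1, setIntegral_const, smul_eq_mul, h.left.area, mul_one]
  have e3 : ∫ y in B₂, ((1 + a₂ * y.re) ^ 3 - 1) = (∫ y in B₂, (1 + a₂ * y.re) ^ 3) - π := by
    rw [integral_sub i3 c2, setIntegral_const, smul_eq_mul, h.right.area, mul_one]
  have k1 := h.abs_setIntegral_left_le fun y hy => h.abs_re_cube_sub_le hy
  have k2 := h.abs_integral_sign_le (f := fun y : ℂ => (1 + a₂ * y.re) ^ 3 - 1)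
    (K := 14 * a₂) (by have := h.right.pos; positivity) fun y hy => by
      have hy2 := mem_closedBall_zero_iff.1 (h.sub_two hy)
      exact abs_re_cube_sub_one_le h.right.pos.le hy2 (h.le_two_right hy2)
  have e4 := h.integral_sub_eq j1 j2
  simp only [smul_eq_mul] at e4
  rw [← e4, e2, e3] at k2
  rw [e1] at k1
  rw [abs_le] at k1 k2 ⊢
  constructor <;> linarith [k1.1, k1.2, k2.1, k2.2]

theorem weighted_sub_le (h : RingPair B₁ B₂ a₁ a₂ β₁ β₂ m₁ m₂ τ) {K Γ : ℝ} (hK : 0 ≤ K)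
    (h1 : ∀ y : ℂ, ‖y‖ ≤ 2 → |ringPot B₁ a₁ β₁ m₁ y| ≤ K)
    (h2 : ∀ y : ℂ, ‖y‖ ≤ 2 → |ringPot B₂ a₂ β₂ m₂ y| ≤ K)
    (h3 : ∀ y : ℂ, ‖y‖ ≤ 2 → |ringPot B₁ a₁ β₁ m₁ y - ringPot B₂ a₂ β₂ m₂ y| ≤ Γ) :
    |(∫ y in B₁, (1 + a₁ * y.re) ^ 3 * ringPot B₁ a₁ β₁ m₁ y) -
      ∫ y in B₂, (1 + a₂ * y.re) ^ 3 * ringPot B₂ a₂ β₂ m₂ y| ≤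
      (14 * (a₂ * |Real.log a₁ - Real.log a₂|) * K + 4 * Γ) * π + 3 * (4 * K) * gap B₁ B₂ := by
  have hb := h.right.pos
  have hX : ∀ y : ℂ, ‖y‖ ≤ 2 → |(1 + a₂ * y.re) ^ 3| ≤ 4 := fun y hy => by
    obtain ⟨v1, v2⟩ := half_le_re hb.le (h.le_two_right hy)
    rw [abs_of_nonneg (by positivity)]
    calc (1 + a₂ * y.re) ^ 3 ≤ (3 / 2) ^ 3 := by gcongr
      _ ≤ 4 := by norm_num
  have c1 : ContinuousOn (fun y : ℂ => (1 + a₁ * y.re) ^ 3 * ringPot B₁ a₁ β₁ m₁ y)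
    (Metric.closedBall 0 2) := ContinuousOn.mul (by fun_prop) h.continuousOn_left
  have c2 : ContinuousOn (fun y : ℂ => (1 + a₂ * y.re) ^ 3 * ringPot B₂ a₂ β₂ m₂ y)
    (Metric.closedBall 0 2) := ContinuousOn.mul (by fun_prop) h.continuousOn_right
  have i1 := integrableOn_continuousOn h.sub_left c1
  have i2 := integrableOn_continuousOn h.sub_left c2
  have i3 := integrableOn_continuousOn h.sub_right c2
  have e1 : ∫ y in B₁, ((1 + a₁ * y.re) ^ 3 * ringPot B₁ a₁ β₁ m₁ y -
      (1 + a₂ * y.re) ^ 3 * ringPot B₂ a₂ β₂ m₂ y) =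
      (∫ y in B₁, (1 + a₁ * y.re) ^ 3 * ringPot B₁ a₁ β₁ m₁ y) -
      ∫ y in B₁, (1 + a₂ * y.re) ^ 3 * ringPot B₂ a₂ β₂ m₂ y := integral_sub i1 i2
  have k1 : |∫ y in B₁, ((1 + a₁ * y.re) ^ 3 * ringPot B₁ a₁ β₁ m₁ y -
      (1 + a₂ * y.re) ^ 3 * ringPot B₂ a₂ β₂ m₂ y)| ≤
      (14 * (a₂ * |Real.log a₁ - Real.log a₂|) * K + 4 * Γ) * π := by
    refine h.abs_setIntegral_left_le fun y hy => ?_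
    rw [show (1 + a₁ * y.re) ^ 3 * ringPot B₁ a₁ β₁ m₁ y -
      (1 + a₂ * y.re) ^ 3 * ringPot B₂ a₂ β₂ m₂ y =
      ((1 + a₁ * y.re) ^ 3 - (1 + a₂ * y.re) ^ 3) * ringPot B₁ a₁ β₁ m₁ y +
      (1 + a₂ * y.re) ^ 3 * (ringPot B₁ a₁ β₁ m₁ y - ringPot B₂ a₂ β₂ m₂ y) by ring]
    refine (abs_add_le _ _).trans ?_
    rw [abs_mul, abs_mul]
    gcongr
    exacts [h.abs_re_cube_sub_le hy, h1 y hy, hX y hy, h3 y hy]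
  have k2 := h.abs_integral_sign_le
    (f := fun y : ℂ => (1 + a₂ * y.re) ^ 3 * ringPot B₂ a₂ β₂ m₂ y)
    (K := 4 * K) (by positivity) fun y hy => by
      have hy2 := mem_closedBall_zero_iff.1 (h.sub_two hy)
      rw [abs_mul]
      exact mul_le_mul (hX y hy2) (h2 y hy2) (abs_nonneg _) (by norm_num)
  have e4 := h.integral_sub_eq i2 i3
  simp only [smul_eq_mul] at e4
  rw [← e4] at k2
  rw [e1] at k1
  rw [abs_le] at k1 k2 ⊢
  constructor <;> linarith [k1.1, k1.2, k2.1, k2.2]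

theorem param_sub_le : ∃ C : ℝ, 1 ≤ C ∧ ∀ B₁ B₂ a₁ a₂ β₁ β₂ m₁ m₂ τ,
    RingPair B₁ B₂ a₁ a₂ β₁ β₂ m₁ m₂ τ →
    |3 * (β₁ - β₂) - (m₁ - m₂)| ≤
      C * (gap B₁ B₂ + |Real.log a₁ - Real.log a₂| + a₁ * (|β₁ - β₂| + |m₁ - m₂|)) := by
  obtain ⟨K, hK, hbd⟩ := abs_ringPot_le
  obtain ⟨C, hC, hsup⟩ := ringPot_sub_sup_le
  obtain ⟨D, hD, hpar⟩ := Ring.params_le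
  refine ⟨182 * K + 28 * C + 42 + 168 * D, by linarith,
    fun B₁ B₂ a₁ a₂ β₁ β₂ m₁ m₂ τ h => ?_⟩
  have ha := h.left.pos
  have hb := h.right.pos
  have hG := gap_nonneg B₁ B₂
  have hδ := abs_nonneg (Real.log a₁ - Real.log a₂)
  have hb1 : a₂ ≤ 1 := h.le_eighth.trans (by norm_num)
  have hτ : τ ≤ 1 := h.tau_le.trans (by norm_num)
  have w := h.weighted_sub_le (K := K) (by linarith)
    (hbd _ _ _ _ _ h.left (h.le.trans h.le_eighth) hτ h.round_left)
    (hbd _ _ _ _ _ h.right h.le_eighth hτ h.round_right) (hsup _ _ _ _ _ _ _ _ _ h).2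
  have p := h.moment_left_le
  have q := h.moment_sub_le
  have v1 := h.left.axis_virial
  have v2 := h.right.axis_virial
  have hβ : β₂ * a₂ ≤ D := by
    have h2 := self_mul_one_sub_log_le hb
    calc β₂ * a₂ ≤ D * (1 - Real.log a₂) * a₂ := by
          gcongr; exact (hpar _ _ _ _ h.right).2
      _ = D * (a₂ * (1 - Real.log a₂)) := by ring
      _ ≤ D * 1 := by gcongr
      _ = D := mul_one D
  have hβ0 := h.right.beta_nonneg
  set G := gap B₁ B₂
  set δ := |Real.log a₁ - Real.log a₂|
  set P₁ := ∫ y in B₁, (1 + a₁ * y.re) ^ 3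
  set P₂ := ∫ y in B₂, (1 + a₂ * y.re) ^ 3
  set L₁ := ∫ y in B₁, (1 + a₁ * y.re) ^ 3 * ringPot B₁ a₁ β₁ m₁ y
  set L₂ := ∫ y in B₂, (1 + a₂ * y.re) ^ 3 * ringPot B₂ a₂ β₂ m₂ y
  have e : π * (3 * (β₁ - β₂) - (m₁ - m₂)) =
      7 * (L₁ - L₂) - 3 * ((β₁ - β₂) * (P₁ - π)) - 3 * (β₂ * (P₁ - P₂)) := by
    linear_combination v2 - v1
  have hπ := Real.pi_gt_three
  have hGπ : G ≤ G * π := by nlinarith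
  have q' : |β₂ * (P₁ - P₂)| ≤ D * (14 * δ + 42 * G) * π := by
    rw [abs_mul, abs_of_nonneg hβ0]
    calc β₂ * |P₁ - P₂| ≤ β₂ * (14 * (a₂ * δ) * π + 3 * (14 * a₂) * G) := by gcongr
      _ = (β₂ * a₂) * (14 * δ * π + 42 * G) := by ring
      _ ≤ D * (14 * δ * π + 42 * (G * π)) := by gcongr
      _ = _ := by ring
  have p' : |(β₁ - β₂) * (P₁ - π)| ≤ |β₁ - β₂| * (14 * a₁ * π) := by
    rw [abs_mul]; gcongr
  have w' : |L₁ - L₂| ≤ (14 * δ * K + 4 * (C * (G + δ + a₁ * |m₁ - m₂|)) + 12 * K * G) * π := by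
    refine w.trans ?_
    have x1 : a₂ * δ ≤ δ := mul_le_of_le_one_left hδ hb1
    calc _ ≤ (14 * δ * K + 4 * (C * (G + δ + a₁ * |m₁ - m₂|))) * π + 3 * (4 * K) * (G * π) := by
          gcongr
      _ = _ := by ring
  have hmain : π * |3 * (β₁ - β₂) - (m₁ - m₂)| ≤ π * (7 * (14 * δ * K +
      4 * (C * (G + δ + a₁ * |m₁ - m₂|)) + 12 * K * G) + 3 * (|β₁ - β₂| * (14 * a₁)) +
      3 * (D * (14 * δ + 42 * G))) := by
    rw [← abs_of_pos Real.pi_pos, ← abs_mul, abs_of_pos Real.pi_pos, e]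
    rw [abs_le] at w' p' q' ⊢
    constructor <;> linarith [w'.1, w'.2, p'.1, p'.2, q'.1, q'.2]
  refine (le_of_mul_le_mul_left hmain Real.pi_pos).trans ?_
  have t1 : 0 ≤ a₁ * |m₁ - m₂| := by positivity
  have t2 : 0 ≤ a₁ * |β₁ - β₂| := by positivity
  have s1 : 0 ≤ K * G := by positivity
  have s2 : 0 ≤ K * δ := by positivity
  have s3 : 0 ≤ C * G := by positivity
  have s4 : 0 ≤ C * δ := by positivity
  have s5 : 0 ≤ D * G := by positivity
  have s6 : 0 ≤ D * δ := by positivity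
  have s7 : 0 ≤ K * (a₁ * |m₁ - m₂|) := by positivity
  have s8 : 0 ≤ K * (a₁ * |β₁ - β₂|) := by positivity
  have s9 : 0 ≤ C * (a₁ * |β₁ - β₂|) := by positivity
  have s10 : 0 ≤ D * (a₁ * |m₁ - m₂|) := by positivity
  have s11 : 0 ≤ D * (a₁ * |β₁ - β₂|) := by positivity
  nlinarith

/-- The parameters and the cross-section of a nearly round ring are controlled by its radius. -/
theorem rigidity : ∃ C : ℝ, 1 ≤ C ∧ ∃ τ₀ : ℝ, 0 < τ₀ ∧ ∀ B₁ B₂ a₁ a₂ β₁ β₂ m₁ m₂ τ,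
    RingPair B₁ B₂ a₁ a₂ β₁ β₂ m₁ m₂ τ → τ ≤ τ₀ → C * (a₁ * (1 - Real.log a₁)) ≤ 1 →
    |β₁ - β₂| + |m₁ - m₂| + gap B₁ B₂ ≤ C * |Real.log a₁ - Real.log a₂| := by
  obtain ⟨C₁, hC₁, τ₀, hτ₀, hgap⟩ := gap_le
  obtain ⟨C₂, hC₂, hsup⟩ := ringPot_sub_sup_le
  obtain ⟨C₃, hC₃, hpar⟩ := param_sub_le
  obtain ⟨M, hM⟩ : ∃ M, M = C₁ + C₂ + C₃ := ⟨_, rfl⟩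
  refine ⟨64 * M ^ 2, by nlinarith, τ₀, hτ₀, fun B₁ B₂ a₁ a₂ β₁ β₂ m₁ m₂ τ h hτ hs => ?_⟩
  have ha := h.left.pos
  have hl := h.left.one_le_neg_log
  have hM3 : 3 ≤ M := by linarith
  have hG := gap_nonneg B₁ B₂
  have hδ := abs_nonneg (Real.log a₁ - Real.log a₂)
  have hx : 0 ≤ a₁ * (1 - Real.log a₁) := by have : 0 ≤ 1 - Real.log a₁ := by linarith
                                             positivity
  have ha' : a₁ ≤ a₁ * (1 - Real.log a₁) := by nlinarith
  have h1 : C₁ * (a₁ * (1 - Real.log a₁)) ≤ 1 := le_trans (by gcongr; nlinarith) hs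
  have h2 : 64 * M ^ 2 * a₁ ≤ 1 := le_trans (by gcongr) hs
  have g := hgap _ _ _ _ _ _ _ _ _ h hτ h1
  have s := (hsup _ _ _ _ _ _ _ _ _ h).1
  have p := hpar _ _ _ _ _ _ _ _ _ h
  have hb := abs_nonneg (β₁ - β₂)
  have hm := abs_nonneg (m₁ - m₂)
  have htri : |β₁ - β₂| + |m₁ - m₂| ≤ 2 * |(β₁ - β₂) + (m₁ - m₂)| + |3 * (β₁ - β₂) - (m₁ - m₂)| := by
    have r1 := le_abs_self ((β₁ - β₂) + (m₁ - m₂))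
    have r2 := neg_abs_le ((β₁ - β₂) + (m₁ - m₂))
    have r3 := le_abs_self (3 * (β₁ - β₂) - (m₁ - m₂))
    have r4 := neg_abs_le (3 * (β₁ - β₂) - (m₁ - m₂))
    rcases abs_cases (β₁ - β₂) with ⟨q1, _⟩ | ⟨q1, _⟩ <;>
    rcases abs_cases (m₁ - m₂) with ⟨q2, _⟩ | ⟨q2, _⟩ <;> rw [q1, q2] <;> linarith
  set G := gap B₁ B₂
  set δ := |Real.log a₁ - Real.log a₂|
  obtain ⟨X, hX⟩ : ∃ X, X = |β₁ - β₂| + |m₁ - m₂| := ⟨_, rfl⟩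
  have hX0 : 0 ≤ X := by linarith
  have hmX : a₁ * |m₁ - m₂| ≤ a₁ * X := by gcongr; linarith
  have g' : G ≤ M * (δ + a₁ * X) := g.trans (by gcongr; linarith)
  have haX : 0 ≤ a₁ * X := by positivity
  have s' : |(β₁ - β₂) + (m₁ - m₂)| ≤ M * (G + δ + a₁ * X) := s.trans (by gcongr; linarith)
  have p' : |3 * (β₁ - β₂) - (m₁ - m₂)| ≤ M * (G + δ + a₁ * X) := by
    rw [hX]; exact p.trans (by gcongr; linarith)
  have k1 : X ≤ 3 * M * (G + δ + a₁ * X) := by rw [hX] at s' p' ⊢; linarith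
  have k2 : G + δ + a₁ * X ≤ 2 * M * (δ + a₁ * X) := by nlinarith
  have k3 : X ≤ 6 * M ^ 2 * (δ + a₁ * X) := by nlinarith
  have k4 : 64 * M ^ 2 * a₁ * X ≤ X := mul_le_of_le_one_left hX0 h2
  have k5 : X ≤ 12 * M ^ 2 * δ := by nlinarith
  have k6 : M * (a₁ * X) ≤ X := by nlinarith
  have k7 : M * δ ≤ M ^ 2 * δ := by nlinarith
  nlinarith

theorem eq_of_gap_eq_zero (h : RingPair B₁ B₂ a₁ a₂ β₁ β₂ m₁ m₂ τ) (h0 : gap B₁ B₂ = 0) :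
    volume (symDiff B₁ B₂) = 0 := by
  have h1 := h.volume_le
  rw [h0, mul_zero] at h1
  exact (measureReal_eq_zero_iff h.volume_ne_top).1 (le_antisymm h1 measureReal_nonneg)

end RingPair

/-- The comparison of rings of small radius, in a form symmetric in both rings. -/
theorem exists_rigid {c : ℝ} (hc : 0 < c) : ∃ C : ℝ, 1 ≤ C ∧ ∃ a₀ : ℝ, 0 < a₀ ∧
    ∀ B₁ B₂ a₁ a₂ β₁ β₂ m₁ m₂, Ring B₁ a₁ β₁ m₁ → Ring B₂ a₂ β₂ m₂ → a₁ < a₀ → a₂ < a₀ →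
    c * -Real.log a₁ ≤ β₁ → c * -Real.log a₂ ≤ β₂ →
    |β₁ - β₂| ≤ C * |Real.log a₁ - Real.log a₂| ∧ (a₁ = a₂ → m₁ = m₂ ∧ B₁ =ᵐ[volume] B₂) := by
  obtain ⟨C, hC, τ₀, hτ₀, hrig⟩ := RingPair.rigidity
  have hτ : 0 < min τ₀ (1 / 40000) := by positivity
  have hev := Ring.roundPatch hc hτ (min_le_right _ _)
  have hev2 : ∀ᶠ a in nhdsWithin (0 : ℝ) (Set.Ioi 0), a * (1 - Real.log a) < C⁻¹ :=
    tendsto_self_mul_one_sub_log.eventually_lt_const (by positivity)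
  obtain ⟨b, hb, hsub⟩ := mem_nhdsGT_iff_exists_Ioo_subset.1 (hev.and hev2)
  have hb : 0 < b := hb
  have main : ∀ B₁ B₂ a₁ a₂ β₁ β₂ m₁ m₂, Ring B₁ a₁ β₁ m₁ → Ring B₂ a₂ β₂ m₂ → a₁ ≤ a₂ →
      a₂ < min b (1 / 8) → c * -Real.log a₁ ≤ β₁ → c * -Real.log a₂ ≤ β₂ →
      |β₁ - β₂| ≤ C * |Real.log a₁ - Real.log a₂| ∧ (a₁ = a₂ → m₁ = m₂ ∧ B₁ =ᵐ[volume] B₂) := by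
    intro B₁ B₂ a₁ a₂ β₁ β₂ m₁ m₂ h1 h2 hle hlt hc1 hc2
    have hltb := hlt.trans_le (min_le_left _ _)
    have e1 := hsub ⟨h1.pos, hle.trans_lt hltb⟩
    have e2 := hsub ⟨h2.pos, hltb⟩
    have hp : RingPair B₁ B₂ a₁ a₂ β₁ β₂ m₁ m₂ (min τ₀ (1 / 40000)) :=
      { left := h1
        right := h2
        le := hle
        le_eighth := (hlt.trans_le (min_le_right _ _)).le
        round_left := e1.1 _ _ _ h1 hc1
        round_right := e2.1 _ _ _ h2 hc2
        tau_pos := hτ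
        tau_le := min_le_right _ _ }
    have hs : C * (a₁ * (1 - Real.log a₁)) ≤ 1 := by
      calc C * (a₁ * (1 - Real.log a₁)) ≤ C * C⁻¹ := by gcongr; exact e1.2.le
        _ = 1 := mul_inv_cancel₀ (by positivity)
    have k := hrig _ _ _ _ _ _ _ _ _ hp (min_le_left _ _) hs
    have hG := gap_nonneg B₁ B₂
    have hm := abs_nonneg (m₁ - m₂)
    have hβ := abs_nonneg (β₁ - β₂)
    refine ⟨by linarith, fun ha => ?_⟩
    rw [ha, sub_self, abs_zero, mul_zero] at k
    refine ⟨sub_eq_zero.1 (abs_eq_zero.1 (by linarith)), ?_⟩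
    have h0 := hp.eq_of_gap_eq_zero (by linarith)
    exact measure_symmDiff_eq_zero_iff.1 h0
  refine ⟨C, hC, min b (1 / 8), by positivity,
    fun B₁ B₂ a₁ a₂ β₁ β₂ m₁ m₂ h1 h2 l1 l2 c1 c2 => ?_⟩
  rcases le_total a₁ a₂ with h | h
  · exact main _ _ _ _ _ _ _ _ h1 h2 h l2 c1 c2
  · obtain ⟨k1, k2⟩ := main _ _ _ _ _ _ _ _ h2 h1 h l1 c2 c1
    rw [abs_sub_comm β₁, abs_sub_comm (Real.log a₁)]
    exact ⟨k1, fun e => ⟨(k2 e.symm).1.symm, (k2 e.symm).2.symm⟩⟩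

theorem ringKern_smul {r : ℝ} (hr : 0 < r) (x x' : ℂ) :
    ringKern ((r : ℂ) * x) ((r : ℂ) * x') = ringKern x x' := by
  have h1 : (r * x'.re) / (r * x.re) = x'.re / x.re := mul_div_mul_left _ _ hr.ne'
  have h2 : √(r * x.re * (r * x'.re)) = r * √(x.re * x'.re) := by
    rw [show r * x.re * (r * x'.re) = r ^ 2 * (x.re * x'.re) by ring, Real.sqrt_mul (sq_nonneg r),
      Real.sqrt_sq hr.le]
  have h3 : ‖(r : ℂ) * x - (r : ℂ) * x'‖ = r * ‖x - x'‖ := by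
    rw [← mul_sub, norm_mul, Complex.norm_real, Real.norm_of_nonneg hr.le]
  simp only [ringKern, Complex.re_ofReal_mul, h1, h2, h3]
  rw [mul_div_mul_left _ _ hr.ne']

/-- The mean distance of a set to the axis. -/
def axisMean (A : Set ℂ) : ℝ := (∫ z in A, z.re) / volume.real A

/-- The radius of the disc with the area of a given set. -/
def areaRadius (A : Set ℂ) : ℝ := √(volume.real A / π)

/-- A set recentred at its mean distance to the axis and rescaled to area `π`. -/
def rescaled (A : Set ℂ) : Set ℂ :=
  (fun y : ℂ => (axisMean A : ℂ) + (areaRadius A : ℂ) * y) ⁻¹' A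

/-- A thin cross-section in the complex half-plane, symmetric about the real axis. The potential
condition is the defining relation of a steady vortex ring with speed coefficient `v`. -/
structure ThinSection (A : Set ℂ) (δ v μ ε Q : ℝ) : Prop where
  isOpen : IsOpen A
  preconnected : IsPreconnected A
  nonempty : A.Nonempty
  conj_mem : ∀ z ∈ A, (starRingEnd ℂ) z ∈ A
  le_re : ∀ z ∈ A, δ ≤ z.re
  re_le : ∀ z ∈ A, z.re ≤ 1 / δ
  diam_le : ∀ z ∈ A, ∀ w ∈ A, ‖z - w‖ ≤ δ / 4
  moment : ∫ z in A, z.re = Q * ε ^ 2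
  mem_iff : ∀ z : ℂ, 0 < z.re →
    (z ∈ A ↔ μ < z.re ^ 2 * (∫ w in A, ringKern z w) / ε ^ 2 - v * z.re ^ 2)

namespace ThinSection
variable {A : Set ℂ} {δ v μ ε Q : ℝ}

theorem bounded (h : ThinSection A δ v μ ε Q) : Bornology.IsBounded A := by
  obtain ⟨w, hw⟩ := h.nonempty
  exact Metric.isBounded_closedBall.subset fun z hz => mem_closedBall_iff_norm.2 (h.diam_le z hz w hw)

theorem volume_ne_top (h : ThinSection A δ v μ ε Q) : volume A ≠ ⊤ := h.bounded.measure_lt_top.ne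

theorem volume_pos (h : ThinSection A δ v μ ε Q) : 0 < volume.real A :=
  ENNReal.toReal_pos (h.isOpen.measure_pos volume h.nonempty).ne' h.volume_ne_top

theorem integrableOn_id (h : ThinSection A δ v μ ε Q) : IntegrableOn (fun z : ℂ => z) A :=
  (continuous_id.continuousOn.integrableOn_compact h.bounded.isCompact_closure).mono_set
    subset_closure

theorem integral_eq (h : ThinSection A δ v μ ε Q) :
    ∫ z in A, z = ((volume.real A * axisMean A : ℝ) : ℂ) := by
  have hre : (∫ z in A, z).re = volume.real A * axisMean A := by
    rw [axisMean, mul_div_cancel₀ _ h.volume_pos.ne']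
    exact ((Complex.reCLM.integral_comp_comm h.integrableOn_id).symm)
  have hA : (starRingEnd ℂ) ⁻¹' A = A := by
    ext z
    refine ⟨fun hz => ?_, fun hz => h.conj_mem z hz⟩
    simpa using h.conj_mem _ hz
  have hconj : ∫ z in A, (starRingEnd ℂ) z = ∫ z in A, z := by
    have := (Complex.conjLIE.measurePreserving).setIntegral_preimage_emb
      Complex.conjLIE.toHomeomorph.measurableEmbedding (fun z : ℂ => z) A
    rw [← this]
    congr 1
    rw [show (Complex.conjLIE : ℂ → ℂ) ⁻¹' A = A from hA]
  rw [integral_conj] at hconj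
  have him := congrArg Complex.im hconj
  rw [Complex.conj_im] at him
  refine Complex.ext (by rw [hre, Complex.ofReal_re]) ?_
  rw [Complex.ofReal_im]
  linarith

theorem axisMean_bounds (h : ThinSection A δ v μ ε Q) : δ ≤ axisMean A ∧ axisMean A ≤ 1 / δ := by
  have hv := h.volume_pos
  have i1 : IntegrableOn (fun z : ℂ => z.re) A := h.integrableOn_id.re
  have c (k : ℝ) : IntegrableOn (fun _ : ℂ => k) A := integrableOn_const h.volume_ne_top
  have e (k : ℝ) : ∫ _ in A, k = k * volume.real A := by
    rw [setIntegral_const, smul_eq_mul, mul_comm]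
  rw [axisMean]
  constructor
  · rw [le_div_iff₀ hv, ← e]
    exact setIntegral_mono_on (c _) i1 h.isOpen.measurableSet h.le_re
  · rw [div_le_iff₀ hv, ← e]
    exact setIntegral_mono_on i1 (c _) h.isOpen.measurableSet h.re_le

theorem norm_sub_axisMean_le (h : ThinSection A δ v μ ε Q) {z : ℂ} (hz : z ∈ A) :
    ‖z - axisMean A‖ ≤ δ / 4 := by
  have hv := h.volume_pos
  have e : ∫ w in A, (z - w) = (volume.real A : ℂ) * (z - axisMean A) := by
    have hc : IntegrableOn (fun _ : ℂ => z) A := integrableOn_const h.volume_ne_top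
    rw [integral_sub hc h.integrableOn_id, h.integral_eq, setIntegral_const, Complex.real_smul]
    push_cast; ring
  have k := norm_setIntegral_le_of_norm_le_const (f := fun w => z - w) h.volume_ne_top.lt_top
    fun w hw => h.diam_le z hz w hw
  rw [e, norm_mul, Complex.norm_real, Real.norm_of_nonneg hv.le, mul_comm (δ / 4)] at k
  exact le_of_mul_le_mul_left k hv

theorem areaRadius_pos (h : ThinSection A δ v μ ε Q) : 0 < areaRadius A :=
  Real.sqrt_pos.2 (div_pos h.volume_pos Real.pi_pos)

theorem volume_eq (h : ThinSection A δ v μ ε Q) : volume.real A = π * areaRadius A ^ 2 := by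
  rw [areaRadius, Real.sq_sqrt (div_pos h.volume_pos Real.pi_pos).le,
    mul_div_cancel₀ _ Real.pi_ne_zero]

theorem moment_eq (h : ThinSection A δ v μ ε Q) :
    π * areaRadius A ^ 2 * axisMean A = Q * ε ^ 2 := by
  rw [← h.volume_eq, axisMean, mul_div_cancel₀ _ h.volume_pos.ne', h.moment]

theorem areaRadius_le (h : ThinSection A δ v μ ε Q) (hδ : 0 < δ) : areaRadius A ≤ δ / 4 := by
  obtain ⟨w, hw⟩ := h.nonempty
  rw [areaRadius]
  refine Real.sqrt_le_iff.2 ⟨by linarith, ?_⟩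
  rw [div_le_iff₀ Real.pi_pos]
  refine le_of_forall_pos_le_add fun η hη => ?_
  have hsub : A ⊆ Metric.closedBall w (δ / 4) := fun z hz =>
    mem_closedBall_iff_norm.2 (h.diam_le z hz w hw)
  have h1 := measureReal_mono (μ := volume) hsub measure_closedBall_lt_top.ne
  have h2 : volume.real (Metric.closedBall w (δ / 4)) = π * (δ / 4) ^ 2 := by
    rw [← volume_real_ball w (by linarith : (0 : ℝ) ≤ δ / 4)]
    exact Measure.addHaar_real_closedBall_eq_addHaar_real_ball _ _ _
  linarith

/-- The potential of the cross-section in rescaled variables. -/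
theorem setIntegral_ringKern (h : ThinSection A δ v μ ε Q) (z : ℂ) :
    ∫ w in A, ringKern z w = areaRadius A ^ 2 *
      ∫ y in rescaled A, ringKern z (axisMean A + (areaRadius A : ℂ) * y) := by
  have := h.areaRadius_pos
  rw [rescaled, setIntegral_comp_affine this (axisMean A : ℂ) (fun w => ringKern z w) A, smul_eq_mul,
    mul_inv_cancel_left₀ (by positivity)]

theorem volume_rescaled (h : ThinSection A δ v μ ε Q) : volume.real (rescaled A) = π := by
  have hh := h.areaRadius_pos
  have := setIntegral_comp_affine hh (axisMean A : ℂ) (fun _ => (1 : ℝ)) A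
  rw [setIntegral_const, setIntegral_const] at this
  simp only [smul_eq_mul, mul_one] at this
  rw [rescaled, this, h.volume_eq]
  field_simp

theorem ring (h : ThinSection A δ v μ ε Q) (hδ : 0 < δ) (hv : 0 < v) (hμ : 0 < μ) (hε : 0 < ε) :
    Ring (rescaled A) (areaRadius A / axisMean A) (v * ε ^ 2 / areaRadius A ^ 2)
      (μ * ε ^ 2 / (areaRadius A ^ 2 * axisMean A ^ 2)) := by
  have hh := h.areaRadius_pos
  obtain ⟨hr1, hr2⟩ := h.axisMean_bounds
  have hle := h.areaRadius_le hδ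
  set H := areaRadius A with hH
  set r := axisMean A with hr
  have hr0 : 0 < r := by linarith
  have hcont : Continuous fun y : ℂ => (r : ℂ) + (H : ℂ) * y := by fun_prop
  have hopen : IsOpen (rescaled A) := h.isOpen.preimage hcont
  have hHc : (H : ℂ) ≠ 0 := Complex.ofReal_ne_zero.2 hh.ne'
  have hscale (y : ℂ) : (r : ℂ) + (H : ℂ) * y = (r : ℂ) * (1 + ((H / r : ℝ) : ℂ) * y) := by
    have : (r : ℂ) ≠ 0 := Complex.ofReal_ne_zero.2 hr0.ne'
    push_cast; field_simp
  have hsmall : ∀ y ∈ rescaled A, H / r * ‖y‖ ≤ 1 / 4 := fun y hy => by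
    have k := h.norm_sub_axisMean_le (z := r + H * y) hy
    rw [add_sub_cancel_left, norm_mul, Complex.norm_real, Real.norm_of_nonneg hh.le] at k
    rw [div_mul_eq_mul_div, div_le_iff₀ hr0]
    linarith
  have hvol := h.volume_rescaled
  refine ⟨hopen, ?_, hvol, ?_, by positivity, ?_, by positivity, by positivity, hsmall, ?_⟩
  · have himg : rescaled A = (fun z : ℂ => (z - r) / H) '' A := by
      ext y
      constructor
      · exact fun hy => ⟨_, hy, by field_simp; ring⟩
      · rintro ⟨z, hz, rfl⟩
        change (r : ℂ) + (H : ℂ) * ((z - r) / H) ∈ A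
        rwa [mul_div_cancel₀ _ hHc, add_sub_cancel]
    rw [himg]
    exact h.preconnected.image _ (by fun_prop)
  · have k := setIntegral_comp_affine hh (r : ℂ) (fun z => (z - r) / H) A
    have e1 : ∀ y : ℂ, ((r : ℂ) + (H : ℂ) * y - r) / H = y := fun y => by field_simp; ring
    simp only [e1] at k
    change ∫ y in rescaled A, y = _ at k
    have hc : IntegrableOn (fun _ : ℂ => (r : ℂ)) A := integrableOn_const h.volume_ne_top
    rw [k, integral_div, integral_sub h.integrableOn_id hc, h.integral_eq, setIntegral_const,
      Complex.real_smul]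
    push_cast
    simp [← hr]
  · rw [div_le_iff₀ hr0]; linarith
  · intro y hy
    have hX := (half_le_re (by positivity : 0 ≤ H / r) hy).1
    have hXre : ((r : ℂ) + (H : ℂ) * y).re = r * (1 + H / r * y.re) := by
      rw [hscale, Complex.re_ofReal_mul, re_scaled]
    have hXpos : 0 < ((r : ℂ) + (H : ℂ) * y).re := by rw [hXre]; positivity
    have k := setIntegral_ringKern_scaled hopen.measurableSet hvol (by positivity : 0 < H / r)
      hsmall hy
    have k2 := h.setIntegral_ringKern ((r : ℂ) + (H : ℂ) * y)
    rw [← hH, ← hr] at k2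
    simp only [hscale, ringKern_smul hr0] at k2
    rw [k] at k2
    have hm := h.mem_iff _ hXpos
    rw [hXre, hscale, k2] at hm
    change (r : ℂ) + (H : ℂ) * y ∈ A ↔ _
    rw [hscale, hm, ringPot, ringCorr]
    set X := 1 + H / r * y.re
    have hXp : 0 < X := by linarith
    rw [← sub_pos, ← mul_pos_iff_of_pos_left (by positivity : 0 < ε ^ 2 / (H ^ 2 * (r * X) ^ 2))]
    refine Iff.of_eq (congrArg _ ?_)
    field_simp
    ring

end ThinSection

/-- The identification of the complex plane with `Plane`. -/
def toPlane : ℂ ≃ₗᵢ[ℝ] Plane := Complex.orthonormalBasisOneI.repr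

theorem toPlane_zero (z : ℂ) : toPlane z 0 = z.re := by
  simp [toPlane, Complex.orthonormalBasisOneI_repr_apply]

theorem toPlane_one (z : ℂ) : toPlane z 1 = z.im := by
  simp [toPlane, Complex.orthonormalBasisOneI_repr_apply]

theorem toPlane_eq_mk2 (z : ℂ) : toPlane z = mk2 z.re z.im := by
  ext i
  fin_cases i
  · simpa [mk2] using toPlane_zero z
  · simpa [mk2] using toPlane_one z

theorem setIntegral_toPlane {E : Type*} [NormedAddCommGroup E] [NormedSpace ℝ E] (f : Plane → E)
    (A : Set Plane) : ∫ z in toPlane ⁻¹' A, f (toPlane z) = ∫ x in A, f x :=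
  toPlane.measurePreserving.setIntegral_preimage_emb
    toPlane.toHomeomorph.measurableEmbedding f A

theorem Gstar_toPlane {z w : ℂ} (hz : 0 < z.re) (hw : 0 < w.re) :
    Gstar (toPlane z) (toPlane w) = z.re ^ 2 * ringKern z w := by
  have hm : 0 < z.re * w.re := mul_pos hz hw
  have hs : 0 < √(z.re * w.re) := Real.sqrt_pos.2 hm
  have hint : ∫ θ in (-π)..π, Real.cos θ / √((z.im - w.im) ^ 2 + z.re ^ 2 + w.re ^ 2 -
      2 * z.re * w.re * Real.cos θ) = (√(z.re * w.re))⁻¹ * ∫ θ in (-π)..π,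
      Real.cos θ / √((‖z - w‖ / √(z.re * w.re)) ^ 2 + 2 - 2 * Real.cos θ) := by
    rw [← intervalIntegral.integral_const_mul]
    refine intervalIntegral.integral_congr fun θ _ => ?_
    have e : (z.im - w.im) ^ 2 + z.re ^ 2 + w.re ^ 2 - 2 * z.re * w.re * Real.cos θ =
        z.re * w.re * ((‖z - w‖ / √(z.re * w.re)) ^ 2 + 2 - 2 * Real.cos θ) := by
      rw [div_pow, Real.sq_sqrt hm.le, Complex.sq_norm, Complex.normSq_apply, Complex.sub_re,
        Complex.sub_im]
      field_simp
      ring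
    rw [e, Real.sqrt_mul hm.le, div_eq_mul_inv, div_eq_mul_inv, mul_inv]
    ring
  have hq : √(w.re / z.re) = w.re * (√(z.re * w.re))⁻¹ := by
    rw [show w.re / z.re = w.re ^ 2 * (z.re * w.re)⁻¹ by field_simp,
      Real.sqrt_mul (sq_nonneg _), Real.sqrt_sq hw.le, Real.sqrt_inv]
  rw [Gstar, toPlane_zero, toPlane_zero, toPlane_one, toPlane_one, hint, ringKern, ringProfile, hq]
  generalize (∫ θ in (-π)..π,
    Real.cos θ / √((‖z - w‖ / √(z.re * w.re)) ^ 2 + 2 - 2 * Real.cos θ)) = I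
  field_simp

theorem isOpen_halfPlane : IsOpen halfPlane :=
  isOpen_lt continuous_const (by fun_prop : Continuous fun x : Plane => x 0)

theorem isOpen_crossSection {ψ : Plane → ℝ} {ε W μ : ℝ} (h : IsVortexRingStream ψ ε W μ) :
    IsOpen (crossSection ψ ε W μ) := by
  have hc : ContinuousOn (fun x : Plane => ψ x - W / 2 * x 0 ^ 2 * Real.log (1 / ε)) halfPlane :=
    h.continuousOn.sub (Continuous.continuousOn (by fun_prop))
  exact hc.isOpen_inter_preimage isOpen_halfPlane isOpen_Ioi

theorem mem_halfPlane_toPlane {z : ℂ} : toPlane z ∈ halfPlane ↔ 0 < z.re := by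
  rw [halfPlane, Set.mem_ofPred_eq, toPlane_zero]

theorem stream_toPlane {ψ : Plane → ℝ} {ε W μ : ℝ} (h : IsVortexRingStream ψ ε W μ) {z : ℂ}
    (hz : 0 < z.re) : ψ (toPlane z) =
      z.re ^ 2 * (∫ w in toPlane ⁻¹' crossSection ψ ε W μ, ringKern z w) / ε ^ 2 := by
  rw [h.repr _ (mem_halfPlane_toPlane.2 hz), ← setIntegral_toPlane, ← integral_const_mul]
  congr 1
  refine setIntegral_congr_fun
    ((isOpen_crossSection h).preimage toPlane.continuous).measurableSet fun w hw => ?_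
  exact Gstar_toPlane hz (mem_halfPlane_toPlane.1 hw.1)

theorem thinSection {ψ : Plane → ℝ} {κ W δ ε μ : ℝ} (h : IsVortexRingStream ψ ε W μ)
    (hc : Centralized ψ) (hκ : circulation ψ ε W μ = κ) (hε : 0 < ε)
    (hs : SimplyConnectedSpace ↥(crossSection ψ ε W μ))
    (hstrip : crossSection ψ ε W μ ⊆ {x : Plane | δ ≤ x 0 ∧ x 0 ≤ 1 / δ})
    (hd : Metric.diam (crossSection ψ ε W μ) ≤ δ / 4) :
    ThinSection (toPlane ⁻¹' crossSection ψ ε W μ) δ (W / 2 * Real.log (1 / ε)) μ ε κ := by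
  have hconn : IsConnected (crossSection ψ ε W μ) := isConnected_iff_connectedSpace.2 inferInstance
  have himg : toPlane ⁻¹' crossSection ψ ε W μ = toPlane.symm '' crossSection ψ ε W μ :=
    (toPlane.toEquiv.image_symm_eq_preimage _).symm
  refine
    { isOpen := (isOpen_crossSection h).preimage toPlane.continuous
      preconnected := ?_
      nonempty := ?_
      conj_mem := fun z hz => ?_
      le_re := fun z hz => ?_
      re_le := fun z hz => ?_
      diam_le := fun z hz w hw => ?_
      moment := ?_
      mem_iff := fun z hz => ?_ }
  · rw [himg]; exact hconn.isPreconnected.image _ toPlane.symm.continuous.continuousOn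
  · rw [himg]; exact hconn.nonempty.image _
  · have e : ψ (toPlane ((starRingEnd ℂ) z)) = ψ (toPlane z) := by
      rw [toPlane_eq_mk2, toPlane_eq_mk2, Complex.conj_re, Complex.conj_im, hc]
    refine ⟨mem_halfPlane_toPlane.2 (mem_halfPlane_toPlane.1 hz.1), ?_⟩
    have h2 := hz.2
    rw [e, toPlane_zero, Complex.conj_re]
    rwa [toPlane_zero] at h2
  · have := (hstrip hz).1; rwa [toPlane_zero] at this
  · have := (hstrip hz).2; rwa [toPlane_zero] at this
  · rw [← dist_eq_norm, ← toPlane.dist_map]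
    exact (Metric.dist_le_diam_of_mem h.bounded hz hw).trans hd
  · rw [← hκ, circulation, div_mul_cancel₀ _ (by positivity), ← setIntegral_toPlane]
    simp only [toPlane_zero]
  · have e := stream_toPlane h hz
    rw [← e]
    refine ⟨fun hzA => ?_, fun hzA => ⟨mem_halfPlane_toPlane.2 hz, ?_⟩⟩
    · have h2 := hzA.2
      rw [toPlane_zero] at h2
      linarith
    · rw [toPlane_zero]
      linarith

theorem ThinSection.log_ratio {A : Set ℂ} {δ v μ ε Q : ℝ} (h : ThinSection A δ v μ ε Q)
    (hδ : 0 < δ) (hε : 0 < ε) (hQ : 0 < Q) :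
    Real.log (areaRadius A / axisMean A) =
      Real.log ε + Real.log (Q / π) / 2 - 3 / 2 * Real.log (axisMean A) := by
  have hh := h.areaRadius_pos
  have hr : 0 < axisMean A := hδ.trans_le h.axisMean_bounds.1
  have e := congrArg Real.log h.moment_eq
  have hπ := Real.pi_pos
  rw [Real.log_mul (by positivity) hr.ne', Real.log_mul hπ.ne' (by positivity), Real.log_pow,
    Real.log_mul hQ.ne' (by positivity), Real.log_pow] at e
  rw [Real.log_div hh.ne' hr.ne', Real.log_div hQ.ne' hπ.ne']
  push_cast at e
  linarith

theorem ThinSection.abs_log_ratio_sub_le {A : Set ℂ} {δ v μ ε Q : ℝ} (h : ThinSection A δ v μ ε Q)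
    (hδ : 0 < δ) (hε : 0 < ε) (hQ : 0 < Q) :
    |Real.log (areaRadius A / axisMean A) - Real.log ε| ≤
      |Real.log (Q / π)| + 3 / 2 * |Real.log δ| := by
  obtain ⟨h1, h2⟩ := h.axisMean_bounds
  have hr : 0 < axisMean A := hδ.trans_le h1
  have l1 := Real.log_le_log hδ h1
  have l2 := Real.log_le_log hr h2
  rw [one_div, Real.log_inv] at l2
  have k1 := neg_abs_le (Real.log δ)
  have k2 := le_abs_self (Real.log (Q / π))
  have k3 := neg_abs_le (Real.log (Q / π))
  rw [h.log_ratio hδ hε hQ, abs_le]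
  constructor <;> linarith

theorem ThinSection.speed_eq {A : Set ℂ} {δ v μ ε Q : ℝ} (h : ThinSection A δ v μ ε Q)
    (hQ : 0 < Q) : v * ε ^ 2 / areaRadius A ^ 2 = v * π * axisMean A / Q := by
  have hh := h.areaRadius_pos
  rw [div_eq_div_iff (by positivity) hQ.ne']
  linear_combination -v * h.moment_eq

/-- Two thin vortex cross-sections with the same moment and the same large speed coincide. -/
theorem ThinSection.unique {w δ Q : ℝ} (hw : 0 < w) (hδ : 0 < δ) (hQ : 0 < Q) :
    ∃ M : ℝ, 1 ≤ M ∧ ∀ A₁ A₂ ε μ₁ μ₂, 0 < ε → M ≤ -Real.log ε → 0 < μ₁ → 0 < μ₂ →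
    ThinSection A₁ δ (w * -Real.log ε) μ₁ ε Q → ThinSection A₂ δ (w * -Real.log ε) μ₂ ε Q →
    μ₁ = μ₂ ∧ ∀ z : ℂ, ∫ x in A₁, ringKern z x = ∫ x in A₂, ringKern z x := by
  obtain ⟨C, hC, a₀, ha₀, hrig⟩ := exists_rigid (c := w * π * δ / (2 * Q)) (by positivity)
  set N := |Real.log (Q / π)| + 3 / 2 * |Real.log δ| with hN
  have hN0 : 0 ≤ N := by positivity
  refine ⟨N + |Real.log a₀| + 1 + 2 * C * Q / (δ * w * π), ?_, ?_⟩
  · have : 0 ≤ 2 * C * Q / (δ * w * π) := by positivity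
    linarith [abs_nonneg (Real.log a₀)]
  intro A₁ A₂ ε μ₁ μ₂ hε hM hμ₁ hμ₂ h1 h2
  set L := -Real.log ε with hL
  have hq : 0 < 2 * C * Q / (δ * w * π) := by positivity
  have hla := neg_abs_le (Real.log a₀)
  have hla' := abs_nonneg (Real.log a₀)
  have hL0 : 0 < L := by linarith
  have hsmall : ∀ A μ, ThinSection A δ (w * L) μ ε Q → areaRadius A / axisMean A < a₀ := by
    intro A μ h
    have hp := div_pos h.areaRadius_pos (hδ.trans_le h.axisMean_bounds.1)
    have k := abs_le.1 (h.abs_log_ratio_sub_le hδ hε hQ)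
    exact (Real.log_lt_log_iff hp ha₀).1 (by linarith [k.2])
  have hfast : ∀ A μ, ThinSection A δ (w * L) μ ε Q →
      w * π * δ / (2 * Q) * -Real.log (areaRadius A / axisMean A) ≤
        w * L * ε ^ 2 / areaRadius A ^ 2 := by
    intro A μ h
    have k := abs_le.1 (h.abs_log_ratio_sub_le hδ hε hQ)
    rw [h.speed_eq hQ]
    calc _ ≤ w * π * δ / (2 * Q) * (2 * L) := by gcongr; linarith [k.1]
      _ = w * L * π * δ / Q := by field_simp
      _ ≤ _ := by gcongr; exact h.axisMean_bounds.1
  have hv : 0 < w * L := by positivity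
  obtain ⟨hβ, heq⟩ := hrig _ _ _ _ _ _ _ _ (h1.ring hδ hv hμ₁ hε) (h2.ring hδ hv hμ₂ hε)
    (hsmall _ _ h1) (hsmall _ _ h2) (hfast _ _ h1) (hfast _ _ h2)
  rw [h1.speed_eq hQ, h2.speed_eq hQ, h1.log_ratio hδ hε hQ, h2.log_ratio hδ hε hQ] at hβ
  have hlog := abs_log_sub_log_le hδ h1.axisMean_bounds.1 h2.axisMean_bounds.1
  have hr0 : 0 < axisMean A₁ := hδ.trans_le h1.axisMean_bounds.1
  have hk1 := h1.setIntegral_ringKern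
  have hk2 := h2.setIntegral_ringKern
  have hm1 := h1.moment_eq
  have hm2 := h2.moment_eq
  have hh1 := h1.areaRadius_pos
  have hh2 := h2.areaRadius_pos
  have hr : axisMean A₁ = axisMean A₂ := by
    by_contra hne
    have hd : 0 < |axisMean A₁ - axisMean A₂| := abs_pos.2 (sub_ne_zero.2 hne)
    rw [show w * L * π * axisMean A₁ / Q - w * L * π * axisMean A₂ / Q =
        w * L * π / Q * (axisMean A₁ - axisMean A₂) by ring,
      show Real.log ε + Real.log (Q / π) / 2 - 3 / 2 * Real.log (axisMean A₁) -
        (Real.log ε + Real.log (Q / π) / 2 - 3 / 2 * Real.log (axisMean A₂)) =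
        -(3 / 2 * (Real.log (axisMean A₁) - Real.log (axisMean A₂))) by ring,
      abs_neg, abs_mul, abs_mul, abs_of_pos (by positivity : 0 < w * L * π / Q),
      abs_of_pos (by norm_num : (0 : ℝ) < 3 / 2)] at hβ
    have k : w * L * π / Q * |axisMean A₁ - axisMean A₂| ≤
        C * (3 / 2) * δ⁻¹ * |axisMean A₁ - axisMean A₂| := by
      refine hβ.trans ?_
      calc _ ≤ C * (3 / 2 * (δ⁻¹ * |axisMean A₁ - axisMean A₂|)) := by gcongr
        _ = _ := by ring
    have k' := le_of_mul_le_mul_right k hd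
    have hlt : 2 * C * Q / (δ * w * π) < L := by linarith
    have : w * π / Q * (2 * C * Q / (δ * w * π)) < w * π / Q * L := by gcongr
    rw [show w * π / Q * (2 * C * Q / (δ * w * π)) = 2 * C * δ⁻¹ by field_simp] at this
    have hCδ : 0 < C * δ⁻¹ := by positivity
    have e : w * L * π / Q = w * π / Q * L := by ring
    linarith
  have hhe : areaRadius A₁ = areaRadius A₂ := by
    rw [hr, ← hm2] at hm1
    rw [hr] at hr0
    have := mul_left_cancel₀ Real.pi_ne_zero (mul_right_cancel₀ hr0.ne' hm1)
    exact (pow_left_inj₀ hh1.le hh2.le two_ne_zero).1 this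
  obtain ⟨hmm, hae⟩ := heq (by rw [hr, hhe])
  rw [hr, hhe] at hmm
  rw [hr] at hr0
  constructor
  · have hX : areaRadius A₂ ^ 2 * axisMean A₂ ^ 2 ≠ 0 := by positivity
    exact mul_right_cancel₀ (by positivity : ε ^ 2 ≠ 0) ((div_left_inj' hX).1 hmm)
  · intro z
    rw [hk1, hk2, hr, hhe, setIntegral_congr_set hae]

end VortexRing

/-- **Uniqueness of steady vortex rings of small cross-section** (Theorem 1.2 /
Proposition 3.1). Two centralized steady vortex rings with the same parameters `(ε, W)`,
the same circulation `κ`, simply connected cross-sections of small diameter lying in a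
fixed annular strip `δ₀ ≤ x₁ ≤ 1/δ₀`, and flux constants bounded below by `m₀`, coincide. -/
theorem uniqueness_steady_vortex_ring (κ W δ₀ m₀ : ℝ)
    (hκ : 0 < κ) (hW : 0 < W) (hδ₀ : 0 < δ₀) (hm₀ : 0 < m₀) :
    ∃ ε₀ > (0 : ℝ), ∃ d₀ > (0 : ℝ), ∀ ε ∈ Set.Ioc (0 : ℝ) ε₀,
      ∀ ψ₁ ψ₂ : Plane → ℝ, ∀ μ₁ μ₂ : ℝ,
        m₀ ≤ μ₁ → m₀ ≤ μ₂ →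
        IsVortexRingStream ψ₁ ε W μ₁ → IsVortexRingStream ψ₂ ε W μ₂ →
        Centralized ψ₁ → Centralized ψ₂ →
        circulation ψ₁ ε W μ₁ = κ → circulation ψ₂ ε W μ₂ = κ →
        SimplyConnectedSpace ↥(crossSection ψ₁ ε W μ₁) →
        SimplyConnectedSpace ↥(crossSection ψ₂ ε W μ₂) →
        crossSection ψ₁ ε W μ₁ ⊆ {x : Plane | δ₀ ≤ x 0 ∧ x 0 ≤ 1 / δ₀} →
        crossSection ψ₂ ε W μ₂ ⊆ {x : Plane | δ₀ ≤ x 0 ∧ x 0 ≤ 1 / δ₀} →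
        Metric.diam (crossSection ψ₁ ε W μ₁) ≤ d₀ →
        Metric.diam (crossSection ψ₂ ε W μ₂) ≤ d₀ →
        Set.EqOn ψ₁ ψ₂ halfPlane ∧ μ₁ = μ₂ := by
  obtain ⟨M, hM, huniq⟩ := VortexRing.ThinSection.unique (w := W / 2) (by positivity) hδ₀ hκ
  refine ⟨Real.exp (-M), Real.exp_pos _, δ₀ / 4, by positivity, ?_⟩
  rintro ε ⟨hε, hεM⟩ ψ₁ ψ₂ μ₁ μ₂ hμ₁ hμ₂ h₁ h₂ hc₁ hc₂ hκ₁ hκ₂ hs₁ hs₂ hA₁ hA₂ hd₁ hd₂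
  have hlog : M ≤ -Real.log ε := by
    have := Real.log_le_log hε hεM
    rw [Real.log_exp] at this
    linarith
  have hinv : Real.log (1 / ε) = -Real.log ε := by rw [one_div, Real.log_inv]
  have t₁ := VortexRing.thinSection h₁ hc₁ hκ₁ hε hs₁ hA₁ hd₁
  have t₂ := VortexRing.thinSection h₂ hc₂ hκ₂ hε hs₂ hA₂ hd₂
  rw [hinv] at t₁ t₂
  obtain ⟨hμ, hK⟩ := huniq _ _ ε μ₁ μ₂ hε hlog (hm₀.trans_le hμ₁) (hm₀.trans_le hμ₂) t₁ t₂
  refine ⟨fun x hx => ?_, hμ⟩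
  obtain ⟨z, rfl⟩ := VortexRing.toPlane.surjective x
  have hz := VortexRing.mem_halfPlane_toPlane.1 hx
  rw [VortexRing.stream_toPlane h₁ hz, VortexRing.stream_toPlane h₂ hz, hK]
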